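/- Let ε > 0. There exists N such that for all n ≥ N and every p = p(n) satisfying (log n)^50 / n ≤ p ≤ 1 − n^{−1/4}(log n)^9, the binomial random graph G ~ G_{n,p} has property H with probability at least 1 − ε. (Consequently, with high probability G_{n,p} contains ⌊δ(G)/2⌋ pairwise edge-disjoint Hamilton cycles, plus an additional edge-disjoint matching of size ⌊n/2⌋ if δ(G) is odd.) -/

import Mathlib

open scoped Classical
open SimpleGraph

namespace EDHC

/-- Degree of a vertex (as cardinality of its neighbour set). -/
noncomputable def deg {V : Type} (G : SimpleGraph V) (v : V) : ℕ := (G.neighborSet v).ncard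

/-- Minimum degree. -/
noncomputable def minDeg {V : Type} (G : SimpleGraph V) : ℕ := sInf (Set.range (deg G))

/-- Maximum degree. -/
noncomputable def maxDeg {V : Type} (G : SimpleGraph V) : ℕ := sSup (Set.range (deg G))

/-- Number of edges of `G` with both endpoints in `S`. -/
noncomputable def eIn {V : Type} (G : SimpleGraph V) (S : Set V) : ℕ :=
  {e ∈ G.edgeSet | ∀ v ∈ e, v ∈ S}.ncard

/-- Number of edges of `G` with one endpoint in `S` and the other in `T`. -/
noncomputable def eBtw {V : Type} (G : SimpleGraph V) (S T : Set V) : ℕ :=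
  {e ∈ G.edgeSet | ∃ a ∈ S, ∃ b ∈ T, e = s(a, b)}.ncard

/-- `G` is `(p, β)`-jumbled. -/
def IsJumbled {V : Type} (G : SimpleGraph V) (p β : ℝ) : Prop :=
  ∀ S : Set V, |(eIn G S : ℝ) - p * ((S.ncard : ℝ) * ((S.ncard : ℝ) - 1) / 2)| ≤ β * S.ncard

/-- `G` is strongly `2`-jumping. -/
def StronglyTwoJumping (n : ℕ) (G : SimpleGraph (Fin n)) : Prop :=
  ∀ T : Set (Fin n), T.Nonempty →
    (∑ v ∈ (Set.toFinite T).toFinset, (deg G v : ℝ)) / (T.ncard : ℝ) ≥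
      (minDeg G : ℝ) + min ((T.ncard : ℝ) - 1) ((Real.log n) ^ 2)

/-- `G` is `p`-pseudorandom. -/
def IsPseudorandom (n : ℕ) (G : SimpleGraph (Fin n)) (p : ℝ) : Prop :=
  IsJumbled G p (2 * Real.sqrt (n * p * (1 - p))) ∧
  (∀ S T : Set (Fin n), Disjoint S T →
    ((1 / (S.ncard : ℝ) + 1 / (T.ncard : ℝ)) * Real.log n / p ≥ 7 / 2 →
      (eBtw G S T : ℝ) ≤ 2 * ((S.ncard : ℝ) + (T.ncard : ℝ)) * Real.log n) ∧
    ((1 / (S.ncard : ℝ) + 1 / (T.ncard : ℝ)) * Real.log n / p ≤ 7 / 2 →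
      (eBtw G S T : ℝ) ≤ 7 * (S.ncard : ℝ) * (T.ncard : ℝ) * p)) ∧
  (∀ S : Set (Fin n),
    (Real.log n / ((S.ncard : ℝ) * p) ≥ 7 / 4 → (eIn G S : ℝ) ≤ 2 * (S.ncard : ℝ) * Real.log n) ∧
    (Real.log n / ((S.ncard : ℝ) * p) ≤ 7 / 4 → (eIn G S : ℝ) ≤ 7 * (S.ncard : ℝ) ^ 2 * p / 2)) ∧
  ((n : ℝ) * p - 2 * Real.sqrt ((n : ℝ) * p * Real.log n) ≤ (minDeg G : ℝ) ∧
    (minDeg G : ℝ) ≤ (n : ℝ) * p - 200 * Real.sqrt ((n : ℝ) * p * (1 - p)) ∧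
    (maxDeg G : ℝ) ≤ (n : ℝ) * p + 2 * Real.sqrt ((n : ℝ) * p * Real.log n)) ∧
  StronglyTwoJumping n G

/-- `G` is `u`-jumping. -/
def IsJumping (n : ℕ) (G : SimpleGraph (Fin n)) (u : ℝ) : Prop :=
  ∃ x₀ : Fin n, deg G x₀ = minDeg G ∧
    ∀ x : Fin n, x ≠ x₀ → (deg G x : ℝ) ≥ (minDeg G : ℝ) + u

/-- `C` is a Hamilton cycle (on the whole vertex set `Fin n`). -/
def IsHamCycle {n : ℕ} (C : SimpleGraph (Fin n)) : Prop :=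
  ∃ (v : Fin n) (w : C.Walk v v), w.IsHamiltonianCycle ∧ C.edgeSet = {e | e ∈ w.edges}

/-- `G` has property `H`. -/
def HasPropertyH (n : ℕ) (G : SimpleGraph (Fin n)) : Prop :=
  ∃ HC : Fin (minDeg G / 2) → SimpleGraph (Fin n),
    (∀ i, HC i ≤ G ∧ IsHamCycle (HC i)) ∧
    (∀ i j, i ≠ j → Disjoint (HC i).edgeSet (HC j).edgeSet) ∧
    (Odd (minDeg G) →
      ∃ M : SimpleGraph (Fin n), M ≤ G ∧ (∀ v, deg M v ≤ 1) ∧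
        M.edgeSet.ncard = n / 2 ∧ ∀ i, Disjoint M.edgeSet (HC i).edgeSet)

/-- Probability of the event `A` under the binomial random graph `G_{n,p}`. -/
noncomputable def gnpProb (n : ℕ) (p : ℝ) (A : SimpleGraph (Fin n) → Prop) : ℝ :=
  ∑ G : SimpleGraph (Fin n),
    if A G then p ^ G.edgeSet.ncard * (1 - p) ^ (n.choose 2 - G.edgeSet.ncard) else 0


/-- Number of cycles of a 2-regular graph = number of connected components. -/
noncomputable def numCycles {V : Type} (F : SimpleGraph V) : ℕ := Nat.card F.ConnectedComponent

/-- `N` is a perfect matching on the whole vertex set. -/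
def IsPerfectMatchingGraph {n : ℕ} (N : SimpleGraph (Fin n)) : Prop :=
  ∀ v, ((N.neighborSet v).ncard) = 1

/-- `N` is a perfect pseudomatching: one vertex of degree 2, all others of degree 1. -/
def IsPerfectPseudomatching {n : ℕ} (N : SimpleGraph (Fin n)) : Prop :=
  ∃ w, ((N.neighborSet w).ncard) = 2 ∧ ∀ v, v ≠ w → ((N.neighborSet v).ncard) = 1

/-- A set of edges forms a matching (no two distinct edges share a vertex). -/
def IsMatchingSet {n : ℕ} (E : Set (Sym2 (Fin n))) : Prop :=
  ∀ e ∈ E, ∀ f ∈ E, e ≠ f → ∀ v : Fin n, v ∈ e → v ∉ f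

/-- Number of cycles (orbits, including fixed points) of a permutation. -/
noncomputable def cycleCount {α : Type} (σ : Equiv.Perm α) : ℕ :=
  Nat.card (Quotient (⟨σ.SameCycle,
    ⟨fun x => Equiv.Perm.SameCycle.refl σ x, fun h => h.symm, fun h h' => h.trans h'⟩⟩ : Setoid α))

/-- Edges of the bipartite graph given by the relation `R` between `S` and `T`. -/
noncomputable def eBip {n : ℕ} (R : Fin n → Fin n → Prop) (S T : Set (Fin n)) : ℕ :=
  {q : Fin n × Fin n | q.1 ∈ S ∧ q.2 ∈ T ∧ R q.1 q.2}.ncard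

/-- One rotation of a path (represented as a list of vertices), with new edge from `H`
and pivot in `Q`. -/
def RotStep {V : Type} (H : SimpleGraph V) (Q : Set V) (l l' : List V) : Prop :=
  ∃ (x : V) (a : List V) (p : V) (b : List V),
    l = (x :: a) ++ p :: b ∧ l' = (x :: a).reverse ++ p :: b ∧ p ∈ Q ∧ H.Adj x p

/-- `v` is `(H, Q, τ)`-reachable from the path `l`. -/
def ReachableVert {V : Type} (H : SimpleGraph V) (Q : Set V) (τ : ℕ) (l : List V) (v : V) : Prop :=
  ∃ (k : ℕ) (f : ℕ → List V), k ≤ τ ∧ f 0 = l ∧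
    (∀ i < k, RotStep H Q (f i) (f (i + 1))) ∧ (f k).head? = some v

/-- External neighbourhood. -/
def extNbhd {V : Type} (H : SimpleGraph V) (S : Set V) : Set V :=
  (⋃ x ∈ S, H.neighborSet x) \ S

end EDHC

namespace EDHC

/-- Elementary rotation of a list with a pivot in `P`, keeping the head in `A`. -/
def PivotStep {V : Type} (Γ : SimpleGraph V) (A P : Finset V) (l l' : List V) : Prop :=
  ∃ (x : V) (L : List V) (p : V) (b : List V), l = L ++ p :: b ∧ l' = L.reverse ++ p :: b ∧
    L.head? = some x ∧ p ∈ P ∧ Γ.Adj x p ∧ ∃ z ∈ A, L.getLast? = some z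

/-- Lists obtained from `l₀` by at most `k` rotations. -/
inductive PivotReach {V : Type} (Γ : SimpleGraph V) (A P : Finset V) (l₀ : List V) :
    ℕ → List V → Prop
  | start (k : ℕ) : PivotReach Γ A P l₀ k l₀
  | step {k : ℕ} {l l' : List V} : PivotReach Γ A P l₀ k l → PivotStep Γ A P l l' →
      PivotReach Γ A P l₀ (k + 1) l'

/-- The pair `a, b` is consecutive in `l`, in one of the two orders. -/
def Consec {V : Type} (l : List V) (a b : V) : Prop := [a, b] <:+: l ∨ [b, a] <:+: l

/-- The list `I` occurs in `l` as a contiguous block, up to reversal. -/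
def Intact {V : Type} (I l : List V) : Prop := I <:+: l ∨ I.reverse <:+: l

section Rotations
variable {V : Type}

lemma PivotReach.mono {Γ : SimpleGraph V} {A P : Finset V} {l₀ l : List V} {k k' : ℕ}
    (h : PivotReach Γ A P l₀ k l) (hk : k ≤ k') : PivotReach Γ A P l₀ k' l := by
  induction h generalizing k' with
  | start k => exact .start _
  | step h hs ih =>
    obtain ⟨j, rfl⟩ : ∃ j, k' = j + 1 := ⟨k' - 1, by omega⟩
    exact .step (ih (by omega)) hs

lemma PivotStep.perm {Γ : SimpleGraph V} {A P : Finset V} {l l' : List V}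
    (h : PivotStep Γ A P l l') : l'.Perm l := by
  obtain ⟨x, L, p, b, rfl, rfl, -⟩ := h
  exact (List.reverse_perm L).append_right _

lemma PivotStep.getLast? {Γ : SimpleGraph V} {A P : Finset V} {l l' : List V}
    (h : PivotStep Γ A P l l') : l'.getLast? = l.getLast? := by
  obtain ⟨x, L, p, b, rfl, rfl, -⟩ := h
  simp [List.getLast?_append, List.getLast?_cons]

lemma PivotStep.head {Γ : SimpleGraph V} {A P : Finset V} {l l' : List V}
    (h : PivotStep Γ A P l l') : ∃ z ∈ A, l'.head? = some z := by
  obtain ⟨x, L, p, b, rfl, rfl, -, -, -, z, hz, h⟩ := h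
  exact ⟨z, hz, by simp [h]⟩

lemma PivotStep.isChain {Γ : SimpleGraph V} {A P : Finset V} {l l' : List V}
    {R : V → V → Prop} (hR : ∀ ⦃a b⦄, R a b → R b a) (hΓ : ∀ x p, p ∈ P → Γ.Adj x p → l.head? = some x → R x p)
    (h : PivotStep Γ A P l l') (hl : l.IsChain R) : l'.IsChain R := by
  obtain ⟨x, L, p, b, rfl, rfl, hx, hp, hxp, -⟩ := h
  rw [List.isChain_append] at hl ⊢
  refine ⟨?_, hl.2.1, ?_⟩
  · rw [List.isChain_reverse]
    exact hl.1.imp (fun _ _ h => hR h)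
  · intro y hy z hz
    simp only [List.getLast?_reverse, hx, List.head?_cons, Option.mem_def, Option.some.injEq] at hy hz
    subst hy hz
    exact hΓ _ _ hp hxp (by simp [hx])

lemma PivotStep.intact {Γ : SimpleGraph V} {A P : Finset V} {l l' : List V}
    (h : PivotStep Γ A P l l') : ∃ p : V, ∀ I : List V, p ∉ I → Intact I l → Intact I l' := by
  obtain ⟨x, L, p, b, rfl, rfl, hx, hp, hxp, -⟩ := h
  have key : ∀ I : List V, p ∉ I → I <:+: L ++ p :: b → I <:+: L ∨ I <:+: b := by
    rintro I hI ⟨s, t, h⟩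
    rw [List.append_eq_append_iff] at h
    rcases h with ⟨as, h1, h2⟩ | ⟨bs, h1, h2⟩
    · left; exact ⟨s, as, h1.symm⟩
    · cases bs with
      | nil => left; exact ⟨s, [], by simpa using h1⟩
      | cons c bs =>
        simp only [List.cons_append, List.cons.injEq] at h2
        obtain ⟨rfl, h2⟩ := h2
        rw [List.append_eq_append_iff] at h1
        rcases h1 with ⟨as, h3, h4⟩ | ⟨as, h3, h4⟩
        · exact absurd (by rw [h4]; simp) hI
        · cases as with
          | nil =>
            simp only [List.nil_append] at h4
            exact absurd (by rw [← h4]; simp) hI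
          | cons d as =>
            simp only [List.cons_append, List.cons.injEq] at h4
            right; exact ⟨as, t, by rw [h2, h4.2]⟩
  refine ⟨p, fun I hI h => ?_⟩
  have key2 : ∀ I : List V, p ∉ I → I <:+: L ++ p :: b → Intact I (L.reverse ++ p :: b) := by
    intro I hI h
    rcases key I hI h with h | h
    · right
      exact (List.reverse_infix.2 h).trans (List.infix_append' [] L.reverse (p :: b))
    · left
      exact h.trans ⟨L.reverse ++ [p], [], by simp⟩
  rcases h with h | h
  · exact key2 I hI h
  · have := key2 I.reverse (by simpa using hI) h
    rcases this with h | h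
    · exact Or.inr h
    · exact Or.inl (by simpa using h)

lemma PivotStep.consec {Γ : SimpleGraph V} {A P : Finset V} {l l' : List V}
    (h : PivotStep Γ A P l l') {a b : V} (hab : Consec l a b) (ha : l'.head? ≠ some a)
    (hb : l'.head? ≠ some b) : Consec l' a b := by
  obtain ⟨x, L, p, t, rfl, rfl, hx, hp, hxp, z, hz, hzL⟩ := h
  have hhd : (L.reverse ++ p :: t).head? = some z := by simp [hzL]
  have key : ∀ a b, z ≠ a → [a, b] <:+: L ++ p :: t → Consec (L.reverse ++ p :: t) a b := by
    rintro a b haz ⟨s, t', h⟩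
    have h' : s ++ (a :: b :: t') = L ++ p :: t := by simpa using h
    rw [List.append_eq_append_iff] at h'
    rcases h' with ⟨as, h1, h2⟩ | ⟨bs, h1, h2⟩
    · match as, h1, h2 with
      | [], h1, h2 =>
        simp only [List.nil_append] at h2
        left
        exact ⟨L.reverse, t', by simp [← h2]⟩
      | [c], h1, h2 =>
        simp only [List.cons_append, List.nil_append, List.cons.injEq] at h2
        rw [h1] at hzL
        simp at hzL
        exact absurd (h2.1.trans hzL).symm haz
      | c :: d :: as, h1, h2 =>
        simp only [List.cons_append, List.cons.injEq] at h2
        obtain ⟨rfl, rfl, h2⟩ := h2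
        right
        exact ⟨as.reverse, s.reverse ++ p :: t, by simp [h1]⟩
    · left
      rw [h2]
      exact ⟨L.reverse ++ bs, t', by simp⟩
  rw [hhd] at ha hb
  rcases hab with h | h
  · exact key a b (by simpa using ha) h
  · exact (key b a (by simpa using hb) h).symm

lemma PivotReach.perm {Γ : SimpleGraph V} {A P : Finset V} {l l' : List V} {k : ℕ}
    (h : PivotReach Γ A P l k l') : l'.Perm l := by
  induction h with
  | start k => exact .refl _
  | step _ hs ih => exact hs.perm.trans ih

lemma PivotReach.getLast? {Γ : SimpleGraph V} {A P : Finset V} {l l' : List V} {k : ℕ}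
    (h : PivotReach Γ A P l k l') : l'.getLast? = l.getLast? := by
  induction h with
  | start k => rfl
  | step _ hs ih => exact hs.getLast?.trans ih

lemma PivotReach.head {Γ : SimpleGraph V} {A P : Finset V} {l l' : List V} {k : ℕ}
    (h : PivotReach Γ A P l k l') (h0 : ∃ z ∈ A, l.head? = some z) :
    ∃ z ∈ A, l'.head? = some z := by
  induction h with
  | start k => exact h0
  | step _ hs ih => exact hs.head

lemma PivotReach.isChain {Γ : SimpleGraph V} {A P : Finset V} {l l' : List V} {k : ℕ}
    {R : V → V → Prop} (hR : ∀ ⦃a b⦄, R a b → R b a) (hΓ : ∀ x ∈ A, ∀ p ∈ P, Γ.Adj x p → R x p)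
    (h : PivotReach Γ A P l k l') (h0 : ∃ z ∈ A, l.head? = some z) (hl : l.IsChain R) :
    l'.IsChain R := by
  induction h with
  | start k => exact hl
  | step h hs ih =>
    refine hs.isChain hR ?_ ih
    intro x p hp hxp hx
    obtain ⟨z, hz, hzx⟩ := h.head h0
    rw [hzx] at hx
    cases hx
    exact hΓ _ hz _ hp hxp

/-- The number of intact blocks decreases by at most one in every rotation. -/
lemma PivotReach.intact {Γ : SimpleGraph V} {A P : Finset V} {l l' : List V} {k : ℕ}
    (h : PivotReach Γ A P l k l') {ι : Type} (I : ι → List V) (J : Finset ι)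
    (hI : ∀ i ∈ J, ∀ j ∈ J, i ≠ j → List.Disjoint (I i) (I j)) (h0 : ∀ i ∈ J, Intact (I i) l) :
    ∃ J' ⊆ J, J.card ≤ J'.card + k ∧ ∀ i ∈ J', Intact (I i) l' := by
  induction h with
  | start k => exact ⟨J, subset_rfl, by omega, h0⟩
  | step h hs ih =>
    obtain ⟨J', hJ', hc, hi⟩ := ih
    obtain ⟨p, hp⟩ := hs.intact
    refine ⟨J'.filter (fun i => p ∉ I i), (Finset.filter_subset _ _).trans hJ', ?_, ?_⟩
    · have h1 : (J'.filter (fun i => ¬ p ∉ I i)).card ≤ 1 := by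
        rw [Finset.card_le_one]
        intro a ha b hb
        simp only [not_not, Finset.mem_filter] at ha hb
        by_contra hne
        exact hI a (hJ' ha.1) b (hJ' hb.1) hne ha.2 hb.2
      have h2 := Finset.card_filter_add_card_filter_not (s := J') (fun i => p ∉ I i)
      omega
    · intro i hi'
      rw [Finset.mem_filter] at hi'
      exact hp _ hi'.2 (hi i hi'.1)

lemma formPerm_of_consecutive {l : List V} (hl : l.Nodup) {a b : V} (h : [a, b] <:+: l) :
    l.formPerm a = b := by
  obtain ⟨s, t, rfl⟩ := h
  have := List.formPerm_apply_lt_getElem _ hl s.length (by simp)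
  simpa [List.getElem_append] using this

end Rotations

/-- Number of neighbours of `v` in `T`. -/
noncomputable def dg {V : Type} (Γ : SimpleGraph V) (v : V) (T : Finset V) : ℕ :=
  (T.filter (Γ.Adj v)).card

section Growth
variable {V : Type} [Fintype V]

/-- The heads of lists reachable by at most `k` rotations. -/
noncomputable def heads (Γ : SimpleGraph V) (A P : Finset V) (l : List V) (k : ℕ) : Finset V :=
  Finset.univ.filter fun u => ∃ l', PivotReach Γ A P l k l' ∧ l'.head? = some u

lemma heads_mono (Γ : SimpleGraph V) (A P : Finset V) (l : List V) {k k' : ℕ} (h : k ≤ k') :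
    heads Γ A P l k ⊆ heads Γ A P l k' := by
  intro u hu
  simp only [heads, Finset.mem_filter, Finset.mem_univ, true_and] at hu ⊢
  obtain ⟨l', h1, h2⟩ := hu
  exact ⟨l', h1.mono h, h2⟩

lemma PivotReach.consec {Γ : SimpleGraph V} {A P : Finset V} {l l' : List V} {k k' : ℕ}
    (h : PivotReach Γ A P l k l') (hk : k ≤ k') {a b : V} (hab : Consec l a b)
    (ha : a ∉ heads Γ A P l k') (hb : b ∉ heads Γ A P l k') : Consec l' a b := by
  induction h with
  | start k => exact hab
  | @step k l1 l2 h hs ih =>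
    refine hs.consec (ih (by omega)) ?_ ?_
    · intro hh
      exact ha (by simpa [heads] using ⟨l2, (PivotReach.step h hs).mono hk, hh⟩)
    · intro hh
      exact hb (by simpa [heads] using ⟨l2, (PivotReach.step h hs).mono hk, hh⟩)

lemma pivot_head_mem {Γ : SimpleGraph V} {A P : Finset V} {l : List V} (hl : l.Nodup) {k : ℕ}
    {u y a b : V} (hu : u ∈ heads Γ A P l k) (hy : y ∈ P) (huy : Γ.Adj u y)
    (ha : a ∈ A) (hb : b ∈ A) (h3 : [a, y, b] <:+: l) :
    y ∈ heads Γ A P l (k + 1) ∨ a ∈ heads Γ A P l (k + 1) ∨ b ∈ heads Γ A P l (k + 1) := by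
  by_contra hcon
  push Not at hcon
  obtain ⟨hy1, ha1, hb1⟩ := hcon
  have hsub := heads_mono Γ A P l (Nat.le_succ k)
  have hy0 : y ∉ heads Γ A P l k := fun h => hy1 (hsub h)
  have ha0 : a ∉ heads Γ A P l k := fun h => ha1 (hsub h)
  have hb0 : b ∉ heads Γ A P l k := fun h => hb1 (hsub h)
  have hab : a ≠ b ∧ y ∈ l := by
    obtain ⟨s, t, rfl⟩ := h3
    simp only [List.append_assoc, List.cons_append, List.nil_append, List.nodup_append,
      List.nodup_cons] at hl
    refine ⟨?_, by simp⟩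
    rintro rfl
    simp at hl
  have hay : [a, y] <:+: l := by
    obtain ⟨s, t, rfl⟩ := h3; exact ⟨s, b :: t, by simp⟩
  have hyb : [y, b] <:+: l := by
    obtain ⟨s, t, rfl⟩ := h3; exact ⟨s ++ [a], t, by simp⟩
  simp only [heads, Finset.mem_filter, Finset.mem_univ, true_and] at hu
  obtain ⟨l', hr, hh⟩ := hu
  have c1 := hr.consec le_rfl (Or.inl hay) ha0 hy0
  have c2 := hr.consec le_rfl (Or.inl hyb) hy0 hb0
  have hl' : l'.Nodup := hr.perm.nodup_iff.2 hl
  have hyl' : y ∈ l' := hr.perm.mem_iff.2 hab.2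
  obtain ⟨L, t, rfl⟩ := List.append_of_mem hyl'
  -- the element preceding `y`
  have main : ∀ c, c ∈ A → [c, y] <:+: L ++ y :: t → c ∈ heads Γ A P l (k + 1) := by
    intro c hc hcy
    obtain ⟨s, t', h⟩ := hcy
    have h' : (s ++ [c]) ++ y :: t' = L ++ y :: t := by simpa using h
    have hn : ((s ++ [c]) ++ y :: t').Nodup := by rw [h']; exact hl'
    have hL : s ++ [c] = L := by
      rw [List.append_eq_append_iff] at h'
      rcases h' with ⟨as, h1, h2⟩ | ⟨as, h1, h2⟩
      · cases as with
        | nil => simpa using h1.symm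
        | cons d as =>
          simp only [List.cons_append, List.cons.injEq] at h2
          rw [h2.2] at hn
          simp [List.nodup_append] at hn
      · cases as with
        | nil => simpa using h1
        | cons d as =>
          simp only [List.cons_append, List.cons.injEq] at h2
          rw [h1, ← h2.1] at hn
          simp [List.nodup_append] at hn
    have hhd : L.head? = some u := by
      rw [← hL] at hh ⊢
      cases s <;> simpa using hh
    have hst : PivotStep Γ A P (L ++ y :: t) (L.reverse ++ y :: t) :=
      ⟨u, L, y, t, rfl, rfl, hhd, hy, huy, c, hc, by simp [← hL]⟩
    simp only [heads, Finset.mem_filter, Finset.mem_univ, true_and]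
    exact ⟨_, .step hr hst, by simp [← hL]⟩
  rcases c1 with c1 | c1
  · exact ha1 (main a ha c1)
  rcases c2 with c2 | c2
  · have e1 := formPerm_of_consecutive hl' c1
    have e2 := formPerm_of_consecutive hl' c2
    exact hab.1 (e1.symm.trans e2)
  · exact hb1 (main b hb c2)

lemma heads_subset {Γ : SimpleGraph V} {A P : Finset V} {l : List V} {k : ℕ}
    (h0 : ∃ z ∈ A, l.head? = some z) : heads Γ A P l k ⊆ A := by
  intro u hu
  simp only [heads, Finset.mem_filter, Finset.mem_univ, true_and] at hu
  obtain ⟨l', hr, hh⟩ := hu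
  obtain ⟨z, hz, hz'⟩ := hr.head h0
  rw [hh] at hz'
  cases hz'
  exact hz

/-- Repeated rotations reach many heads. -/
lemma le_card_heads {Γ : SimpleGraph V} {A P : Finset V} {l : List V} (hl : l.Nodup)
    (h0 : ∃ z ∈ A, l.head? = some z) {m κ τ : ℕ}
    (hP : ∀ y ∈ P, ∃ a ∈ A, ∃ b ∈ A, [a, y, b] <:+: l)
    (hdeg : ∀ u ∈ A, κ ≤ dg Γ u P)
    (hexp : ∀ S T : Finset V, S ⊆ A → (∀ s ∈ S, κ ≤ dg Γ s T) → m ≤ S.card ∨ 12 * S.card ≤ T.card)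
    (hτ : m ≤ 4 ^ τ) : m ≤ (heads Γ A P l τ).card := by
  have grow : ∀ i, m ≤ (heads Γ A P l i).card ∨
      4 * (heads Γ A P l i).card ≤ (heads Γ A P l (i + 1)).card := by
    intro i
    set U := heads Γ A P l i with hU
    set U' := heads Γ A P l (i + 1) with hU'
    set T := P.filter (fun y => ∃ u ∈ U, Γ.Adj u y) with hT
    have h1 := hexp U T (heads_subset h0) (by
      intro s hs
      refine (hdeg s (heads_subset h0 hs)).trans (Finset.card_le_card ?_)
      intro y hy
      rw [Finset.mem_filter] at hy
      simp only [hT, Finset.mem_filter]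
      exact ⟨⟨hy.1, s, hs, hy.2⟩, hy.2⟩)
    refine h1.imp id fun h1 => ?_
    have h2 : T ⊆ U' ∪ (U'.image l.formPerm ∪ U'.image (l.formPerm⁻¹ : Equiv.Perm V)) := by
      intro y hy
      simp only [hT, Finset.mem_filter] at hy
      obtain ⟨hyP, u, hu, huy⟩ := hy
      obtain ⟨a, ha, b, hb, h3⟩ := hP y hyP
      simp only [Finset.mem_union, Finset.mem_image]
      have hay : l.formPerm a = y := by
        apply formPerm_of_consecutive hl
        obtain ⟨s, t, rfl⟩ := h3; exact ⟨s, b :: t, by simp⟩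
      have hyb : l.formPerm y = b := by
        apply formPerm_of_consecutive hl
        obtain ⟨s, t, rfl⟩ := h3; exact ⟨s ++ [a], t, by simp⟩
      rcases pivot_head_mem hl hu hyP huy ha hb h3 with h | h | h
      · exact Or.inl h
      · exact Or.inr (Or.inl ⟨a, h, hay⟩)
      · exact Or.inr (Or.inr ⟨b, h, by rw [Equiv.Perm.inv_eq_iff_eq, hyb]⟩)
    have h3 := Finset.card_le_card h2
    have h4 := Finset.card_union_le U' (U'.image l.formPerm ∪ U'.image (l.formPerm⁻¹ : Equiv.Perm V))
    have h5 := Finset.card_union_le (U'.image l.formPerm) (U'.image (l.formPerm⁻¹ : Equiv.Perm V))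
    have h6 : (U'.image l.formPerm).card ≤ U'.card := Finset.card_image_le
    have h7 : (U'.image (l.formPerm⁻¹ : Equiv.Perm V)).card ≤ U'.card := Finset.card_image_le
    omega
  have all : ∀ i, m ≤ (heads Γ A P l i).card ∨ 4 ^ i ≤ (heads Γ A P l i).card := by
    intro i
    induction i with
    | zero =>
      right
      obtain ⟨z, hz, hz'⟩ := h0
      rw [pow_zero, Nat.one_le_iff_ne_zero, Finset.card_ne_zero]
      exact ⟨z, by simpa [heads] using ⟨l, .start _, hz'⟩⟩
    | succ i ih =>
      have hm : (heads Γ A P l i).card ≤ (heads Γ A P l (i + 1)).card :=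
        Finset.card_le_card (heads_mono Γ A P l (Nat.le_succ i))
      rcases ih with ih | ih
      · left; omega
      · rcases grow i with h | h
        · left; omega
        · right; rw [pow_succ]; omega
  rcases all τ with h | h <;> omega

end Growth

/-- The expansion hypotheses under which a Hamilton path can be closed by rotations with pivots
in `Q`, moving only through vertices of `X`. -/
structure Closable {V : Type} [Fintype V] (Γ : SimpleGraph V) (X Z Q : Finset V)
    (K κ m b b' τ : ℕ) : Prop where
  sub : Q ⊆ X
  kap : 1 ≤ κ
  exp : ∀ S T : Finset V, S ⊆ X → (∀ s ∈ S, κ ≤ dg Γ s T) → m ≤ S.card ∨ 12 * S.card ≤ T.card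
  degQ : ∀ v ∈ X, κ + 2 ≤ dg Γ v Q
  poor : ∀ Q' ⊆ Q, Q.card / K ≤ Q'.card → (X.filter fun v => dg Γ v Q' < 2 * κ + 2).card ≤ b'
  bad : K * b' + (X \ Z).card ≤ b
  lt : 2 * b < m
  link : ∀ S S' : Finset V, S ⊆ Z → S' ⊆ Z → m ≤ S.card → m ≤ S'.card → Disjoint S S' →
    ∃ s ∈ S, ∃ t ∈ S', Γ.Adj s t
  pow : m ≤ 4 ^ τ
  rot : 2 * τ + 2 ≤ K

section Closing
variable {V : Type}

lemma exists_infix_triple {l : List V} {y : V} (hy : y ∈ l) (h1 : l.head? ≠ some y)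
    (h2 : l.getLast? ≠ some y) : ∃ a b, [a, y, b] <:+: l := by
  obtain ⟨s, t, rfl⟩ := List.append_of_mem hy
  rcases List.eq_nil_or_concat s with rfl | ⟨s, a, rfl⟩
  · simp at h1
  cases t with
  | nil => simp at h2
  | cons b t => exact ⟨a, b, s, t, by simp⟩

lemma exists_prefix_countP (p : V → Bool) (l : List V) (q : ℕ) (h : q ≤ l.countP p) :
    ∃ s t, l = s ++ t ∧ s.countP p = q := by
  induction l generalizing q with
  | nil => exact ⟨[], [], rfl, by simp at h ⊢; exact h.symm⟩
  | cons a l ih =>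
    rcases Nat.eq_zero_or_pos q with rfl | hq
    · exact ⟨[], a :: l, rfl, rfl⟩
    by_cases ha : p a
    · obtain ⟨s, t, rfl, hs⟩ := ih (q - 1) (by rw [List.countP_cons_of_pos ha] at h; omega)
      exact ⟨a :: s, t, rfl, by rw [List.countP_cons_of_pos ha, hs]; omega⟩
    · obtain ⟨s, t, rfl, hs⟩ := ih q (by rwa [List.countP_cons_of_neg ha] at h)
      exact ⟨a :: s, t, rfl, by rw [List.countP_cons_of_neg ha, hs]⟩

lemma exists_blocks (p : V → Bool) (q K : ℕ) (l : List V) (h : K * q ≤ l.countP p) :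
    ∃ Ls : List (List V), Ls.length = K ∧ Ls.flatten <+: l ∧ ∀ I ∈ Ls, I.countP p = q := by
  induction K generalizing l with
  | zero => exact ⟨[], rfl, by simp, by simp⟩
  | succ K ih =>
    rw [Nat.succ_mul] at h
    obtain ⟨s, t, rfl, hs⟩ := exists_prefix_countP p l q (by omega)
    rw [List.countP_append] at h
    obtain ⟨Ls, h1, h2, h3⟩ := ih t (by omega)
    refine ⟨s :: Ls, by simp [h1], by simpa using h2, ?_⟩
    intro I hI
    rcases List.mem_cons.1 hI with rfl | hI
    exacts [hs, h3 I hI]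

/-- Two disjoint nonempty blocks of a list can be separated by a cut. -/
lemma exists_cut_of_blocks {I I' l : List V} (hI : I <:+: l) (hI' : I' <:+: l)
    (hd : List.Disjoint I I') : ∃ X Y, l = X ++ Y ∧
      ((I <:+: X ∧ I' <:+: Y) ∨ (I' <:+: X ∧ I <:+: Y)) := by
  rcases eq_or_ne I [] with rfl | hI0
  · exact ⟨[], l, rfl, Or.inl ⟨⟨[], _, rfl⟩, hI'⟩⟩
  rcases eq_or_ne I' [] with rfl | hI0'
  · exact ⟨[], l, rfl, Or.inr ⟨⟨[], _, rfl⟩, hI⟩⟩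
  have cut : ∀ {I I' s t s' t' : List V}, s ++ I ++ t = l → s' ++ I' ++ t' = l →
      s.length + I.length ≤ s'.length → ∃ X Y, l = X ++ Y ∧ I <:+: X ∧ I' <:+: Y := by
    intro I I' s t s' t' h h' hle
    refine ⟨s', I' ++ t', by simp [← h'], ?_, ⟨[], t', by simp⟩⟩
    have h1 : s ++ I <+: l := ⟨t, h⟩
    have h2 : s' <+: l := ⟨I' ++ t', by simpa using h'⟩
    obtain ⟨r, hr⟩ := List.prefix_of_prefix_length_le h1 h2 (by simpa using hle)
    exact ⟨s, r, hr⟩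
  obtain ⟨s, t, h⟩ := hI
  obtain ⟨s', t', h'⟩ := hI'
  by_cases c1 : s.length + I.length ≤ s'.length
  · obtain ⟨X, Y, h1, h2⟩ := cut h h' c1
    exact ⟨X, Y, h1, Or.inl h2⟩
  by_cases c2 : s'.length + I'.length ≤ s.length
  · obtain ⟨X, Y, h1, h2⟩ := cut h' h c2
    exact ⟨X, Y, h1, Or.inr h2⟩
  exfalso
  have p1 := List.length_pos_iff.2 hI0
  have p2 := List.length_pos_iff.2 hI0'
  set k := max s.length s'.length with hk
  have e1 : l[k]? = I[k - s.length]? := by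
    rw [← h, List.append_assoc, List.getElem?_append_right (by omega),
      List.getElem?_append_left (by omega)]
  have e2 : l[k]? = I'[k - s'.length]? := by
    rw [← h', List.append_assoc, List.getElem?_append_right (by omega),
      List.getElem?_append_left (by omega)]
  rw [e1, List.getElem?_eq_getElem (by omega), List.getElem?_eq_getElem (by omega),
    Option.some.injEq] at e2
  exact hd (List.getElem_mem (l := I) (n := k - s.length) (by omega)) (by rw [e2]; exact List.getElem_mem _)

lemma exists_cut_of_intact {I I' l : List V} (hI : Intact I l) (hI' : Intact I' l)
    (hd : List.Disjoint I I') : ∃ X Y, l = X ++ Y ∧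
      ((Intact I X ∧ Intact I' Y) ∨ (Intact I' X ∧ Intact I Y)) := by
  obtain ⟨J, hJ, hJ1, hJ2⟩ : ∃ J, J <:+: l ∧ (∀ x ∈ J, x ∈ I) ∧ ∀ X, J <:+: X → Intact I X := by
    rcases hI with h | h
    · exact ⟨I, h, fun _ h => h, fun X hX => Or.inl hX⟩
    · exact ⟨I.reverse, h, fun _ h => by simpa using h, fun X hX => Or.inr hX⟩
  obtain ⟨J', hJ', hJ1', hJ2'⟩ :
      ∃ J, J <:+: l ∧ (∀ x ∈ J, x ∈ I') ∧ ∀ X, J <:+: X → Intact I' X := by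
    rcases hI' with h | h
    · exact ⟨I', h, fun _ h => h, fun X hX => Or.inl hX⟩
    · exact ⟨I'.reverse, h, fun _ h => by simpa using h, fun X hX => Or.inr hX⟩
  obtain ⟨X, Y, h, h2⟩ := exists_cut_of_blocks hJ hJ' (fun x h1 h2 => hd (hJ1 x h1) (hJ1' x h2))
  exact ⟨X, Y, h, h2.imp (fun h => ⟨hJ2 _ h.1, hJ2' _ h.2⟩) (fun h => ⟨hJ2' _ h.1, hJ2 _ h.2⟩)⟩

lemma Intact.reverse {I l : List V} (h : Intact I l) : Intact I l.reverse := by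
  rcases h with h | h
  · exact Or.inr (List.reverse_infix.2 h)
  · left; simpa using List.reverse_infix.2 h

lemma Intact.triple {I l : List V} (h : Intact I l) {A : Finset V} {y : V}
    (h3 : ∃ a ∈ A, ∃ b ∈ A, [a, y, b] <:+: I) : ∃ a ∈ A, ∃ b ∈ A, [a, y, b] <:+: l := by
  obtain ⟨a, ha, b, hb, h3⟩ := h3
  rcases h with h | h
  · exact ⟨a, ha, b, hb, h3.trans h⟩
  · exact ⟨b, hb, a, ha, (by simpa using List.reverse_infix.2 h3 : [b, y, a] <:+: I.reverse).trans h⟩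

lemma PivotReach.mono_pivots {Γ : SimpleGraph V} {A P Q : Finset V} {l l' : List V} {k : ℕ}
    (h : PivotReach Γ A P l k l') (hPQ : P ⊆ Q) : PivotReach Γ A Q l k l' := by
  induction h with
  | start k => exact .start _
  | step h hs ih =>
    obtain ⟨x, L, p, b, h1, h2, h3, h4, h5⟩ := hs
    exact .step ih ⟨x, L, p, b, h1, h2, h3, hPQ h4, h5⟩

lemma isChain_triple {R : V → V → Prop} {l : List V} (hl : l.IsChain R) {a y b : V}
    (h : [a, y, b] <:+: l) : R a y ∧ R y b := by
  obtain ⟨L, R, rfl⟩ := h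
  simpa using hl.left_of_append.right_of_append

lemma dg_mono (Γ : SimpleGraph V) (v : V) {S T : Finset V} (h : S ⊆ T) : dg Γ v S ≤ dg Γ v T :=
  Finset.card_le_card (Finset.filter_subset_filter _ h)

lemma dg_le_card (Γ : SimpleGraph V) (v : V) (T : Finset V) : dg Γ v T ≤ T.card :=
  Finset.card_filter_le _ _

lemma dg_union_le (Γ : SimpleGraph V) (v : V) (S T : Finset V) :
    dg Γ v (S ∪ T) ≤ dg Γ v S + dg Γ v T := by
  unfold dg
  rw [Finset.filter_union]
  exact Finset.card_union_le _ _

variable [Fintype V]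

/-- Rotations escape from any small set. -/
lemma exists_head_notMem {Γ : SimpleGraph V} {X Z Q : Finset V} {K κ m b b' τ : ℕ}
    (H : Closable Γ X Z Q K κ m b b' τ) {R : V → V → Prop} (hR : ∀ ⦃a b⦄, R a b → R b a)
    (hQR : ∀ y ∈ Q, ∀ z, R y z → z ∈ X) {l : List V} (hl : l.Nodup) (hlc : l.IsChain R)
    (hX : ∀ v ∈ X, v ∈ l) (h0 : ∃ z ∈ X, l.head? = some z) {C : Finset V} (hC : C.card < m) :
    ∃ l', PivotReach Γ X Q l τ l' ∧ ∃ z ∈ X \ C, l'.head? = some z := by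
  set P := Q.filter (fun y => ∃ a ∈ X, ∃ b ∈ X, [a, y, b] <:+: l) with hP
  have hQP : Q ⊆ P ∪ (l.head?.toFinset ∪ l.getLast?.toFinset) := by
    intro y hy
    simp only [Finset.mem_union, Option.mem_toFinset, Option.mem_def]
    by_contra hcon
    push Not at hcon
    obtain ⟨h1, h2, h3⟩ := hcon
    obtain ⟨a, b, hab⟩ := exists_infix_triple (hX y (H.sub hy)) h2 h3
    obtain ⟨r1, r2⟩ := isChain_triple hlc hab
    refine h1 ?_
    rw [hP, Finset.mem_filter]
    exact ⟨hy, a, hQR y hy a (hR r1), b, hQR y hy b r2, hab⟩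
  have hcard : ∀ o : Option V, o.toFinset.card ≤ 1 := by
    intro o; cases o <;> simp
  have hm : m ≤ (heads Γ X P l τ).card := by
    apply le_card_heads hl h0 (κ := κ) (P := P)
    · intro y hy; exact (Finset.mem_filter.1 hy).2
    · intro u hu
      have h1 := H.degQ u hu
      have h2 := dg_mono Γ u hQP
      have h3 := dg_union_le Γ u P (l.head?.toFinset ∪ l.getLast?.toFinset)
      have h4 := dg_union_le Γ u l.head?.toFinset l.getLast?.toFinset
      have h5 := (dg_le_card Γ u l.head?.toFinset).trans (hcard _)
      have h6 := (dg_le_card Γ u l.getLast?.toFinset).trans (hcard _)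
      omega
    · exact H.exp
    · exact H.pow
  obtain ⟨u, hu, huC⟩ : ∃ u ∈ heads Γ X P l τ, u ∉ C := by
    by_contra hcon
    push Not at hcon
    have := Finset.card_le_card (show heads Γ X P l τ ⊆ C from hcon)
    omega
  have huX := heads_subset h0 hu
  simp only [heads, Finset.mem_filter, Finset.mem_univ, true_and] at hu
  obtain ⟨l', hr, hh⟩ := hu
  refine ⟨l', ?_, u, by simp [huX, huC], hh⟩
  exact hr.mono_pivots (Finset.filter_subset _ _)

/-- A set containing `B₀` outside of which all vertices have few neighbours next to it. -/
lemma exists_closed_bad_set {Γ : SimpleGraph V} {X B₀ : Finset V} {κ m b : ℕ} (f : Equiv.Perm V)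
    (hexp : ∀ S T : Finset V, S ⊆ X → (∀ s ∈ S, κ ≤ dg Γ s T) →
      m ≤ S.card ∨ 12 * S.card ≤ T.card) (hκ : 1 ≤ κ) (hB : B₀.card ≤ b) (hm : b < m) :
    ∃ C : Finset V, B₀ ⊆ C ∧ C.card ≤ 2 * b ∧
      ∀ v ∈ X \ C, dg Γ v (C.image f ∪ C.image (f⁻¹ : Equiv.Perm V)) < κ := by
  set N : Finset V → Finset V := fun C => C.image f ∪ C.image (f⁻¹ : Equiv.Perm V) with hN
  have hNc : ∀ C, (N C).card ≤ 2 * C.card := by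
    intro C
    have h1 := Finset.card_union_le (C.image f) (C.image (f⁻¹ : Equiv.Perm V))
    have h2 : (C.image f).card ≤ C.card := Finset.card_image_le
    have h3 : (C.image (f⁻¹ : Equiv.Perm V)).card ≤ C.card := Finset.card_image_le
    simp only [hN]
    omega
  set F : Finset (Finset V) := Finset.univ.filter
    (fun Y => Y ⊆ X ∧ Y.card ≤ b ∧ ∀ y ∈ Y, κ ≤ dg Γ y (N (B₀ ∪ Y))) with hF
  have hne : F.Nonempty := ⟨∅, by simp [hF]⟩
  obtain ⟨Y, hY, hmax⟩ := F.exists_max_image Finset.card hne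
  simp only [hF, Finset.mem_filter, Finset.mem_univ, true_and] at hY hmax
  obtain ⟨hYX, hYb, hYd⟩ := hY
  have hcu := Finset.card_union_le B₀ Y
  have hYs : 10 * Y.card ≤ 2 * b := by
    have := hNc (B₀ ∪ Y)
    rcases hexp Y (N (B₀ ∪ Y)) hYX hYd with h | h <;> omega
  refine ⟨B₀ ∪ Y, Finset.subset_union_left, by omega, ?_⟩
  intro v hv
  rw [Finset.mem_sdiff, Finset.mem_union, not_or] at hv
  by_contra hcon
  push Not at hcon
  by_cases hb0 : b = 0
  · have : N (B₀ ∪ Y) = ∅ := by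
      rw [← Finset.card_eq_zero]
      have := hNc (B₀ ∪ Y)
      omega
    have h1 : N (B₀ ∪ Y) = ∅ := this
    simp only [hN] at h1
    rw [h1] at hcon
    simp [dg] at hcon
    omega
  have := hmax (insert v Y) ⟨?_, ?_, ?_⟩
  · rw [Finset.card_insert_of_notMem hv.2.2] at this
    omega
  · exact Finset.insert_subset hv.1 hYX
  · rw [Finset.card_insert_of_notMem hv.2.2]; omega
  · have hsub : N (B₀ ∪ Y) ⊆ N (B₀ ∪ insert v Y) := by
      have : B₀ ∪ Y ⊆ B₀ ∪ insert v Y := Finset.union_subset_union_right (Finset.subset_insert _ _)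
      exact Finset.union_subset_union (Finset.image_subset_image this)
        (Finset.image_subset_image this)
    intro y hy
    rcases Finset.mem_insert.1 hy with rfl | hy
    · exact hcon.trans (dg_mono Γ _ hsub)
    · exact (hYd y hy).trans (dg_mono Γ _ hsub)

end Closing

section Closing
variable {V : Type} [Fintype V]

/-- **Closing a Hamilton path by rotations.** -/
theorem exists_closing {Γ : SimpleGraph V} {X Z Q : Finset V} {K κ m b b' τ : ℕ}
    (H : Closable Γ X Z Q K κ m b b' τ) {R : V → V → Prop} (hR : ∀ ⦃a b⦄, R a b → R b a)
    (hΓR : ∀ x ∈ X, ∀ y ∈ X, Γ.Adj x y → R x y)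
    (hQR : ∀ y ∈ Q, ∀ z, R y z → z ∈ X) {l : List V} (hl : l.Nodup) (hlc : l.IsChain R)
    (hX : ∀ v ∈ X, v ∈ l) (h0 : ∃ z ∈ X, l.head? = some z) (h1 : ∃ z ∈ X, l.getLast? = some z) :
    ∃ l' : List V, l'.Perm l ∧ l'.IsChain R ∧
      ∃ s t, l'.head? = some s ∧ l'.getLast? = some t ∧ R t s ∧ s ≠ t := by
  have hKpos : 0 < K := by have := H.rot; omega
  -- blocks
  have hcQ : K * (Q.card / K) ≤ l.countP (fun v => decide (v ∈ Q)) := by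
    refine (Nat.mul_div_le _ _).trans ?_
    rw [List.countP_eq_length_filter, ← List.toFinset_card_of_nodup (hl.filter _)]
    apply Finset.card_le_card
    intro y hy
    simpa [hy] using hX y (H.sub hy)
  obtain ⟨Ls, hLlen, hLpre, hLc⟩ := exists_blocks _ _ K l hcQ
  set I : Fin K → List V := fun i => Ls[i.1]'(by rw [hLlen]; exact i.2) with hI
  have hImem : ∀ i, I i ∈ Ls := fun i => List.getElem_mem _
  have hLn : Ls.flatten.Nodup := by
    obtain ⟨t, ht⟩ := hLpre
    rw [← ht] at hl
    exact (List.nodup_append.1 hl).1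
  have hLd := List.nodup_flatten.1 hLn
  have hIn : ∀ i, (I i).Nodup := fun i => hLd.1 _ (hImem i)
  have hIinf : ∀ i, I i <:+: l := by
    intro i
    obtain ⟨s, t, hst⟩ := List.append_of_mem (hImem i)
    exact List.IsInfix.trans ⟨s.flatten, t.flatten, by simp [hst]⟩ hLpre.isInfix
  have hId : ∀ i j, i ≠ j → List.Disjoint (I i) (I j) := by
    intro i j hij
    rcases lt_or_gt_of_ne hij with h | h
    · exact List.pairwise_iff_getElem.1 hLd.2 i.1 j.1 _ _ h
    · exact (List.pairwise_iff_getElem.1 hLd.2 j.1 i.1 _ _ h).symm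
  set QI : Fin K → Finset V := fun i => Q.filter (· ∈ I i) with hQI
  have hQIc : ∀ i, Q.card / K ≤ (QI i).card := by
    intro i
    rw [← hLc _ (hImem i), List.countP_eq_length_filter,
      ← List.toFinset_card_of_nodup ((hIn i).filter _)]
    apply Finset.card_le_card
    intro y hy
    simp only [List.mem_toFinset, List.mem_filter, decide_eq_true_eq] at hy
    simp only [hQI, Finset.mem_filter]
    exact ⟨hy.2, hy.1⟩
  -- bad vertices
  set B₀ : Finset V := (X \ Z) ∪ Finset.univ.biUnion
    (fun i => X.filter fun v => dg Γ v (QI i) < 2 * κ + 2) with hB₀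
  have hB₀c : B₀.card ≤ b := by
    refine (Finset.card_union_le _ _).trans ?_
    have : (Finset.univ.biUnion
        (fun i => X.filter fun v => dg Γ v (QI i) < 2 * κ + 2)).card ≤ K * b' := by
      refine Finset.card_biUnion_le.trans ?_
      refine (Finset.sum_le_card_nsmul _ _ b' ?_).trans (by simp)
      intro i _
      exact H.poor _ (Finset.filter_subset _ _) (hQIc i)
    have := H.bad
    omega
  obtain ⟨C, hBC, hCc, hC⟩ := exists_closed_bad_set (X := X) (B₀ := B₀) l.formPerm H.exp H.kap hB₀c
    (by have := H.lt; omega)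
  set A : Finset V := X \ C with hA
  have hAZ : A ⊆ Z := by
    intro v hv
    rw [hA, Finset.mem_sdiff] at hv
    by_contra hvZ
    exact hv.2 (hBC (by simp [hB₀, hv.1, hvZ]))
  have hAX : A ⊆ X := Finset.sdiff_subset
  set P : Fin K → Finset V := fun i => (QI i).filter
    (fun y => ∃ a ∈ A, ∃ c ∈ A, [a, y, c] <:+: I i) with hP
  have hPQ : ∀ i, P i ⊆ Q := fun i => (Finset.filter_subset _ _).trans (Finset.filter_subset _ _)
  have hcard : ∀ o : Option V, o.toFinset.card ≤ 1 := by
    intro o; cases o <;> simp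
  have hrich : ∀ v ∈ A, ∀ i, κ ≤ dg Γ v (P i) := by
    intro v hv i
    have hsub : QI i ⊆ P i ∪ ((C.image l.formPerm ∪ C.image (l.formPerm⁻¹ : Equiv.Perm V)) ∪
        ((I i).head?.toFinset ∪ (I i).getLast?.toFinset)) := by
      intro y hy
      have hy' := hy
      simp only [hQI, Finset.mem_filter] at hy'
      obtain ⟨hyQ, hyI⟩ := hy'
      by_contra hcon
      simp only [Finset.mem_union, Option.mem_toFinset, Option.mem_def] at hcon
      push Not at hcon
      obtain ⟨n1, ⟨n2, n3⟩, n4, n5⟩ := hcon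
      obtain ⟨a, c, hac⟩ := exists_infix_triple hyI n4 n5
      obtain ⟨r1, r2⟩ := isChain_triple hlc (hac.trans (hIinf i))
      have e1 : l.formPerm a = y := by
        apply formPerm_of_consecutive hl
        refine List.IsInfix.trans ?_ (hac.trans (hIinf i))
        exact ⟨[], [c], rfl⟩
      have e2 : l.formPerm y = c := by
        apply formPerm_of_consecutive hl
        refine List.IsInfix.trans ?_ (hac.trans (hIinf i))
        exact ⟨[a], [], rfl⟩
      apply n1
      simp only [hP, Finset.mem_filter]
      refine ⟨hy, a, ?_, c, ?_, hac⟩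
      · rw [hA, Finset.mem_sdiff]
        refine ⟨hQR y hyQ a (hR r1), fun haC => n2 ?_⟩
        exact Finset.mem_image.2 ⟨a, haC, e1⟩
      · rw [hA, Finset.mem_sdiff]
        refine ⟨hQR y hyQ c r2, fun hcC => n3 ?_⟩
        exact Finset.mem_image.2 ⟨c, hcC, by rw [Equiv.Perm.inv_eq_iff_eq, e2]⟩
    have d0 : 2 * κ + 2 ≤ dg Γ v (QI i) := by
      by_contra hcon
      push Not at hcon
      rw [hA, Finset.mem_sdiff] at hv
      apply hv.2
      apply hBC
      simp only [hB₀, Finset.mem_union, Finset.mem_biUnion, Finset.mem_filter]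
      exact Or.inr ⟨i, Finset.mem_univ _, hv.1, hcon⟩
    have d1 := dg_mono Γ v hsub
    have d2 := dg_union_le Γ v (P i) ((C.image l.formPerm ∪ C.image (l.formPerm⁻¹ : Equiv.Perm V)) ∪
        ((I i).head?.toFinset ∪ (I i).getLast?.toFinset))
    have d3 := dg_union_le Γ v (C.image l.formPerm ∪ C.image (l.formPerm⁻¹ : Equiv.Perm V))
        ((I i).head?.toFinset ∪ (I i).getLast?.toFinset)
    have d4 := dg_union_le Γ v (I i).head?.toFinset (I i).getLast?.toFinset
    have d5 := (dg_le_card Γ v (I i).head?.toFinset).trans (hcard _)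
    have d6 := (dg_le_card Γ v (I i).getLast?.toFinset).trans (hcard _)
    have d7 := hC v hv
    omega
  have hΓR' : ∀ x ∈ X, ∀ p ∈ Q, Γ.Adj x p → R x p := fun x hx p hp h => hΓR x hx p (H.sub hp) h
  have hClt : C.card < m := by have := H.lt; omega
  -- escape at both ends
  obtain ⟨l1, hr1, z1, hz1, hh1⟩ := exists_head_notMem H hR hQR hl hlc hX h0 hClt
  have hl1 : l1.Nodup := hr1.perm.nodup_iff.2 hl
  have hc1 : l1.IsChain R := hr1.isChain hR hΓR' h0 hlc
  have hl1' : l1.reverse.Nodup := List.nodup_reverse.2 hl1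
  have hc1' : l1.reverse.IsChain R := by
    rw [List.isChain_reverse]; exact hc1.imp (fun _ _ h => hR h)
  obtain ⟨J1, -, hJ1c, hJ1⟩ := hr1.intact I Finset.univ (fun i _ j _ h => hId i j h)
    (fun i _ => Or.inl (hIinf i))
  have h2 : ∃ z ∈ X, l1.reverse.head? = some z := by
    rw [List.head?_reverse, hr1.getLast?]; exact h1
  obtain ⟨l2, hr2, z2, hz2, hh2⟩ := exists_head_notMem H hR hQR hl1' hc1'
    (fun v hv => by rw [List.mem_reverse]; exact hr1.perm.mem_iff.2 (hX v hv)) h2 hClt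
  have hl2 : l2.Nodup := hr2.perm.nodup_iff.2 hl1'
  have hc2 : l2.IsChain R := hr2.isChain hR hΓR' h2 hc1'
  obtain ⟨J2, hJ2s, hJ2c, hJ2⟩ := hr2.intact I J1 (fun i _ j _ h => hId i j h)
    (fun i hi => (hJ1 i hi).reverse)
  have hlast : l2.getLast? = some z1 := by
    rw [hr2.getLast?, List.getLast?_reverse, hh1]
  have hJ2two : 1 < J2.card := by
    rw [Finset.card_univ, Fintype.card_fin] at hJ1c
    have := H.rot
    omega
  obtain ⟨i, hi, j, hj, hij⟩ := Finset.one_lt_card.1 hJ2two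
  obtain ⟨i, j, hij, X', Y', hXY, hiX, hjY⟩ :
      ∃ i j, i ≠ j ∧ ∃ X' Y', l2 = X' ++ Y' ∧ Intact (I i) X' ∧ Intact (I j) Y' := by
    obtain ⟨X', Y', h, h' | h'⟩ := exists_cut_of_intact (hJ2 i hi) (hJ2 j hj) (hId i j hij)
    · exact ⟨i, j, hij, X', Y', h, h'⟩
    · exact ⟨j, i, hij.symm, X', Y', h, h'⟩
  -- the blocks are nonempty
  have hne : ∀ i, ∀ W : List V, Intact (I i) W → W ≠ [] := by
    intro i W hW hW0
    have h3 := hrich z1 hz1 i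
    have h4 := (dg_le_card Γ z1 (P i))
    have h5 : (P i).Nonempty := by
      rw [← Finset.card_pos]; have := H.kap; omega
    obtain ⟨y, hy⟩ := h5
    simp only [hP, Finset.mem_filter] at hy
    obtain ⟨a, -, c, -, h6⟩ := hW.triple hy.2
    rw [hW0] at h6
    simp at h6
  have hX0 := hne i X' hiX
  have hY0 := hne j Y' hjY
  rw [hXY] at hl2 hc2 hh2 hlast
  rw [List.nodup_append] at hl2
  rw [List.isChain_append] at hc2
  have hXhead : ∃ z ∈ A, X'.head? = some z := by
    refine ⟨z2, hz2, ?_⟩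
    cases X' with
    | nil => exact absurd rfl hX0
    | cons a t => simpa using hh2
  have hYhead : ∃ z ∈ A, Y'.reverse.head? = some z := by
    refine ⟨z1, hz1, ?_⟩
    rw [List.head?_reverse]
    rw [List.getLast?_append_of_ne_nil _ hY0] at hlast
    exact hlast
  have hexpA : ∀ S T : Finset V, S ⊆ A → (∀ s ∈ S, κ ≤ dg Γ s T) →
      m ≤ S.card ∨ 12 * S.card ≤ T.card := fun S T hS => H.exp S T (hS.trans hAX)
  have hSL := le_card_heads hl2.1 hXhead (P := P i) (κ := κ)
    (fun y hy => hiX.triple (Finset.mem_filter.1 hy).2) (fun u hu => hrich u hu i) hexpA H.pow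
  have hSR := le_card_heads (List.nodup_reverse.2 hl2.2.1) hYhead (P := P j) (κ := κ)
    (fun y hy => hjY.reverse.triple (Finset.mem_filter.1 hy).2) (fun u hu => hrich u hu j) hexpA
    H.pow
  have hmemL : ∀ u ∈ heads Γ A (P i) X' τ, u ∈ X' := by
    intro u hu
    simp only [heads, Finset.mem_filter, Finset.mem_univ, true_and] at hu
    obtain ⟨l', hr, hh⟩ := hu
    exact hr.perm.mem_iff.1 (List.mem_of_mem_head? hh)
  have hmemR : ∀ u ∈ heads Γ A (P j) Y'.reverse τ, u ∈ Y' := by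
    intro u hu
    simp only [heads, Finset.mem_filter, Finset.mem_univ, true_and] at hu
    obtain ⟨l', hr, hh⟩ := hu
    exact List.mem_reverse.1 (hr.perm.mem_iff.1 (List.mem_of_mem_head? hh))
  obtain ⟨s, hs, t, ht, hst⟩ := H.link _ _ ((heads_subset hXhead).trans hAZ)
    ((heads_subset hYhead).trans hAZ) hSL hSR (by
      rw [Finset.disjoint_left]
      intro u hu hu'
      exact hl2.2.2 u (hmemL u hu) u (hmemR u hu') rfl)
  have hsX := hAX (heads_subset hXhead hs)
  have htX := hAX (heads_subset hYhead ht)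
  simp only [heads, Finset.mem_filter, Finset.mem_univ, true_and] at hs ht
  obtain ⟨L', hrL, hhL⟩ := hs
  obtain ⟨M', hrM, hhM⟩ := ht
  have hΓA : ∀ k, ∀ x ∈ A, ∀ p ∈ P k, Γ.Adj x p → R x p :=
    fun k x hx p hp h => hΓR' x (hAX hx) p (hPQ k hp) h
  have hcL : L'.IsChain R := hrL.isChain hR (hΓA i) hXhead hc2.1
  have hcM : M'.reverse.IsChain R := by
    rw [List.isChain_reverse]
    refine (hrM.isChain hR (hΓA j) hYhead ?_).imp (fun _ _ h => hR h)
    rw [List.isChain_reverse]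
    exact hc2.2.1.imp (fun _ _ h => hR h)
  refine ⟨L' ++ M'.reverse, ?_, ?_, s, t, ?_, ?_, hΓR t htX s hsX hst.symm, hst.ne⟩
  · have p1 : (L' ++ M'.reverse).Perm (X' ++ Y') := by
      refine hrL.perm.append ?_
      exact (List.reverse_perm _).trans (hrM.perm.trans (List.reverse_perm _))
    rw [← hXY] at p1
    exact p1.trans (hr2.perm.trans ((List.reverse_perm _).trans hr1.perm))
  · rw [List.isChain_append]
    refine ⟨hcL, hcM, ?_⟩
    rw [hrL.getLast?, List.head?_reverse, hrM.getLast?, List.getLast?_reverse]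
    exact hc2.2.2
  · simp [hhL]
  · simp [hhM]

end Closing

section Conversion
variable {V : Type} [Fintype V]

lemma exists_list_of_isCycleOn {σ : Equiv.Perm V} (hσ : σ.IsCycleOn Set.univ) (u : V) :
    ∃ l : List V, l.Nodup ∧ (∀ v, v ∈ l) ∧ l.head? = some (σ u) ∧ l.getLast? = some u ∧
      l.IsChain (fun a b => b = σ a ∧ a ≠ u) := by
  set n := Fintype.card V with hn
  have hpos : 0 < n := Fintype.card_pos_iff.2 ⟨u⟩
  have hσ' : σ.IsCycleOn (Finset.univ : Finset V) := by simpa using hσ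
  have hinj : ∀ i < n, ∀ j < n, (σ ^ (i + 1)) u = (σ ^ (j + 1)) u → i = j := by
    intro i hi j hj h
    have := (hσ'.pow_apply_eq_pow_apply (Finset.mem_univ u)).1 h
    rw [Finset.card_univ] at this
    have h2 : i ≡ j [MOD n] := Nat.ModEq.add_right_cancel' 1 this
    rwa [Nat.ModEq, Nat.mod_eq_of_lt hi, Nat.mod_eq_of_lt hj] at h2
  refine ⟨List.ofFn (fun i : Fin n => (σ ^ (i.1 + 1)) u), ?_, ?_, ?_, ?_, ?_⟩
  · rw [List.nodup_ofFn]
    intro i j h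
    exact Fin.ext (hinj _ i.2 _ j.2 h)
  · intro v
    have : Function.Bijective (fun i : Fin n => (σ ^ (i.1 + 1)) u) := by
      rw [Fintype.bijective_iff_injective_and_card]
      exact ⟨fun i j h => Fin.ext (hinj _ i.2 _ j.2 h), by simp [hn]⟩
    rw [List.mem_ofFn]
    exact this.2 v
  · rw [List.head?_eq_getElem?, List.getElem?_ofFn]
    simp [hpos]
  · rw [List.getLast?_eq_getElem?, List.getElem?_ofFn]
    simp only [List.length_ofFn]
    rw [dif_pos (by omega), Nat.sub_add_cancel hpos]
    have := hσ'.pow_card_apply (Finset.mem_univ u)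
    rw [Finset.card_univ] at this
    rw [this]
  · rw [List.isChain_iff_getElem]
    intro i hi
    rw [List.length_ofFn] at hi
    simp only [List.getElem_ofFn]
    refine ⟨by rw [pow_succ' σ (i + 1)]; rfl, ?_⟩
    intro h
    have := (hσ'.pow_apply_eq (Finset.mem_univ u)).1 h
    rw [Finset.card_univ] at this
    exact absurd (Nat.le_of_dvd (by omega) this) (by omega)

lemma exists_isCycleOn_of_list {R : V → V → Prop} {l : List V} (hl : l.Nodup) (hm : ∀ v, v ∈ l)
    (hc : l.IsChain R) {s t : V} (hs : l.head? = some s) (ht : l.getLast? = some t)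
    (hts : R t s) : ∃ σ : Equiv.Perm V, σ.IsCycleOn Set.univ ∧ ∀ u, R u (σ u) := by
  refine ⟨l.formPerm, ?_, ?_⟩
  · have := hl.isCycleOn_formPerm
    rwa [show {a | a ∈ l} = Set.univ from Set.eq_univ_of_forall hm] at this
  · intro u
    obtain ⟨i, hi, rfl⟩ := List.getElem_of_mem (hm u)
    rw [List.formPerm_apply_getElem l hl i hi]
    rcases Nat.lt_or_ge (i + 1) l.length with h | h
    · simp only [Nat.mod_eq_of_lt h]
      exact List.isChain_iff_getElem.1 hc i h
    · have e : i = l.length - 1 := by omega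
      have e2 : (i + 1) % l.length = 0 := by
        rw [show i + 1 = l.length by omega, Nat.mod_self]
      simp only [e2]
      have h1 : l[i] = t := by
        rw [List.getLast?_eq_getElem?, ← e, List.getElem?_eq_getElem hi] at ht
        simpa using ht
      have h2 : l[0] = s := by
        rw [List.head?_eq_getElem?, List.getElem?_eq_getElem (by omega)] at hs
        simpa using hs
      rw [h1, h2]
      exact hts

/-- All cycles of a permutation can be merged at arcs inside `X`. -/
lemma exists_isCycleOn_merge [Nonempty V] {Rel : V → V → Prop} {X : Finset V} (π : Equiv.Perm V)
    (hπ : ∀ u, Rel u (π u) ∨ (u ∈ X ∧ π u ∈ X))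
    (hcyc : ∀ u, ∃ a, π.SameCycle u a ∧ a ∈ X ∧ π a ∈ X) :
    ∃ σ : Equiv.Perm V, σ.IsCycleOn Set.univ ∧ ∀ u, Rel u (σ u) ∨ (u ∈ X ∧ σ u ∈ X) := by
  obtain ⟨x⟩ := ‹Nonempty V›
  set F : Finset (Equiv.Perm V) := Finset.univ.filter (fun π =>
    (∀ u, Rel u (π u) ∨ (u ∈ X ∧ π u ∈ X)) ∧ ∀ u, ∃ a, π.SameCycle u a ∧ a ∈ X ∧ π a ∈ X) with hF
  obtain ⟨σ, hσ, hmax⟩ := F.exists_max_image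
    (fun σ => (Finset.univ.filter fun y => σ.SameCycle x y).card)
    ⟨π, by simp only [hF, Finset.mem_filter, Finset.mem_univ, true_and]; exact ⟨hπ, hcyc⟩⟩
  simp only [hF, Finset.mem_filter, Finset.mem_univ, true_and] at hσ hmax
  obtain ⟨hσ1, hσ2⟩ := hσ
  refine ⟨σ, ?_, hσ1⟩
  have hall : ∀ y, σ.SameCycle x y := by
    by_contra hcon
    push Not at hcon
    obtain ⟨y, hy⟩ := hcon
    obtain ⟨a, ha, haX, haX'⟩ := hσ2 x
    obtain ⟨b, hb, hbX, hbX'⟩ := hσ2 y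
    have hab : ¬ σ.SameCycle a b := fun h => hy (ha.trans (h.trans hb.symm))
    have hne : a ≠ b := fun h => hab (h ▸ Equiv.Perm.SameCycle.refl _ _)
    set ρ : Equiv.Perm V := σ * Equiv.swap a b with hρ
    have ρa : ρ a = σ b := by simp [hρ]
    have ρb : ρ b = σ a := by simp [hρ]
    have ρz : ∀ z, z ≠ a → z ≠ b → ρ z = σ z := by
      intro z h1 h2; simp [hρ, Equiv.swap_apply_of_ne_of_ne h1 h2]
    have step : ∀ z, ρ.SameCycle z (ρ z) := fun z => ⟨1, by simp⟩
    have hba : ρ.SameCycle b a := by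
      have key : ∀ k : ℕ, ρ.SameCycle b ((σ ^ (k + 1)) a) ∨ ρ.SameCycle b a := by
        intro k
        induction k with
        | zero => left; simpa [ρb] using step b
        | succ k ih =>
          rcases ih with ih | ih
          · by_cases h : (σ ^ (k + 1)) a = a
            · right; rwa [h] at ih
            · left
              have h2 : (σ ^ (k + 1)) a ≠ b := fun h => hab ⟨((k + 1 : ℕ) : ℤ), by rw [zpow_natCast]; exact h⟩
              have h3 := ih.trans (step _)
              rw [ρz _ h h2] at h3
              rwa [pow_succ' σ (k + 1)]
          · exact Or.inr ih
      have := key (orderOf σ - 1)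
      rw [Nat.sub_add_cancel (orderOf_pos σ), pow_orderOf_eq_one] at this
      simpa using this
    have hstep : ∀ z, ρ.SameCycle z (σ z) := by
      intro z
      by_cases h1 : z = a
      · subst h1
        have := step b
        rw [ρb] at this
        exact hba.symm.trans this
      by_cases h2 : z = b
      · subst h2
        have := step a
        rw [ρa] at this
        exact hba.trans this
      · have := step z
        rwa [ρz z h1 h2] at this
    have hle : ∀ u v, σ.SameCycle u v → ρ.SameCycle u v := by
      intro u v h
      obtain ⟨k, -, hk⟩ := h.exists_pow_eq'
      rw [← hk]
      clear hk
      induction k with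
      | zero => exact Equiv.Perm.SameCycle.refl _ _
      | succ k ih =>
        rw [pow_succ']
        exact ih.trans (hstep _)
    have hρF : (∀ u, Rel u (ρ u) ∨ (u ∈ X ∧ ρ u ∈ X)) ∧
        ∀ u, ∃ a, ρ.SameCycle u a ∧ a ∈ X ∧ ρ a ∈ X := by
      constructor
      · intro u
        by_cases h1 : u = a
        · subst h1; right; rw [ρa]; exact ⟨haX, hbX'⟩
        by_cases h2 : u = b
        · subst h2; right; rw [ρb]; exact ⟨hbX, haX'⟩
        rw [ρz u h1 h2]; exact hσ1 u
      · intro u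
        obtain ⟨c, hc, hcX, hcX'⟩ := hσ2 u
        refine ⟨c, hle _ _ hc, hcX, ?_⟩
        by_cases h1 : c = a
        · subst h1; rw [ρa]; exact hbX'
        by_cases h2 : c = b
        · subst h2; rw [ρb]; exact haX'
        rwa [ρz c h1 h2]
    have h := hmax ρ hρF
    apply absurd h
    rw [not_le]
    apply Finset.card_lt_card
    rw [Finset.ssubset_iff_of_subset]
    · refine ⟨y, ?_, by simpa using hy⟩
      simp only [Finset.mem_filter, Finset.mem_univ, true_and]
      exact (hle _ _ ha).trans (hba.symm.trans (hle _ _ hb.symm))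
    · intro z hz
      simp only [Finset.mem_filter, Finset.mem_univ, true_and] at hz ⊢
      exact hle _ _ hz
  refine ⟨?_, fun u _ v _ => (hall u).symm.trans (hall v)⟩
  simp only [Set.bijOn_univ]
  exact σ.bijective

/-- Replacing all virtual arcs of a cyclic permutation by edges of `Γ`. -/
theorem exists_conversion {Γ : SimpleGraph V} {X Z Q : Finset V} {K κ m b b' τ : ℕ}
    (H : Closable Γ X Z Q K κ m b b' τ) (hcard : 3 ≤ Fintype.card V) {Rel : V → V → Prop}
    (hRel : ∀ ⦃a b⦄, Rel a b → Rel b a) (hQ : ∀ y ∈ Q, ∀ z, Rel y z → z ∈ X)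
    (σ₀ : Equiv.Perm V) (hσ₀ : σ₀.IsCycleOn Set.univ)
    (hσ₀' : ∀ u, Rel u (σ₀ u) ∨ (u ∈ X ∧ σ₀ u ∈ X)) :
    ∃ σ : Equiv.Perm V, σ.IsCycleOn Set.univ ∧
      ∀ u, Rel u (σ u) ∨ (u ∈ X ∧ σ u ∈ X ∧ Γ.Adj u (σ u)) := by
  have main : ∀ W : Finset (Sym2 V), (∃ σ : Equiv.Perm V, σ.IsCycleOn Set.univ ∧
      ∀ u, Rel u (σ u) ∨ (u ∈ X ∧ σ u ∈ X ∧ (Γ.Adj u (σ u) ∨ s(u, σ u) ∈ W))) →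
      ∃ σ : Equiv.Perm V, σ.IsCycleOn Set.univ ∧
      ∀ u, Rel u (σ u) ∨ (u ∈ X ∧ σ u ∈ X ∧ Γ.Adj u (σ u)) := by
    intro W
    induction W using Finset.induction_on with
    | empty => simp
    | insert e W he ih =>
      rintro ⟨σ, hσ, hσ'⟩
      apply ih
      by_cases hex : ∃ u, s(u, σ u) = e ∧ u ∈ X ∧ σ u ∈ X
      swap
      · refine ⟨σ, hσ, fun u => ?_⟩
        rcases hσ' u with h | ⟨h1, h2, h3⟩
        · exact Or.inl h
        · refine Or.inr ⟨h1, h2, h3.imp id fun h3 => ?_⟩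
          rcases Finset.mem_insert.1 h3 with h | h
          · exact absurd ⟨u, h, h1, h2⟩ hex
          · exact h
      obtain ⟨u, rfl, huX, hσuX⟩ := hex
      obtain ⟨l, hl, hlm, hlh, hll, hlc⟩ := exists_list_of_isCycleOn hσ u
      set R : V → V → Prop := fun a b =>
        Rel a b ∨ (a ∈ X ∧ b ∈ X ∧ (Γ.Adj a b ∨ s(a, b) ∈ W)) with hR
      have hRs : ∀ ⦃a b⦄, R a b → R b a := by
        rintro a b (h | ⟨h1, h2, h3⟩)
        · exact Or.inl (hRel h)
        · exact Or.inr ⟨h2, h1, h3.imp (fun h => h.symm) (fun h => by rwa [Sym2.eq_swap])⟩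
      have hlR : l.IsChain R := by
        refine hlc.imp ?_
        rintro a c ⟨rfl, ha⟩
        refine (hσ' a).imp id fun ⟨h1, h2, h3⟩ => ⟨h1, h2, h3.imp id fun h3 => ?_⟩
        rcases Finset.mem_insert.1 h3 with h | h
        · exfalso
          rcases Sym2.eq_iff.1 h with ⟨h, -⟩ | ⟨h4, h5⟩
          · exact ha h
          · have hσ' : σ.IsCycleOn (Finset.univ : Finset V) := by simpa using hσ
            have := (hσ'.pow_apply_eq (Finset.mem_univ u) (n := 2)).1 (by
              rw [pow_two, Equiv.Perm.mul_apply, ← h4, h5])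
            rw [Finset.card_univ] at this
            have := Nat.le_of_dvd (by omega) this
            omega
        · exact h
      obtain ⟨l', hp, hc, s, t, hs, ht, hts, -⟩ := exists_closing H hRs
        (fun x hx y hy h => Or.inr ⟨hx, hy, Or.inl h⟩)
        (fun y hy z h => by
          rcases h with h | ⟨-, h, -⟩
          · exact hQ y hy z h
          · exact h) hl hlR (fun v _ => hlm v) ⟨_, hσuX, hlh⟩ ⟨_, huX, hll⟩
      exact exists_isCycleOn_of_list (hp.nodup_iff.2 hl) (fun v => hp.mem_iff.2 (hlm v)) hc hs ht hts
  apply main Finset.univ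
  exact ⟨σ₀, hσ₀, fun u => (hσ₀' u).imp id fun ⟨h1, h2⟩ => ⟨h1, h2, Or.inr (Finset.mem_univ _)⟩⟩

end Conversion

/-- Number of ordered pairs in `S × T` that are edges of `Γ`. -/
noncomputable def edg {V : Type} (Γ : SimpleGraph V) (S T : Finset V) : ℕ := ∑ s ∈ S, dg Γ s T

/-- An upper bound on the number of edges between any two sets of vertices. -/
def UpperReg {V : Type} (Γ : SimpleGraph V) (q A ε : ℝ) : Prop :=
  ∀ S T : Finset V, (edg Γ S T : ℝ) ≤ (1 + ε) * q * S.card * T.card + A * (S.card + T.card)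

section Upper
variable {V : Type}

lemma card_mul_le_edg {Γ : SimpleGraph V} {S T : Finset V} {c : ℝ}
    (h : ∀ s ∈ S, c ≤ (dg Γ s T : ℝ)) : S.card * c ≤ (edg Γ S T : ℝ) := by
  unfold edg
  push_cast
  have := Finset.card_nsmul_le_sum S (fun s => (dg Γ s T : ℝ)) c h
  simpa using this

lemma dg_sdiff_add (Γ : SimpleGraph V) (v : V) {S T : Finset V} (h : S ⊆ T) :
    dg Γ v (T \ S) + dg Γ v S = dg Γ v T := by
  unfold dg
  rw [← Finset.card_union_of_disjoint, ← Finset.filter_union, Finset.sdiff_union_of_subset h]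
  exact Finset.disjoint_filter_filter Finset.sdiff_disjoint

variable [Fintype V]

set_option maxHeartbeats 1000000 in
theorem closable_of_upperReg {Γ : SimpleGraph V} {X Z Q : Finset V} {q A ε : ℝ} {w : ℕ}
    (Zs : Fin 3 → Finset V) (hU : UpperReg Γ q A ε) (hq0 : 0 < q) (hq1 : q ≤ 1) (hA : 1 ≤ A)
    (hε0 : 0 ≤ ε)
    (hε : ε * (24000 * (2 * w + 2)) ≤ 1) (hcard : Fintype.card V ≤ 4 ^ w)
    (hN : 20000000 * (2 * w + 2) ^ 3 * A ≤ q * Q.card) (hQX : Q ⊆ X)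
    (hdegQ : ∀ v ∈ X, (1 - ε) * (q * Q.card) ≤ dg Γ v Q)
    (hXZ : ((X \ Z).card : ℝ) * (7000 * (2 * w + 2)) ≤ Q.card)
    (hZs : ∀ v ∈ Z, ∃ i, v ∈ Zs i) (hZc : ∀ i, ((Zs i).card : ℝ) ≤ (1 + ε) * Q.card)
    (hZd : ∀ i, ∀ v ∈ Z, (1 - ε) * (q * Q.card) ≤ dg Γ v (Zs i)) :
    ∃ K κ m b b' : ℕ, Closable Γ X Z Q K κ m b b' w := by
  set y : ℝ := (Q.card : ℝ) with hy
  set N : ℝ := q * y with hNdef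
  set k : ℝ := 2 * (w : ℝ) + 2 with hk
  have hk2 : 2 ≤ k := by rw [hk]; have := Nat.cast_nonneg (α := ℝ) w; linarith
  have hy0 : 0 ≤ y := Nat.cast_nonneg _
  clear_value y N k
  have hk0 : 0 < k := by linarith
  have hk3 : k ≤ k ^ 3 := by nlinarith [sq_nonneg (k - 1), mul_pos hk0 hk0]
  have hk23 : 2 * k ^ 2 ≤ k ^ 3 := by nlinarith [mul_pos hk0 hk0]
  have hk1 : 2 * k ≤ k ^ 2 := by nlinarith
  have hkA : k ^ 3 ≤ k ^ 3 * A := by nlinarith [pow_pos hk0 3]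
  have hNbig : 0 ≤ N - 20000000 * k := by nlinarith
  have hNk : 0 ≤ N / k - 20000000 * k ^ 2 * A := by
    rw [sub_nonneg, le_div_iff₀ hk0]
    calc _ = 20000000 * k ^ 3 * A := by ring
      _ ≤ N := hN
  have hNk1 : 0 ≤ N / k - 20000000 * k * A := by
    have : k * A ≤ k ^ 2 * A := by apply mul_le_mul_of_nonneg_right _ (by linarith); nlinarith
    nlinarith
  have hNkA : 0 ≤ N / k - 20000000 * A := by nlinarith
  have hNy : N ≤ y := by rw [hNdef]; nlinarith
  have hyk : 0 ≤ y / k - 20000000 := by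
    rw [sub_nonneg, le_div_iff₀ hk0]; linarith
  have hypos : 0 < y := by linarith
  have hN0 : 0 < N := by rw [hNdef]; exact mul_pos hq0 hypos
  have hNk0 : 0 < N / k := div_pos hN0 hk0
  have hNeq : N = N / k * k := by field_simp
  have hyeq : y = y / k * k := by field_simp
  have hεN : 0 ≤ N / k / 24000 - ε * N := by
    have : N / k / 24000 = N * (1 / (24000 * k)) := by field_simp
    rw [sub_nonneg, this, mul_comm]
    apply mul_le_mul_of_nonneg_left _ hN0.le
    rw [le_div_iff₀ (by positivity)]
    linarith
  have hε1 : 0 ≤ 1 / 48000 - ε := by nlinarith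
  have hXZ' : 0 ≤ y / k / 7000 - ((X \ Z).card : ℝ) := by
    rw [sub_nonneg, div_div, le_div_iff₀ (by positivity)]
    linarith
  have hqNk : q * (y / k) = N / k := by rw [hNdef]; ring
  have hN3 : y / k / 7000 * (20000000 * k ^ 3 * A) ≤ y / k / 7000 * N :=
    mul_le_mul_of_nonneg_left hN (by positivity)
  have hAN : 2 * k * A * y / N * k ≤ y / k / 7000 := by
    rw [div_mul_eq_mul_div, div_le_iff₀ hN0]
    have e : y / k / 7000 * (20000000 * k ^ 3 * A) = (20000000 / 7000) * (y * k ^ 2 * A) := by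
      field_simp
    have : 0 ≤ y * k ^ 2 * A := by positivity
    linarith
  clear hN hε hXZ hN3
  -- parameters
  set K : ℕ := 2 * w + 2 with hK
  have hKk : (K : ℝ) = k := by rw [hK, hk]; push_cast; ring
  set κ : ℕ := ⌈N / k / 17⌉₊ with hκ
  have hκ1 : N / k / 17 ≤ κ := Nat.le_ceil _
  have hκ2 : (κ : ℝ) ≤ N / k / 17 + 1 := (Nat.ceil_lt_add_one (by positivity)).le
  set m : ℕ := ⌈y / k / 1000⌉₊ with hm
  have hm1 : y / k / 1000 ≤ m := Nat.le_ceil _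
  have hm2 : (m : ℝ) < y / k / 1000 + 1 := Nat.ceil_lt_add_one (by positivity)
  set b : ℕ := ⌊y / k / 3000⌋₊ with hb
  have hb1 : (b : ℝ) ≤ y / k / 3000 := Nat.floor_le (by positivity)
  have hb2 : y / k / 3000 < b + 1 := Nat.lt_floor_add_one _
  set b' : ℕ := ⌊2 * k * A * y / N⌋₊ with hb'
  have hb'1 : (b' : ℝ) ≤ 2 * k * A * y / N := Nat.floor_le (by positivity)
  have hb'3 : ∀ x : ℕ, (x : ℝ) ≤ 2 * k * A * y / N → x ≤ b' := fun x hx => Nat.le_floor hx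
  have hK0 : 0 < K := by omega
  clear_value κ m b b'
  refine ⟨K, κ, m, b, b', hQX, ?_, ?_, ?_, ?_, ?_, ?_, ?_, ?_, ?_⟩
  · -- kap
    have : (1 : ℝ) ≤ κ := by linarith
    exact_mod_cast this
  · -- exp
    intro S T _ hST
    by_contra hcon
    push Not at hcon
    obtain ⟨h1, h2⟩ := hcon
    have h3 := card_mul_le_edg (Γ := Γ) (S := S) (T := T) (c := κ)
      (fun s hs => by exact_mod_cast hST s hs)
    have h4 := hU S T
    have h1' : (S.card : ℝ) + 1 ≤ m := by exact_mod_cast h1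
    have h2' : (T.card : ℝ) ≤ 12 * S.card := by exact_mod_cast h2.le
    have hS0 : 0 < (S.card : ℝ) := by
      have : 0 < S.card := by omega
      exact_mod_cast this
    have h5 : (1 + ε) * q * S.card * T.card ≤ 2 * q * S.card * (12 * (y / k / 1000)) := by
      have h6 : (T.card : ℝ) ≤ 12 * (y / k / 1000) := by linarith
      have h7 : 0 ≤ q * S.card := mul_nonneg hq0.le hS0.le
      have h8 : q * S.card * T.card ≤ q * S.card * (12 * (y / k / 1000)) :=
        mul_le_mul_of_nonneg_left h6 h7
      have h9 : (1 + ε) * (q * S.card * T.card) ≤ 2 * (q * S.card * T.card) :=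
        mul_le_mul_of_nonneg_right (by linarith) (mul_nonneg h7 (Nat.cast_nonneg _))
      linarith
    have h6 : 2 * q * S.card * (12 * (y / k / 1000)) = S.card * (24 / 1000 * (N / k)) := by
      rw [← hqNk]; ring
    have h7 : A * (S.card + T.card) ≤ S.card * (13 * A) := by
      have := mul_le_mul_of_nonneg_left h2' (by linarith : 0 ≤ A)
      linarith
    have h8 : (S.card : ℝ) * κ ≤ S.card * (24 / 1000 * (N / k) + 13 * A) := by
      rw [mul_add]; linarith
    have h9 := le_of_mul_le_mul_left h8 hS0
    linarith
  · -- degQ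
    intro v hv
    have h1 := hdegQ v hv
    have h2 : N / k * 2 ≤ N := by
      have := mul_le_mul_of_nonneg_left hk2 hNk0.le
      linarith
    have : (κ : ℝ) + 2 ≤ dg Γ v Q := by linarith
    exact_mod_cast this
  · -- poor
    intro Q' hQ' hc
    set B := X.filter fun v => dg Γ v Q' < 2 * κ + 2 with hB
    have hBd : ∀ v ∈ B, (1 - ε) * N - 2 * κ - 2 ≤ (dg Γ v (Q \ Q') : ℝ) := by
      intro v hv
      rw [hB, Finset.mem_filter] at hv
      have h1 := hdegQ v hv.1
      have h2 := dg_sdiff_add Γ v hQ'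
      have h2' : (dg Γ v (Q \ Q') : ℝ) + dg Γ v Q' = dg Γ v Q := by exact_mod_cast h2
      have h3 : (dg Γ v Q' : ℝ) ≤ 2 * κ + 2 := by exact_mod_cast hv.2.le
      linarith
    have h3 := card_mul_le_edg hBd
    have h4 := hU B (Q \ Q')
    have hc' : y / k - 1 ≤ Q'.card := by
      have h5 : Q.card < K * (Q.card / K + 1) := Nat.lt_mul_div_succ _ hK0
      have h6 : Q.card ≤ K * (Q'.card + 1) := h5.le.trans (Nat.mul_le_mul_left _ (by omega))
      have h7 : y ≤ k * (Q'.card + 1) := by rw [hy, ← hKk]; exact_mod_cast h6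
      rw [sub_le_iff_le_add, div_le_iff₀ hk0]; linarith
    have hcd : ((Q \ Q').card : ℝ) = y - Q'.card := by
      rw [Finset.card_sdiff_of_subset hQ', Nat.cast_sub (Finset.card_le_card hQ'), hy]
    have hB0 : 0 ≤ (B.card : ℝ) := Nat.cast_nonneg _
    have h5 : (1 + ε) * q * B.card * (Q \ Q').card ≤ B.card * ((1 + ε) * (N - N / k + 1)) := by
      rw [hcd]
      have : q * (y - Q'.card) ≤ N - N / k + 1 := by
        have h6 : q * (y - Q'.card) ≤ q * (y - y / k + 1) :=
          mul_le_mul_of_nonneg_left (by linarith) hq0.le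
        have h7 : q * (y - y / k + 1) = N - N / k + q := by rw [← hqNk, hNdef]; ring
        linarith
      calc _ = B.card * ((1 + ε) * (q * (y - Q'.card))) := by ring
        _ ≤ _ := mul_le_mul_of_nonneg_left (mul_le_mul_of_nonneg_left this (by linarith)) hB0
    have h6 : A * (B.card + (Q \ Q').card) ≤ B.card * A + A * y := by
      rw [hcd]
      have := mul_nonneg (by linarith : 0 ≤ A) (Nat.cast_nonneg (α := ℝ) Q'.card)
      linarith
    have h7 : (B.card : ℝ) * (N / k / 2) ≤ A * y := by
      have h8 : N / k / 2 ≤ (1 - ε) * N - 2 * κ - 2 - (1 + ε) * (N - N / k + 1) - A := by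
        have e : (1 - ε) * N - (1 + ε) * (N - N / k + 1) =
          - 2 * (ε * N) + N / k + ε * (N / k) - 1 - ε := by ring
        have : 0 ≤ ε * (N / k) := mul_nonneg hε0 hNk0.le
        have h10 : A ≤ N / k / 1000 := by linarith
        have h11 : 1 ≤ N / k / 1000 := by linarith
        linarith
      have h9 : (B.card : ℝ) * (N / k / 2) ≤
        B.card * ((1 - ε) * N - 2 * κ - 2 - (1 + ε) * (N - N / k + 1) - A) :=
        mul_le_mul_of_nonneg_left h8 hB0
      linarith
    apply hb'3
    rw [le_div_iff₀ hN0]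
    have : (B.card : ℝ) * N = (B.card : ℝ) * (N / k / 2) * (2 * k) := by
      linear_combination (B.card : ℝ) * hNeq
    rw [this]
    have := mul_le_mul_of_nonneg_right h7 (by linarith : 0 ≤ 2 * k)
    linarith
  · -- bad
    have h1 : ((K * b' + (X \ Z).card : ℕ) : ℝ) < b + 1 := by
      push_cast
      rw [hKk]
      have h2 : k * (b' : ℝ) ≤ y / k / 7000 := by
        calc k * (b' : ℝ) ≤ k * (2 * k * A * y / N) := mul_le_mul_of_nonneg_left hb'1 hk0.le
          _ = 2 * k * A * y / N * k := by ring
          _ ≤ _ := hAN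
      linarith
    have : K * b' + (X \ Z).card < b + 1 := by exact_mod_cast h1
    omega
  · -- lt
    have : ((2 * b : ℕ) : ℝ) < m := by push_cast; linarith
    exact_mod_cast this
  · -- link
    intro S S' hS hS' hSm hSm' hdis
    by_contra hcon
    push Not at hcon
    have hSle : (S.card : ℝ) ≤ ∑ i, ((Zs i ∩ S).card : ℝ) := by
      have h1 : S ⊆ Finset.univ.biUnion (fun i => Zs i ∩ S) := by
        intro v hv
        obtain ⟨i, hi⟩ := hZs v (hS hv)
        simp only [Finset.mem_biUnion, Finset.mem_inter]
        exact ⟨i, Finset.mem_univ _, hi, hv⟩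
      have := (Finset.card_le_card h1).trans Finset.card_biUnion_le
      exact_mod_cast this
    obtain ⟨i, hi⟩ : ∃ i, (S.card : ℝ) / 3 ≤ ((Zs i ∩ S).card : ℝ) := by
      by_contra hc
      push Not at hc
      rw [Fin.sum_univ_three] at hSle
      have := hc 0
      have := hc 1
      have := hc 2
      linarith
    have hd : ∀ s ∈ S', (1 - ε) * N ≤ (dg Γ s (Zs i \ S) : ℝ) := by
      intro s hs
      refine (hZd i s (hS' hs)).trans ?_
      have : dg Γ s (Zs i) ≤ dg Γ s (Zs i \ S) := by
        apply Finset.card_le_card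
        intro z hz
        rw [Finset.mem_filter] at hz ⊢
        refine ⟨Finset.mem_sdiff.2 ⟨hz.1, fun hzS => hcon z hzS s hs hz.2.symm⟩, hz.2⟩
      exact_mod_cast this
    have h3 := card_mul_le_edg hd
    have h4 := hU S' (Zs i \ S)
    have hmS : y / k / 1000 ≤ S.card := hm1.trans (by exact_mod_cast hSm)
    have hmS' : y / k / 1000 ≤ S'.card := hm1.trans (by exact_mod_cast hSm')
    have hc1 : ((Zs i \ S).card : ℝ) ≤ (1 + ε) * y - y / k / 3000 := by
      have h5 : (Zs i \ S).card + (Zs i ∩ S).card = (Zs i).card := Finset.card_sdiff_add_card_inter _ _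
      have h6 : ((Zs i \ S).card : ℝ) + (Zs i ∩ S).card = (Zs i).card := by exact_mod_cast h5
      have := hZc i
      linarith
    have hS0 : 0 < (S'.card : ℝ) := by linarith
    have h5 : (1 + ε) * q * S'.card * (Zs i \ S).card ≤
        S'.card * ((1 + ε) * ((1 + ε) * N - N / k / 3000)) := by
      calc (1 + ε) * q * S'.card * (Zs i \ S).card
          ≤ (1 + ε) * q * S'.card * ((1 + ε) * y - y / k / 3000) :=
            mul_le_mul_of_nonneg_left hc1 (mul_nonneg (mul_nonneg (by linarith) hq0.le) hS0.le)
        _ = _ := by rw [← hqNk, hNdef]; ring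
    have hc2 : ((Zs i \ S).card : ℝ) ≤ 2 * y := by
      have : 0 ≤ y / k := div_nonneg hy0 hk0.le
      have := mul_nonneg hε1 hy0
      linarith
    have h6 : A * (S'.card + (Zs i \ S).card) ≤ S'.card * (A * (1 + 2000 * k)) := by
      have h7 : 2 * y ≤ S'.card * (2000 * k) := by
        have e : 2 * y = y / k / 1000 * (2000 * k) := by field_simp; norm_num
        rw [e]; exact mul_le_mul_of_nonneg_right hmS' (by linarith)
      calc A * (S'.card + (Zs i \ S).card) ≤ A * (S'.card + S'.card * (2000 * k)) := by
            exact mul_le_mul_of_nonneg_left (by linarith) (by linarith)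
        _ = _ := by ring
    have h8 : (S'.card : ℝ) * ((1 - ε) * N) ≤
        S'.card * ((1 + ε) * ((1 + ε) * N - N / k / 3000) + A * (1 + 2000 * k)) := by linarith
    have h9 := le_of_mul_le_mul_left h8 hS0
    have h10 : A * (1 + 2000 * k) ≤ N / k / 9000 := by
      have : A * 1 ≤ A * k := mul_le_mul_of_nonneg_left (by linarith) (by linarith)
      linarith
    have h11 : ε * (ε * N) ≤ 1 * (ε * N) :=
      mul_le_mul_of_nonneg_right (by linarith) (mul_nonneg hε0 hN0.le)
    have h12 : 0 ≤ ε * (N / k) := mul_nonneg hε0 hNk0.le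
    have h13 : (1 + ε) * ((1 + ε) * N - N / k / 3000) + A * (1 + 2000 * k) =
      N + 2 * (ε * N) + ε * (ε * N) - N / k / 3000 - ε * (N / k) / 3000 + A * (1 + 2000 * k) := by
      ring
    rw [h13] at h9
    have h14 : 0 < N / k / 9000 := by linarith
    linarith
  · -- pow
    refine le_trans ?_ hcard
    have : (m : ℝ) ≤ Q.card := by
      rw [← hy]
      have : y / k ≤ y / 2 := div_le_div_of_nonneg_left hy0 two_pos hk2
      linarith
    exact (by exact_mod_cast this : m ≤ Q.card).trans (Finset.card_le_univ _)
  · exact le_rfl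

end Upper

section Koenig
variable {V : Type} [Fintype V]

lemma exists_transport (N : ℕ) (R C : V → ℕ) (hR : ∑ u, R u = N) (hC : ∑ v, C v = N) :
    ∃ a : V → V → ℕ, (∀ u, ∑ v, a u v = R u) ∧ ∀ v, ∑ u, a u v = C v := by
  induction N generalizing R C with
  | zero =>
    refine ⟨fun _ _ => 0, fun u => ?_, fun v => ?_⟩
    · have := Finset.sum_eq_zero_iff.1 hR u (Finset.mem_univ u); simp [this]
    · have := Finset.sum_eq_zero_iff.1 hC v (Finset.mem_univ v); simp [this]
  | succ N ih =>
    obtain ⟨u₀, -, hu⟩ : ∃ u ∈ Finset.univ, R u ≠ 0 := by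
      by_contra h
      push Not at h
      rw [Finset.sum_eq_zero h] at hR
      omega
    obtain ⟨v₀, -, hv⟩ : ∃ v ∈ Finset.univ, C v ≠ 0 := by
      by_contra h
      push Not at h
      rw [Finset.sum_eq_zero h] at hC
      omega
    have key : ∀ (f : V → ℕ) (x : V), f x ≠ 0 → ∑ u, f u = N + 1 →
        (∀ u, f u = (if u = x then f x - 1 else f u) + if u = x then 1 else 0) ∧
        ∑ u, (if u = x then f x - 1 else f u) = N := by
      intro f x hx hf
      have h1 : ∀ u, f u = (if u = x then f x - 1 else f u) + if u = x then 1 else 0 := by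
        intro u; split_ifs with h
        · subst h; omega
        · rfl
      refine ⟨h1, ?_⟩
      rw [Finset.sum_congr rfl (fun u _ => h1 u), Finset.sum_add_distrib] at hf
      simp only [Finset.sum_ite_eq', Finset.mem_univ, if_true] at hf
      omega
    obtain ⟨hR1, hR2⟩ := key R u₀ hu hR
    obtain ⟨hC1, hC2⟩ := key C v₀ hv hC
    obtain ⟨a, ha, hb⟩ := ih _ _ hR2 hC2
    refine ⟨fun u v => a u v + if u = u₀ ∧ v = v₀ then 1 else 0, fun u => ?_, fun v => ?_⟩
    · refine Eq.trans ?_ (hR1 u).symm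
      rw [Finset.sum_add_distrib, ha]
      congr 1
      by_cases h : u = u₀ <;> simp [h]
    · refine Eq.trans ?_ (hC1 v).symm
      rw [Finset.sum_add_distrib, hb]
      congr 1
      by_cases h : v = v₀ <;> simp [h]

lemma exists_perm_of_sums {M : ℕ} (a : V → V → ℕ) (hr : ∀ u, ∑ v, a u v = M + 1)
    (hc : ∀ v, ∑ u, a u v = M + 1) : ∃ π : Equiv.Perm V, ∀ u, a u (π u) ≠ 0 := by
  have hall := (Finset.all_card_le_biUnion_card_iff_exists_injective
    (fun u : V => Finset.univ.filter fun v => a u v ≠ 0)).1 (by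
    intro S
    set T := S.biUnion fun u => Finset.univ.filter fun v => a u v ≠ 0 with hT
    have h1 : ∑ u ∈ S, ∑ v, a u v = ∑ u ∈ S, ∑ v ∈ T, a u v := by
      refine Finset.sum_congr rfl fun u hu => ?_
      symm
      apply Finset.sum_subset (Finset.subset_univ _)
      intro v _ hv
      by_contra h
      exact hv (Finset.mem_biUnion.2 ⟨u, hu, by simpa using h⟩)
    have h2 : ∑ u ∈ S, ∑ v ∈ T, a u v ≤ ∑ v ∈ T, ∑ u, a u v := by
      rw [Finset.sum_comm]
      exact Finset.sum_le_sum fun v _ =>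
        Finset.sum_le_sum_of_subset (Finset.subset_univ _)
    rw [← h1] at h2
    simp only [hr, hc, Finset.sum_const, smul_eq_mul] at h2
    exact Nat.le_of_mul_le_mul_right h2 (Nat.succ_pos M))
  obtain ⟨f, hf, hf'⟩ := hall
  refine ⟨Equiv.ofBijective f (Finite.injective_iff_bijective.1 hf), fun u => ?_⟩
  have := hf' u
  simpa using this

lemma exists_perms_of_sums (M : ℕ) (a : V → V → ℕ) (hr : ∀ u, ∑ v, a u v = M)
    (hc : ∀ v, ∑ u, a u v = M) :
    ∃ π : ℕ → Equiv.Perm V, ∀ u v, a u v ≠ 0 → ∃ f < M, π f u = v := by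
  induction M generalizing a with
  | zero =>
    refine ⟨fun _ => 1, fun u v h => (h ?_).elim⟩
    exact Finset.sum_eq_zero_iff.1 (hr u) v (Finset.mem_univ v)
  | succ M ih =>
    obtain ⟨ρ, hρ⟩ := exists_perm_of_sums a hr hc
    have key : ∀ u v, a u v = (a u v - if ρ u = v then 1 else 0) + if ρ u = v then 1 else 0 := by
      intro u v
      split_ifs with h
      · have := hρ u; rw [h] at this; omega
      · rfl
    obtain ⟨π, hπ⟩ := ih (fun u v => a u v - if ρ u = v then 1 else 0)
      (fun u => by
        have h := hr u
        rw [Finset.sum_congr rfl (fun v _ => key u v), Finset.sum_add_distrib] at h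
        simp only [Finset.sum_ite_eq, Finset.mem_univ, if_true] at h
        omega)
      (fun v => by
        have h := hc v
        rw [Finset.sum_congr rfl (fun u _ => key u v), Finset.sum_add_distrib] at h
        have : ∑ u, (if ρ u = v then 1 else 0) = 1 := by
          simp_rw [← Equiv.eq_symm_apply]
          simp
        omega)
    refine ⟨fun f => if f = M then ρ else π f, fun u v h => ?_⟩
    by_cases h1 : ρ u = v
    · exact ⟨M, by omega, by simp [h1]⟩
    · obtain ⟨f, hf, hf'⟩ := hπ u v (by simpa [h1] using h)
      exact ⟨f, by omega, by simpa [hf.ne] using hf'⟩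

/-- A relation with at most `M` entries in every row and column is covered by `M`
permutations. -/
theorem exists_perms_of_relation (M : ℕ) (r : V → V → Prop)
    (hr : ∀ u, (Finset.univ.filter fun v => r u v).card ≤ M)
    (hc : ∀ v, (Finset.univ.filter fun u => r u v).card ≤ M) :
    ∃ (π : ℕ → Equiv.Perm V) (col : V → V → ℕ),
      ∀ u v, r u v → col u v < M ∧ π (col u v) u = v := by
  set t : V → V → ℕ := fun u v => if r u v then 1 else 0 with ht
  have h1 : ∀ u, ∑ v, t u v ≤ M := fun u => by simpa [ht] using hr u
  have h2 : ∀ v, ∑ u, t u v ≤ M := fun v => by simpa [ht] using hc v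
  have h3 : ∑ u, (M - ∑ v, t u v) + ∑ u, ∑ v, t u v = Fintype.card V * M := by
    rw [← Finset.sum_add_distrib, Finset.sum_congr rfl (fun u _ => Nat.sub_add_cancel (h1 u))]
    simp
  have h4 : ∑ v, (M - ∑ u, t u v) + ∑ u, ∑ v, t u v = Fintype.card V * M := by
    rw [Finset.sum_comm (f := t), ← Finset.sum_add_distrib,
      Finset.sum_congr rfl (fun u _ => Nat.sub_add_cancel (h2 u))]
    simp
  obtain ⟨a, ha, hb⟩ := exists_transport _ (fun u => M - ∑ v, t u v) (fun v => M - ∑ u, t u v) rfl (by omega)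
  obtain ⟨π, hπ⟩ := exists_perms_of_sums M (fun u v => a u v + t u v)
    (fun u => by rw [Finset.sum_add_distrib, ha]; have := h1 u; omega)
    (fun v => by rw [Finset.sum_add_distrib, hb]; have := h2 v; omega)
  have : ∀ u v, ∃ f, r u v → f < M ∧ π f u = v := by
    intro u v
    by_cases h : r u v
    · obtain ⟨f, hf, hf'⟩ := hπ u v (by simp [ht, h])
      exact ⟨f, fun _ => ⟨hf, hf'⟩⟩
    · exact ⟨0, fun h' => (h h').elim⟩
  choose col hcol using this
  exact ⟨π, col, hcol⟩

end Koenig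

section Product
variable {ι κ : Type} [Fintype ι] [Fintype κ]

/-- Expectation with respect to a product of weights on a finite power. -/
noncomputable def Ex (μ : ι → κ → ℝ) (F : (ι → κ) → ℝ) : ℝ := ∑ ω, (∏ i, μ i (ω i)) * F ω

/-- Probability with respect to a product of weights on a finite power. -/
noncomputable def Pr (μ : ι → κ → ℝ) (A : (ι → κ) → Prop) : ℝ :=
  Ex μ fun ω => if A ω then 1 else 0

/-- Each `μ i` is a probability vector. -/
structure IsProb (μ : ι → κ → ℝ) : Prop where
  nonneg : ∀ i k, 0 ≤ μ i k
  sum_eq : ∀ i, ∑ k, μ i k = 1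

variable {μ : ι → κ → ℝ}

lemma Ex_prod (f : ι → κ → ℝ) : Ex μ (fun ω => ∏ i, f i (ω i)) = ∏ i, ∑ k, μ i k * f i k := by
  unfold Ex
  simp_rw [← Finset.prod_mul_distrib]
  rw [Finset.prod_univ_sum]
  simp

lemma Ex_mono (hμ : IsProb μ) {F G : (ι → κ) → ℝ} (h : ∀ ω, F ω ≤ G ω) : Ex μ F ≤ Ex μ G :=
  Finset.sum_le_sum fun ω _ => mul_le_mul_of_nonneg_left (h ω)
    (Finset.prod_nonneg fun i _ => hμ.nonneg i _)

lemma Ex_const (hμ : IsProb μ) (c : ℝ) : Ex μ (fun _ => c) = c := by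
  have h := Ex_prod (μ := μ) (fun _ _ => 1)
  simp only [Finset.prod_const_one, mul_one, hμ.sum_eq] at h
  unfold Ex at h ⊢
  simp only [mul_one] at h
  rw [← Finset.sum_mul, h, one_mul]

lemma Ex_add (F G : (ι → κ) → ℝ) : Ex μ (fun ω => F ω + G ω) = Ex μ F + Ex μ G := by
  unfold Ex; rw [← Finset.sum_add_distrib]; exact Finset.sum_congr rfl fun _ _ => by ring

lemma Ex_mul_left (c : ℝ) (F : (ι → κ) → ℝ) : Ex μ (fun ω => c * F ω) = c * Ex μ F := by
  unfold Ex; rw [Finset.mul_sum]; exact Finset.sum_congr rfl fun _ _ => by ring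

lemma Ex_sum {α : Type} (s : Finset α) (F : α → (ι → κ) → ℝ) :
    Ex μ (fun ω => ∑ a ∈ s, F a ω) = ∑ a ∈ s, Ex μ (F a) := by
  unfold Ex; simp_rw [Finset.mul_sum]; rw [Finset.sum_comm]

lemma Pr_nonneg (hμ : IsProb μ) (A : (ι → κ) → Prop) : 0 ≤ Pr μ A := by
  have := Ex_mono hμ (F := fun _ => 0) (G := fun ω => if A ω then 1 else 0)
    fun ω => by split_ifs <;> norm_num
  rwa [Ex_const hμ] at this

lemma Pr_mono (hμ : IsProb μ) {A B : (ι → κ) → Prop} (h : ∀ ω, A ω → B ω) :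
    Pr μ A ≤ Pr μ B := by
  refine Ex_mono hμ fun ω => ?_
  by_cases hA : A ω
  · simp [hA, h ω hA]
  · simp only [hA, if_false]; split_ifs <;> norm_num

lemma Pr_or_le (hμ : IsProb μ) (A B : (ι → κ) → Prop) :
    Pr μ (fun ω => A ω ∨ B ω) ≤ Pr μ A + Pr μ B := by
  unfold Pr
  rw [← Ex_add]
  refine Ex_mono hμ fun ω => ?_
  by_cases hA : A ω <;> by_cases hB : B ω <;> simp [hA, hB]

lemma Pr_not (hμ : IsProb μ) (A : (ι → κ) → Prop) : Pr μ (fun ω => ¬ A ω) = 1 - Pr μ A := by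
  have : Pr μ (fun ω => ¬ A ω) + Pr μ A = 1 := by
    unfold Pr
    rw [← Ex_add]
    refine Eq.trans ?_ (Ex_const hμ 1)
    congr 1; ext ω
    by_cases h : A ω <;> simp [h]
  linarith

lemma Pr_exists_le (hμ : IsProb μ) {α : Type} (s : Finset α) (A : α → (ι → κ) → Prop) :
    Pr μ (fun ω => ∃ a ∈ s, A a ω) ≤ ∑ a ∈ s, Pr μ (A a) := by
  unfold Pr
  rw [← Ex_sum]
  refine Ex_mono hμ fun ω => ?_
  split_ifs with h
  · obtain ⟨a, ha, hA⟩ := h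
    have := Finset.single_le_sum (f := fun a => if A a ω then (1 : ℝ) else 0)
      (fun a _ => by split_ifs <;> norm_num) ha
    simpa [hA] using this
  · exact Finset.sum_nonneg fun a _ => by split_ifs <;> norm_num

lemma Pr_exists_le_card (hμ : IsProb μ) {α : Type} (s : Finset α) (A : α → (ι → κ) → Prop)
    {c : ℝ} (h : ∀ a ∈ s, Pr μ (A a) ≤ c) : Pr μ (fun ω => ∃ a ∈ s, A a ω) ≤ s.card * c := by
  refine (Pr_exists_le hμ s A).trans ?_
  have := Finset.sum_le_card_nsmul s (fun a => Pr μ (A a)) c h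
  simpa using this

lemma exists_not_of_Pr_lt_one (hμ : IsProb μ) {A : (ι → κ) → Prop} (h : Pr μ A < 1) :
    ∃ ω, ¬ A ω := by
  by_contra hc
  push Not at hc
  have := Pr_mono hμ (A := fun _ => True) (B := A) fun ω _ => hc ω
  unfold Pr at this h
  simp only [if_true, Ex_const hμ] at this
  linarith

lemma Pr_le_Ex (hμ : IsProb μ) {A : (ι → κ) → Prop} {F : (ι → κ) → ℝ} (h0 : ∀ ω, 0 ≤ F ω)
    (h : ∀ ω, A ω → 1 ≤ F ω) : Pr μ A ≤ Ex μ F := by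
  refine Ex_mono hμ fun ω => ?_
  split_ifs with hA
  · exact h ω hA
  · exact h0 ω

lemma exp_mul_le {x y : ℝ} (hx : |x| ≤ 1) (hy0 : 0 ≤ y) (hy1 : y ≤ 1) :
    Real.exp (x * y) ≤ 1 + y * (x + x ^ 2) := by
  have h1 := convexOn_exp.2 (Set.mem_univ 0) (Set.mem_univ x) (by linarith : 0 ≤ 1 - y) hy0
    (by ring)
  simp only [smul_eq_mul, mul_zero, zero_add, Real.exp_zero, mul_one] at h1
  have h2 := (abs_le.1 (Real.abs_exp_sub_one_sub_id_le hx)).2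
  have h3 := mul_le_mul_of_nonneg_left h2 hy0
  rw [mul_comm x y]
  linarith

lemma Ex_exp_le (hμ : IsProb μ) (φ : ι → κ → ℝ) (h0 : ∀ i k, 0 ≤ φ i k) (h1 : ∀ i k, φ i k ≤ 1)
    {x : ℝ} (hx : |x| ≤ 1) :
    Ex μ (fun ω => Real.exp (x * ∑ i, φ i (ω i))) ≤
      Real.exp ((x + x ^ 2) * ∑ i, ∑ k, μ i k * φ i k) := by
  simp_rw [Finset.mul_sum Finset.univ _ x, Real.exp_sum]
  rw [Ex_prod (fun i k => Real.exp (x * φ i k)), Finset.mul_sum, Real.exp_sum]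
  refine Finset.prod_le_prod (fun i _ => Finset.sum_nonneg fun k _ =>
    mul_nonneg (hμ.nonneg i k) (Real.exp_pos _).le) fun i _ => ?_
  have : ∑ k, μ i k * Real.exp (x * φ i k) ≤ ∑ k, (μ i k + (x + x ^ 2) * (μ i k * φ i k)) := by
    refine Finset.sum_le_sum fun k _ => ?_
    have := mul_le_mul_of_nonneg_left (exp_mul_le hx (h0 i k) (h1 i k)) (hμ.nonneg i k)
    linarith
  refine this.trans ?_
  rw [Finset.sum_add_distrib, hμ.sum_eq, ← Finset.mul_sum]
  have := Real.add_one_le_exp ((x + x ^ 2) * ∑ k, μ i k * φ i k)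
  linarith

variable {α : Type} (I : Finset α) (f : α → ι) (g : α → κ → ℝ) {b : ℕ}

lemma Ex_exp_count_le (hμ : IsProb μ) (hb0 : 0 < b)
    (hb : ∀ i, (I.filter fun a => f a = i).card ≤ b)
    (h0 : ∀ a k, 0 ≤ g a k) (h1 : ∀ a k, g a k ≤ 1) {x : ℝ} (hx : |x| ≤ 1) :
    Ex μ (fun ω => Real.exp (x / b * ∑ a ∈ I, g a (ω (f a)))) ≤
      Real.exp ((x + x ^ 2) / b * ∑ a ∈ I, ∑ k, μ (f a) k * g a k) := by
  have hb' : (0 : ℝ) < b := by exact_mod_cast hb0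
  have h := Ex_exp_le hμ (fun i k => (∑ a ∈ I.filter fun a => f a = i, g a k) / b)
    (fun i k => div_nonneg (Finset.sum_nonneg fun a _ => h0 a k) hb'.le)
    (fun i k => by
      rw [div_le_one hb']
      refine (Finset.sum_le_card_nsmul _ _ 1 fun a _ => h1 a k).trans ?_
      simpa using hb i) hx
  have e1 : ∀ ω : ι → κ, x / b * ∑ a ∈ I, g a (ω (f a)) =
      x * ∑ i, (∑ a ∈ I.filter fun a => f a = i, g a (ω i)) / b := by
    intro ω
    rw [← Finset.sum_div, ← Finset.sum_fiberwise (s := I) (g := f) (f := fun a => g a (ω (f a)))]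
    have : ∀ i, ∑ a ∈ I.filter fun a => f a = i, g a (ω (f a)) =
        ∑ a ∈ I.filter fun a => f a = i, g a (ω i) := fun i =>
      Finset.sum_congr rfl fun a ha => by rw [(Finset.mem_filter.1 ha).2]
    simp_rw [this]; ring
  have e2 : (x + x ^ 2) / b * ∑ a ∈ I, ∑ k, μ (f a) k * g a k =
      (x + x ^ 2) * ∑ i, ∑ k, μ i k * ((∑ a ∈ I.filter fun a => f a = i, g a k) / b) := by
    rw [← Finset.sum_fiberwise (s := I) (g := f)]
    have : ∀ i, ∑ a ∈ I.filter fun a => f a = i, ∑ k, μ (f a) k * g a k =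
        b * ∑ k, μ i k * ((∑ a ∈ I.filter fun a => f a = i, g a k) / b) := fun i => by
      rw [Finset.sum_congr rfl fun a ha => by rw [(Finset.mem_filter.1 ha).2], Finset.sum_comm,
        Finset.mul_sum]
      refine Finset.sum_congr rfl fun k _ => ?_
      rw [← Finset.mul_sum]; field_simp
    simp_rw [this]
    rw [← Finset.mul_sum]; field_simp
  rw [e2]
  simp_rw [e1]
  exact h

/-- Upper Chernoff bound for a weighted count. -/
theorem Pr_count_ge (hμ : IsProb μ) (hb0 : 0 < b)
    (hb : ∀ i, (I.filter fun a => f a = i).card ≤ b)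
    (h0 : ∀ a k, 0 ≤ g a k) (h1 : ∀ a k, g a k ≤ 1) {m x t : ℝ}
    (hm : ∑ a ∈ I, ∑ k, μ (f a) k * g a k ≤ m) (hx0 : 0 ≤ x) (hx1 : x ≤ 1) :
    Pr μ (fun ω => (1 + x) * m + t ≤ ∑ a ∈ I, g a (ω (f a))) ≤ Real.exp (-(x * t / b)) := by
  have hb' : (0 : ℝ) < b := by exact_mod_cast hb0
  have h := Ex_exp_count_le I f g hμ hb0 hb h0 h1 (x := x) (by rw [abs_of_nonneg hx0]; exact hx1)
  have h2 : Pr μ (fun ω => (1 + x) * m + t ≤ ∑ a ∈ I, g a (ω (f a))) ≤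
      Ex μ (fun ω => Real.exp (-(x / b * ((1 + x) * m + t))) *
        Real.exp (x / b * ∑ a ∈ I, g a (ω (f a)))) := by
    refine Pr_le_Ex hμ (fun ω => by positivity) fun ω hω => ?_
    rw [← Real.exp_add]
    have := mul_le_mul_of_nonneg_left hω (div_nonneg hx0 hb'.le)
    exact Real.one_le_exp (by linarith)
  refine h2.trans ?_
  rw [Ex_mul_left]
  refine (mul_le_mul_of_nonneg_left h (Real.exp_pos _).le).trans ?_
  rw [← Real.exp_add]
  apply Real.exp_le_exp.2
  have := mul_le_mul_of_nonneg_left hm (by positivity : 0 ≤ (x + x ^ 2) / b)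
  have e : -(x / b * ((1 + x) * m + t)) = - ((x + x ^ 2) / b * m) - x * t / b := by ring
  linarith

/-- Lower Chernoff bound for a weighted count. -/
theorem Pr_count_le (hμ : IsProb μ) (hb0 : 0 < b)
    (hb : ∀ i, (I.filter fun a => f a = i).card ≤ b)
    (h0 : ∀ a k, 0 ≤ g a k) (h1 : ∀ a k, g a k ≤ 1) {m x t : ℝ}
    (hm : m ≤ ∑ a ∈ I, ∑ k, μ (f a) k * g a k) (hx0 : 0 ≤ x) (hx1 : x ≤ 1) :
    Pr μ (fun ω => ∑ a ∈ I, g a (ω (f a)) ≤ (1 - x) * m - t) ≤ Real.exp (-(x * t / b)) := by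
  have hb' : (0 : ℝ) < b := by exact_mod_cast hb0
  have h := Ex_exp_count_le I f g hμ hb0 hb h0 h1 (x := -x)
    (by rw [abs_neg, abs_of_nonneg hx0]; exact hx1)
  have h2 : Pr μ (fun ω => ∑ a ∈ I, g a (ω (f a)) ≤ (1 - x) * m - t) ≤
      Ex μ (fun ω => Real.exp (x / b * ((1 - x) * m - t)) *
        Real.exp (-x / b * ∑ a ∈ I, g a (ω (f a)))) := by
    refine Pr_le_Ex hμ (fun ω => by positivity) fun ω hω => ?_
    rw [← Real.exp_add]
    have := mul_le_mul_of_nonneg_left hω (div_nonneg hx0 hb'.le)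
    have e : -x / b * ∑ a ∈ I, g a (ω (f a)) = - (x / b * ∑ a ∈ I, g a (ω (f a))) := by ring
    exact Real.one_le_exp (by linarith)
  refine h2.trans ?_
  rw [Ex_mul_left]
  refine (mul_le_mul_of_nonneg_left h (Real.exp_pos _).le).trans ?_
  rw [← Real.exp_add]
  apply Real.exp_le_exp.2
  have := mul_le_mul_of_nonneg_left hm (by
    apply div_nonneg _ hb'.le; nlinarith : 0 ≤ (x - x ^ 2) / b)
  have e : x / b * ((1 - x) * m - t) = ((x - x ^ 2) / b * m) - x * t / b := by ring
  have e2 : (-x + (-x) ^ 2) / b * ∑ a ∈ I, ∑ k, μ (f a) k * g a k =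
    - ((x - x ^ 2) / b * ∑ a ∈ I, ∑ k, μ (f a) k * g a k) := by ring
  linarith

lemma sum_mul_indicator (ν : κ → ℝ) (P : κ → Prop) :
    ∑ k, ν k * (if P k then 1 else 0) = ∑ k ∈ Finset.univ.filter P, ν k := by
  rw [Finset.sum_filter]; simp

theorem Pr_card_ge (p : α → κ → Prop) (hμ : IsProb μ) (hb0 : 0 < b)
    (hb : ∀ i, (I.filter fun a => f a = i).card ≤ b) {m x t : ℝ}
    (hm : ∑ a ∈ I, ∑ k ∈ Finset.univ.filter (p a), μ (f a) k ≤ m) (hx0 : 0 ≤ x) (hx1 : x ≤ 1) :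
    Pr μ (fun ω => (1 + x) * m + t ≤ ((I.filter fun a => p a (ω (f a))).card : ℝ)) ≤
      Real.exp (-(x * t / b)) := by
  have := Pr_count_ge I f (fun a k => if p a k then 1 else 0) hμ hb0 hb
    (fun a k => by split_ifs <;> norm_num) (fun a k => by split_ifs <;> norm_num) (m := m) (x := x)
    (t := t) (by simpa only [sum_mul_indicator] using hm) hx0 hx1
  simpa [Finset.sum_boole] using this

theorem Pr_card_le (p : α → κ → Prop) (hμ : IsProb μ) (hb0 : 0 < b)
    (hb : ∀ i, (I.filter fun a => f a = i).card ≤ b) {m x t : ℝ}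
    (hm : m ≤ ∑ a ∈ I, ∑ k ∈ Finset.univ.filter (p a), μ (f a) k) (hx0 : 0 ≤ x) (hx1 : x ≤ 1) :
    Pr μ (fun ω => ((I.filter fun a => p a (ω (f a))).card : ℝ) ≤ (1 - x) * m - t) ≤
      Real.exp (-(x * t / b)) := by
  have := Pr_count_le I f (fun a k => if p a k then 1 else 0) hμ hb0 hb
    (fun a k => by split_ifs <;> norm_num) (fun a k => by split_ifs <;> norm_num) (m := m) (x := x)
    (t := t) (by simpa only [sum_mul_indicator] using hm) hx0 hx1
  simpa [Finset.sum_boole] using this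

/-- The uniform weights. -/
noncomputable def unif (ι κ : Type) [Fintype κ] : ι → κ → ℝ := fun _ _ => (Fintype.card κ : ℝ)⁻¹

lemma isProb_unif [Nonempty κ] : IsProb (unif ι κ) :=
  ⟨fun _ _ => by unfold unif; positivity, fun _ => by simp [unif]⟩

end Product

section Round
variable {V ι : Type} [Fintype V] [Fintype ι]

lemma dg_univ_filter (Γ : SimpleGraph V) (v : V) (P : V → Prop) :
    dg Γ v (Finset.univ.filter P) =
      ((Finset.univ.filter fun u => Γ.Adj v u).filter fun u => P u).card := by
  unfold dg
  congr 1
  ext u; simp [and_comm]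

lemma card_filter_eq_le_one {α β : Type} (I : Finset α) (f : α → β)
    (h : ∀ a ∈ I, ∀ a' ∈ I, f a = f a' → a = a') (i : β) :
    (I.filter fun a => f a = i).card ≤ 1 := by
  rw [Finset.card_le_one]
  intro a ha a' ha'
  rw [Finset.mem_filter] at ha ha'
  exact h a ha.1 a' ha'.1 (ha.2.trans ha'.2.symm)

lemma sum_unif_eq {α : Type} (I : Finset α) (f : α → V) (h : α → ι) :
    ∑ a ∈ I, ∑ k ∈ Finset.univ.filter (fun k => k = h a), unif V ι (f a) k =
      I.card / Fintype.card ι := by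
  have : ∀ a, Finset.univ.filter (fun k => k = h a) = {h a} := fun a => by ext; simp
  simp_rw [this]
  simp [unif, div_eq_mul_inv]

theorem exists_round_colouring [Nonempty ι] {ρ ℓ w : ℕ} (hρ : Fintype.card ι = ρ) (π : ι → Equiv.Perm V) (re : ι → V → Prop)
    (Γ : SimpleGraph V) {d x : ℝ} (hd : ∀ v, d ≤ dg Γ v Finset.univ) (hn : d ≤ Fintype.card V)
    (hinj : ∀ a u, (∀ j < ℓ, re a ((π a ^ j) u)) →
      ∀ i < ℓ, ∀ j < ℓ, (π a ^ i) u = (π a ^ j) u → i = j)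
    (hout : ∀ v a a', re a v → re a' v → π a v = π a' v → a = a')
    (hin : ∀ v a a', re a ((π a).symm v) → re a' ((π a').symm v) →
      (π a).symm v = (π a').symm v → a = a')
    (hw : 2 ≤ w) (hcard : Fintype.card V ≤ 2 ^ w) (hρw : ρ ≤ 2 ^ w)
    (hx0 : 0 ≤ x) (hx1 : x ≤ 1) (hx : 3 * w ≤ x * (x * (d / ρ))) (hℓ : 24 * w * ρ ≤ ℓ) :
    ∃ c : V → ι,
      (∀ a v, (1 - 2 * x) * (d / ρ) ≤ dg Γ v (Finset.univ.filter fun u => c u = a)) ∧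
      (∀ a v, (1 - 2 * x) * (d / ρ) ≤ dg Γ v (Finset.univ.filter fun u => c (π a u) = a)) ∧
      (∀ a v, (1 - 2 * x) * (d / ρ) ≤ dg Γ v (Finset.univ.filter fun u => c ((π a).symm u) = a)) ∧
      (∀ a, ((Finset.univ.filter fun u => c u = a).card : ℝ) ≤
        (1 + 2 * x) * (Fintype.card V / ρ)) ∧
      (∀ a, (1 - 2 * x) * (Fintype.card V / ρ) ≤
        ((Finset.univ.filter fun u => c u = a).card : ℝ)) ∧
      (∀ a v, (∀ j < ℓ, re a ((π a ^ j) v)) → ∃ j < ℓ, c ((π a ^ j) v) = a) ∧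
      (∀ v, (Finset.univ.filter fun a => re a v ∧ c (π a v) = a).card ≤ 2 + 3 * w) ∧
      (∀ v, (Finset.univ.filter fun a => re a ((π a).symm v) ∧ c ((π a).symm v) = a).card ≤
        2 + 3 * w) := by
  have hμ : IsProb (unif V ι) := isProb_unif
  have hρ0 : 0 < ρ := hρ ▸ Fintype.card_pos
  have hρR : (0 : ℝ) < ρ := by exact_mod_cast hρ0
  set e : ℝ := Real.exp (-(3 * w)) with he
  have hdeg : ∀ (τ : Equiv.Perm V) (a : ι) (v : V), Pr (unif V ι) (fun c =>
      (dg Γ v (Finset.univ.filter fun u => c (τ u) = a) : ℝ) < (1 - 2 * x) * (d / ρ)) ≤ e := by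
    intro τ a v
    have h := Pr_card_le (Finset.univ.filter fun u => Γ.Adj v u) (fun u => τ u) (b := 1)
      (fun _ k => k = a) hμ one_pos (card_filter_eq_le_one _ _ fun _ _ _ _ h => τ.injective h)
      (m := d / ρ) (x := x) (t := x * (d / ρ)) (by
        rw [sum_unif_eq _ (fun u => τ u) (fun _ => a), hρ]
        have : (dg Γ v Finset.univ) = (Finset.univ.filter fun u => Γ.Adj v u).card := rfl
        rw [← this]
        exact div_le_div_of_nonneg_right (hd v) hρR.le) hx0 hx1
    refine (Pr_mono hμ fun c hc => ?_).trans (h.trans ?_)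
    · rw [dg_univ_filter] at hc
      linarith
    · rw [he]; apply Real.exp_le_exp.2; push_cast; linarith
  have hn' : x * (x * (d / ρ)) ≤ x * (x * (Fintype.card V / ρ)) := by gcongr
  have hup : ∀ a, Pr (unif V ι) (fun c => (1 + 2 * x) * (Fintype.card V / ρ) <
      ((Finset.univ.filter fun u => c u = a).card : ℝ)) ≤ e := by
    intro a
    have h := Pr_card_ge (Finset.univ) (fun u : V => u) (b := 1)
      (fun _ k => k = a) hμ one_pos (card_filter_eq_le_one _ _ fun _ _ _ _ h => h)
      (m := Fintype.card V / ρ) (x := x) (t := x * (Fintype.card V / ρ)) (by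
        rw [sum_unif_eq _ (fun u => u) (fun _ => a), hρ]; rfl) hx0 hx1
    refine (Pr_mono hμ fun c hc => ?_).trans (h.trans ?_)
    · linarith
    · rw [he]; apply Real.exp_le_exp.2; push_cast; linarith
  have hlow : ∀ a, Pr (unif V ι) (fun c =>
      ((Finset.univ.filter fun u => c u = a).card : ℝ) <
        (1 - 2 * x) * (Fintype.card V / ρ)) ≤ e := by
    intro a
    have h := Pr_card_le (Finset.univ) (fun u : V => u) (b := 1)
      (fun _ k => k = a) hμ one_pos (card_filter_eq_le_one _ _ fun _ _ _ _ h => h)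
      (m := Fintype.card V / ρ) (x := x) (t := x * (Fintype.card V / ρ)) (by
        rw [sum_unif_eq _ (fun u => u) (fun _ => a), hρ]; rfl) hx0 hx1
    refine (Pr_mono hμ fun c hc => ?_).trans (h.trans ?_)
    · linarith
    · rw [he]; apply Real.exp_le_exp.2; push_cast; linarith
  have hhit : ∀ a v, Pr (unif V ι) (fun c => (∀ j < ℓ, re a ((π a ^ j) v)) ∧
      ∀ j < ℓ, c ((π a ^ j) v) ≠ a) ≤ e := by
    intro a v
    by_cases hre : ∀ j < ℓ, re a ((π a ^ j) v)
    · have h := Pr_card_le (Finset.range ℓ) (fun j => (π a ^ j) v) (b := 1)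
        (fun _ k => k = a) hμ one_pos (card_filter_eq_le_one _ _ fun i hi j hj h =>
          hinj a v hre i (Finset.mem_range.1 hi) j (Finset.mem_range.1 hj) h)
        (m := ℓ / ρ) (x := 1 / 2) (t := ℓ / ρ / 4) (by
          rw [sum_unif_eq _ (fun j => (π a ^ j) v) (fun _ => a), hρ]; simp) (by norm_num) (by norm_num)
      refine (Pr_mono hμ fun c hc => ?_).trans (h.trans ?_)
      · rw [Finset.filter_false_of_mem fun j hj => hc.2 j (Finset.mem_range.1 hj)]
        have : (0 : ℝ) ≤ ℓ / ρ := by positivity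
        simp only [Finset.card_empty, Nat.cast_zero]
        linarith
      · rw [he]; apply Real.exp_le_exp.2
        have : 24 * (w : ℝ) ≤ ℓ / ρ := by
          rw [le_div_iff₀ hρR]; exact_mod_cast hℓ
        push_cast; linarith
    · have : Pr (unif V ι) (fun _ => False) = 0 := by
        unfold Pr; simp [Ex_const hμ]
      refine (Pr_mono hμ fun c hc => (hre hc.1)).trans ?_
      rw [this]; exact (Real.exp_pos _).le
  have hnb : ∀ (τ : ι → V) (P : ι → Prop), (∀ a a', P a → P a' → τ a = τ a' → a = a') →
      Pr (unif V ι) (fun c =>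
        2 + 3 * w < (Finset.univ.filter fun a => P a ∧ c (τ a) = a).card) ≤ e := by
    intro τ P hP
    have h := Pr_card_ge (Finset.univ.filter fun a => P a) (fun a => τ a) (b := 1)
      (fun a k => k = a) hμ one_pos (card_filter_eq_le_one _ _ fun a ha a' ha' h =>
        hP a a' (Finset.mem_filter.1 ha).2 (Finset.mem_filter.1 ha').2 h)
      (m := 1) (x := 1) (t := 3 * w) (by
        rw [sum_unif_eq _ (fun a => τ a) (fun a => a), hρ, div_le_one hρR]
        have := Finset.card_le_univ (Finset.univ.filter fun a => P a)
        rw [hρ] at this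
        exact_mod_cast this) zero_le_one le_rfl
    refine (Pr_mono hμ fun c hc => ?_).trans (h.trans ?_)
    · rw [Finset.filter_filter]
      have : ((2 + 3 * w : ℕ) : ℝ) ≤ (Finset.univ.filter fun a => P a ∧ c (τ a) = a).card := by
        exact_mod_cast hc.le
      push_cast at this
      linarith
    · rw [he]; apply Real.exp_le_exp.2; push_cast; linarith
  have hall := Pr_exists_le_card hμ (Finset.univ : Finset (ι × V)) (c := 8 * e) (fun av c =>
      ((dg Γ av.2 (Finset.univ.filter fun u => c ((1 : Equiv.Perm V) u) = av.1) : ℝ) <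
        (1 - 2 * x) * (d / ρ)) ∨
      ((dg Γ av.2 (Finset.univ.filter fun u => c (π av.1 u) = av.1) : ℝ) <
        (1 - 2 * x) * (d / ρ)) ∨
      ((dg Γ av.2 (Finset.univ.filter fun u => c ((π av.1).symm u) = av.1) : ℝ) <
        (1 - 2 * x) * (d / ρ)) ∨
      ((1 + 2 * x) * (Fintype.card V / ρ) <
        ((Finset.univ.filter fun u => c u = av.1).card : ℝ)) ∨
      (((Finset.univ.filter fun u => c u = av.1).card : ℝ) <
        (1 - 2 * x) * (Fintype.card V / ρ)) ∨
      ((∀ j < ℓ, re av.1 ((π av.1 ^ j) av.2)) ∧ ∀ j < ℓ, c ((π av.1 ^ j) av.2) ≠ av.1) ∨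
      (2 + 3 * w < (Finset.univ.filter fun a => re a av.2 ∧ c (π a av.2) = a).card) ∨
      (2 + 3 * w < (Finset.univ.filter fun a =>
        re a ((π a).symm av.2) ∧ c ((π a).symm av.2) = a).card)) (by
    rintro ⟨a, v⟩ -
    have := hdeg 1 a v
    have := hdeg (π a) a v
    have := hdeg (π a).symm a v
    have := hup a
    have := hlow a
    have := hhit a v
    have := hnb (fun a => π a v) (fun a => re a v) (hout v)
    have := hnb (fun a => (π a).symm v) (fun a => re a ((π a).symm v)) (hin v)
    refine (Pr_or_le hμ _ _).trans ?_
    refine (add_le_add_right ((Pr_or_le hμ _ _).trans <| add_le_add_right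
      ((Pr_or_le hμ _ _).trans <| add_le_add_right ((Pr_or_le hμ _ _).trans <| add_le_add_right
      ((Pr_or_le hμ _ _).trans <| add_le_add_right ((Pr_or_le hμ _ _).trans <| add_le_add_right
        (Pr_or_le hμ _ _) _) _) _) _) _) _).trans ?_
    linarith)
  have hlt : ((Finset.univ : Finset (ι × V)).card : ℝ) * (8 * e) < 1 := by
    rw [Finset.card_univ, Fintype.card_prod, hρ]
    have h1 : ((ρ * Fintype.card V : ℕ) : ℝ) ≤ 4 ^ w := by
      have : ρ * Fintype.card V ≤ 4 ^ w := by
        calc _ ≤ 2 ^ w * 2 ^ w := Nat.mul_le_mul hρw hcard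
          _ = 4 ^ w := by rw [← mul_pow]; norm_num
      exact_mod_cast this
    have h2 : e = (Real.exp (-3)) ^ w := by rw [he, ← Real.exp_nat_mul]; congr 1; ring
    have h3 : Real.exp (-3) ≤ 1 / 16 := by
      rw [Real.exp_neg, one_div]
      apply inv_anti₀ (by norm_num)
      have h4 : Real.exp 3 = Real.exp 1 ^ 3 := by rw [← Real.exp_nat_mul]; norm_num
      rw [h4]
      have := Real.exp_one_gt_d9
      calc (16 : ℝ) ≤ 2.7 ^ 3 := by norm_num
        _ ≤ _ := by gcongr; linarith
    have h5 : e ≤ (1 / 16) ^ w := by rw [h2]; gcongr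
    calc ((ρ * Fintype.card V : ℕ) : ℝ) * (8 * e) ≤ 4 ^ w * (8 * (1 / 16) ^ w) := by gcongr
      _ = 8 * (1 / 4) ^ w := by
        rw [mul_left_comm, ← mul_pow]; norm_num
      _ ≤ 8 * (1 / 4) ^ 2 := by
        gcongr 8 * ?_
        exact pow_le_pow_of_le_one (by norm_num) (by norm_num) hw
      _ < 1 := by norm_num
  obtain ⟨c, hc⟩ := exists_not_of_Pr_lt_one hμ (hall.trans_lt hlt)
  have hc' := fun a v => not_exists.1 hc (a, v)
  simp only [Finset.mem_univ, true_and, not_or, not_lt, Equiv.Perm.coe_one, id_eq] at hc'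
  have hvex : Nonempty V ∨ IsEmpty V := (isEmpty_or_nonempty V).symm
  refine ⟨c, fun a v => (hc' a v).1, fun a v => (hc' a v).2.1, fun a v => (hc' a v).2.2.1, ?_, ?_,
    fun a v h => ?_, fun v => (hc' (Classical.arbitrary ι) v).2.2.2.2.2.2.1,
    fun v => (hc' (Classical.arbitrary ι) v).2.2.2.2.2.2.2⟩
  · intro a
    rcases hvex with ⟨⟨v⟩⟩ | hV
    · exact (hc' a v).2.2.2.1
    · simp
  · intro a
    rcases hvex with ⟨⟨v⟩⟩ | hV
    · exact (hc' a v).2.2.2.2.1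
    · simp
  · by_contra hcon
    push Not at hcon
    exact (hc' a v).2.2.2.2.2.1 ⟨h, hcon⟩

end Round

section Step
variable {V : Type}

/-- The graph of the arcs `u ⟶ π u` with `re u`. -/
def arcGraph (π : Equiv.Perm V) (re : V → Prop) : SimpleGraph V :=
  SimpleGraph.fromRel fun u v => re u ∧ π u = v

/-- The graph underlying a permutation. -/
def permGraph (π : Equiv.Perm V) : SimpleGraph V := SimpleGraph.fromRel fun u v => π u = v

lemma arcGraph_adj (π : Equiv.Perm V) (re : V → Prop) (u v : V) :
    (arcGraph π re).Adj u v ↔ u ≠ v ∧ ((re u ∧ π u = v) ∨ (re v ∧ π v = u)) := Iff.rfl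

lemma permGraph_adj (π : Equiv.Perm V) (u v : V) :
    (permGraph π).Adj u v ↔ u ≠ v ∧ (π u = v ∨ π v = u) := Iff.rfl

lemma permGraph_le {π : Equiv.Perm V} {G : SimpleGraph V} (h : ∀ u, π u ≠ u → G.Adj u (π u)) :
    permGraph π ≤ G := by
  intro u v huv
  rw [permGraph_adj] at huv
  obtain ⟨hne, h1 | h1⟩ := huv
  · subst h1; exact h u hne.symm
  · subst h1; exact (h v hne).symm

lemma disjoint_adj {G H : SimpleGraph V} (h : Disjoint G H) {u v : V} (h1 : G.Adj u v)
    (h2 : H.Adj u v) : False := by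
  have := (h.le_bot : G ⊓ H ≤ ⊥) (show (G ⊓ H).Adj u v from ⟨h1, h2⟩)
  exact this

lemma disjoint_of_adj {G H : SimpleGraph V} (h : ∀ u v, G.Adj u v → H.Adj u v → False) :
    Disjoint G H := by
  rw [disjoint_iff_inf_le]
  intro u v huv
  exact (h u v huv.1 huv.2).elim

lemma dg_le_dg_of_imp {Γ Γ' : SimpleGraph V} {v : V} {S : Finset V}
    (h : ∀ t ∈ S, Γ.Adj v t → Γ'.Adj v t) : dg Γ v S ≤ dg Γ' v S := by
  unfold dg
  refine Finset.card_le_card fun t ht => ?_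
  rw [Finset.mem_filter] at ht ⊢
  exact ⟨ht.1, h t ht.1 ht.2⟩

lemma dg_le_dg_add_two {Γ Γ' : SimpleGraph V} {v a b : V} {S : Finset V}
    (h : ∀ t ∈ S, Γ.Adj v t → Γ'.Adj v t ∨ t = a ∨ t = b) : dg Γ v S ≤ dg Γ' v S + 2 := by
  unfold dg
  have : S.filter (fun t => Γ.Adj v t) ⊆ S.filter (fun t => Γ'.Adj v t) ∪ {a, b} := by
    intro t ht
    rw [Finset.mem_filter] at ht
    rw [Finset.mem_union, Finset.mem_filter]
    rcases h t ht.1 ht.2 with h | h | h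
    · exact Or.inl ⟨ht.1, h⟩
    · simp [h]
    · simp [h]
  refine (Finset.card_le_card this).trans ((Finset.card_union_le _ _).trans ?_)
  exact Nat.add_le_add_left Finset.card_le_two _

lemma dg_sdiff_permGraph (Γ : SimpleGraph V) (σ : Equiv.Perm V) (v : V) (S : Finset V) :
    dg Γ v S ≤ dg (Γ \ permGraph σ) v S + 2 := by
  refine dg_le_dg_add_two (a := σ v) (b := σ.symm v) fun t _ ht => ?_
  by_cases h : (permGraph σ).Adj v t
  · right
    rw [permGraph_adj] at h
    rcases h.2 with h | h
    · simp [h]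
    · simp [← h]
  · left; rw [sdiff_adj]; exact ⟨ht, h⟩

lemma UpperReg.mono {Γ Γ' : SimpleGraph V} {q A ε : ℝ} (h : UpperReg Γ q A ε) (hle : Γ' ≤ Γ) :
    UpperReg Γ' q A ε := by
  intro S T
  refine le_trans ?_ (h S T)
  unfold edg
  exact_mod_cast Finset.sum_le_sum fun s _ => dg_le_dg_of_imp fun t _ ht => hle ht

variable [Fintype V]

/-- The vertices at which an arc of `π` is missing. -/
noncomputable def ends (π : Equiv.Perm V) (re : V → Prop) : Finset V :=
  Finset.univ.filter fun v => ¬ re v ∨ ¬ re (π.symm v)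

/-- The vertices affected by converting `π` with pivot set `Q`. -/
noncomputable def affected (π : Equiv.Perm V) (re : V → Prop) (Q : Finset V) : Finset V :=
  Finset.univ.filter fun v => v ∈ Q ∨ (re v ∧ π v ∈ Q) ∨ (re (π.symm v) ∧ π.symm v ∈ Q) ∨
    v ∈ ends π re

theorem exists_step {Γ : SimpleGraph V} (π : Equiv.Perm V) (re : V → Prop) (Q : Finset V)
    {q A ε : ℝ} {w ℓ : ℕ} (hre : ∀ u, re u → π u ≠ u) (hdis : Disjoint (arcGraph π re) Γ)
    (hU : UpperReg Γ q A ε) (hq0 : 0 < q) (hq1 : q ≤ 1) (hA : 1 ≤ A)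
    (hε0 : 0 ≤ ε) (hε : ε * (24000 * (2 * w + 2)) ≤ 1) (hcard : Fintype.card V ≤ 4 ^ w)
    (hcard3 : 3 ≤ Fintype.card V)
    (hN : 20000000 * (2 * w + 2) ^ 3 * A ≤ q * Q.card)
    (hd1 : ∀ v, (1 - ε) * (q * Q.card) ≤ dg Γ v Q)
    (hd2 : ∀ v, (1 - ε) * (q * Q.card) ≤ dg Γ v (Finset.univ.filter fun u => π u ∈ Q))
    (hd3 : ∀ v, (1 - ε) * (q * Q.card) ≤ dg Γ v (Finset.univ.filter fun u => π.symm u ∈ Q))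
    (hE : ((ends π re).card : ℝ) * (7000 * (2 * w + 2)) ≤ Q.card)
    (hhit : ∀ v, (∀ j < ℓ, re ((π ^ j) v)) → ∃ j < ℓ, (π ^ j) v ∈ Q) :
    ∃ σ : Equiv.Perm V, σ.IsCycleOn Set.univ ∧ permGraph σ ≤ arcGraph π re ⊔ Γ ∧
      ∀ v ∉ affected π re Q, ∀ S, dg Γ v S ≤ dg (Γ \ permGraph σ) v S := by
  haveI : Nonempty V := Fintype.card_pos_iff.1 (by omega)
  set X := affected π re Q with hX
  have hXm : ∀ v, v ∈ X ↔ (v ∈ Q ∨ (re v ∧ π v ∈ Q) ∨ (re (π.symm v) ∧ π.symm v ∈ Q) ∨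
    v ∈ ends π re) := fun v => by simp [hX, affected]
  have hEm : ∀ v, v ∈ ends π re ↔ (¬ re v ∨ ¬ re (π.symm v)) := fun v => by simp [ends]
  set Q1 := Finset.univ.filter fun u => π u ∈ Q with hQ1
  set Q2 := Finset.univ.filter fun u => π.symm u ∈ Q with hQ2
  have hc1 : Q1.card = Q.card := by
    apply Finset.card_bij (fun u _ => π u)
    · intro a ha; simpa [hQ1] using ha
    · intro a _ b _ h; exact π.injective h
    · intro b hb; exact ⟨π.symm b, by simpa [hQ1] using hb, by simp⟩
  have hc2 : Q2.card = Q.card := by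
    apply Finset.card_bij (fun u _ => π.symm u)
    · intro a ha; simpa [hQ2] using ha
    · intro a _ b _ h; exact π.symm.injective h
    · intro b hb; exact ⟨π b, by simpa [hQ2] using hb, by simp⟩
  have hQX : Q ⊆ X := fun v hv => (hXm v).2 (Or.inl hv)
  have hQ1le : (Q.card : ℝ) ≤ (1 + ε) * Q.card := by
    have : 0 ≤ ε * (Q.card : ℝ) := mul_nonneg hε0 (Nat.cast_nonneg _)
    linarith
  obtain ⟨K, κ, m, b, b', H⟩ := closable_of_upperReg (X := X) (Z := Q ∪ Q1 ∪ Q2) (Q := Q)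
    ![Q, Q1, Q2] hU hq0 hq1 hA hε0 hε hcard hN hQX (fun v _ => hd1 v) (by
      refine le_trans ?_ hE
      have hsub : X \ (Q ∪ Q1 ∪ Q2) ⊆ ends π re := by
        intro v hv
        rw [Finset.mem_sdiff, hXm] at hv
        simp only [Finset.mem_union, not_or, hQ1, hQ2, Finset.mem_filter, Finset.mem_univ,
          true_and] at hv
        tauto
      have : ((X \ (Q ∪ Q1 ∪ Q2)).card : ℝ) ≤ (ends π re).card := by
        exact_mod_cast Finset.card_le_card hsub
      exact mul_le_mul_of_nonneg_right this (by positivity)) (by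
      intro v hv
      simp only [Finset.mem_union] at hv
      rcases hv with (hv | hv) | hv
      · exact ⟨0, hv⟩
      · exact ⟨1, hv⟩
      · exact ⟨2, hv⟩) (by
      intro i
      fin_cases i
      · exact hQ1le
      · exact hc1 ▸ hQ1le
      · exact hc2 ▸ hQ1le) (by
      intro i v _
      fin_cases i
      · exact hd1 v
      · exact hd2 v
      · exact hd3 v)
  have hadj : ∀ u, re u → (arcGraph π re).Adj u (π u) := fun u hu =>
    (arcGraph_adj _ _ _ _).2 ⟨(hre u hu).symm, Or.inl ⟨hu, rfl⟩⟩
  have hE1 : ∀ u, ¬ re u → u ∈ X ∧ π u ∈ X := fun u hu =>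
    ⟨(hXm u).2 (Or.inr <| Or.inr <| Or.inr <| (hEm u).2 (Or.inl hu)),
      (hXm _).2 (Or.inr <| Or.inr <| Or.inr <| (hEm _).2 (Or.inr (by simpa using hu)))⟩
  obtain ⟨σ₀, hσ₀, hσ₀'⟩ := exists_isCycleOn_merge (Rel := (arcGraph π re).Adj) (X := X) π (by
    intro u
    by_cases hu : re u
    · exact Or.inl (hadj u hu)
    · exact Or.inr (hE1 u hu)) (by
    intro u
    by_cases hall : ∀ j < ℓ, re ((π ^ j) u)
    · obtain ⟨j, hj, hjQ⟩ := hhit u hall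
      refine ⟨(π ^ j) u, ⟨j, by simp⟩, hQX hjQ, ?_⟩
      exact (hXm _).2 (Or.inr <| Or.inr <| Or.inl (by simpa using ⟨hall j hj, hjQ⟩))
    · push Not at hall
      obtain ⟨j, _, hj⟩ := hall
      exact ⟨(π ^ j) u, ⟨j, by simp⟩, hE1 _ hj⟩)
  obtain ⟨σ, hσ, hσ'⟩ := exists_conversion H hcard3 (Rel := (arcGraph π re).Adj)
    (fun a b h => h.symm) (by
      intro y hy z hz
      rw [arcGraph_adj] at hz
      rcases hz.2 with ⟨h1, h2⟩ | ⟨h1, h2⟩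
      · subst h2
        exact (hXm _).2 (Or.inr <| Or.inr <| Or.inl (by simpa using ⟨h1, hy⟩))
      · subst h2
        exact (hXm _).2 (Or.inr <| Or.inl ⟨h1, hy⟩)) σ₀ hσ₀ hσ₀'
  refine ⟨σ, hσ, permGraph_le fun u _ => ?_, fun v hv S => ?_⟩
  · rcases hσ' u with h | h
    · exact Or.inl h
    · exact Or.inr h.2.2
  · refine dg_le_dg_of_imp fun t _ ht => (sdiff_adj _ _ _ _).2 ⟨ht, fun h => ?_⟩
    rw [permGraph_adj] at h
    rcases h.2 with h | h
    · subst h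
      rcases hσ' v with h | h
      · exact disjoint_adj hdis h ht
      · exact hv h.1
    · subst h
      rcases hσ' t with h | h
      · exact disjoint_adj hdis h.symm ht
      · exact hv h.2.1

end Step

section PivotSets
variable {V ι : Type} [Fintype V] [Fintype ι]

/-- Pivot sets for the simultaneous conversion of a family of permutations. -/
theorem exists_pivot_sets [Nonempty ι] {ρ ℓ w : ℕ} (hρ : Fintype.card ι = ρ)
    (π : ι → Equiv.Perm V) (re : ι → V → Prop)
    (Γ : SimpleGraph V) {d x : ℝ} (hd : ∀ v, d ≤ dg Γ v Finset.univ) (hn : d ≤ Fintype.card V)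
    (hinj : ∀ a u, (∀ j < ℓ, re a ((π a ^ j) u)) →
      ∀ i < ℓ, ∀ j < ℓ, (π a ^ i) u = (π a ^ j) u → i = j)
    (hout : ∀ v a a', re a v → re a' v → π a v = π a' v → a = a')
    (hin : ∀ v a a', re a ((π a).symm v) → re a' ((π a').symm v) →
      (π a).symm v = (π a').symm v → a = a')
    (hw : 2 ≤ w) (hcard : Fintype.card V ≤ 2 ^ w) (hρw : ρ ≤ 2 ^ w)
    (hx0 : 0 ≤ x) (hx1 : x ≤ 1) (hx : 3 * w ≤ x * (x * (d / ρ))) (hℓ : 24 * w * ρ ≤ ℓ) :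
    ∃ Q : ι → Finset V,
      (∀ a v, (1 - 2 * x) * (d / ρ) ≤ dg Γ v (Q a)) ∧
      (∀ a v, (1 - 2 * x) * (d / ρ) ≤ dg Γ v (Finset.univ.filter fun u => π a u ∈ Q a)) ∧
      (∀ a v, (1 - 2 * x) * (d / ρ) ≤ dg Γ v (Finset.univ.filter fun u => (π a).symm u ∈ Q a)) ∧
      (∀ a, ((Q a).card : ℝ) ≤ (1 + 2 * x) * (Fintype.card V / ρ)) ∧
      (∀ a, (1 - 2 * x) * (Fintype.card V / ρ) ≤ ((Q a).card : ℝ)) ∧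
      (∀ a v, (∀ j < ℓ, re a ((π a ^ j) v)) → ∃ j < ℓ, (π a ^ j) v ∈ Q a) ∧
      (∀ v, (Finset.univ.filter fun a => v ∈ Q a ∨ (re a v ∧ π a v ∈ Q a) ∨
        (re a ((π a).symm v) ∧ (π a).symm v ∈ Q a)).card ≤ 5 + 6 * w) := by
  obtain ⟨c, h1, h2, h3, h4, h5, h6, h7, h8⟩ := exists_round_colouring hρ π re Γ hd hn hinj hout
    hin hw hcard hρw hx0 hx1 hx hℓ
  have hm : ∀ a u, u ∈ (Finset.univ.filter fun u => c u = a) ↔ c u = a := fun a u => by simp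
  refine ⟨fun a => Finset.univ.filter fun u => c u = a, h1, ?_, ?_, h4, h5, ?_, ?_⟩
  · intro a v
    convert h2 a v using 4
    simp
  · intro a v
    convert h3 a v using 4
    simp
  · intro a v h
    obtain ⟨j, hj, hc⟩ := h6 a v h
    exact ⟨j, hj, by simpa using hc⟩
  · intro v
    have hsub : (Finset.univ.filter fun a => v ∈ (Finset.univ.filter fun u => c u = a) ∨
        (re a v ∧ π a v ∈ (Finset.univ.filter fun u => c u = a)) ∨
        (re a ((π a).symm v) ∧ (π a).symm v ∈ (Finset.univ.filter fun u => c u = a))) ⊆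
        {c v} ∪ ((Finset.univ.filter fun a => re a v ∧ c (π a v) = a) ∪
          (Finset.univ.filter fun a => re a ((π a).symm v) ∧ c ((π a).symm v) = a)) := by
      intro a ha
      rw [Finset.mem_filter] at ha
      simp only [hm] at ha
      simp only [Finset.mem_union, Finset.mem_singleton, Finset.mem_filter, Finset.mem_univ,
        true_and]
      rcases ha.2 with h | h | h
      · exact Or.inl h.symm
      · exact Or.inr (Or.inl h)
      · exact Or.inr (Or.inr h)
    refine (Finset.card_le_card hsub).trans ((Finset.card_union_le _ _).trans ?_)
    have h9 := Finset.card_union_le (Finset.univ.filter fun a => re a v ∧ c (π a v) = a)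
      (Finset.univ.filter fun a => re a ((π a).symm v) ∧ c ((π a).symm v) = a)
    have := h7 v
    have := h8 v
    rw [Finset.card_singleton]
    omega

end PivotSets

section Round
variable {V : Type} [Fintype V]

/-- The numerical hypotheses used for converting families of permutations. -/
structure Params (q A ε x d : ℝ) (w ρ ℓ n : ℕ) : Prop where
  q0 : 0 < q
  q1 : q ≤ 1
  A1 : 1 ≤ A
  ε0 : 0 ≤ ε
  ε_le : ε * (24000 * (2 * w + 2)) ≤ 1
  n_le : n ≤ 2 ^ w
  n3 : 3 ≤ n
  w2 : 2 ≤ w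
  ρ0 : 0 < ρ
  ρ_le : ρ ≤ 2 ^ w
  ℓ_ge : 24 * w * ρ ≤ ℓ
  ℓ0 : 0 < ℓ
  x0 : 0 ≤ x
  x1 : x ≤ 1
  d_le : d ≤ n
  x_ge : 3 * w ≤ x * (x * (d / ρ))
  d_ge : (1 - ε) * (q * ((1 + 2 * x) * (n / ρ))) ≤ (1 - 2 * x) * (d / ρ) - 2 * ρ
  N_ge : 20000000 * (2 * w + 2) ^ 3 * A ≤ q * ((1 - 2 * x) * (n / ρ))
  ε1 : ε ≤ 1

/-- A family of `k` edge-disjoint partial permutations. -/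
structure Systems (π : ℕ → Equiv.Perm V) (re : ℕ → V → Prop) (J : SimpleGraph V) (k ℓ : ℕ) :
    Prop where
  irr : ∀ i < k, ∀ u, re i u → π i u ≠ u
  disJ : ∀ i < k, Disjoint (arcGraph (π i) (re i)) J
  pw : ∀ i < k, ∀ j < k, i ≠ j → Disjoint (arcGraph (π i) (re i)) (arcGraph (π j) (re j))
  inj : ∀ i < k, ∀ u, (∀ j < ℓ, re i ((π i ^ j) u)) →
    ∀ a < ℓ, ∀ b < ℓ, (π i ^ a) u = (π i ^ b) u → a = b

/-- The first `m` permutations have been converted to Hamilton cycles, leaving `Γ`. -/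
structure Proc (π : ℕ → Equiv.Perm V) (re : ℕ → V → Prop) (J : SimpleGraph V) (m : ℕ)
    (Γ : SimpleGraph V) (σ : ℕ → Equiv.Perm V) : Prop where
  le : Γ ≤ J
  cyc : ∀ i < m, (σ i).IsCycleOn Set.univ
  sub : ∀ i < m, permGraph (σ i) ≤ arcGraph (π i) (re i) ⊔ J
  dis : ∀ i < m, Disjoint (permGraph (σ i)) Γ
  pw : ∀ i < m, ∀ j < i, Disjoint (permGraph (σ j)) (permGraph (σ i))

lemma Proc.succ {π : ℕ → Equiv.Perm V} {re : ℕ → V → Prop} {J Γ : SimpleGraph V} {m k ℓ : ℕ}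
    {σ : ℕ → Equiv.Perm V} (hS : Systems π re J k ℓ) (hm : m < k) (h : Proc π re J m Γ σ)
    {τ : Equiv.Perm V} (hτ : τ.IsCycleOn Set.univ)
    (hsub : permGraph τ ≤ arcGraph (π m) (re m) ⊔ Γ) :
    Proc π re J (m + 1) (Γ \ permGraph τ) (Function.update σ m τ) := by
  have hlt : ∀ i < m, Function.update σ m τ i = σ i := fun i hi =>
    Function.update_of_ne hi.ne _ _
  have hle : Γ \ permGraph τ ≤ Γ := sdiff_le
  refine ⟨hle.trans h.le, ?_, ?_, ?_, ?_⟩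
  · intro i hi
    rcases Nat.lt_succ_iff_lt_or_eq.1 hi with hi | rfl
    · rw [hlt i hi]; exact h.cyc i hi
    · simpa using hτ
  · intro i hi
    rcases Nat.lt_succ_iff_lt_or_eq.1 hi with hi | rfl
    · rw [hlt i hi]; exact h.sub i hi
    · simpa using hsub.trans (sup_le_sup_left h.le _)
  · intro i hi
    rcases Nat.lt_succ_iff_lt_or_eq.1 hi with hi | rfl
    · rw [hlt i hi]; exact (h.dis i hi).mono_right hle
    · simpa using disjoint_sdiff_self_right
  · intro i hi j hj
    rcases Nat.lt_succ_iff_lt_or_eq.1 hi with hi | rfl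
    · rw [hlt i hi, hlt j (hj.trans hi)]; exact h.pw i hi j hj
    · rw [hlt j hj, Function.update_self]
      refine Disjoint.mono_right hsub (Disjoint.sup_right ?_ (h.dis j hj))
      exact Disjoint.mono_left (h.sub j hj) (Disjoint.sup_left
        (hS.pw j (hj.trans hm) i hm hj.ne) (hS.disJ i hm).symm)

theorem exists_round {π : ℕ → Equiv.Perm V} {re : ℕ → V → Prop} {J Γ₀ : SimpleGraph V}
    {q A ε x d : ℝ} {w ρ ℓ k m r : ℕ} {σ₀ : ℕ → Equiv.Perm V}
    (hp : Params q A ε x d w ρ ℓ (Fintype.card V)) (hS : Systems π re J k ℓ)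
    (hU : UpperReg J q A ε)
    (hE : ∀ i < k, ((ends (π i) (re i)).card : ℝ) * (7000 * (2 * w + 2)) ≤
      (1 - 2 * x) * (Fintype.card V / ρ))
    (hP : Proc π re J m Γ₀ σ₀) (hd : ∀ v, d ≤ dg Γ₀ v Finset.univ) (hr : r ≤ ρ)
    (hmr : m + r ≤ k) :
    ∃ Γ σ, Proc π re J (m + r) Γ σ ∧ ∀ v, dg Γ₀ v Finset.univ ≤ dg Γ v Finset.univ +
      2 * (5 + 6 * w + ((Finset.range r).filter fun a => v ∈ ends (π (m + a)) (re (m + a))).card) := by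
  have hρ0 := hp.ρ0
  haveI : Nonempty (Fin ρ) := ⟨⟨0, hρ0⟩⟩
  set re' : Fin ρ → V → Prop := fun a u => a.1 < r ∧ re (m + a) u with hre'
  have hadj : ∀ (a : Fin ρ) u, re' a u → (arcGraph (π (m + a)) (re (m + a))).Adj u (π (m + a) u) :=
    fun a u hu => (arcGraph_adj _ _ _ _).2
      ⟨(hS.irr (m + a) (by have := hu.1; omega) u hu.2).symm, Or.inl ⟨hu.2, rfl⟩⟩
  have hpw : ∀ (a a' : Fin ρ) u v, a.1 < r → a'.1 < r →
      (arcGraph (π (m + a)) (re (m + a))).Adj u v →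
      (arcGraph (π (m + a')) (re (m + a'))).Adj u v → a = a' := by
    intro a a' u v h1 h2 h3 h4
    by_contra hne
    exact disjoint_adj (hS.pw (m + a) (by omega) (m + a') (by omega)
      (fun h => hne (Fin.ext (by omega)))) h3 h4
  obtain ⟨Q, h1, h2, h3, h4, h5, h6, h7⟩ := exists_pivot_sets (Fintype.card_fin ρ)
    (fun a : Fin ρ => π (m + a)) re' Γ₀ hd hp.d_le (by
      intro a u hu
      have := (hu 0 hp.ℓ0).1
      exact hS.inj (m + a) (by omega) u fun j hj => (hu j hj).2) (by
      intro v a a' h h' heq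
      exact hpw a a' v _ h.1 h'.1 (hadj a v h) (by
        have := hadj a' v h'; rwa [← heq] at this)) (by
      intro v a a' h h' heq
      have e1 := hadj a _ h
      have e2 := hadj a' _ h'
      rw [Equiv.apply_symm_apply] at e1 e2
      rw [← heq] at e2
      exact hpw a a' _ v h.1 h'.1 e1 e2) hp.w2 hp.n_le hp.ρ_le hp.x0 hp.x1 hp.x_ge hp.ℓ_ge
  set Qn : ℕ → Finset V := fun a => if h : a < ρ then Q ⟨a, h⟩ else ∅ with hQn
  set aff : V → ℕ → Prop := fun v a => v ∈ affected (π (m + a)) (re (m + a)) (Qn a) with haff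
  have main : ∀ s ≤ r, ∃ Γ σ, Proc π re J (m + s) Γ σ ∧ ∀ v S,
      dg Γ₀ v S ≤ dg Γ v S + 2 * ((Finset.range s).filter fun a => aff v a).card := by
    intro s
    induction s with
    | zero => exact fun _ => ⟨Γ₀, σ₀, hP, fun v S => Nat.le_add_right _ _⟩
    | succ s ih =>
      intro hs
      obtain ⟨Γ, σ, hΓ, hdam⟩ := ih (by omega)
      have hsρ : s < ρ := by omega
      have hloss : ∀ v S, (dg Γ₀ v S : ℝ) - 2 * ρ ≤ dg Γ v S := by
        intro v S
        have e1 := hdam v S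
        have e2 : ((Finset.range s).filter fun a => aff v a).card ≤ ρ := by
          refine (Finset.card_filter_le _ _).trans ?_
          rw [Finset.card_range]; omega
        have : dg Γ₀ v S ≤ dg Γ v S + 2 * ρ := by omega
        have : (dg Γ₀ v S : ℝ) ≤ dg Γ v S + 2 * ρ := by exact_mod_cast this
        linarith
      have hQs : Qn s = Q ⟨s, hsρ⟩ := by simp [hQn, hsρ]
      have hdq : ∀ v S, (1 - 2 * x) * (d / ρ) ≤ dg Γ₀ v S →
          (1 - ε) * (q * (Qn s).card) ≤ dg Γ v S := by
        intro v S h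
        have e1 := hloss v S
        have e2 := hp.d_ge
        have e3 : (1 - ε) * (q * (Qn s).card) ≤
            (1 - ε) * (q * ((1 + 2 * x) * (Fintype.card V / ρ))) := by
          refine mul_le_mul_of_nonneg_left (mul_le_mul_of_nonneg_left ?_ hp.q0.le) ?_
          · rw [hQs]; exact h4 _
          · have := hp.ε1; linarith
        linarith
      obtain ⟨τ, hτ, hτ1, hτ2⟩ := exists_step (Γ := Γ) (π (m + s)) (re (m + s)) (Qn s) (q := q)
        (A := A) (ε := ε) (w := w) (ℓ := ℓ) (hS.irr _ (by omega))
        ((hS.disJ _ (by omega)).mono_right hΓ.le) (hU.mono hΓ.le) hp.q0 hp.q1 hp.A1 hp.ε0 hp.ε_le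
        (hp.n_le.trans (Nat.pow_le_pow_left (by norm_num) _)) hp.n3
        (hp.N_ge.trans (mul_le_mul_of_nonneg_left (by rw [hQs]; exact h5 _) hp.q0.le))
        (fun v => hdq v _ (by rw [hQs]; exact h1 _ v))
        (fun v => hdq v _ (by rw [hQs]; exact h2 ⟨s, hsρ⟩ v))
        (fun v => hdq v _ (by rw [hQs]; exact h3 ⟨s, hsρ⟩ v))
        ((hE _ (by omega)).trans (by rw [hQs]; exact h5 _))
        (by
          intro v hv
          rw [hQs]
          exact h6 ⟨s, hsρ⟩ v fun j hj => ⟨by simpa using hs, hv j hj⟩)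
      refine ⟨_, _, hΓ.succ hS (by omega) hτ hτ1, fun v S => ?_⟩
      rw [Finset.range_add_one, Finset.filter_insert]
      by_cases hv : aff v s
      · rw [if_pos hv, Finset.card_insert_of_notMem (by simp)]
        have := dg_sdiff_permGraph Γ τ v S
        have := hdam v S
        omega
      · rw [if_neg hv]
        have := hτ2 v hv S
        have := hdam v S
        omega
  obtain ⟨Γ, σ, hΓ, hdam⟩ := main r le_rfl
  refine ⟨Γ, σ, hΓ, fun v => (hdam v _).trans ?_⟩
  have hsub : ((Finset.range r).filter fun a => aff v a) ⊆
      ((Finset.univ.filter fun a : Fin ρ => v ∈ Q a ∨ (re' a v ∧ π (m + a) v ∈ Q a) ∨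
        (re' a ((π (m + a)).symm v) ∧ (π (m + a)).symm v ∈ Q a)).image Fin.val) ∪
      ((Finset.range r).filter fun a => v ∈ ends (π (m + a)) (re (m + a))) := by
    intro a ha
    rw [Finset.mem_filter, Finset.mem_range] at ha
    obtain ⟨har, ha⟩ := ha
    have haρ : a < ρ := by omega
    have hQa : Qn a = Q ⟨a, haρ⟩ := by simp [hQn, haρ]
    simp only [haff, affected, Finset.mem_filter, Finset.mem_univ, true_and, hQa] at ha
    rw [Finset.mem_union]
    by_cases hve : v ∈ ends (π (m + a)) (re (m + a))
    · right; rw [Finset.mem_filter, Finset.mem_range]; exact ⟨har, hve⟩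
    · left
      rw [Finset.mem_image]
      refine ⟨⟨a, haρ⟩, ?_, rfl⟩
      rw [Finset.mem_filter]
      refine ⟨Finset.mem_univ _, ?_⟩
      rcases ha with h | h | h | h
      · exact Or.inl h
      · exact Or.inr (Or.inl ⟨⟨har, h.1⟩, h.2⟩)
      · exact Or.inr (Or.inr ⟨⟨har, h.1⟩, h.2⟩)
      · exact (hve h).elim
  have e1 := (Finset.card_le_card hsub).trans (Finset.card_union_le _ _)
  have e2 := Finset.card_image_le (s := Finset.univ.filter fun a : Fin ρ => v ∈ Q a ∨
    (re' a v ∧ π (m + a) v ∈ Q a) ∨ (re' a ((π (m + a)).symm v) ∧ (π (m + a)).symm v ∈ Q a))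
    (f := Fin.val)
  have e3 := h7 v
  refine Nat.add_le_add_left (Nat.mul_le_mul_left 2 ?_) _
  refine e1.trans (Nat.add_le_add_right (e2.trans (le_trans (le_of_eq ?_) e3)) _)
  congr!

/-- Converting a whole family of partial permutations. -/
theorem exists_proc {π : ℕ → Equiv.Perm V} {re : ℕ → V → Prop} {J : SimpleGraph V}
    {q A ε x d : ℝ} {w ρ ℓ k B : ℕ} (hp : Params q A ε x d w ρ ℓ (Fintype.card V))
    (hS : Systems π re J k ℓ) (hU : UpperReg J q A ε)
    (hE : ∀ i < k, ((ends (π i) (re i)).card : ℝ) * (7000 * (2 * w + 2)) ≤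
      (1 - 2 * x) * (Fintype.card V / ρ))
    (hB : ∀ v, ((Finset.range k).filter fun i => v ∈ ends (π i) (re i)).card ≤ B)
    (hd : ∀ v, d + 2 * ((5 + 6 * w) * (k / ρ + 1 : ℕ) + B) ≤ dg J v Finset.univ) :
    ∃ Γ σ, Proc π re J k Γ σ := by
  have hρ0 := hp.ρ0
  have main : ∀ t, ∃ Γ σ, Proc π re J (min k (t * ρ)) Γ σ ∧
      ∀ v, dg J v Finset.univ ≤ dg Γ v Finset.univ + 2 * ((5 + 6 * w) * t +
        ((Finset.range (min k (t * ρ))).filter fun i => v ∈ ends (π i) (re i)).card) := by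
    intro t
    induction t with
    | zero =>
      refine ⟨J, fun _ => 1, ⟨le_rfl, ?_, ?_, ?_, ?_⟩, fun v => Nat.le_add_right _ _⟩ <;>
      · intro i hi; simp at hi
    | succ t ih =>
      obtain ⟨Γ₀, σ₀, hP, hdam⟩ := ih
      by_cases ht : k ≤ t * ρ
      · have e1 : min k (t * ρ) = k := min_eq_left ht
        have e2 : min k ((t + 1) * ρ) = k := min_eq_left (ht.trans (by gcongr; omega))
        rw [e1] at hP hdam
        refine ⟨Γ₀, σ₀, by rw [e2]; exact hP, fun v => (hdam v).trans ?_⟩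
        rw [e2]
        gcongr
        omega
      · push Not at ht
        set m := min k (t * ρ) with hm
        have hm' : m = t * ρ := min_eq_right ht.le
        set r := min k ((t + 1) * ρ) - m with hr
        have hmr : m + r = min k ((t + 1) * ρ) := by
          have : (t + 1) * ρ = t * ρ + ρ := by ring
          omega
        have htk : t ≤ k / ρ := by
          rw [Nat.le_div_iff_mul_le hρ0]; exact ht.le
        obtain ⟨Γ, σ, hΓ, hdam'⟩ := exists_round (r := r) hp hS hU hE hP (fun v => by
          have e1 := hd v
          have e2 : (dg J v Finset.univ : ℝ) ≤ dg Γ₀ v Finset.univ +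
            2 * ((5 + 6 * w) * (k / ρ + 1 : ℕ) + B) := by
            have e3 : dg J v Finset.univ ≤ dg Γ₀ v Finset.univ +
              2 * ((5 + 6 * w) * (k / ρ + 1) + B) := by
              refine (hdam v).trans ?_
              gcongr
              · omega
              · refine (Finset.card_le_card (Finset.filter_subset_filter _ ?_)).trans (hB v)
                exact Finset.range_subset_range.2 (min_le_left _ _)
            exact_mod_cast e3
          linarith) (by
            have : (t + 1) * ρ = t * ρ + ρ := by ring
            omega) (by rw [hmr]; exact min_le_left _ _)
        rw [hmr] at hΓ
        refine ⟨Γ, σ, hΓ, fun v => ?_⟩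
        have e1 := hdam v
        have e2 := hdam' v
        have e3 : ((Finset.range (min k ((t + 1) * ρ))).filter fun i => v ∈ ends (π i) (re i)).card =
            ((Finset.range m).filter fun i => v ∈ ends (π i) (re i)).card +
            ((Finset.range r).filter fun a => v ∈ ends (π (m + a)) (re (m + a))).card := by
          rw [← hmr]
          simp only [Finset.card_filter]
          exact Finset.sum_range_add _ _ _
        rw [e3]
        have : (5 + 6 * w) * (t + 1) = (5 + 6 * w) * t + (5 + 6 * w) := by ring
        omega
  obtain ⟨Γ, σ, hΓ, -⟩ := main k
  have : min k (k * ρ) = k := min_eq_left (Nat.le_mul_of_pos_right _ hρ0)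
  exact ⟨Γ, σ, this ▸ hΓ⟩

end Round

section Build
variable {V : Type} [Fintype V]

lemma card_bad_mul_le {M b t : ℕ} (P : ℕ → V → Prop)
    (h : ∀ u, ((Finset.range M).filter fun f => ¬ P f u).card ≤ b) :
    ((Finset.range M).filter fun f => t < (Finset.univ.filter fun u => ¬ P f u).card).card * (t + 1)
      ≤ b * Fintype.card V := by
  calc _ = ∑ f ∈ (Finset.range M).filter fun f => t < (Finset.univ.filter fun u => ¬ P f u).card,
        (t + 1) := by rw [Finset.sum_const, smul_eq_mul]
    _ ≤ ∑ f ∈ (Finset.range M).filter fun f => t < (Finset.univ.filter fun u => ¬ P f u).card,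
        (Finset.univ.filter fun u => ¬ P f u).card :=
        Finset.sum_le_sum fun f hf => (Finset.mem_filter.1 hf).2
    _ ≤ ∑ f ∈ Finset.range M, (Finset.univ.filter fun u => ¬ P f u).card :=
        Finset.sum_le_sum_of_subset (Finset.filter_subset _ _)
    _ = ∑ u : V, ((Finset.range M).filter fun f => ¬ P f u).card :=
        Finset.sum_card_bipartiteAbove_eq_sum_card_bipartiteBelow (fun f u => ¬ P f u)
    _ ≤ ∑ u : V, b := Finset.sum_le_sum fun u _ => h u
    _ = _ := by rw [Finset.sum_const, Finset.card_univ, smul_eq_mul, mul_comm]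

lemma natCast_zmod_ne {ℓ h a b : ℕ} (hh : 2 * h < ℓ) (ha : a < h) (hb : b < h) :
    ((a + 1 : ℕ) : ZMod ℓ) + ((b + 1 : ℕ) : ZMod ℓ) ≠ 0 := by
  rw [← Nat.cast_add, Ne, ZMod.natCast_eq_zero_iff]
  intro hd
  have := Nat.le_of_dvd (by omega) hd
  omega

lemma natCast_zmod_inj {ℓ a b : ℕ} (ha : a < ℓ) (hb : b < ℓ)
    (h : (a : ZMod ℓ) = (b : ZMod ℓ)) : a = b := by
  rw [ZMod.natCast_eq_natCast_iff', Nat.mod_eq_of_lt ha, Nat.mod_eq_of_lt hb] at h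
  exact h

theorem exists_systems {W J : SimpleGraph V} (hWJ : Disjoint W J) {ℓ h M m t β k : ℕ}
    [Fact ℓ.Prime] (hh : 2 * h < ℓ) (col : V → ZMod ℓ) (S : ZMod ℓ → Finset V)
    (hS : ∀ u a, u ∈ S a ↔ col u = a) (hM : ∀ v a, dg W v (S a) ≤ M)
    (hm : ∀ v a, m ≤ dg W v (S a))
    (hβ : (M - m) * Fintype.card V < (β + 1) * (t + 1)) (hk : k ≤ h * (M - β)) :
    ∃ (π : ℕ → Equiv.Perm V) (re : ℕ → V → Prop), Systems π re J k ℓ ∧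
      (∀ i < k, arcGraph (π i) (re i) ≤ W) ∧ (∀ i < k, (ends (π i) (re i)).card ≤ 2 * t) ∧
      ∀ v, ((Finset.range k).filter fun i => v ∈ ends (π i) (re i)).card ≤ h * (2 * (M - m)) := by
  obtain ⟨r, hr⟩ : ∃ r : ℕ → V → V → Prop, ∀ i u v, r i u v ↔
      W.Adj u v ∧ col v = col u + ((i + 1 : ℕ) : ZMod ℓ) := ⟨_, fun _ _ _ => Iff.rfl⟩
  have hrow : ∀ i u, (Finset.univ.filter fun v => r i u v) =
      (S (col u + ((i + 1 : ℕ) : ZMod ℓ))).filter fun v => W.Adj u v := by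
    intro i u; ext v; simp [hr, hS, and_comm]
  have hcol : ∀ i v, (Finset.univ.filter fun u => r i u v) =
      (S (col v - ((i + 1 : ℕ) : ZMod ℓ))).filter fun u => W.Adj v u := by
    intro i v; ext u
    simp only [hr, Finset.mem_filter, Finset.mem_univ, true_and, hS, W.adj_comm u v]
    rw [and_comm, eq_sub_iff_add_eq, eq_comm]
  choose P cl hP using fun i => exists_perms_of_relation M (r i)
    (fun u => by rw [hrow]; exact hM _ _) (fun v => by rw [hcol]; exact hM _ _)
  obtain ⟨R, hR⟩ : ∃ R : ℕ → ℕ → V → Prop, ∀ i f u, R i f u ↔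
      r i u (P i f u) ∧ cl i u (P i f u) = f := ⟨_, fun _ _ _ => Iff.rfl⟩
  have hRa : ∀ i f u, R i f u → W.Adj u (P i f u) := fun i f u h =>
    ((hr _ _ _).1 ((hR i f u).1 h).1).1
  have hRc : ∀ i f u, R i f u → col (P i f u) = col u + ((i + 1 : ℕ) : ZMod ℓ) := fun i f u h =>
    ((hr _ _ _).1 ((hR i f u).1 h).1).2
  have hRl : ∀ i f u, R i f u → cl i u (P i f u) = f := fun i f u h => ((hR i f u).1 h).2
  -- missing arcs at a vertex
  have hvirt : ∀ i u, ((Finset.range M).filter fun f => ¬ R i f u).card ≤ M - m := by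
    intro i u
    have h1 : m ≤ ((Finset.range M).filter fun f => R i f u).card := by
      refine (hm u (col u + ((i + 1 : ℕ) : ZMod ℓ))).trans ?_
      unfold dg
      rw [← hrow]
      refine Finset.card_le_card_of_injOn (fun v => cl i u v) ?_ ?_
      · intro v hv
        have hv' : r i u v := by simpa using hv
        have := hP i u v hv'
        simp [hR, this, hv']
      · intro v hv v' hv' he
        have hv : r i u v := by simpa using hv
        have hv' : r i u v' := by simpa using hv'
        have he : cl i u v = cl i u v' := he
        rw [← (hP i u v hv).2, ← (hP i u v' hv').2, he]
    have h2 := Finset.card_filter_add_card_filter_not (s := Finset.range M) (fun f => R i f u)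
    rw [Finset.card_range] at h2
    omega
  have hvirt' : ∀ i v, ((Finset.range M).filter fun f => ¬ R i f ((P i f).symm v)).card ≤ M - m := by
    intro i v
    have h1 : m ≤ ((Finset.range M).filter fun f => R i f ((P i f).symm v)).card := by
      refine (hm v (col v - ((i + 1 : ℕ) : ZMod ℓ))).trans ?_
      unfold dg
      rw [← hcol]
      refine Finset.card_le_card_of_injOn (fun u => cl i u v) ?_ ?_
      · intro u hu
        have hu' : r i u v := by simpa using hu
        obtain ⟨h1, h2⟩ := hP i u v hu'
        have : (P i (cl i u v)).symm v = u := by rw [Equiv.symm_apply_eq, h2]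
        simp [hR, this, h1, hu']
      · intro u hu u' hu' he
        have hu : r i u v := by simpa using hu
        have hu' : r i u' v := by simpa using hu'
        have he : cl i u v = cl i u' v := he
        have e1 := (hP i u v hu).2
        have e2 := (hP i u' v hu').2
        rw [← he] at e2
        exact (P i (cl i u v)).injective (e1.trans e2.symm)
    have h2 := Finset.card_filter_add_card_filter_not (s := Finset.range M)
      (fun f => R i f ((P i f).symm v))
    rw [Finset.card_range] at h2
    omega
  obtain ⟨bad, hbad⟩ : ∃ bad : ℕ → ℕ → Prop, ∀ i f, bad i f ↔
      t < (Finset.univ.filter fun u => ¬ R i f u).card := ⟨_, fun _ _ => Iff.rfl⟩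
  have hbadc : ∀ i, ((Finset.range M).filter fun f => bad i f).card ≤ β := by
    intro i
    have := card_bad_mul_le (t := t) (fun f u => R i f u) (hvirt i)
    simp only [← hbad] at this
    by_contra hcon
    push Not at hcon
    have h2 := Nat.mul_le_mul_right (t + 1) hcon
    exact absurd (h2.trans this) (not_le.2 hβ)
  set Gd : Finset (ℕ × ℕ) := (Finset.range h).sigma (fun i => (Finset.range M).filter
    fun f => ¬ bad i f) |>.map (Equiv.sigmaEquivProd ℕ ℕ).toEmbedding with hGd
  have hGdm : ∀ p, p ∈ Gd ↔ p.1 < h ∧ p.2 < M ∧ ¬ bad p.1 p.2 := by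
    intro p; simp [hGd, Finset.mem_map_equiv]
  have hGdc : k ≤ Gd.card := by
    refine hk.trans ?_
    rw [hGd, Finset.card_map, Finset.card_sigma]
    calc h * (M - β) = ∑ i ∈ Finset.range h, (M - β) := by simp
      _ ≤ _ := by
        refine Finset.sum_le_sum fun i _ => ?_
        have h2 := Finset.card_filter_add_card_filter_not (s := Finset.range M) (fun f => bad i f)
        have := hbadc i
        rw [Finset.card_range] at h2
        omega
  obtain ⟨L, hL, hLc⟩ := Finset.exists_subset_card_eq hGdc
  set eqv := L.equivFinOfCardEq hLc with heqv
  set e : ℕ → ℕ × ℕ := fun i => if hi : i < k then (eqv.symm ⟨i, hi⟩).1 else 0 with he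
  have heG : ∀ i < k, e i ∈ Gd := by
    intro i hi; simp only [he, hi, dif_pos]; exact hL (eqv.symm ⟨i, hi⟩).2
  have heinj : ∀ i < k, ∀ j < k, e i = e j → i = j := by
    intro i hi j hj hij
    simp only [he, hi, hj, dif_pos] at hij
    have := eqv.symm.injective (Subtype.ext hij)
    exact Fin.mk.inj_iff.1 this
  have hle : ∀ i f, arcGraph (P i f) (R i f) ≤ W := by
    intro i f u v huv
    rw [arcGraph_adj] at huv
    rcases huv.2 with ⟨h1, h2⟩ | ⟨h1, h2⟩
    · rw [← h2]; exact hRa _ _ _ h1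
    · rw [← h2]; exact (hRa _ _ _ h1).symm
  -- an arc determines its system
  have hdet : ∀ i f i' f' u v, R i f u → P i f u = v → R i' f' u → P i' f' u = v →
      i < h → i' < h → (i, f) = (i', f') := by
    intro i f i' f' u v h1 h2 h3 h4 hi hi'
    have e1 := hRc _ _ _ h1
    have e2 := hRc _ _ _ h3
    rw [h2] at e1
    rw [h4, e1] at e2
    have e3 := natCast_zmod_inj (by omega) (by omega) (add_left_cancel e2)
    have e4 : i = i' := by omega
    subst e4
    have e5 := hRl _ _ _ h1
    have e6 := hRl _ _ _ h3
    rw [h2] at e5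
    rw [h4] at e6
    rw [← e5, ← e6]
  have hrev : ∀ i f i' f' u v, R i f u → P i f u = v → R i' f' v → P i' f' v = u →
      i < h → i' < h → False := by
    intro i f i' f' u v h1 h2 h3 h4 hi hi'
    have e1 := hRc _ _ _ h1
    have e2 := hRc _ _ _ h3
    rw [h2] at e1
    rw [h4, e1, add_assoc] at e2
    exact natCast_zmod_ne hh hi hi' (by simpa using e2.symm)
  refine ⟨fun i => P (e i).1 (e i).2, fun i => R (e i).1 (e i).2,
    ⟨?_, fun i _ => hWJ.mono_left (hle _ _), ?_, ?_⟩, fun i _ => hle _ _, ?_, ?_⟩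
  · intro i hi u hu hfix
    have := hRa _ _ _ hu
    rw [hfix] at this
    exact W.irrefl this
  · intro i hi j hj hij
    have hi' := (hGdm _).1 (heG i hi)
    have hj' := (hGdm _).1 (heG j hj)
    refine disjoint_of_adj fun u v h1 h2 => ?_
    rw [arcGraph_adj] at h1 h2
    rcases h1.2 with ⟨a1, a2⟩ | ⟨a1, a2⟩ <;> rcases h2.2 with ⟨b1, b2⟩ | ⟨b1, b2⟩
    · exact hij (heinj i hi j hj (hdet _ _ _ _ u v a1 a2 b1 b2 hi'.1 hj'.1))
    · exact hrev _ _ _ _ u v a1 a2 b1 b2 hi'.1 hj'.1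
    · exact hrev _ _ _ _ v u a1 a2 b1 b2 hi'.1 hj'.1
    · exact hij (heinj i hi j hj (hdet _ _ _ _ v u a1 a2 b1 b2 hi'.1 hj'.1))
  · intro i hi u hu a ha b hb hab
    have hi' := (hGdm _).1 (heG i hi)
    have hc : ∀ j ≤ ℓ, col ((P (e i).1 (e i).2 ^ j) u) =
        col u + (j : ZMod ℓ) * (((e i).1 + 1 : ℕ) : ZMod ℓ) := by
      intro j
      induction j with
      | zero => intro _; simp
      | succ j ih =>
        intro hj
        rw [pow_succ', Equiv.Perm.mul_apply, hRc _ _ _ (hu j hj), ih (by omega)]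
        push_cast; ring
    have e1 := hc a ha.le
    have e2 := hc b hb.le
    rw [hab, e2] at e1
    have e3 := add_left_cancel e1
    have hne : (((e i).1 + 1 : ℕ) : ZMod ℓ) ≠ 0 := by
      rw [Ne, ZMod.natCast_eq_zero_iff]
      intro hd
      have := Nat.le_of_dvd (by omega) hd
      omega
    exact natCast_zmod_inj ha hb (mul_right_cancel₀ hne e3).symm
  · intro i hi
    have hi' := (hGdm _).1 (heG i hi)
    have h1 : (Finset.univ.filter fun u => ¬ R (e i).1 (e i).2 u).card ≤ t :=
      not_lt.1 fun h => hi'.2.2 ((hbad _ _).2 h)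
    have h2 : (Finset.univ.filter fun u => ¬ R (e i).1 (e i).2 ((P (e i).1 (e i).2).symm u)).card ≤
        t := by
      refine le_trans (Finset.card_le_card_of_injOn (fun u => (P (e i).1 (e i).2).symm u) ?_ ?_) h1
      · intro u hu; simpa using hu
      · intro u _ u' _ h; exact (P (e i).1 (e i).2).symm.injective h
    have h3 : ends (P (e i).1 (e i).2) (R (e i).1 (e i).2) ⊆
        (Finset.univ.filter fun u => ¬ R (e i).1 (e i).2 u) ∪
        (Finset.univ.filter fun u => ¬ R (e i).1 (e i).2 ((P (e i).1 (e i).2).symm u)) := by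
      intro v hv
      simpa [ends] using hv
    refine (Finset.card_le_card h3).trans ((Finset.card_union_le _ _).trans ?_)
    rw [two_mul]
    exact Nat.add_le_add h1 h2
  · intro v
    have h1 : ((Finset.range k).filter fun i =>
        v ∈ ends (P (e i).1 (e i).2) (R (e i).1 (e i).2)).card ≤
        ((Finset.range h).sigma fun i => ((Finset.range M).filter fun f => ¬ R i f v) ∪
          ((Finset.range M).filter fun f => ¬ R i f ((P i f).symm v))).card := by
      refine Finset.card_le_card_of_injOn (fun i => ⟨(e i).1, (e i).2⟩) ?_ ?_
      · intro i hi
        have hi := Finset.mem_filter.1 (Finset.mem_coe.1 hi)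
        have hik := Finset.mem_range.1 hi.1
        have hi' := (hGdm _).1 (heG i hik)
        have hv : ¬ R (e i).1 (e i).2 v ∨ ¬ R (e i).1 (e i).2 ((P (e i).1 (e i).2).symm v) := by
          simpa [ends] using hi.2
        rw [Finset.mem_coe, Finset.mem_sigma, Finset.mem_range, Finset.mem_union,
          Finset.mem_filter, Finset.mem_filter, Finset.mem_range]
        exact ⟨hi'.1, hv.imp (fun h => ⟨hi'.2.1, h⟩) (fun h => ⟨hi'.2.1, h⟩)⟩
      · intro i hi j hj hij
        have hi := Finset.mem_range.1 (Finset.mem_filter.1 (Finset.mem_coe.1 hi)).1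
        have hj := Finset.mem_range.1 (Finset.mem_filter.1 (Finset.mem_coe.1 hj)).1
        apply heinj i hi j hj
        simp only [Sigma.mk.injEq, heq_eq_eq] at hij
        exact Prod.ext hij.1 hij.2
    refine h1.trans ?_
    rw [Finset.card_sigma]
    calc _ ≤ ∑ i ∈ Finset.range h, 2 * (M - m) := by
          refine Finset.sum_le_sum fun i _ => (Finset.card_union_le _ _).trans ?_
          have := hvirt i v
          have := hvirt' i v
          omega
      _ = _ := by simp

end Build

section Classes
variable {V κ : Type} [Fintype V] [Fintype κ]

lemma pow_mul_sixteenth_lt {w a b : ℕ} (hw : 2 ≤ w) (ha : a ≤ 2 ^ w) (hb : b ≤ 2 ^ w) {C : ℝ}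
    (hC0 : 0 ≤ C) (hC : C < 16) : ((a * b : ℕ) : ℝ) * (C * Real.exp (-(3 * w))) < 1 := by
  have h1 : ((a * b : ℕ) : ℝ) ≤ 4 ^ w := by
    have : a * b ≤ 4 ^ w := by
      calc _ ≤ 2 ^ w * 2 ^ w := Nat.mul_le_mul ha hb
        _ = 4 ^ w := by rw [← mul_pow]; norm_num
    exact_mod_cast this
  have h2 : Real.exp (-(3 * w)) = (Real.exp (-3)) ^ w := by
    rw [← Real.exp_nat_mul]; congr 1; ring
  have h3 : Real.exp (-3) ≤ 1 / 16 := by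
    rw [Real.exp_neg, one_div]
    apply inv_anti₀ (by norm_num)
    have h4 : Real.exp 3 = Real.exp 1 ^ 3 := by rw [← Real.exp_nat_mul]; norm_num
    rw [h4]
    have := Real.exp_one_gt_d9
    calc (16 : ℝ) ≤ 2.7 ^ 3 := by norm_num
      _ ≤ _ := by gcongr; linarith
  have h5 : Real.exp (-(3 * w)) ≤ (1 / 16) ^ w := by rw [h2]; gcongr
  calc ((a * b : ℕ) : ℝ) * (C * Real.exp (-(3 * w))) ≤ 4 ^ w * (C * (1 / 16) ^ w) := by gcongr
    _ = C * (1 / 4) ^ w := by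
      rw [mul_left_comm, ← mul_pow]; norm_num
    _ ≤ C * (1 / 4) ^ 2 := by
      gcongr C * ?_
      exact pow_le_pow_of_le_one (by norm_num) (by norm_num) hw
    _ < 1 := by linarith

/-- A colouring of the vertices splitting all neighbourhoods evenly. -/
theorem exists_classes [Nonempty κ] {ℓ w : ℕ} (hℓ : Fintype.card κ = ℓ) (W : SimpleGraph V)
    {d D x : ℝ} (hd : ∀ v, d ≤ dg W v Finset.univ) (hD : ∀ v, dg W v Finset.univ ≤ D)
    (hw : 2 ≤ w) (hcard : Fintype.card V ≤ 2 ^ w) (hℓw : ℓ ≤ 2 ^ w)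
    (hx0 : 0 ≤ x) (hx1 : x ≤ 1) (hdD : d ≤ D) (hx : 3 * w ≤ x * (x * (d / ℓ))) :
    ∃ (col : V → κ) (S : κ → Finset V), (∀ u a, u ∈ S a ↔ col u = a) ∧
      (∀ v a, (1 - 2 * x) * (d / ℓ) ≤ dg W v (S a)) ∧
      (∀ v a, dg W v (S a) ≤ (1 + 2 * x) * (D / ℓ)) := by
  have hμ : IsProb (unif V κ) := isProb_unif
  have hℓ0 : (0 : ℝ) < ℓ := by
    have : 0 < ℓ := hℓ ▸ Fintype.card_pos
    exact_mod_cast this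
  set e : ℝ := Real.exp (-(3 * w)) with he
  have hlow : ∀ (a : κ) (v : V), Pr (unif V κ) (fun c =>
      (dg W v (Finset.univ.filter fun u => c u = a) : ℝ) < (1 - 2 * x) * (d / ℓ)) ≤ e := by
    intro a v
    have h := Pr_card_le (Finset.univ.filter fun u => W.Adj v u) (fun u => u) (b := 1)
      (fun _ k => k = a) hμ one_pos (card_filter_eq_le_one _ _ fun _ _ _ _ h => h)
      (m := d / ℓ) (x := x) (t := x * (d / ℓ)) (by
        rw [sum_unif_eq _ (fun u => u) (fun _ => a), hℓ]
        have : (dg W v Finset.univ) = (Finset.univ.filter fun u => W.Adj v u).card := rfl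
        rw [← this]
        exact div_le_div_of_nonneg_right (hd v) hℓ0.le) hx0 hx1
    refine (Pr_mono hμ fun c hc => ?_).trans (h.trans ?_)
    · rw [dg_univ_filter] at hc
      linarith
    · rw [he]; apply Real.exp_le_exp.2; push_cast; linarith
  have hx' : x * (x * (d / ℓ)) ≤ x * (x * (D / ℓ)) := by gcongr
  have hup : ∀ (a : κ) (v : V), Pr (unif V κ) (fun c =>
      (1 + 2 * x) * (D / ℓ) < (dg W v (Finset.univ.filter fun u => c u = a) : ℝ)) ≤ e := by
    intro a v
    have h := Pr_card_ge (Finset.univ.filter fun u => W.Adj v u) (fun u => u) (b := 1)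
      (fun _ k => k = a) hμ one_pos (card_filter_eq_le_one _ _ fun _ _ _ _ h => h)
      (m := D / ℓ) (x := x) (t := x * (D / ℓ)) (by
        rw [sum_unif_eq _ (fun u => u) (fun _ => a), hℓ]
        have : (dg W v Finset.univ) = (Finset.univ.filter fun u => W.Adj v u).card := rfl
        rw [← this]
        exact div_le_div_of_nonneg_right (hD v) hℓ0.le) hx0 hx1
    refine (Pr_mono hμ fun c hc => ?_).trans (h.trans ?_)
    · rw [dg_univ_filter] at hc
      linarith
    · rw [he]; apply Real.exp_le_exp.2; push_cast; linarith
  have hall := Pr_exists_le_card hμ (Finset.univ : Finset (κ × V)) (c := 2 * e) (fun av c =>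
      ((dg W av.2 (Finset.univ.filter fun u => c u = av.1) : ℝ) < (1 - 2 * x) * (d / ℓ)) ∨
      ((1 + 2 * x) * (D / ℓ) < (dg W av.2 (Finset.univ.filter fun u => c u = av.1) : ℝ))) (by
    rintro ⟨a, v⟩ -
    refine (Pr_or_le hμ _ _).trans ?_
    have := hlow a v
    have := hup a v
    linarith)
  have hlt : ((Finset.univ : Finset (κ × V)).card : ℝ) * (2 * e) < 1 := by
    rw [Finset.card_univ, Fintype.card_prod, hℓ]
    exact pow_mul_sixteenth_lt hw hℓw hcard (by norm_num) (by norm_num)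
  obtain ⟨c, hc⟩ := exists_not_of_Pr_lt_one hμ (hall.trans_lt hlt)
  have hc' := fun a v => not_exists.1 hc (a, v)
  simp only [Finset.mem_univ, true_and, not_or, not_lt] at hc'
  exact ⟨c, fun a => Finset.univ.filter fun u => c u = a, fun u a => by simp,
    fun v a => (hc' a v).1, fun v a => (hc' a v).2⟩

end Classes

section Stage
variable {V : Type} [Fintype V]

lemma params_of_large {z n : ℕ} (hz : 10 ^ 9 ≤ z) (hn : n ≤ 2 ^ z ^ 4) {q : ℝ} (hq1 : q ≤ 1)
    (hqn : (z : ℝ) ^ 52 ≤ q * n) {ℓ : ℕ} (hℓ : z ^ 15 < ℓ) :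
    Params q ((z : ℝ) ^ 10) (1 / (z : ℝ) ^ 5) (1 / (z : ℝ) ^ 6) ((1 - 1 / (z : ℝ) ^ 5 / 2) * (q * n)) (z ^ 4) (z ^ 10) ℓ n := by
  have hZ : (1000000000 : ℝ) ≤ z := by exact_mod_cast hz
  set Z : ℝ := (z : ℝ) with hZdef
  have hZ0 : 0 < Z := by linarith
  have hZ1 : 1 ≤ Z := by linarith
  have hn0 : (0 : ℝ) ≤ n := Nat.cast_nonneg _
  have hstep : ∀ k l : ℕ, l = k + 1 → 1000000000 * Z ^ k ≤ Z ^ l := fun k l h => by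
    rw [h, pow_succ']; exact mul_le_mul_of_nonneg_right hZ (by positivity)
  have hmono : ∀ {a b : ℕ}, a ≤ b → Z ^ a ≤ Z ^ b := fun h => pow_le_pow_right₀ hZ1 h
  have h52 : 0 < Z ^ 52 := by positivity
  have hqn0 : 0 < q * n := h52.trans_le hqn
  have hq0 : 0 < q := pos_of_mul_pos_left hqn0 hn0
  have hqnn : q * n ≤ n := by nlinarith
  have hN1 : 1 ≤ Z ^ 52 := one_le_pow₀ hZ1
  have hpow : ∀ k : ℕ, k ≤ 100 → z ^ k ≤ 2 ^ z ^ 4 := by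
    intro k hk
    have h1 : z ^ k ≤ (2 ^ z) ^ k := Nat.pow_le_pow_left Nat.lt_two_pow_self.le k
    rw [← pow_mul] at h1
    refine h1.trans (Nat.pow_le_pow_right (by norm_num) ?_)
    calc z * k ≤ z * z := by gcongr; omega
      _ = z ^ 2 := by ring
      _ ≤ z ^ 4 := Nat.pow_le_pow_right (by omega) (by norm_num)
  have hε1 : 1 / Z ^ 5 ≤ 1 := by
    rw [div_le_one (by positivity)]; exact one_le_pow₀ hZ1
  have hε0 : 0 ≤ 1 / Z ^ 5 := by positivity
  have hx2 : 1 / Z ^ 6 ≤ 1 / 4 := by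
    apply one_div_le_one_div_of_le (by norm_num)
    have := hstep 5 6 rfl
    have h1 : 1 ≤ Z ^ 5 := one_le_pow₀ hZ1
    linarith
  have hd0 : (q * n) / 2 ≤ (1 - 1 / Z ^ 5 / 2) * (q * n) := by
    have : (1 / 2 : ℝ) ≤ 1 - 1 / Z ^ 5 / 2 := by linarith
    have := mul_le_mul_of_nonneg_right this hqn0.le
    linarith
  refine ⟨hq0, hq1, one_le_pow₀ hZ1, hε0, ?_, hn, ?_, ?_, by positivity, hpow _ (by norm_num), ?_,
    by omega, by positivity, by linarith, ?_, ?_, ?_, ?_, hε1⟩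
  · push_cast
    rw [← hZdef, one_div_mul_eq_div, div_le_one (by positivity)]
    have := hstep 4 5 rfl
    have h1 : 1 ≤ Z ^ 4 := one_le_pow₀ hZ1
    linarith
  · have h1 : (3 : ℝ) ≤ n := by
      have := hstep 51 52 rfl
      have h1 : 1 ≤ Z ^ 51 := one_le_pow₀ hZ1
      linarith
    exact_mod_cast h1
  · exact le_trans (by omega) (Nat.le_self_pow (by norm_num) z)
  · have : 24 * z ^ 4 * z ^ 10 ≤ z * z ^ 4 * z ^ 10 := by gcongr; omega
    calc _ ≤ _ := this
      _ = z ^ 15 := by ring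
      _ ≤ ℓ := hℓ.le
  · have : (1 - 1 / Z ^ 5 / 2) * (q * n) ≤ 1 * (q * n) :=
      mul_le_mul_of_nonneg_right (by linarith) hqn0.le
    linarith
  · push_cast
    rw [← hZdef]
    have e : 1 / Z ^ 6 * (1 / Z ^ 6 * ((1 - 1 / Z ^ 5 / 2) * (q * n) / Z ^ 10)) =
        ((1 - 1 / Z ^ 5 / 2) * (q * n)) / Z ^ 22 := by
      rw [show Z ^ 22 = Z ^ 6 * (Z ^ 6 * Z ^ 10) by ring]
      field_simp
    rw [e, le_div_iff₀ (by positivity)]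
    have h1 : 3 * Z ^ 4 * Z ^ 22 = 3 * Z ^ 26 := by ring
    have h2 := hstep 26 27 rfl
    have h3 := hmono (show 27 ≤ 52 by norm_num)
    have h4 : 0 < Z ^ 26 := by positivity
    linarith
  · push_cast
    rw [← hZdef]
    have key : 2 * Z ^ 10 ≤ (q * n) / Z ^ 10 * (1 / Z ^ 6) := by
      rw [div_mul_div_comm, mul_one, le_div_iff₀ (by positivity)]
      have h1 : 2 * Z ^ 10 * (Z ^ 10 * Z ^ 6) = 2 * Z ^ 26 := by ring
      have h2 := hstep 26 27 rfl
      have h3 := hmono (show 27 ≤ 52 by norm_num)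
      have h4 : 0 < Z ^ 26 := by positivity
      linarith
    have hεx : 1 / Z ^ 5 = Z * (1 / Z ^ 6) := by field_simp
    have hx0 : 0 < 1 / Z ^ 6 := by positivity
    have hy0 : 0 ≤ (q * n) / Z ^ 10 := by positivity
    set ε := 1 / Z ^ 5
    set x := 1 / Z ^ 6
    set y := (q * n) / Z ^ 10 with hy
    have e1 : (1 - ε) * (q * ((1 + 2 * x) * (n / Z ^ 10))) = (1 - ε) * (1 + 2 * x) * y := by
      rw [hy]; ring
    have e2 : (1 - 2 * x) * ((1 - ε / 2) * (q * n) / Z ^ 10) = (1 - 2 * x) * (1 - ε / 2) * y := by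
      rw [hy]; ring
    rw [e1, e2]
    have e3 : 10 * x ≤ ε := by rw [hεx]; exact mul_le_mul_of_nonneg_right (by linarith) hx0.le
    have e4 : x ≤ (1 - 2 * x) * (1 - ε / 2) - (1 - ε) * (1 + 2 * x) := by
      have : 0 ≤ ε * x := by positivity
      linarith
    have e5 := mul_le_mul_of_nonneg_right e4 hy0
    linarith
  · push_cast
    rw [← hZdef]
    have e1 : q * ((1 - 2 * (1 / Z ^ 6)) * (n / Z ^ 10)) = (1 - 2 * (1 / Z ^ 6)) * ((q * n) / Z ^ 10) := by
      ring
    rw [e1]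
    have e2 : (1 / 2 : ℝ) * ((q * n) / Z ^ 10) ≤ (1 - 2 * (1 / Z ^ 6)) * ((q * n) / Z ^ 10) :=
      mul_le_mul_of_nonneg_right (by linarith) (by positivity)
    refine le_trans ?_ e2
    have h0 : 1 ≤ Z ^ 4 := one_le_pow₀ hZ1
    have h1 : (2 * Z ^ 4 + 2) ^ 3 ≤ (4 * Z ^ 4) ^ 3 := by
      gcongr; linarith
    have h2 : 20000000 * (2 * Z ^ 4 + 2) ^ 3 * Z ^ 10 ≤ 20000000 * (4 * Z ^ 4) ^ 3 * Z ^ 10 :=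
      mul_le_mul_of_nonneg_right (mul_le_mul_of_nonneg_left h1 (by norm_num)) (by positivity)
    refine h2.trans ?_
    rw [← mul_div_assoc, le_div_iff₀ (by positivity)]
    have h3 : 20000000 * (4 * Z ^ 4) ^ 3 * Z ^ 10 * Z ^ 10 = 1280000000 * Z ^ 32 := by ring
    rw [h3]
    have h4 := hstep 32 33 rfl
    have h5 := hstep 33 34 rfl
    have h6 := hmono (show 34 ≤ 52 by norm_num)
    have h7 : 0 < Z ^ 32 := by positivity
    linarith

end Stage

section Stage
variable {V : Type} [Fintype V]

/-- Almost all of a nearly regular graph `W` is covered by edge-disjoint Hamilton cycles, using a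
random-like reservoir `J`. -/
theorem exists_stage {W J : SimpleGraph V} {z : ℕ} (hz : 10 ^ 9 ≤ z) {q c : ℝ} {k : ℕ}
    (hn : Fintype.card V ≤ 2 ^ z ^ 4) (hq1 : q ≤ 1) (hqn : (z : ℝ) ^ 52 ≤ q * Fintype.card V)
    (hWJ : Disjoint W J) (hU : UpperReg J q ((z : ℝ) ^ 10) (1 / (z : ℝ) ^ 5))
    (hJ : ∀ v, (1 - 1 / (z : ℝ) ^ 5 / 8) * (q * Fintype.card V) ≤ dg J v Finset.univ)
    (hWl : ∀ v, (1 - 1 / (z : ℝ) ^ 16) * c ≤ dg W v Finset.univ)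
    (hWu : ∀ v, dg W v Finset.univ ≤ (1 + 1 / (z : ℝ) ^ 16) * c)
    (hc1 : q * Fintype.card V / 4 ≤ c) (hc2 : c ≤ 4 * (q * Fintype.card V))
    (hk : (k : ℝ) ≤ c * (15 / 32)) :
    ∃ σ : ℕ → Equiv.Perm V, (∀ i < k, (σ i).IsCycleOn Set.univ) ∧
      (∀ i < k, permGraph (σ i) ≤ W ⊔ J) ∧
      ∀ i < k, ∀ j < i, Disjoint (permGraph (σ j)) (permGraph (σ i)) := by
  have hZ : (1000000000 : ℝ) ≤ z := by exact_mod_cast hz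
  obtain ⟨ℓ, hℓp, hℓ1, hℓ2⟩ := Nat.exists_prime_lt_and_le_two_mul (z ^ 15) (by positivity)
  have hp := params_of_large hz hn hq1 hqn hℓ1
  have hℓ1' : (z : ℝ) ^ 15 < ℓ := by exact_mod_cast hℓ1
  have hℓ2' : (ℓ : ℝ) ≤ 2 * (z : ℝ) ^ 15 := by exact_mod_cast hℓ2
  have hz2 : z ^ 15 ≤ 2 ^ (z ^ 4 - 1) := by
    have h1 : z ^ 15 ≤ (2 ^ z) ^ 15 := Nat.pow_le_pow_left Nat.lt_two_pow_self.le 15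
    rw [← pow_mul] at h1
    refine h1.trans (Nat.pow_le_pow_right (by norm_num) ?_)
    have : z * 15 + 1 ≤ z ^ 4 := by
      calc z * 15 + 1 ≤ z * z := by nlinarith
        _ = z ^ 2 := by ring
        _ ≤ z ^ 4 := Nat.pow_le_pow_right (by omega) (by norm_num)
    omega
  have hℓw : ℓ ≤ 2 ^ z ^ 4 := by
    have e : 2 ^ z ^ 4 = 2 * 2 ^ (z ^ 4 - 1) := by
      rw [← pow_succ']; congr 1
      have : 0 < z ^ 4 := by positivity
      omega
    omega
  set Z : ℝ := (z : ℝ) with hZdef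
  set n := Fintype.card V with hndef
  have hZ0 : 0 < Z := by linarith
  have hZ1 : 1 ≤ Z := by linarith
  have hstep : ∀ k l : ℕ, l = k + 1 → 1000000000 * Z ^ k ≤ Z ^ l := fun k l h => by
    rw [h, pow_succ']; exact mul_le_mul_of_nonneg_right hZ (by positivity)
  have hone : ∀ k : ℕ, 1 ≤ Z ^ k := fun k => one_le_pow₀ hZ1
  have hmono : ∀ {a b : ℕ}, a ≤ b → Z ^ a ≤ Z ^ b := fun h => pow_le_pow_right₀ hZ1 h
  have hn0 : (0 : ℝ) < n := by have := hp.n3; exact_mod_cast (by omega : 0 < n)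
  have hD0 : 0 < q * n := mul_pos hp.q0 hn0
  have hc0 : 0 < c := by linarith
  have hℓ0 : (0 : ℝ) < ℓ := (pow_pos hZ0 15).trans hℓ1'
  set x : ℝ := 1 / Z ^ 16 with hx
  have hx0 : 0 < x := by positivity
  have hxs : x ≤ 1 / 1000000000 := by
    apply one_div_le_one_div_of_le (by norm_num)
    have := hstep 15 16 rfl
    have := hone 15
    linarith
  have hcℓ : Z ^ 37 / 8 ≤ c / ℓ := by
    rw [le_div_iff₀ hℓ0]
    have h1 := mul_le_mul_of_nonneg_left hℓ2' (show 0 ≤ Z ^ 37 / 8 by positivity)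
    have h2 : Z ^ 37 / 8 * (2 * Z ^ 15) = Z ^ 52 / 4 := by ring
    linarith
  set y := c / ℓ with hy
  have hy0 : 0 < y := by positivity
  have : Fact ℓ.Prime := ⟨hℓp⟩
  obtain ⟨col, S, hS, hSl, hSu⟩ := exists_classes (κ := ZMod ℓ) (ℓ := ℓ) (w := z ^ 4) (ZMod.card ℓ) W
    (d := (1 - x) * c) (D := (1 + x) * c) (x := x) hWl hWu hp.w2 hn hℓw hx0.le (by linarith)
    (mul_le_mul_of_nonneg_right (by linarith) hc0.le) (by
      push_cast
      rw [← hZdef, mul_div_assoc, ← hy]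
      have h1 : (1 / 2 : ℝ) * y ≤ (1 - x) * y := mul_le_mul_of_nonneg_right (by linarith) hy0.le
      have h2 : x * (x * (1 / 2 * (Z ^ 37 / 8))) ≤ x * (x * ((1 - x) * y)) := by
        refine mul_le_mul_of_nonneg_left (mul_le_mul_of_nonneg_left ?_ hx0.le) hx0.le
        linarith
      refine le_trans ?_ h2
      have h3 : x * (x * (1 / 2 * (Z ^ 37 / 8))) = Z ^ 5 / 16 := by
        rw [hx, show Z ^ 37 = Z ^ 16 * Z ^ 16 * Z ^ 5 by ring]; field_simp; norm_num
      rw [h3]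
      have := hstep 4 5 rfl
      have := hone 4
      linarith)
  obtain ⟨M, hM⟩ : ∃ M, M = ⌊(1 + 2 * x) * ((1 + x) * c / ℓ)⌋₊ := ⟨_, rfl⟩
  obtain ⟨m, hm⟩ : ∃ m, m = ⌈(1 - 2 * x) * ((1 - x) * c / ℓ)⌉₊ := ⟨_, rfl⟩
  have hMv : ∀ v a, dg W v (S a) ≤ M := fun v a => hM ▸ Nat.le_floor (hSu v a)
  have hmv : ∀ v a, m ≤ dg W v (S a) := fun v a => hm ▸ Nat.ceil_le.2 (hSl v a)
  have hMle : (M : ℝ) ≤ (1 + 2 * x) * ((1 + x) * y) := by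
    have : 0 ≤ (1 + 2 * x) * ((1 + x) * c / ℓ) := by positivity
    have := Nat.floor_le this
    rwa [← hM, mul_div_assoc, ← hy] at this
  have hMge : y - 1 ≤ M := by
    have h1 := Nat.lt_floor_add_one ((1 + 2 * x) * ((1 + x) * c / ℓ))
    rw [← hM, mul_div_assoc, ← hy] at h1
    have h2 : y ≤ (1 + 2 * x) * ((1 + x) * y) := by
      have : 0 ≤ x * y := by positivity
      have : 0 ≤ x * (x * y) := by positivity
      linarith
    linarith
  have hmge : (1 - 2 * x) * ((1 - x) * y) ≤ m := by
    have := Nat.le_ceil ((1 - 2 * x) * ((1 - x) * c / ℓ))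
    rwa [← hm, mul_div_assoc, ← hy] at this
  have hMm : ((M - m : ℕ) : ℝ) ≤ 6 * (x * y) := by
    rcases le_total M m with h | h
    · rw [Nat.sub_eq_zero_of_le h]; push_cast; positivity
    · rw [Nat.cast_sub h]; linarith
  obtain ⟨t, ht⟩ : ∃ t, t = ⌊(n : ℝ) / Z ^ 15⌋₊ := ⟨_, rfl⟩
  obtain ⟨β, hβ⟩ : ∃ β, β = ⌊6 * (x * y) * Z ^ 15⌋₊ := ⟨_, rfl⟩
  obtain ⟨h, hh⟩ : ∃ h, h = (ℓ - 1) / 2 := ⟨_, rfl⟩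
  have hℓodd : ℓ = 2 * h + 1 := by
    have h1 : ℓ ≠ 2 := by
      have : 2 ≤ z ^ 15 := le_trans (by omega) (Nat.le_self_pow (by norm_num) z)
      omega
    have := hℓp.eq_two_or_odd
    omega
  have hhR : (ℓ : ℝ) = 2 * h + 1 := by exact_mod_cast hℓodd
  have hh0 : (0 : ℝ) ≤ h := Nat.cast_nonneg _
  have htle : (t : ℝ) ≤ n / Z ^ 15 := ht ▸ Nat.floor_le (by positivity)
  have htlt : (n : ℝ) / Z ^ 15 < t + 1 := ht ▸ Nat.lt_floor_add_one _
  have hβle : (β : ℝ) ≤ 6 * (x * y) * Z ^ 15 := hβ ▸ Nat.floor_le (by positivity)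
  have hβlt : 6 * (x * y) * Z ^ 15 < β + 1 := hβ ▸ Nat.lt_floor_add_one _
  have hβ' : (M - m) * n < (β + 1) * (t + 1) := by
    have h1 : ((M - m : ℕ) : ℝ) * n < ((β + 1 : ℕ) : ℝ) * ((t + 1 : ℕ) : ℝ) := by
      push_cast
      calc ((M - m : ℕ) : ℝ) * n ≤ 6 * (x * y) * n := mul_le_mul_of_nonneg_right hMm hn0.le
        _ = (6 * (x * y) * Z ^ 15) * (n / Z ^ 15) := by field_simp
        _ < _ := mul_lt_mul'' hβlt htlt (by positivity) (by positivity)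
    exact_mod_cast h1
  have hxZ : x * Z ^ 15 * 1000000000 ≤ 1 := by
    have : x * Z ^ 15 * Z = 1 := by
      rw [hx, mul_assoc, ← pow_succ]; field_simp
    have := mul_le_mul_of_nonneg_left hZ (show 0 ≤ x * Z ^ 15 by positivity)
    linarith
  have hβy : (β : ℝ) ≤ y / 100 := by
    have h1 := mul_le_mul_of_nonneg_right hxZ hy0.le
    have h2 : 6 * (x * y) * Z ^ 15 = 6 * (x * Z ^ 15 * y) := by ring
    linarith
  have hyl : 1000 ≤ y := by
    have := hstep 36 37 rfl
    have := hone 36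
    linarith
  have hβM : β ≤ M := by
    have : (β : ℝ) ≤ M := by linarith
    exact_mod_cast this
  have hk' : k ≤ h * (M - β) := by
    have h1 : (k : ℝ) ≤ ((h * (M - β) : ℕ) : ℝ) := by
      rw [Nat.cast_mul, Nat.cast_sub hβM]
      have h2 : y * (98 / 100) ≤ (M : ℝ) - β := by linarith
      have h3 : (ℓ : ℝ) * (49 / 100) ≤ h := by
        have := hstep 14 15 rfl
        have := hone 14
        linarith
      have h4 : (ℓ : ℝ) * y = c := by rw [hy]; field_simp
      calc (k : ℝ) ≤ c * (15 / 32) := hk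
        _ ≤ c * (49 / 100 * (98 / 100)) := mul_le_mul_of_nonneg_left (by norm_num) hc0.le
        _ = (ℓ : ℝ) * (49 / 100) * (y * (98 / 100)) := by rw [← h4]; ring
        _ ≤ h * (M - β) := mul_le_mul h3 h2 (by positivity) hh0
    exact_mod_cast h1
  obtain ⟨π, re, hsys, hW, hends, hB⟩ := exists_systems hWJ (by omega : 2 * h < ℓ) col S hS hMv hmv
    hβ' hk'
  have hBR : ((h * (2 * (M - m)) : ℕ) : ℝ) ≤ 6 * (x * c) := by
    push_cast
    have h1 : (h : ℝ) * 2 ≤ ℓ := by linarith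
    calc (h : ℝ) * (2 * ((M - m : ℕ) : ℝ)) = (h : ℝ) * 2 * ((M - m : ℕ) : ℝ) := by ring
      _ ≤ ℓ * (6 * (x * y)) := mul_le_mul h1 hMm (Nat.cast_nonneg _) hℓ0.le
      _ = 6 * (x * c) := by rw [hy]; field_simp
  obtain ⟨Γ, σ, hP⟩ := exists_proc hp hsys hU (by
      intro i hi
      have h1 : ((ends (π i) (re i)).card : ℝ) ≤ 2 * t := by exact_mod_cast hends i hi
      push_cast
      rw [← hZdef]
      have h2 : ((ends (π i) (re i)).card : ℝ) ≤ 2 * (n / Z ^ 15) := by linarith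
      have h3 : (7000 * (2 * Z ^ 4 + 2) : ℝ) ≤ 28000 * Z ^ 4 := by
        have := hone 4; linarith
      have h4 : (1 : ℝ) / 2 ≤ 1 - 2 * (1 / Z ^ 6) := by
        have h5 : 1 / Z ^ 6 ≤ 1 / 4 := by
          apply one_div_le_one_div_of_le (by norm_num)
          have := hstep 5 6 rfl
          have := hone 5
          linarith
        linarith
      calc ((ends (π i) (re i)).card : ℝ) * (7000 * (2 * Z ^ 4 + 2))
          ≤ 2 * (n / Z ^ 15) * (28000 * Z ^ 4) := mul_le_mul h2 h3 (by positivity) (by positivity)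
        _ = (56000 / Z) * (n / Z ^ 10) := by
          rw [show Z ^ 15 = Z * Z ^ 10 * Z ^ 4 by ring]; field_simp; norm_num
        _ ≤ (1 - 2 * (1 / Z ^ 6)) * (n / Z ^ 10) := by
          refine mul_le_mul_of_nonneg_right (le_trans ?_ h4) (by positivity)
          rw [div_le_iff₀ hZ0]; linarith) hB (by
      intro v
      refine le_trans ?_ (hJ v)
      have hkρ : ((k / z ^ 10 + 1 : ℕ) : ℝ) ≤ 2 * (q * n) / Z ^ 10 + 1 := by
        have h1 : ((k / z ^ 10 : ℕ) : ℝ) ≤ (k : ℝ) / ((z ^ 10 : ℕ) : ℝ) := Nat.cast_div_le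
        push_cast at h1 ⊢
        have h2 : (k : ℝ) / Z ^ 10 ≤ 2 * (q * n) / Z ^ 10 :=
          div_le_div_of_nonneg_right (by linarith) (by positivity)
        linarith
      have h5 : (5 + 6 * Z ^ 4 : ℝ) ≤ 11 * Z ^ 4 := by
        have := hone 4; linarith
      have h6 : (5 + 6 * Z ^ 4 : ℝ) * ((k / z ^ 10 + 1 : ℕ) : ℝ) ≤
          11 * Z ^ 4 * (2 * (q * n) / Z ^ 10 + 1) :=
        mul_le_mul h5 hkρ (Nat.cast_nonneg _) (by positivity)
      have h7 : 11 * Z ^ 4 * (2 * (q * n) / Z ^ 10 + 1) = 22 * ((q * n) / Z ^ 6) + 11 * Z ^ 4 := by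
        rw [show Z ^ 10 = Z ^ 6 * Z ^ 4 by ring]; field_simp; ring
      have h8 : Z ^ 4 ≤ (q * n) / Z ^ 6 := by
        rw [le_div_iff₀ (by positivity), ← pow_add]
        exact (hmono (by norm_num)).trans hqn
      have h9 : 6 * (x * c) ≤ 24 * ((q * n) / Z ^ 6) := by
        have h10 : x ≤ 1 / Z ^ 6 := one_div_le_one_div_of_le (by positivity) (hmono (by norm_num))
        have h11 := mul_le_mul h10 hc2 hc0.le (by positivity)
        have h12 : 1 / Z ^ 6 * (4 * (q * n)) = 4 * ((q * n) / Z ^ 6) := by ring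
        linarith
      have h10 : (q * n) / Z ^ 6 * 1000000000 ≤ 1 / Z ^ 5 * (q * n) := by
        have : 1 / Z ^ 5 * (q * n) = (q * n) / Z ^ 6 * Z := by
          rw [show Z ^ 6 = Z ^ 5 * Z by ring]; field_simp
        rw [this]
        exact mul_le_mul_of_nonneg_left hZ (by positivity)
      push_cast at h6 hBR ⊢
      rw [← hZdef]
      linarith)
  refine ⟨σ, hP.cyc, fun i hi => (hP.sub i hi).trans (sup_le_sup_right (hW i hi) _), hP.pw⟩

end Stage

section Final
variable {V : Type} [Fintype V]

lemma exists_matching_of_cycle {Δ : SimpleGraph V} {σ : Equiv.Perm V} (hσ : σ.IsCycleOn Set.univ)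
    {x0 : V} (h0 : Δ.Adj x0 (σ x0)) (h1 : ∀ v, v ≠ x0 → σ v ≠ x0 → Δ.Adj v (σ v)) :
    ∃ M ≤ Δ, (∀ v a b, M.Adj v a → M.Adj v b → a = b) ∧ M.edgeSet.ncard = Fintype.card V / 2 := by
  set n := Fintype.card V with hn
  have hσ' : σ.IsCycleOn (Finset.univ : Finset V) := by simpa using hσ
  obtain ⟨p, hp⟩ : ∃ p : ℕ → V, ∀ i, p i = (σ ^ i) x0 := ⟨_, fun _ => rfl⟩
  have hps : ∀ i, p (i + 1) = σ (p i) := fun i => by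
    rw [hp, hp, pow_succ', Equiv.Perm.mul_apply]
  have hinj : ∀ i < n, ∀ j < n, p i = p j → i = j := by
    intro i hi j hj h
    rw [hp, hp] at h
    have := (hσ'.pow_apply_eq_pow_apply (Finset.mem_univ x0)).1 h
    rw [Finset.card_univ] at this
    rwa [Nat.ModEq, Nat.mod_eq_of_lt hi, Nat.mod_eq_of_lt hj] at this
  set M : SimpleGraph V := SimpleGraph.fromRel fun a b => ∃ i < n / 2, a = p (2 * i) ∧ b = p (2 * i + 1)
    with hM
  have hMadj : ∀ a b, M.Adj a b ↔ a ≠ b ∧ ((∃ i < n / 2, a = p (2 * i) ∧ b = p (2 * i + 1)) ∨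
      ∃ i < n / 2, b = p (2 * i) ∧ a = p (2 * i + 1)) := fun a b => Iff.rfl
  have hp0 : p 0 = x0 := by simp [hp]
  have hadj : ∀ i < n / 2, Δ.Adj (p (2 * i)) (p (2 * i + 1)) := by
    intro i hi
    rw [hps]
    rcases Nat.eq_zero_or_pos i with rfl | h
    · simpa [hp0] using h0
    · refine h1 _ (fun h => ?_) (fun h => ?_)
      · rw [← hp0] at h
        have := hinj _ (by omega) _ (by omega) h
        omega
      · rw [← hp0, ← hps] at h
        have := hinj _ (by omega) _ (by omega) h
        omega
  refine ⟨M, ?_, ?_, ?_⟩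
  · intro a b hab
    rcases (hMadj a b).1 hab with ⟨_, ⟨i, hi, rfl, rfl⟩ | ⟨i, hi, rfl, rfl⟩⟩
    · exact hadj i hi
    · exact (hadj i hi).symm
  · intro v a b ha hb
    rcases (hMadj v a).1 ha with ⟨_, ⟨i, hi, h1, rfl⟩ | ⟨i, hi, rfl, h1⟩⟩ <;>
    rcases (hMadj v b).1 hb with ⟨_, ⟨j, hj, h2, rfl⟩ | ⟨j, hj, rfl, h2⟩⟩ <;>
    · have h3 := hinj _ (by omega) _ (by omega) (h1.symm.trans h2)
      first
        | omega
        | (congr 1; omega)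
  · have himg : M.edgeSet = (fun i => s(p (2 * i), p (2 * i + 1))) '' (Finset.range (n / 2) : Set ℕ) := by
      ext e
      induction e with | _ a b => ?_
      simp only [mem_edgeSet, Set.mem_image, Finset.coe_range, Set.mem_Iio, Sym2.eq_iff]
      constructor
      · intro hab
        rcases (hMadj a b).1 hab with ⟨_, ⟨i, hi, rfl, rfl⟩ | ⟨i, hi, rfl, rfl⟩⟩
        · exact ⟨i, hi, Or.inl ⟨rfl, rfl⟩⟩
        · exact ⟨i, hi, Or.inr ⟨rfl, rfl⟩⟩
      · rintro ⟨i, hi, ⟨rfl, rfl⟩ | ⟨rfl, rfl⟩⟩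
        · exact (hMadj _ _).2 ⟨(hadj i hi).ne, Or.inl ⟨i, hi, rfl, rfl⟩⟩
        · exact (hMadj _ _).2 ⟨(hadj i hi).ne', Or.inr ⟨i, hi, rfl, rfl⟩⟩
    rw [himg, Set.ncard_image_of_injOn, Set.ncard_coe_finset, Finset.card_range]
    intro i hi j hj h
    simp only [Finset.coe_range, Set.mem_Iio] at hi hj
    rcases Sym2.eq_iff.1 h with ⟨h, _⟩ | ⟨h, _⟩
    · have := hinj _ (by omega) _ (by omega) h
      omega
    · have := hinj _ (by omega) _ (by omega) h
      omega

/-- The edges from `x0` to `u` and `u'`. -/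
def atVertex (x0 u u' a b : V) : Prop := (a = x0 ∧ (b = u ∨ b = u')) ∨ (b = x0 ∧ (a = u ∨ a = u'))

lemma exists_link {Γ : SimpleGraph V} {x0 u u' : V} (hu : u ≠ x0) (hu' : u' ≠ x0) (huu : u ≠ u')
    {q A ε : ℝ} {w : ℕ} (hU : UpperReg Γ q A ε) (hq0 : 0 < q) (hq1 : q ≤ 1) (hA : 1 ≤ A)
    (hε0 : 0 ≤ ε) (hε1 : ε ≤ 1) (hε : ε * (24000 * (2 * w + 2)) ≤ 1)
    (hcard : Fintype.card V ≤ 4 ^ w)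
    (hN : 20000000 * (2 * w + 2) ^ 3 * A ≤ q * (Fintype.card V - 3))
    (hn : 2 ≤ ε * (Fintype.card V - 3))
    (hd : ∀ v ≠ x0, (1 - ε) * (q * Fintype.card V) + 3 ≤ dg Γ v Finset.univ) :
    ∃ σ : Equiv.Perm V, σ.IsCycleOn Set.univ ∧
      ∀ v, atVertex x0 u u' v (σ v) ∨ (v ≠ x0 ∧ σ v ≠ x0 ∧ Γ.Adj v (σ v)) := by
  set n : ℝ := (Fintype.card V : ℝ) with hnd
  have hn3 : 3 ≤ Fintype.card V := by
    have h1 : (3 : ℝ) < n := by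
      by_contra h
      have := mul_nonneg hε0 (show 0 ≤ 3 - n by linarith)
      linarith
    rw [hnd] at h1
    have : 3 < Fintype.card V := by exact_mod_cast h1
    omega
  set P : Finset V := {x0, u, u'} with hP
  have hPc : P.card = 3 := by
    rw [hP, Finset.card_eq_three]
    exact ⟨x0, u, u', hu.symm, hu'.symm, huu, rfl⟩
  set Q : Finset V := Finset.univ \ P with hQ
  set X : Finset V := Finset.univ \ {x0} with hX
  have hXm : ∀ v, v ∈ X ↔ v ≠ x0 := fun v => by simp [hX]
  have hQc : (Q.card : ℝ) = n - 3 := by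
    have h1 : Q.card + P.card = Fintype.card V :=
      Finset.card_sdiff_add_card_eq_card (Finset.subset_univ P)
    have : (Q.card : ℝ) + P.card = n := by rw [hnd]; exact_mod_cast h1
    rw [hPc] at this; push_cast at this; linarith
  have hXc : (X.card : ℝ) = n - 1 := by
    have h1 : X.card + ({x0} : Finset V).card = Fintype.card V :=
      Finset.card_sdiff_add_card_eq_card (Finset.subset_univ _)
    have : (X.card : ℝ) + 1 = n := by rw [hnd]; exact_mod_cast h1
    linarith
  have hQX : Q ⊆ X := by
    intro v hv
    simp only [hQ, hP, Finset.mem_sdiff, Finset.mem_univ, true_and, Finset.mem_insert, not_or] at hv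
    exact (hXm v).2 hv.1
  have hdQ : ∀ v ≠ x0, (1 - ε) * (q * Q.card) ≤ dg Γ v Q := by
    intro v hv
    have h1 : dg Γ v Finset.univ ≤ dg Γ v Q + dg Γ v P := by
      have := dg_union_le Γ v Q P
      rwa [hQ, Finset.sdiff_union_of_subset (Finset.subset_univ _)] at this
    have h2 : dg Γ v P ≤ 3 := hPc ▸ dg_le_card Γ v P
    have h3 : (dg Γ v Finset.univ : ℝ) ≤ dg Γ v Q + 3 := by exact_mod_cast (by omega)
    have h4 := hd v hv
    have h5 : (1 - ε) * (q * Q.card) ≤ (1 - ε) * (q * n) :=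
      mul_le_mul_of_nonneg_left (mul_le_mul_of_nonneg_left (by linarith) hq0.le) (by linarith)
    linarith
  obtain ⟨K, κ, m, b, b', H⟩ := closable_of_upperReg (X := X) (Z := X) (Q := Q) (fun _ => X)
    hU hq0 hq1 hA hε0 hε hcard (by rw [hQc]; exact hN) hQX
    (fun v hv => hdQ v ((hXm v).1 hv)) (by simp) (fun v hv => ⟨0, hv⟩)
    (fun _ => by rw [hXc, hQc]; linarith)
    (fun _ v hv => (hdQ v ((hXm v).1 hv)).trans (by exact_mod_cast dg_mono Γ v hQX))
  have hQl : ∀ v, v ∈ Q.toList ↔ v ≠ x0 ∧ v ≠ u ∧ v ≠ u' := fun v => by simp [hQ, hP]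
  obtain ⟨t, ht⟩ : ∃ t, (u' :: x0 :: u :: Q.toList).getLast? = some t :=
    ⟨_, List.getLast?_eq_some_getLast (by simp)⟩
  have htm : t ≠ x0 := by
    rintro rfl
    rw [show (u' :: t :: u :: Q.toList) = [u', t] ++ (u :: Q.toList) by rfl,
      List.getLast?_append_of_ne_nil _ (by simp)] at ht
    have := List.mem_of_getLast? ht
    rw [List.mem_cons, hQl] at this
    rcases this with h | h
    · exact hu h.symm
    · exact h.1 rfl
  obtain ⟨σ₀, hσ₀, hσ₀'⟩ := exists_isCycleOn_of_list
    (R := fun a b => atVertex x0 u u' a b ∨ (a ∈ X ∧ b ∈ X))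
    (l := u' :: x0 :: u :: Q.toList) (by
      simp only [List.nodup_cons, List.mem_cons, hQl, Finset.nodup_toList]
      tauto) (by
      intro v
      simp only [List.mem_cons, hQl]
      tauto) (by
      refine List.IsChain.cons_cons (Or.inl (Or.inr ⟨rfl, Or.inr rfl⟩)) (List.IsChain.cons_cons
        (Or.inl (Or.inl ⟨rfl, Or.inl rfl⟩)) ?_)
      have hall : ∀ v ∈ u :: Q.toList, v ∈ X := by
        intro v hv
        rw [List.mem_cons, hQl] at hv
        rw [hXm]
        rcases hv with rfl | hv
        · exact hu
        · exact hv.1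
      refine List.isChain_iff_getElem.2 fun i hi => Or.inr ⟨hall _ (List.getElem_mem _),
        hall _ (List.getElem_mem _)⟩) (s := u') rfl ht (Or.inr ⟨(hXm _).2 htm, (hXm _).2 hu'⟩)
  obtain ⟨σ, hσ, hσ'⟩ := exists_conversion H hn3 (Rel := atVertex x0 u u') (by
      rintro a b (h | h)
      · exact Or.inr h
      · exact Or.inl h) (by
      intro y hy z hz
      simp only [hQ, hP, Finset.mem_sdiff, Finset.mem_univ, true_and, Finset.mem_insert,
        Finset.mem_singleton, not_or] at hy
      rcases hz with h | h
      · exact absurd h.1 hy.1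
      · rcases h.2 with h | h
        · exact absurd h hy.2.1
        · exact absurd h hy.2.2) σ₀ hσ₀ hσ₀'
  refine ⟨σ, hσ, fun v => (hσ' v).imp id fun h => ⟨(hXm _).1 h.1, (hXm _).1 h.2.1, h.2.2⟩⟩

/-- The edges at a vertex `x0` can be completed to Hamilton cycles, using a random-like graph `R`. -/
theorem exists_final {G R : SimpleGraph V} (hRG : R ≤ G) {x0 : V} {r : ℕ} {f : ℕ → V}
    (hf : ∀ i < r, G.Adj x0 (f i)) (hfi : ∀ i < r, ∀ j < r, f i = f j → i = j)
    {q A ε : ℝ} {w : ℕ} (hU : UpperReg R q A ε) (hq0 : 0 < q) (hq1 : q ≤ 1) (hA : 1 ≤ A)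
    (hε0 : 0 ≤ ε) (hε1 : ε ≤ 1) (hε : ε * (24000 * (2 * w + 2)) ≤ 1)
    (hcard : Fintype.card V ≤ 4 ^ w)
    (hN : 20000000 * (2 * w + 2) ^ 3 * A ≤ q * (Fintype.card V - 3))
    (hn : 2 ≤ ε * (Fintype.card V - 3))
    (hd : ∀ v ≠ x0, (1 - ε) * (q * Fintype.card V) + 3 + r ≤ dg R v Finset.univ) :
    ∃ σ : ℕ → Equiv.Perm V, (∀ i < r / 2, (σ i).IsCycleOn Set.univ) ∧
      (∀ i < r / 2, permGraph (σ i) ≤ G) ∧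
      (∀ i < r / 2, ∀ j < i, Disjoint (permGraph (σ j)) (permGraph (σ i))) ∧
      (Odd r → ∃ M ≤ G, (∀ v a b, M.Adj v a → M.Adj v b → a = b) ∧
        M.edgeSet.ncard = Fintype.card V / 2 ∧ ∀ i < r / 2, Disjoint (permGraph (σ i)) M) := by
  have hn3 : 3 < Fintype.card V := by
    have h1 : (3 : ℝ) < Fintype.card V := by
      by_contra h
      have := mul_nonneg hε0 (show (0 : ℝ) ≤ 3 - Fintype.card V by linarith)
      linarith
    exact_mod_cast h1
  have hlink : ∀ (Δ : SimpleGraph V) (m : ℕ) (u u' : V), 2 * m ≤ r →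
      (∀ v, dg R v Finset.univ ≤ dg (Δ ⊓ R) v Finset.univ + 2 * m) → u ≠ x0 → u' ≠ x0 → u ≠ u' →
      ∃ σ : Equiv.Perm V, σ.IsCycleOn Set.univ ∧
      ∀ v, atVertex x0 u u' v (σ v) ∨ (v ≠ x0 ∧ σ v ≠ x0 ∧ (Δ ⊓ R).Adj v (σ v)) := by
    intro Δ m u u' hm hdeg hu hu' huu
    refine exists_link hu hu' huu (hU.mono inf_le_right) hq0 hq1 hA hε0 hε1 hε hcard hN hn ?_
    intro v hv
    have h1 := hd v hv
    have h2 : (dg R v Finset.univ : ℝ) ≤ dg (Δ ⊓ R) v Finset.univ + 2 * m := by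
      exact_mod_cast hdeg v
    have h3 : (2 * m : ℝ) ≤ r := by exact_mod_cast hm
    linarith
  have hfx : ∀ i < r, f i ≠ x0 := fun i hi => (hf i hi).ne'
  have main : ∀ m, 2 * m ≤ r → ∃ (Δ : SimpleGraph V) (σ : ℕ → Equiv.Perm V), Δ ≤ G ∧
      (∀ i < m, (σ i).IsCycleOn Set.univ) ∧ (∀ i < m, permGraph (σ i) ≤ G) ∧
      (∀ i < m, ∀ j < i, Disjoint (permGraph (σ j)) (permGraph (σ i))) ∧
      (∀ i < m, Disjoint (permGraph (σ i)) Δ) ∧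
      (∀ v, dg R v Finset.univ ≤ dg (Δ ⊓ R) v Finset.univ + 2 * m) ∧
      ∀ i < r, 2 * m ≤ i → Δ.Adj x0 (f i) := by
    intro m
    induction m with
    | zero =>
      intro _
      refine ⟨G, fun _ => 1, le_rfl, by simp, by simp, by simp, by simp, fun v => ?_,
        fun i hi _ => hf i hi⟩
      rw [inf_eq_right.2 hRG]; omega
    | succ m ih =>
      intro hm
      obtain ⟨Δ, σ, hΔ, hcyc, hsub, hpw, hdis, hdeg, hrem⟩ := ih (by omega)
      obtain ⟨τ, hτ, hτ'⟩ := hlink Δ m (f (2 * m)) (f (2 * m + 1)) (by omega) hdeg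
        (hfx _ (by omega)) (hfx _ (by omega)) (fun h => by
          have := hfi _ (by omega) _ (by omega) h; omega)
      have hτΔ : permGraph τ ≤ Δ := by
        intro a b hab
        have key : ∀ a, Δ.Adj a (τ a) := by
          intro a
          rcases hτ' a with (⟨rfl, h | h⟩ | ⟨h0, h | h⟩) | h
          · rw [h]; exact hrem _ (by omega) (by omega)
          · rw [h]; exact hrem _ (by omega) (by omega)
          · rw [h0, h]; exact (hrem _ (by omega) (by omega)).symm
          · rw [h0, h]; exact (hrem _ (by omega) (by omega)).symm
          · exact h.2.2.1
        rcases ((permGraph_adj _ _ _).1 hab).2 with h | h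
        · rw [← h]; exact key a
        · rw [← h]; exact (key b).symm
      have hlt : ∀ i < m, Function.update σ m τ i = σ i := fun i hi =>
        Function.update_of_ne hi.ne _ _
      refine ⟨Δ \ permGraph τ, Function.update σ m τ, sdiff_le.trans hΔ, ?_, ?_, ?_, ?_, ?_, ?_⟩
      · intro i hi
        rcases Nat.lt_succ_iff_lt_or_eq.1 hi with hi | rfl
        · rw [hlt i hi]; exact hcyc i hi
        · rw [Function.update_self]; exact hτ
      · intro i hi
        rcases Nat.lt_succ_iff_lt_or_eq.1 hi with hi | rfl
        · rw [hlt i hi]; exact hsub i hi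
        · rw [Function.update_self]; exact hτΔ.trans hΔ
      · intro i hi j hj
        rcases Nat.lt_succ_iff_lt_or_eq.1 hi with hi | rfl
        · rw [hlt i hi, hlt j (hj.trans hi)]; exact hpw i hi j hj
        · rw [Function.update_self, hlt j hj]; exact (hdis j hj).mono_right hτΔ
      · intro i hi
        rcases Nat.lt_succ_iff_lt_or_eq.1 hi with hi | rfl
        · rw [hlt i hi]; exact (hdis i hi).mono_right sdiff_le
        · rw [Function.update_self]; exact disjoint_sdiff_self_right
      · intro v
        have h1 := hdeg v
        have h2 := dg_sdiff_permGraph (Γ := Δ ⊓ R) τ v Finset.univ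
        have h3 : (Δ ⊓ R) \ permGraph τ = (Δ \ permGraph τ) ⊓ R := by
          rw [inf_comm, inf_sdiff_assoc, inf_comm]
        rw [h3] at h2
        omega
      · intro i hi hmi
        refine (sdiff_adj _ _ _ _).2 ⟨hrem i hi (by omega), fun h => ?_⟩
        rcases ((permGraph_adj _ _ _).1 h).2 with h | h
        · rcases hτ' x0 with (⟨_, h' | h'⟩ | ⟨h0, h' | h'⟩) | h'
          · have := hfi _ hi _ (by omega) (h.symm.trans h'); omega
          · have := hfi _ hi _ (by omega) (h.symm.trans h'); omega
          · exact hfx _ (by omega) h'.symm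
          · exact hfx _ (by omega) h'.symm
          · exact h'.1 rfl
        · rcases hτ' (f i) with (⟨h0, _⟩ | ⟨h0, h' | h'⟩) | h'
          · exact hfx _ hi h0
          · have := hfi _ hi _ (by omega) h'; omega
          · have := hfi _ hi _ (by omega) h'; omega
          · exact h'.2.1 h
  obtain ⟨Δ, σ, hΔ, hcyc, hsub, hpw, hdis, hdeg, hrem⟩ := main (r / 2) (by omega)
  refine ⟨σ, hcyc, hsub, hpw, fun hodd => ?_⟩
  have hr : r = 2 * (r / 2) + 1 := by have := Nat.odd_iff.1 hodd; omega
  obtain ⟨u, hu⟩ : ∃ u, u = f (2 * (r / 2)) := ⟨_, rfl⟩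
  have hux : u ≠ x0 := hu ▸ hfx _ (by omega)
  have hΔu : Δ.Adj x0 u := hu ▸ hrem _ (by omega) le_rfl
  obtain ⟨u', hu'⟩ : ∃ u', u' ∉ ({x0, u} : Finset V) := by
    by_contra h
    push Not at h
    have h1 := Finset.card_le_card (show (Finset.univ : Finset V) ⊆ {x0, u} from fun v _ => h v)
    have h2 := Finset.card_le_two (a := x0) (b := u)
    rw [Finset.card_univ] at h1
    omega
  simp only [Finset.mem_insert, Finset.mem_singleton, not_or] at hu'
  obtain ⟨τ, hτ, hτ'⟩ := hlink Δ (r / 2) u u' (by omega) hdeg hux hu'.1 (Ne.symm hu'.2)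
  have hτadj : ∀ v, v ≠ x0 → τ v ≠ x0 → Δ.Adj v (τ v) := by
    intro v h1 h2
    rcases hτ' v with (h | h) | h
    · exact absurd h.1 h1
    · exact absurd h.1 h2
    · exact h.2.2.1
  have hfinal : ∃ ρ : Equiv.Perm V, ρ.IsCycleOn Set.univ ∧ ρ x0 = u ∧
      ∀ v, v ≠ x0 → ρ v ≠ x0 → Δ.Adj v (ρ v) := by
    by_cases h : τ x0 = u
    · exact ⟨τ, hτ, h, hτadj⟩
    · refine ⟨τ⁻¹, hτ.inv, ?_, ?_⟩
      · have hx' : τ x0 = u' := by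
          rcases hτ' x0 with (⟨_, h' | h'⟩ | ⟨h0, h' | h'⟩) | h'
          · exact absurd h' h
          · exact h'
          · exact absurd h' hux.symm
          · exact absurd h'.symm hu'.1
          · exact absurd rfl h'.1
        by_contra hne
        set v := τ⁻¹ x0 with hv
        have hτv : τ v = x0 := by simp [hv]
        have hvx : v ≠ x0 := by
          intro h; rw [h, hx'] at hτv; exact hu'.1 hτv
        have hvu' : v = u' := by
          rcases hτ' v with (⟨h0, _⟩ | ⟨_, h' | h'⟩) | h'
          · exact absurd h0 hvx
          · exact absurd h' hne
          · exact h'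
          · exact absurd hτv h'.2.1
        have hτ2 : (τ ^ 2) x0 = x0 := by
          rw [pow_two, Equiv.Perm.mul_apply, hx', ← hvu', hτv]
        have hσ' : τ.IsCycleOn (Finset.univ : Finset V) := by simpa using hτ
        have := (hσ'.pow_apply_eq (Finset.mem_univ x0)).1 hτ2
        rw [Finset.card_univ] at this
        have := Nat.le_of_dvd (by norm_num) this
        omega
      · intro v h1 h2
        have := hτadj (τ⁻¹ v) h2 (by simpa using h1)
        simpa using this.symm
  obtain ⟨ρ, hρ, hρu, hρ'⟩ := hfinal
  obtain ⟨M, hM, hM1, hM2⟩ := exists_matching_of_cycle hρ (hρu ▸ hΔu) hρ'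
  exact ⟨M, hM.trans hΔ, hM1, hM2, fun i hi => (hdis i hi).mono_right hM⟩

end Final

lemma isHamCycle_permGraph {n : ℕ} (hn : 3 ≤ n) {σ : Equiv.Perm (Fin n)}
    (hσ : σ.IsCycleOn Set.univ) : IsHamCycle (permGraph σ) := by
  have hσ' : σ.IsCycleOn (Finset.univ : Finset (Fin n)) := by simpa using hσ
  have hcard : (Finset.univ : Finset (Fin n)).card = n := by simp
  obtain ⟨v⟩ : Nonempty (Fin n) := ⟨⟨0, by omega⟩⟩
  obtain ⟨p, hp⟩ : ∃ p : ℕ → Fin n, ∀ i, p i = (σ ^ i) v := ⟨_, fun _ => rfl⟩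
  have hps : ∀ i, p (i + 1) = σ (p i) := fun i => by
    rw [hp, hp, pow_succ', Equiv.Perm.mul_apply]
  have hinj : ∀ i < n, ∀ j < n, p i = p j → i = j := by
    intro i hi j hj h
    rw [hp, hp] at h
    have := (hσ'.pow_apply_eq_pow_apply (Finset.mem_univ v)).1 h
    rw [hcard] at this
    rwa [Nat.ModEq, Nat.mod_eq_of_lt hi, Nat.mod_eq_of_lt hj] at this
  have hpn : p n = v := by
    rw [hp]
    exact (hσ'.pow_apply_eq (Finset.mem_univ v)).2 (by rw [hcard])
  have hsurj : ∀ a, ∃ i < n, p i = a := by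
    intro a
    obtain ⟨i, hi, h⟩ := hσ'.exists_pow_eq (Finset.mem_univ v) (Finset.mem_univ a)
    exact ⟨i, by rwa [hcard] at hi, by rw [hp, h]⟩
  have hne : ∀ a, σ a ≠ a := by
    intro a h
    have := (hσ'.pow_apply_eq (Finset.mem_univ a) (n := 1)).1 (by simpa using h)
    rw [hcard] at this
    have := Nat.le_of_dvd one_pos this
    omega
  have hadj : ∀ a, (permGraph σ).Adj a (σ a) := fun a =>
    (permGraph_adj _ _ _).2 ⟨(hne a).symm, Or.inl rfl⟩
  have hwalk : ∀ k, ∃ w : (permGraph σ).Walk (p 0) (p k), w.support = (List.range (k + 1)).map p ∧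
      w.edges = (List.range k).map fun i => s(p i, p (i + 1)) := by
    intro k
    induction k with
    | zero => exact ⟨Walk.nil, by simp, by simp⟩
    | succ k ih =>
      obtain ⟨w, hw1, hw2⟩ := ih
      have h : (permGraph σ).Adj (p k) (p (k + 1)) := by rw [hps]; exact hadj _
      refine ⟨w.concat h, ?_, ?_⟩
      · rw [Walk.support_concat, hw1, List.range_succ (n := k + 1), List.map_append]; simp
      · rw [Walk.edges_concat, hw2, List.range_succ (n := k), List.map_append]; simp
  obtain ⟨m, rfl⟩ : ∃ m, n = m + 1 := ⟨n - 1, by omega⟩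
  obtain ⟨w, hw1, hw2⟩ := hwalk m
  have hp0 : p 0 = p (m + 1) := by rw [hpn, hp]; simp
  have hlast : (permGraph σ).Adj (p m) (p 0) := by
    rw [hp0, hps]; exact hadj _
  have hpath : w.IsPath := by
    rw [Walk.isPath_def, hw1]
    refine (List.nodup_map_iff_inj_on List.nodup_range).2 fun i hi j hj h => ?_
    exact hinj i (List.mem_range.1 hi) j (List.mem_range.1 hj) h
  refine ⟨_, Walk.cons hlast w, ?_, ?_⟩
  · rw [Walk.isHamiltonianCycle_iff_isCycle_and_length_eq, Walk.cons_isCycle_iff]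
    refine ⟨⟨hpath, fun h => ?_⟩, ?_⟩
    · rw [hw2, List.mem_map] at h
      obtain ⟨i, hi, h⟩ := h
      rw [List.mem_range] at hi
      rcases Sym2.eq_iff.1 h with ⟨h1, h2⟩ | ⟨h1, h2⟩
      · have := hinj _ (by omega) _ (by omega) h1; omega
      · have := hinj _ (by omega) _ (by omega) h1
        have := hinj _ (by omega) _ (by omega) h2
        omega
    · have := congrArg List.length hw1
      rw [Walk.length_support] at this
      simp only [List.length_map, List.length_range] at this
      rw [Walk.length_cons, Fintype.card_fin, this]
  · ext e
    constructor
    · have key : ∀ a, s(a, σ a) ∈ (Walk.cons hlast w).edges := by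
        intro a
        obtain ⟨i, hi, rfl⟩ := hsurj a
        rw [Walk.edges_cons, hw2, ← hps, List.mem_cons, List.mem_map]
        rcases Nat.lt_succ_iff_lt_or_eq.1 hi with h | rfl
        · exact Or.inr ⟨i, List.mem_range.2 h, rfl⟩
        · left; rw [hp0]
      induction e with | _ a b => ?_
      intro h
      rcases ((permGraph_adj _ a b).1 h).2 with h | h
      · rw [← h]; exact key a
      · rw [Sym2.eq_swap, ← h]; exact key b
    · exact fun h => Walk.edges_subset_edgeSet _ h

lemma deg_eq_dg {V : Type} [Fintype V] (G : SimpleGraph V) (v : V) :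
    deg G v = dg G v Finset.univ := by
  rw [deg, dg, ← Set.ncard_coe_finset]
  congr 1
  ext u; simp

lemma exists_dg_eq_minDeg {V : Type} [Fintype V] [Nonempty V] (G : SimpleGraph V) :
    ∃ x0, dg G x0 Finset.univ = minDeg G ∧ ∀ v, minDeg G ≤ dg G v Finset.univ := by
  obtain ⟨x0, hx0⟩ := Nat.sInf_mem (Set.range_nonempty (deg G))
  refine ⟨x0, ?_, fun v => ?_⟩
  · rw [← deg_eq_dg]; exact hx0
  · rw [← deg_eq_dg]; exact Nat.sInf_le ⟨v, rfl⟩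

/-- Property `H` in terms of cyclic permutations. -/
lemma hasPropertyH_of_perms {n : ℕ} (hn : 3 ≤ n) {G : SimpleGraph (Fin n)}
    (h : ∃ σ : ℕ → Equiv.Perm (Fin n), (∀ i < minDeg G / 2, (σ i).IsCycleOn Set.univ) ∧
      (∀ i < minDeg G / 2, permGraph (σ i) ≤ G) ∧
      (∀ i < minDeg G / 2, ∀ j < i, Disjoint (permGraph (σ j)) (permGraph (σ i))) ∧
      (Odd (minDeg G) → ∃ M ≤ G, (∀ v a b, M.Adj v a → M.Adj v b → a = b) ∧
        M.edgeSet.ncard = n / 2 ∧ ∀ i < minDeg G / 2, Disjoint (permGraph (σ i)) M)) :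
    HasPropertyH n G := by
  obtain ⟨σ, h1, h2, h3, h4⟩ := h
  refine ⟨fun i => permGraph (σ i), fun i => ⟨h2 i i.2, isHamCycle_permGraph hn (h1 i i.2)⟩, ?_, ?_⟩
  · intro i j hij
    rw [disjoint_edgeSet]
    rcases lt_or_gt_of_ne hij with h | h
    · exact h3 j j.2 i h
    · exact (h3 i i.2 j h).symm
  · intro hodd
    obtain ⟨M, hM, hM1, hM2, hM3⟩ := h4 hodd
    refine ⟨M, hM, fun v => ?_, hM2, fun i => ?_⟩
    · rw [deg, Set.ncard_le_one (Set.toFinite _)]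
      intro a ha b hb
      exact hM1 v a b ha hb
    · rw [disjoint_edgeSet]; exact (hM3 i i.2).symm

section Assembly
variable {V : Type} [Fintype V]

lemma dg_sup_of_disjoint {G H : SimpleGraph V} (h : Disjoint G H) (v : V) (S : Finset V) :
    dg (G ⊔ H) v S = dg G v S + dg H v S := by
  unfold dg
  rw [← Finset.card_union_of_disjoint]
  · congr 1
    ext u
    simp only [Finset.mem_filter, Finset.mem_union, sup_adj]
    tauto
  · rw [Finset.disjoint_filter]
    exact fun u _ h1 h2 => disjoint_adj h h1 h2

lemma dg_permGraph (hn : 3 ≤ Fintype.card V) {σ : Equiv.Perm V} (hσ : σ.IsCycleOn Set.univ) (v : V) :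
    dg (permGraph σ) v Finset.univ = 2 := by
  have hσ' : σ.IsCycleOn (Finset.univ : Finset V) := by simpa using hσ
  have h1 : σ v ≠ v := fun h => by
    have := (hσ'.pow_apply_eq (Finset.mem_univ v) (n := 1)).1 (by simpa using h)
    rw [Finset.card_univ] at this
    have := Nat.le_of_dvd one_pos this
    omega
  have h2 : σ v ≠ σ⁻¹ v := fun h => by
    have := (hσ'.pow_apply_eq (Finset.mem_univ v) (n := 2)).1 (by
      rw [pow_two, Equiv.Perm.mul_apply, h]; simp)
    rw [Finset.card_univ] at this
    have := Nat.le_of_dvd two_pos this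
    omega
  rw [dg, Finset.card_eq_two]
  refine ⟨σ v, σ⁻¹ v, h2, ?_⟩
  ext u
  simp only [Finset.mem_filter, Finset.mem_univ, true_and, permGraph_adj, Finset.mem_insert,
    Finset.mem_singleton]
  rw [Equiv.Perm.eq_inv_iff_eq, eq_comm (a := u)]
  constructor
  · rintro ⟨_, h | h⟩
    · exact Or.inl h
    · exact Or.inr h
  · rintro (h | h)
    · exact ⟨fun e => h1 (h.trans e.symm), Or.inl h⟩
    · exact ⟨fun e => h1 (by rw [← e] at h; exact h), Or.inr h⟩

lemma exists_remove (hn : 3 ≤ Fintype.card V) (H : SimpleGraph V) {σ : ℕ → Equiv.Perm V} {k : ℕ}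
    (hc : ∀ i < k, (σ i).IsCycleOn Set.univ) (hle : ∀ i < k, permGraph (σ i) ≤ H)
    (hpw : ∀ i < k, ∀ j < i, Disjoint (permGraph (σ j)) (permGraph (σ i))) :
    ∃ W ≤ H, (∀ i < k, Disjoint (permGraph (σ i)) W) ∧
      (∀ τ : Equiv.Perm V, permGraph τ ≤ H → (∀ i < k, Disjoint (permGraph (σ i)) (permGraph τ)) →
        permGraph τ ≤ W) ∧
      ∀ v, dg W v Finset.univ + 2 * k = dg H v Finset.univ := by
  induction k with
  | zero => exact ⟨H, le_rfl, by simp, by simp, by simp⟩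
  | succ k ih =>
    obtain ⟨W, hW, h1, h2, h3⟩ := ih (fun i hi => hc i (by omega)) (fun i hi => hle i (by omega))
      (fun i hi => hpw i (by omega))
    have hk : permGraph (σ k) ≤ W := h2 _ (hle k (by omega)) fun i hi => hpw k (by omega) i hi
    refine ⟨W \ permGraph (σ k), sdiff_le.trans hW, ?_, ?_, ?_⟩
    · intro i hi
      rcases Nat.lt_succ_iff_lt_or_eq.1 hi with hi | rfl
      · exact (h1 i hi).mono_right sdiff_le
      · exact disjoint_sdiff_self_right
    · intro τ hτ hd
      exact le_sdiff.2 ⟨h2 τ hτ fun i hi => hd i (by omega), (hd k (by omega)).symm⟩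
    · intro v
      have h4 := dg_sup_of_disjoint (disjoint_sdiff_self_left (x := permGraph (σ k)) (y := W)) v
        Finset.univ
      rw [sdiff_sup_cancel hk, dg_permGraph hn (hc k (by omega))] at h4
      have := h3 v
      omega

/-- A splitting of the edges of `G` into nested nearly regular graphs and a random-like graph. -/
structure Split (G : SimpleGraph V) (z T δ : ℕ) (p qR : ℝ) (q : ℕ → ℝ) (x0 : V)
    (P : ℕ → SimpleGraph V) (R : SimpleGraph V) : Prop where
  z_ge : 10 ^ 9 ≤ z
  n_le : Fintype.card V ≤ 2 ^ z ^ 4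
  mono : ∀ i < T, P i ≤ P (i + 1)
  P_le : P T ≤ G
  R_le : R ≤ G
  disj : Disjoint (P T) R
  p1 : p ≤ 1
  δ_ge : 99 / 100 * (p * Fintype.card V) ≤ δ
  δ_le : δ ≤ 101 / 100 * (p * Fintype.card V)
  q_ge : ∀ i < T, p / 2 ^ (i + 2) ≤ q i
  q_le : ∀ i < T, q i ≤ p / 2 ^ (i + 1)
  q_big : ∀ i < T, (z : ℝ) ^ 52 ≤ q i * Fintype.card V
  upJ : ∀ i < T, UpperReg (P (i + 1) \ P i) (q i) ((z : ℝ) ^ 10) (1 / (z : ℝ) ^ 5)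
  degJ : ∀ i < T, ∀ v, (1 - 1 / (z : ℝ) ^ 5 / 8) * (q i * Fintype.card V) ≤
    dg (P (i + 1) \ P i) v Finset.univ
  degP : ∀ i < T, ∀ v, |(dg (P i) v Finset.univ : ℝ) - δ * (1 - 1 / 2 ^ (i + 1))| ≤
    1 / (z : ℝ) ^ 16 * (δ * (1 / 2 ^ (i + 1)))
  degx : dg (P T) x0 Finset.univ = δ
  R1 : qR ≤ 1
  R_big : (z : ℝ) ^ 52 ≤ qR * Fintype.card V
  upR : UpperReg R qR ((z : ℝ) ^ 10) (1 / (z : ℝ) ^ 5)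
  degR : ∀ v ≠ x0, (1 - 1 / (z : ℝ) ^ 5 / 2) * (qR * Fintype.card V) ≤ dg R v Finset.univ
  T_ge : δ * (1 / 2 ^ T) ≤ 1 / (z : ℝ) ^ 5 / 10 * (qR * Fintype.card V)

/-- The number of Hamilton cycles found in the first `i` stages. -/
noncomputable def cycleNum (δ i : ℕ) : ℕ := ⌊(δ : ℝ) / 2 * (1 - 5 / 4 * (1 / 2 ^ i))⌋₊

lemma cycleNum_zero (δ : ℕ) : cycleNum δ 0 = 0 := by
  rw [cycleNum]
  apply Nat.floor_of_nonpos
  have : (0 : ℝ) ≤ δ := Nat.cast_nonneg _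
  norm_num
  linarith

lemma cycleNum_gt (δ i : ℕ) : (δ : ℝ) / 2 * (1 - 5 / 4 * (1 / 2 ^ i)) - 1 < cycleNum δ i := by
  have := Nat.lt_floor_add_one ((δ : ℝ) / 2 * (1 - 5 / 4 * (1 / 2 ^ i)))
  rw [cycleNum]
  linarith

lemma cycleNum_succ_le (δ i : ℕ) :
    (cycleNum δ (i + 1) : ℝ) ≤ (δ : ℝ) / 2 * (1 - 5 / 4 * (1 / 2 ^ (i + 1))) := by
  apply Nat.floor_le
  have : (1 : ℝ) / 2 ^ (i + 1) ≤ 1 / 2 := by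
    apply one_div_le_one_div_of_le (by norm_num)
    exact le_self_pow₀ (by norm_num) (by omega)
  exact mul_nonneg (by positivity) (by linarith)

lemma cycleNum_le (δ i : ℕ) : cycleNum δ i ≤ cycleNum δ (i + 1) := by
  apply Nat.floor_le_floor
  have : (1 : ℝ) / 2 ^ (i + 1) ≤ 1 / 2 ^ i :=
    one_div_le_one_div_of_le (by positivity) (pow_le_pow_right₀ (by norm_num) (by omega))
  exact mul_le_mul_of_nonneg_left (by linarith) (by positivity)

lemma Split.exists_cycles {G : SimpleGraph V} {z T δ : ℕ} {p qR : ℝ} {q : ℕ → ℝ} {x0 : V}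
    {P : ℕ → SimpleGraph V} {R : SimpleGraph V} (h : Split G z T δ p qR q x0 P R)
    (hn : 3 ≤ Fintype.card V) : ∀ i ≤ T, ∃ (σ : ℕ → Equiv.Perm V) (W : SimpleGraph V), W ≤ P i ∧
      (∀ j < cycleNum δ i, (σ j).IsCycleOn Set.univ) ∧ (∀ j < cycleNum δ i, permGraph (σ j) ≤ P i) ∧
      (∀ j < cycleNum δ i, ∀ l < j, Disjoint (permGraph (σ l)) (permGraph (σ j))) ∧
      (∀ j < cycleNum δ i, Disjoint (permGraph (σ j)) W) ∧
      ∀ v, dg W v Finset.univ + 2 * cycleNum δ i = dg (P i) v Finset.univ := by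
  intro i
  induction i with
  | zero =>
    intro _
    refine ⟨fun _ => 1, P 0, le_rfl, ?_⟩
    rw [cycleNum_zero]; simp
  | succ i ih =>
    intro hi
    obtain ⟨σ, W, hW, hc, hle, hpw, hd, hdeg⟩ := ih (by omega)
    set K := cycleNum δ i with hK
    set K' := cycleNum δ (i + 1) with hK'
    have hKK : K ≤ K' := cycleNum_le δ i
    set J := P (i + 1) \ P i with hJ
    have hWJ : Disjoint W J := disjoint_sdiff_self_right.mono_left hW
    have hZ : (1000000000 : ℝ) ≤ z := by exact_mod_cast h.z_ge
    have h52 : 0 < (z : ℝ) ^ 52 := pow_pos (by linarith) _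
    have hbig : (1000000 : ℝ) ≤ (z : ℝ) ^ 52 := by
      have := le_self_pow₀ (show (1 : ℝ) ≤ z by linarith) (show 52 ≠ 0 by norm_num)
      linarith
    have hqb := h.q_big i (by omega)
    set n : ℝ := (Fintype.card V : ℝ) with hndef
    have hn0 : 0 < n := by rw [hndef]; exact_mod_cast (by omega : 0 < Fintype.card V)
    set a : ℝ := 1 / 2 ^ (i + 1) with ha
    have ha0 : 0 < a := by positivity
    have ha2 : (1 : ℝ) / 2 ^ i = 2 * a := by rw [ha, pow_succ]; field_simp
    have hq1 : q i * n ≤ p * n * a := by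
      have := mul_le_mul_of_nonneg_right (h.q_le i (by omega)) hn0.le
      calc _ ≤ _ := this
        _ = _ := by rw [ha]; ring
    have hq2 : p * n * a / 2 ≤ q i * n := by
      have := mul_le_mul_of_nonneg_right (h.q_ge i (by omega)) hn0.le
      calc _ = _ := by rw [ha, pow_succ 2 (i + 1)]; field_simp
        _ ≤ _ := this
    have hδ1 : 99 / 100 * (p * n * a) ≤ δ * a := by
      have := mul_le_mul_of_nonneg_right h.δ_ge ha0.le
      linarith
    have hδ2 : δ * a ≤ 101 / 100 * (p * n * a) := by
      have := mul_le_mul_of_nonneg_right h.δ_le ha0.le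
      linarith
    obtain ⟨c, hcdef⟩ : ∃ c : ℝ, c = δ * (1 - a) - 2 * K := ⟨_, rfl⟩
    have hc1 : δ * a ≤ c := by
      rcases Nat.eq_zero_or_pos i with h0 | h0
      · have hK0 : K = 0 := by rw [hK, h0, cycleNum_zero]
        have : a = 1 / 2 := by rw [ha, h0]; norm_num
        rw [hcdef, hK0, this]; push_cast; linarith
      · obtain ⟨l, rfl⟩ : ∃ l, i = l + 1 := ⟨i - 1, by omega⟩
        have := cycleNum_succ_le δ l
        rw [← hK, ha2] at this
        have hδa : 0 ≤ (δ : ℝ) * a := by positivity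
        rw [hcdef]; linarith
    have hc2 : c ≤ 3 / 2 * (δ * a) + 2 := by
      have := cycleNum_gt δ i
      rw [← hK, ha2] at this
      rw [hcdef]; linarith
    have hkc : ((K' - K : ℕ) : ℝ) ≤ c * (15 / 32) := by
      rw [Nat.cast_sub hKK]
      have := cycleNum_succ_le δ i
      rw [← hK', ← ha] at this
      rw [hcdef] at hc2 ⊢
      linarith
    have hx : (0 : ℝ) ≤ 1 / (z : ℝ) ^ 16 := by positivity
    have hxc := mul_le_mul_of_nonneg_left hc1 hx
    have hdegW : ∀ v, |(dg W v Finset.univ : ℝ) - c| ≤ 1 / (z : ℝ) ^ 16 * c := by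
      intro v
      have h1 := h.degP i (by omega) v
      have h2 : (dg W v Finset.univ : ℝ) + 2 * K = dg (P i) v Finset.univ := by exact_mod_cast hdeg v
      rw [← ha, ← h2] at h1
      have h3 : (dg W v Finset.univ : ℝ) - c = dg W v Finset.univ + 2 * K - δ * (1 - a) := by
        rw [hcdef]; ring
      rw [h3]
      exact h1.trans hxc
    obtain ⟨τ, hτc, hτle, hτpw⟩ := exists_stage (W := W) (J := J) h.z_ge (q := q i) (c := c)
      (k := K' - K) h.n_le ((h.q_le i (by omega)).trans ((div_le_self (by
          have : 0 < p * n := by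
            by_contra hneg
            have := mul_nonneg (show 0 ≤ -(p * n) by linarith) ha0.le
            linarith
          exact (pos_of_mul_pos_left this hn0.le).le) (one_le_pow₀ (by norm_num))).trans h.p1))
      hqb hWJ (h.upJ i (by omega)) (h.degJ i (by omega))
      (fun v => by have := (abs_le.1 (hdegW v)).1; linarith)
      (fun v => by have := (abs_le.1 (hdegW v)).2; linarith)
      (by linarith) (by linarith) hkc
    have hWJP : W ⊔ J ≤ P (i + 1) := sup_le (hW.trans (h.mono i (by omega))) sdiff_le
    obtain ⟨W', hW', hW'1, -, hW'3⟩ := exists_remove hn (W ⊔ J) hτc hτle hτpw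
    have hold : ∀ j < K, Disjoint (permGraph (σ j)) (W ⊔ J) := fun j hj =>
      disjoint_sup_right.2 ⟨hd j hj, disjoint_sdiff_self_right.mono_left (hle j hj)⟩
    obtain ⟨ρ, hρ1, hρ2⟩ : ∃ ρ : ℕ → Equiv.Perm V, (∀ j < K, ρ j = σ j) ∧
        ∀ j, K ≤ j → ρ j = τ (j - K) :=
      ⟨fun j => if j < K then σ j else τ (j - K), fun j hj => if_pos hj,
        fun j hj => if_neg (by omega)⟩
    refine ⟨ρ, W', hW'.trans hWJP, ?_, ?_, ?_, ?_, ?_⟩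
    · intro j hj
      rcases lt_or_ge j K with h1 | h1
      · rw [hρ1 j h1]; exact hc j h1
      · rw [hρ2 j h1]; exact hτc _ (by omega)
    · intro j hj
      rcases lt_or_ge j K with h1 | h1
      · rw [hρ1 j h1]; exact (hle j h1).trans (h.mono i (by omega))
      · rw [hρ2 j h1]; exact (hτle _ (by omega)).trans hWJP
    · intro j hj l hl
      rcases lt_or_ge j K with h1 | h1
      · rw [hρ1 j h1, hρ1 l (by omega)]; exact hpw j h1 l hl
      · rw [hρ2 j h1]
        rcases lt_or_ge l K with h2 | h2
        · rw [hρ1 l h2]; exact (hold l h2).mono_right (hτle _ (by omega))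
        · rw [hρ2 l h2]; exact hτpw _ (by omega) _ (by omega)
    · intro j hj
      rcases lt_or_ge j K with h1 | h1
      · rw [hρ1 j h1]; exact (hold j h1).mono_right hW'
      · rw [hρ2 j h1]; exact hW'1 _ (by omega)
    · intro v
      have h1 := hW'3 v
      rw [dg_sup_of_disjoint hWJ] at h1
      have h2 := hdeg v
      have h3 := dg_sup_of_disjoint (disjoint_sdiff_self_right (x := P i) (y := P (i + 1))) v
        Finset.univ
      rw [sup_sdiff_cancel_right (h.mono i (by omega)), ← hJ] at h3
      omega

theorem Split.exists_perms {G : SimpleGraph V} {z T δ : ℕ} {p qR : ℝ} {q : ℕ → ℝ} {x0 : V}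
    {P : ℕ → SimpleGraph V} {R : SimpleGraph V} (h : Split G z T δ p qR q x0 P R)
    (hn : 3 ≤ Fintype.card V) :
    ∃ σ : ℕ → Equiv.Perm V, (∀ i < δ / 2, (σ i).IsCycleOn Set.univ) ∧
      (∀ i < δ / 2, permGraph (σ i) ≤ G) ∧
      (∀ i < δ / 2, ∀ j < i, Disjoint (permGraph (σ j)) (permGraph (σ i))) ∧
      (Odd δ → ∃ M ≤ G, (∀ v a b, M.Adj v a → M.Adj v b → a = b) ∧
        M.edgeSet.ncard = Fintype.card V / 2 ∧ ∀ i < δ / 2, Disjoint (permGraph (σ i)) M) := by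
  obtain ⟨σ, W, hW, hc, hle, hpw, hd, hdeg⟩ := h.exists_cycles hn T le_rfl
  set K := cycleNum δ T with hK
  have hx := hdeg x0
  rw [h.degx] at hx
  set N : Finset V := Finset.univ.filter (W.Adj x0) with hN
  obtain ⟨r, hr⟩ : ∃ r, r = dg W x0 Finset.univ := ⟨_, rfl⟩
  have hNr : N.card = r := by rw [hr, dg]
  obtain ⟨v0⟩ : Nonempty V := Fintype.card_pos_iff.1 (by omega)
  obtain ⟨f, hf, hfi⟩ : ∃ f : ℕ → V, (∀ i < r, f i ∈ N) ∧ ∀ i < r, ∀ j < r, f i = f j → i = j := by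
    refine ⟨fun i => if hi : i < r then (N.equivFin.symm ⟨i, hNr ▸ hi⟩ : V) else v0,
      fun i hi => ?_, fun i hi j hj hij => ?_⟩
    · beta_reduce; rw [dif_pos hi]; exact Subtype.coe_prop _
    · beta_reduce at hij; rw [dif_pos hi, dif_pos hj] at hij
      have := N.equivFin.symm.injective (Subtype.ext hij)
      simpa using this
  have hZ : (1000000000 : ℝ) ≤ z := by exact_mod_cast h.z_ge
  have hR1 := h.R1
  have hRb := h.R_big
  have hT := h.T_ge
  have hdR := h.degR
  set Z : ℝ := (z : ℝ) with hZdef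
  set n : ℝ := (Fintype.card V : ℝ) with hndef
  have hZ1 : 1 ≤ Z := by linarith
  have hn0 : 0 < n := by rw [hndef]; exact_mod_cast (by omega : 0 < Fintype.card V)
  have hstep : ∀ k l : ℕ, l = k + 1 → 1000000000 * Z ^ k ≤ Z ^ l := fun k l h => by
    rw [h, pow_succ']; exact mul_le_mul_of_nonneg_right hZ (by positivity)
  have hone : ∀ k : ℕ, 1 ≤ Z ^ k := fun k => one_le_pow₀ hZ1
  have hmono : ∀ {a b : ℕ}, a ≤ b → Z ^ a ≤ Z ^ b := fun h => pow_le_pow_right₀ hZ1 h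
  set D := qR * n with hD
  have hD0 : 0 < D := lt_of_lt_of_le (by positivity) hRb
  have hq0 : 0 < qR := pos_of_mul_pos_left hD0 hn0.le
  have hDn : D ≤ n := by
    have := mul_le_mul_of_nonneg_right hR1 hn0.le
    linarith
  have hε0 : 0 < 1 / Z ^ 5 := by positivity
  have hε1 : 1 / Z ^ 5 ≤ 1 := by
    rw [div_le_one (by positivity)]; exact hone 5
  have hεD : 1000 ≤ 1 / Z ^ 5 * D := by
    rw [one_div_mul_eq_div, le_div_iff₀ (by positivity)]
    have := hstep 5 6 rfl
    have := hmono (show 6 ≤ 52 by norm_num)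
    have := hone 5
    linarith
  have hrle : (r : ℝ) ≤ 5 / 4 * (1 / Z ^ 5 / 10 * D) + 2 := by
    have h1 := cycleNum_gt δ T
    rw [← hK] at h1
    have h2 : (r : ℝ) + 2 * K = δ := by rw [hr]; exact_mod_cast hx
    linarith
  have hn1 : Fintype.card V ≤ 4 ^ z ^ 4 :=
    h.n_le.trans (Nat.pow_le_pow_left (by norm_num) _)
  obtain ⟨τ, hτc, hτle, hτpw, hτM⟩ := exists_final (G := W ⊔ R) (R := R) le_sup_right (x0 := x0)
    (r := r) (f := f) (fun i hi => Or.inl (by have := hf i hi; simpa [hN] using this)) hfi h.upR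
    hq0 hR1 (hone 10) hε0.le hε1 (w := z ^ 4) (by
      push_cast
      rw [← hZdef, one_div_mul_eq_div, div_le_one (by positivity)]
      have := hstep 4 5 rfl
      have := hone 4
      linarith) hn1 (by
      push_cast
      rw [← hZdef]
      have h0 := hone 4
      have h1 : (2 * Z ^ 4 + 2) ^ 3 ≤ (4 * Z ^ 4) ^ 3 :=
        pow_le_pow_left₀ (by positivity) (by linarith) 3
      have h2 : 20000000 * (2 * Z ^ 4 + 2) ^ 3 * Z ^ 10 ≤ 20000000 * (4 * Z ^ 4) ^ 3 * Z ^ 10 :=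
        mul_le_mul_of_nonneg_right (mul_le_mul_of_nonneg_left h1 (by norm_num)) (by positivity)
      have h3 : 20000000 * (4 * Z ^ 4) ^ 3 * Z ^ 10 = 1280000000 * Z ^ 22 := by ring
      have h4 := hstep 22 23 rfl
      have h5 := hstep 23 24 rfl
      have h6 := hmono (show 24 ≤ 52 by norm_num)
      have h7 := hone 22
      have h8 : qR * (n - 3) = D - 3 * qR := by rw [hD]; ring
      linarith) (by
      have h8 := mul_le_mul_of_nonneg_left hDn hε0.le
      linarith) (by
      intro v hv
      have h8 := hdR v hv
      linarith)
  have hsub : ∀ j < K, Disjoint (permGraph (σ j)) (W ⊔ R) := fun j hj =>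
    disjoint_sup_right.2 ⟨hd j hj, h.disj.mono_left (hle j hj)⟩
  have hWR : W ⊔ R ≤ G := sup_le (hW.trans h.P_le) h.R_le
  obtain ⟨ρ, hρ1, hρ2⟩ : ∃ ρ : ℕ → Equiv.Perm V, (∀ j < K, ρ j = σ j) ∧
      ∀ j, K ≤ j → ρ j = τ (j - K) :=
    ⟨fun j => if j < K then σ j else τ (j - K), fun j hj => if_pos hj,
      fun j hj => if_neg (by omega)⟩
  refine ⟨ρ, ?_, ?_, ?_, ?_⟩
  · intro j hj
    rcases lt_or_ge j K with h1 | h1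
    · rw [hρ1 j h1]; exact hc j h1
    · rw [hρ2 j h1]; exact hτc _ (by omega)
  · intro j hj
    rcases lt_or_ge j K with h1 | h1
    · rw [hρ1 j h1]; exact (hle j h1).trans h.P_le
    · rw [hρ2 j h1]; exact (hτle _ (by omega)).trans hWR
  · intro j hj l hl
    rcases lt_or_ge j K with h1 | h1
    · rw [hρ1 j h1, hρ1 l (by omega)]; exact hpw j h1 l hl
    · rw [hρ2 j h1]
      rcases lt_or_ge l K with h2 | h2
      · rw [hρ1 l h2]; exact (hsub l h2).mono_right (hτle _ (by omega))
      · rw [hρ2 l h2]; exact hτpw _ (by omega) _ (by omega)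
  · intro hodd
    obtain ⟨M, hM, hM1, hM2, hM3⟩ := hτM (by
      rw [Nat.odd_iff] at hodd ⊢; omega)
    refine ⟨M, hM.trans hWR, hM1, hM2, fun j hj => ?_⟩
    rcases lt_or_ge j K with h1 | h1
    · rw [hρ1 j h1]; exact (hsub j h1).mono_right hM
    · rw [hρ2 j h1]; exact hM3 _ (by omega)

end Assembly

section RandomSubgraph
variable {V κ : Type} [Fintype V] [Fintype κ]

/-- The subgraph of `H` formed by the edges satisfying `c`. -/
def edgeFilter (H : SimpleGraph V) (c : Sym2 V → Prop) : SimpleGraph V where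
  Adj u v := H.Adj u v ∧ c s(u, v)
  symm := ⟨fun _ _ h => ⟨h.1.symm, by rw [Sym2.eq_swap]; exact h.2⟩⟩
  loopless := ⟨fun _ h => h.1.ne rfl⟩

lemma edgeFilter_adj (H : SimpleGraph V) (c : Sym2 V → Prop) (u v : V) :
    (edgeFilter H c).Adj u v ↔ H.Adj u v ∧ c s(u, v) := Iff.rfl

lemma edg_eq_card (H : SimpleGraph V) (S T : Finset V) :
    edg H S T = ((S ×ˢ T).filter fun a => H.Adj a.1 a.2).card := by
  unfold edg dg
  rw [Finset.card_filter, Finset.sum_product]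
  exact Finset.sum_congr rfl fun s _ => Finset.card_filter _ _

lemma edg_edgeFilter (H : SimpleGraph V) (c : Sym2 V → Prop) (S T : Finset V) :
    edg (edgeFilter H c) S T =
      (((S ×ˢ T).filter fun a => H.Adj a.1 a.2).filter fun a => c s(a.1, a.2)).card := by
  rw [edg_eq_card, Finset.filter_filter]
  congr 1
  ext a
  simp only [Finset.mem_filter, edgeFilter_adj]

lemma card_filter_sym2_le (I : Finset (V × V)) (e : Sym2 V) :
    (I.filter fun a => s(a.1, a.2) = e).card ≤ 2 := by
  induction e using Sym2.ind with
  | _ x y =>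
    refine (Finset.card_le_card (t := {(x, y), (y, x)}) fun a ha => ?_).trans Finset.card_le_two
    rw [Finset.mem_filter, Sym2.eq_iff] at ha
    rw [Finset.mem_insert, Finset.mem_singleton]
    rcases ha.2 with h | h
    · left; exact Prod.ext h.1 h.2
    · right; exact Prod.ext h.1 h.2

lemma sum_pow_card_pair (x : ℝ) :
    ∑ a : Finset V × Finset V, x ^ (a.1.card + a.2.card) = (1 + x) ^ (2 * Fintype.card V) := by
  rw [Fintype.sum_prod_type]
  simp_rw [pow_add, ← Finset.mul_sum]
  rw [← Finset.sum_mul]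
  have := Fintype.sum_pow_mul_eq_add_pow V x 1
  simp only [one_pow, mul_one] at this
  rw [this, add_comm, two_mul, pow_add]

theorem Pr_not_upperReg_le {μ : Sym2 V → κ → ℝ} (hμ : IsProb μ) {H : SimpleGraph V} (C : κ → Prop)
    {θ q A A' η ε x w : ℝ} (hθ0 : 0 ≤ θ)
    (hθ : ∀ e, ∑ k ∈ Finset.univ.filter C, μ e k ≤ θ) (hH : UpperReg H q A η) (hq : 0 ≤ q)
    (hx0 : 0 < x) (hx1 : x ≤ 1) (hε : (1 + x) * (1 + η) ≤ 1 + ε)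
    (hA : (1 + x) * (θ * A) + 4 * w / x ≤ A') (hw : 1 ≤ w)
    (hn : (Fintype.card V : ℝ) ≤ Real.exp w) :
    Pr μ (fun ω => ¬ UpperReg (edgeFilter H fun e => C (ω e)) (θ * q) A' ε) ≤
      4 * Real.exp (-w) := by
  set y := Real.exp (-(2 * w)) with hy
  have hy0 : 0 < y := Real.exp_pos _
  set B : Finset V × Finset V → (Sym2 V → κ) → Prop := fun a ω =>
    (1 + ε) * (θ * q) * a.1.card * a.2.card + A' * (a.1.card + a.2.card) <
      (edg (edgeFilter H fun e => C (ω e)) a.1 a.2 : ℝ) with hB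
  have hbound : ∀ a : Finset V × Finset V, Pr μ (B a) ≤ y ^ (a.1.card + a.2.card) := by
    intro a
    set I := (a.1 ×ˢ a.2).filter fun a => H.Adj a.1 a.2 with hI
    set k : ℝ := (a.1.card : ℝ) + a.2.card with hk
    have hk0 : 0 ≤ k := by positivity
    have hm : ∑ b ∈ I, ∑ j ∈ Finset.univ.filter C, μ s(b.1, b.2) j ≤
        θ * ((1 + η) * q * a.1.card * a.2.card + A * k) := by
      refine (Finset.sum_le_sum fun b _ => hθ s(b.1, b.2)).trans ?_
      rw [Finset.sum_const, nsmul_eq_mul, mul_comm]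
      refine mul_le_mul_of_nonneg_left ?_ hθ0
      rw [hI, ← edg_eq_card]
      exact hH a.1 a.2
    have := Pr_card_ge I (fun b => s(b.1, b.2)) (b := 2) (fun _ j => C j) hμ (by norm_num)
      (fun e => by convert card_filter_sym2_le I e) hm hx0.le hx1 (t := 4 * w / x * k)
    refine (Pr_mono hμ fun ω hω => ?_).trans (this.trans (le_of_eq ?_))
    · simp only [hB] at hω
      rw [edg_edgeFilter] at hω
      refine le_trans ?_ hω.le
      have h1 : (1 + x) * (1 + η) * (θ * q * a.1.card * a.2.card) ≤
          (1 + ε) * (θ * q * a.1.card * a.2.card) := mul_le_mul_of_nonneg_right hε (by positivity)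
      have h2 := mul_le_mul_of_nonneg_right hA hk0
      rw [← hk]
      linarith
    · rw [hy, ← Real.exp_nat_mul]
      congr 1
      push_cast
      rw [← hk]
      field_simp
      ring
  have h1 : Pr μ (fun ω => ¬ UpperReg (edgeFilter H fun e => C (ω e)) (θ * q) A' ε) ≤
      ∑ a ∈ Finset.univ.erase ((∅, ∅) : Finset V × Finset V), Pr μ (B a) := by
    refine le_trans (Pr_mono hμ fun ω hω => ?_) (Pr_exists_le hμ _ B)
    unfold UpperReg at hω
    push Not at hω
    obtain ⟨S, T, h⟩ := hω
    refine ⟨(S, T), Finset.mem_erase.2 ⟨?_, Finset.mem_univ _⟩, h⟩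
    intro he
    rw [Prod.mk.injEq] at he
    rw [he.1, he.2] at h
    simp [edg] at h
  have h2 := Finset.sum_le_sum (s := Finset.univ.erase ((∅, ∅) : Finset V × Finset V))
    fun a _ => hbound a
  rw [Finset.sum_erase_eq_sub (f := fun a : Finset V × Finset V => y ^ (a.1.card + a.2.card)) (Finset.mem_univ _),
    sum_pow_card_pair] at h2
  simp only [Finset.card_empty, add_zero, pow_zero] at h2
  have h3 : (1 + y) ^ (2 * Fintype.card V) ≤ Real.exp (2 * Fintype.card V * y) := by
    have h := pow_le_pow_left₀ (by positivity) (Real.add_one_le_exp y) (2 * Fintype.card V)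
    rw [← Real.exp_nat_mul] at h
    push_cast at h
    rwa [add_comm] at h
  have h4 : 2 * Fintype.card V * y ≤ 2 * Real.exp (-w) := by
    have : Real.exp w * y = Real.exp (-w) := by rw [hy, ← Real.exp_add]; congr 1; ring
    rw [← this]
    have := mul_le_mul_of_nonneg_right hn hy0.le
    linarith
  have h5 : Real.exp (-w) ≤ 1 / 2 := by
    have := Real.exp_le_exp.2 (show -w ≤ -1 by linarith)
    have h6 := Real.exp_neg_one_lt_d9
    linarith
  have h6 := Real.abs_exp_sub_one_le (x := 2 * Fintype.card V * y) (by
    rw [abs_of_nonneg (by positivity)]; linarith)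
  rw [abs_of_nonneg (show 0 ≤ 2 * Fintype.card V * y by positivity)] at h6
  have := (le_abs_self _).trans h6
  linarith

end RandomSubgraph

section Typical
variable {V : Type} [Fintype V]

/-- The typical properties of a random graph which are used: edges are well distributed, degrees
are concentrated, also on neighbourhoods, and the minimum degree is attained only at `x0`, with a
gap to all other degrees. Here `σ ^ 2` is the degree variance. -/
structure Typical (G : SimpleGraph V) (z : ℕ) (p σ : ℝ) (x0 : V) : Prop where
  z_ge : 10 ^ 9 ≤ z
  n_le : Fintype.card V ≤ 2 ^ z ^ 4
  p1 : p ≤ 1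
  σ_ge : (z : ℝ) ^ 98 ≤ σ
  σ_le : σ ^ 2 ≤ p * Fintype.card V
  up : UpperReg G p (32 * (z : ℝ) ^ 9) (1 / (z : ℝ) ^ 5 / 8)
  degs : ∀ v, |(dg G v Finset.univ : ℝ) - p * Fintype.card V| ≤ (z : ℝ) ^ 3 * σ
  gap : ∀ v ≠ x0, (dg G x0 Finset.univ : ℝ) + σ / (z : ℝ) ^ 16 ≤ dg G v Finset.univ
  nbr : ∀ u, |∑ v ∈ Finset.univ.filter (G.Adj u),
    ((dg G v Finset.univ : ℝ) - p * Fintype.card V)| ≤ p * Fintype.card V * σ / (z : ℝ) ^ 62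
  tot : p * |∑ v, ((dg G v Finset.univ : ℝ) - p * Fintype.card V)| ≤
    p * Fintype.card V * σ / (z : ℝ) ^ 62

lemma Typical.exists_weights {G : SimpleGraph V} {z : ℕ} {p σ : ℝ} {x0 : V}
    (h : Typical G z p σ x0) : ∃ (g : V → ℝ) (c ρ : ℝ),
      ρ * p = σ / (z : ℝ) ^ 16 / 4 / Fintype.card V ∧ 0 ≤ ρ ∧ ρ ≤ 1 / 2 ∧ 0 < c ∧
      (∀ u, 0 ≤ g u) ∧ (∀ u v, g u * g v / c ≤ 1 / 2) ∧
      (∀ v ≠ x0, g v = dg G v Finset.univ - dg G x0 Finset.univ - σ / (z : ℝ) ^ 16 / 4) ∧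
      (∀ v, g v ≤ 2 * ((z : ℝ) ^ 3 * σ)) ∧
      (∀ v ≠ x0, |∑ u ∈ Finset.univ.filter (fun u => G.Adj v u ∧ u ≠ x0), (g u * g v / c + ρ) -
        (g v + σ / (z : ℝ) ^ 16 / 4)| ≤ σ / (z : ℝ) ^ 42) ∧
      (∀ v ≠ x0, (1 - 1 / (z : ℝ) ^ 5 / 8) * (σ / (z : ℝ) ^ 16 / 4) ≤
        ∑ u ∈ Finset.univ.filter (fun u => G.Adj v u ∧ u ≠ x0), ρ) := by
  have hZ : (1000000000 : ℝ) ≤ z := by exact_mod_cast h.z_ge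
  have hσ98 := h.σ_ge
  have hσ2 := h.σ_le
  have hp1 := h.p1
  have hdegs := h.degs
  have hgap := h.gap
  have hnbr := h.nbr
  have htot := h.tot
  set Z : ℝ := (z : ℝ) with hZdef
  set n : ℝ := (Fintype.card V : ℝ) with hndef
  obtain ⟨d, hd⟩ : ∃ d : V → ℝ, ∀ v, d v = dg G v Finset.univ := ⟨_, fun _ => rfl⟩
  simp only [← hd] at hdegs hgap hnbr htot ⊢
  have hZ1 : 1 ≤ Z := by linarith
  have hZ0 : 0 < Z := by linarith
  have hpow : ∀ k, 0 < Z ^ k := fun k => pow_pos hZ0 k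
  have hσ0 : 0 < σ := lt_of_lt_of_le (hpow _) hσ98
  have hone : ∀ k : ℕ, 1 ≤ Z ^ k := fun k => one_le_pow₀ hZ1
  have hpn0 : 0 < p * n := lt_of_lt_of_le (by positivity) hσ2
  have hn0 : 0 < n := by
    rcases (Nat.cast_nonneg (Fintype.card V) : (0 : ℝ) ≤ _).eq_or_lt with h0 | h0
    · rw [hndef, ← h0, mul_zero] at hpn0; exact absurd hpn0 (lt_irrefl _)
    · exact h0
  have hp0 : 0 < p := pos_of_mul_pos_left hpn0 hn0.le
  obtain ⟨N, hN⟩ : ∃ N, N = p * n := ⟨_, rfl⟩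
  rw [← hN] at hσ2 hpn0 hdegs hnbr htot
  have hNσ : Z ^ 98 * σ ≤ N := by
    refine le_trans ?_ hσ2
    rw [sq]; exact mul_le_mul_of_nonneg_right hσ98 hσ0.le
  have hNn : N ≤ n := by
    have := mul_le_mul_of_nonneg_right hp1 hn0.le
    linarith
  obtain ⟨D, hD⟩ : ∃ D, D = σ / Z ^ 16 / 4 := ⟨_, rfl⟩
  rw [← hD]
  have hL : σ / Z ^ 16 = 4 * D := by rw [hD]; ring
  rw [hL] at hgap
  have hD0 : 0 < D := by rw [hD]; have := hpow 16; positivity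
  have hDσ : D * Z ^ 16 * 4 = σ := by rw [hD]; have := hpow 16; field_simp
  have hDx : 4 * D ≤ σ := by
    rw [← hL]; exact div_le_self hσ0.le (hone 16)
  obtain ⟨x, hx⟩ : ∃ x, x = Z ^ 3 * σ := ⟨_, rfl⟩
  rw [← hx] at hdegs ⊢
  have hσx : σ ≤ x := by rw [hx]; exact le_mul_of_one_le_left hσ0.le (hone 3)
  have hZD : ∀ k l : ℕ, k < l → 1000000000 * Z ^ k ≤ Z ^ l := fun k l hkl => by
    have h1 : 1000000000 * Z ^ k ≤ Z ^ (k + 1) := by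
      rw [pow_succ']; exact mul_le_mul_of_nonneg_right hZ (hpow k).le
    exact h1.trans (pow_le_pow_right₀ hZ1 (by omega))
  -- the weights
  obtain ⟨g, hg⟩ : ∃ g : V → ℝ, ∀ u, g u = if u = x0 then 0 else d u - d x0 - D := ⟨_, fun _ => rfl⟩
  have hg0 : g x0 = 0 := by rw [hg, if_pos rfl]
  have hg1 : ∀ v ≠ x0, g v = d v - d x0 - D := fun v hv => by rw [hg, if_neg hv]
  have hglow : ∀ v ≠ x0, 3 * D ≤ g v := fun v hv => by
    rw [hg1 v hv]; have := hgap v hv; linarith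
  have hgnn : ∀ v, 0 ≤ g v := fun v => by
    by_cases hv : v = x0
    · rw [hv, hg0]
    · have := hglow v hv; linarith
  have hgup : ∀ v, g v ≤ 2 * x := fun v => by
    by_cases hv : v = x0
    · rw [hv, hg0]; linarith
    · rw [hg1 v hv]
      have h1 := (abs_le.1 (hdegs v)).2
      have h2 := (abs_le.1 (hdegs x0)).1
      linarith
  obtain ⟨a, ha⟩ : ∃ a, a = N - d x0 - D := ⟨_, rfl⟩
  have haabs : |a| ≤ 2 * x := by
    have := abs_le.1 (hdegs x0)
    rw [abs_le, ha]; constructor <;> linarith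
  have hgβ : ∀ u, g u = (d u - N) + a + if u = x0 then D else 0 := fun u => by
    rw [hg, ha]
    split_ifs with h1
    · rw [h1]; ring
    · ring
  have hcard : (Finset.univ : Finset V).card = n := by rw [hndef, Finset.card_univ]
  have hsum : ∑ u, g u = ∑ u, (d u - N) + n * a + D := by
    simp_rw [hgβ]
    rw [Finset.sum_add_distrib, Finset.sum_add_distrib, Finset.sum_const, nsmul_eq_mul, hcard]
    simp
  have hsumlow : n * D ≤ ∑ u, g u := by
    have h1 : ∑ u ∈ Finset.univ.erase x0, 3 * D ≤ ∑ u ∈ Finset.univ.erase x0, g u :=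
      Finset.sum_le_sum fun u hu => hglow u (Finset.ne_of_mem_erase hu)
    have h2 : ∑ u ∈ Finset.univ.erase x0, g u ≤ ∑ u, g u :=
      Finset.sum_le_sum_of_subset_of_nonneg (Finset.subset_univ _) fun u _ _ => hgnn u
    rw [Finset.sum_const, nsmul_eq_mul, Finset.card_erase_of_mem (Finset.mem_univ _),
      Nat.cast_sub (Finset.card_pos.2 ⟨x0, Finset.mem_univ _⟩), hcard] at h1
    have h3 : (1 : ℝ) ≤ n / 2 := by
      have h5 := hone 98
      have h6 := mul_le_mul hσ98 hσ98 (hpow 98).le hσ0.le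
      have h7 := hZD 0 98 (by norm_num)
      have h8 := mul_le_mul_of_nonneg_right (hone 98) (hpow 98).le
      norm_num at h7
      linarith [sq σ]
    have h4 := mul_le_mul_of_nonneg_right h3 hD0.le
    push_cast at h1
    linarith
  obtain ⟨c, hc⟩ : ∃ c, c = p * ∑ u, g u := ⟨_, rfl⟩
  have hclow : N * D ≤ c := by
    have := mul_le_mul_of_nonneg_left hsumlow hp0.le
    rw [hc, hN]; linarith
  have hND : 0 < N * D := mul_pos hpn0 hD0
  have hc0 : 0 < c := hND.trans_le hclow
  obtain ⟨ρ, hρ⟩ : ∃ ρ, ρ = D / N := ⟨_, rfl⟩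
  have hρN : ρ * N = D := by rw [hρ]; field_simp
  have hρ0 : 0 ≤ ρ := by rw [hρ]; positivity
  have hρx : ρ * (x + 1) * Z ^ 95 ≤ 2 * D := by
    rw [← hρN, mul_assoc]
    have h1 : (x + 1) * Z ^ 95 ≤ 2 * N := by
      have h2 : 1 ≤ x := by linarith [hone 98]
      have h3 : x * Z ^ 95 = Z ^ 98 * σ := by rw [hx]; ring
      have h4 := mul_le_mul_of_nonneg_right h2 (hpow 95).le
      linarith
    have := mul_le_mul_of_nonneg_left h1 hρ0
    linarith
  have hI : ∀ v, |((Finset.univ.filter (fun u => G.Adj v u ∧ u ≠ x0)).card : ℝ) - N| ≤ x + 1 := by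
    intro v
    have h1 : (Finset.univ.filter (fun u => G.Adj v u ∧ u ≠ x0)).card ≤ dg G v Finset.univ :=
      Finset.card_le_card fun u => by simp +contextual
    have h2 : dg G v Finset.univ ≤ (Finset.univ.filter (fun u => G.Adj v u ∧ u ≠ x0)).card + 1 := by
      rw [← Finset.card_singleton x0]
      refine le_trans (Finset.card_le_card fun u hu => ?_) (Finset.card_union_le _ _)
      simp only [Finset.mem_filter, Finset.mem_union, Finset.mem_singleton, Finset.mem_univ,
        true_and] at hu ⊢
      tauto
    have h1' : ((Finset.univ.filter (fun u => G.Adj v u ∧ u ≠ x0)).card : ℝ) ≤ d v := by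
      rw [hd]; exact_mod_cast h1
    have h2' : d v ≤ ((Finset.univ.filter (fun u => G.Adj v u ∧ u ≠ x0)).card : ℝ) + 1 := by
      rw [hd]; exact_mod_cast h2
    have h3 := abs_le.1 (hdegs v)
    rw [abs_le]; constructor <;> linarith
  have hρsum : ∀ v, |∑ u ∈ Finset.univ.filter (fun u => G.Adj v u ∧ u ≠ x0), ρ - D| ≤
      ρ * (x + 1) := by
    intro v
    rw [Finset.sum_const, nsmul_eq_mul, ← hρN, mul_comm, ← mul_sub, abs_mul, abs_of_nonneg hρ0]
    exact mul_le_mul_of_nonneg_left (hI v) hρ0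
  refine ⟨g, c, ρ, ?_, hρ0, ?_, hc0, hgnn, ?_, hg1, hgup, ?_, ?_⟩
  · rw [hρ, hN]; field_simp
  · rw [hρ, div_le_iff₀ hpn0]
    have := mul_le_mul_of_nonneg_right (hone 98) hσ0.le
    linarith
  · intro u v
    rw [div_le_iff₀ hc0]
    have h1 := mul_le_mul (hgup u) (hgup v) (hgnn v) (by linarith)
    have h2 : 2 * x * (2 * x) ≤ 1 / 2 * (N * D) := by
      have h3 := mul_le_mul_of_nonneg_right hNσ hD0.le
      have h4 : Z ^ 98 * σ * D = Z ^ 82 * σ ^ 2 / 4 := by rw [← hDσ]; ring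
      have h5 : 2 * x * (2 * x) = 4 * Z ^ 6 * σ ^ 2 := by rw [hx]; ring
      have h6 := mul_le_mul_of_nonneg_right (hZD 6 82 (by norm_num)) (sq_nonneg σ)
      have h7 := mul_nonneg (hpow 6).le (sq_nonneg σ)
      linarith
    linarith
  · intro v hv
    set I := Finset.univ.filter (fun u => G.Adj v u ∧ u ≠ x0) with hIdef
    have hIg : ∑ u ∈ I, g u = ∑ u ∈ Finset.univ.filter (G.Adj v), g u := by
      refine Finset.sum_subset (fun u => by simp +contextual [hIdef]) fun u hu hu' => ?_
      have : u = x0 := by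
        by_contra hne
        exact hu' (by simp at hu; simp [hIdef, hu, hne])
      rw [this, hg0]
    have hdcard : ((Finset.univ.filter (G.Adj v)).card : ℝ) = d v := by rw [hd]; rfl
    obtain ⟨e, he, he0, he1⟩ : ∃ e : ℝ, ∑ u ∈ Finset.univ.filter (G.Adj v),
        (if u = x0 then D else 0) = e ∧ 0 ≤ e ∧ e ≤ D := by
      refine ⟨_, rfl, Finset.sum_nonneg fun u _ => by split_ifs <;> linarith, ?_⟩
      rw [Finset.sum_ite_eq']
      split_ifs <;> linarith
    have hsN : ∑ u ∈ Finset.univ.filter (G.Adj v), g u =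
        ∑ u ∈ Finset.univ.filter (G.Adj v), (d u - N) + d v * a + e := by
      rw [← he, ← hdcard, ← nsmul_eq_mul, ← Finset.sum_const, ← Finset.sum_add_distrib,
        ← Finset.sum_add_distrib]
      exact Finset.sum_congr rfl fun u _ => hgβ u
    obtain ⟨E, hE⟩ : ∃ E, E = ∑ u ∈ I, g u - c := ⟨_, rfl⟩
    have hE' : E = ∑ u ∈ Finset.univ.filter (G.Adj v), (d u - N) - p * ∑ u, (d u - N) +
        (d v - N) * a + (e - p * D) := by
      rw [hE, hIg, hsN, hc, hsum, hN]; ring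
    have hpD : p * D ≤ D := by
      have := mul_le_mul_of_nonneg_right hp1 hD0.le
      linarith
    have hpD0 : 0 ≤ p * D := by positivity
    have htot' : |p * ∑ u, (d u - N)| ≤ N * σ / Z ^ 62 := by
      rw [abs_mul, abs_of_pos hp0]; exact htot
    have hx2 : |(d v - N) * a| ≤ x * (2 * x) := by
      rw [abs_mul]
      exact mul_le_mul (hdegs v) haabs (abs_nonneg _) (by linarith)
    have hEabs : |E| ≤ N * σ / Z ^ 62 + N * σ / Z ^ 62 + x * (2 * x) + D := by
      have h1 := abs_le.1 (hnbr v)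
      have h2 := abs_le.1 htot'
      have h3 := abs_le.1 hx2
      rw [hE', abs_le]; constructor <;> linarith
    have hEZ : |E| * Z ^ 62 ≤ 5 * (N * σ) := by
      have h1 := mul_le_mul_of_nonneg_right hEabs (hpow 62).le
      have h2 : N * σ / Z ^ 62 * Z ^ 62 = N * σ := div_mul_cancel₀ _ (hpow 62).ne'
      have h3 := mul_le_mul_of_nonneg_right hNσ hσ0.le
      have h4 : x * (2 * x) * Z ^ 62 = 2 * Z ^ 68 * σ ^ 2 := by rw [hx]; ring
      have h5 := mul_le_mul_of_nonneg_right (hZD 68 98 (by norm_num)) (sq_nonneg σ)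
      have h6 := mul_le_mul_of_nonneg_right hDx (hpow 62).le
      have h7 := mul_le_mul_of_nonneg_right
        ((pow_le_pow_right₀ hZ1 (show 62 ≤ 98 by norm_num)).trans hσ98) hσ0.le
      have h8 := mul_le_mul_of_nonneg_right (hone 98) (sq_nonneg σ)
      have h9 := mul_nonneg (hpow 68).le (sq_nonneg σ)
      have h10 : Z ^ 98 * σ * σ = Z ^ 98 * σ ^ 2 := by ring
      linarith
    have hy : ∑ u ∈ I, (g u * g v / c + ρ) - (g v + D) = g v * E / c + (∑ u ∈ I, ρ - D) := by
      rw [Finset.sum_add_distrib]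
      have : ∑ u ∈ I, g u * g v / c = (c + E) * g v / c := by
        rw [← Finset.sum_div, ← Finset.sum_mul, hE]; ring
      rw [this]
      field_simp
      ring
    have hgE : |g v * E / c| * Z ^ 43 ≤ 40 * σ := by
      rw [abs_div, abs_of_pos hc0, div_mul_eq_mul_div, div_le_iff₀ hc0, abs_mul,
        abs_of_nonneg (hgnn v)]
      have h1 := mul_le_mul_of_nonneg_right (hgup v)
        (mul_nonneg (abs_nonneg E) (hpow 43).le)
      have h2 := mul_le_mul_of_nonneg_left hclow (show 0 ≤ 40 * σ by positivity)
      have h3 : 2 * x * (|E| * Z ^ 43) * Z ^ 16 ≤ 40 * σ * (N * D) * Z ^ 16 := by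
        have h4 := mul_le_mul_of_nonneg_left hEZ (show 0 ≤ 2 * σ by positivity)
        have h5 : 2 * x * (|E| * Z ^ 43) * Z ^ 16 = 2 * σ * (|E| * Z ^ 62) := by rw [hx]; ring
        have h6 : 40 * σ * (N * D) * Z ^ 16 = 10 * σ * N * (D * Z ^ 16 * 4) := by ring
        rw [h5, h6, hDσ]
        linarith
      have h7 := le_of_mul_le_mul_right h3 (hpow 16)
      linarith
    rw [hy]
    refine (abs_add_le _ _).trans ?_
    rw [le_div_iff₀ (hpow 42)]
    have h1 : |∑ u ∈ I, ρ - D| * Z ^ 43 ≤ 2 * D := by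
      have h2 := mul_le_mul_of_nonneg_right (hρsum v) (hpow 43).le
      have h3 : ρ * (x + 1) * Z ^ 43 ≤ ρ * (x + 1) * Z ^ 95 :=
        mul_le_mul_of_nonneg_left (pow_le_pow_right₀ hZ1 (by norm_num))
          (mul_nonneg hρ0 (by linarith))
      linarith
    have h2 : (|g v * E / c| + |∑ u ∈ I, ρ - D|) * Z ^ 42 * Z ≤ σ * Z := by
      have h3 : (|g v * E / c| + |∑ u ∈ I, ρ - D|) * Z ^ 42 * Z =
        |g v * E / c| * Z ^ 43 + |∑ u ∈ I, ρ - D| * Z ^ 43 := by ring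
      rw [h3]
      have h4 := mul_le_mul_of_nonneg_left hZ hσ0.le
      linarith
    exact le_of_mul_le_mul_right h2 hZ0
  · intro v _
    have h1 := (abs_le.1 (hρsum v)).1
    have h2 : ρ * (x + 1) ≤ 1 / Z ^ 5 / 8 * D := by
      have h3 : ρ * (x + 1) * (8 * Z ^ 5) ≤ D := by
        have h4 := mul_le_mul_of_nonneg_left (hZD 5 95 (by norm_num))
          (show 0 ≤ ρ * (x + 1) from mul_nonneg hρ0 (by linarith))
        have h5 : 0 ≤ ρ * (x + 1) * Z ^ 5 :=
          mul_nonneg (mul_nonneg hρ0 (by linarith)) (hpow 5).le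
        linarith
      have h6 : 1 / Z ^ 5 / 8 * D = D / (8 * Z ^ 5) := by ring
      rw [h6, le_div_iff₀ (by have := hpow 5; positivity)]
      exact h3
    linarith

end Typical

lemma exists_three_colours {ι : Type} [Fintype ι] (y : ι → ℝ) (ρ : ℝ) (hy0 : ∀ i, 0 ≤ y i)
    (hy : ∀ i, y i ≤ 1 / 2) (hρ0 : 0 ≤ ρ) (hρ : ρ ≤ 1 / 2) :
    ∃ (μ : ι → Fin 3 → ℝ) (isR isN : Fin 3 → Prop), IsProb μ ∧ (∀ k, isR k → isN k) ∧
      (∀ i, ∑ k ∈ Finset.univ.filter isR, μ i k = ρ) ∧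
      ∀ i, ∑ k ∈ Finset.univ.filter isN, μ i k = y i + ρ := by
  refine ⟨fun i => ![y i, ρ, 1 - y i - ρ], fun k => k = 1, fun k => k ≠ 2,
    ⟨fun i k => ?_, fun i => ?_⟩, ?_, fun i => ?_, fun i => ?_⟩
  · fin_cases k
    · exact hy0 i
    · exact hρ0
    · have := hy i
      change 0 ≤ 1 - y i - ρ
      linarith
  · rw [Fin.sum_univ_three]; simp
  · intro k hk; rw [hk]; decide
  · rw [Finset.sum_filter, Fin.sum_univ_three]; simp
  · rw [Finset.sum_filter, Fin.sum_univ_three]; simp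

section Kept
variable {V : Type} [Fintype V]

lemma dg_edgeFilter_add (G : SimpleGraph V) (c c' : Sym2 V → Prop) (v x0 : V) (hv : v ≠ x0)
    (hc : ∀ u ≠ x0, c s(v, u) ↔ ¬ c' s(v, u)) (hx : c s(v, x0)) :
    dg (edgeFilter G c) v Finset.univ +
      ((Finset.univ.filter fun u => G.Adj v u ∧ u ≠ x0).filter fun u => c' s(v, u)).card =
      dg G v Finset.univ := by
  unfold dg
  rw [← Finset.card_union_of_disjoint]
  · congr 1
    ext u
    simp only [Finset.mem_union, Finset.mem_filter, Finset.mem_univ, true_and, edgeFilter_adj]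
    by_cases hu : u = x0
    · subst hu; tauto
    · have := hc u hu; tauto
  · rw [Finset.disjoint_left]
    intro u h1 h2
    simp only [Finset.mem_filter, Finset.mem_univ, true_and, edgeFilter_adj] at h1 h2
    exact (hc u h2.1.2).1 h1.2 h2.2

theorem Typical.exists_kept {G : SimpleGraph V} {z : ℕ} {p σ : ℝ} {x0 : V}
    (h : Typical G z p σ x0) : ∃ K R : SimpleGraph V, K ≤ G ∧ R ≤ G ∧ Disjoint K R ∧
      dg K x0 Finset.univ = dg G x0 Finset.univ ∧
      (∀ v, |(dg K v Finset.univ : ℝ) - dg G x0 Finset.univ| ≤ σ / (z : ℝ) ^ 38) ∧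
      UpperReg R (σ / (z : ℝ) ^ 16 / 4 / Fintype.card V) ((z : ℝ) ^ 10) (1 / (z : ℝ) ^ 5) ∧
      ∀ v ≠ x0, (1 - 1 / (z : ℝ) ^ 5 / 2) * (σ / (z : ℝ) ^ 16 / 4) ≤ dg R v Finset.univ := by
  obtain ⟨g, c, ρ, hρp, hρ0, hρ1, hc0, hg0, hgg, hg, hgup, hN, hR⟩ := h.exists_weights
  obtain ⟨y, hy⟩ : ∃ y : Sym2 V → ℝ, ∀ u v, y s(u, v) = g u * g v / c :=
    ⟨Sym2.lift ⟨fun u v => g u * g v / c, fun u v => by ring⟩, fun u v => Sym2.lift_mk _ _ _⟩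
  obtain ⟨μ, isR, isN, hμ, hRN, hμR, hμN⟩ := exists_three_colours y ρ
    (fun e => by
      induction e using Sym2.ind with
      | _ u v => rw [hy]; exact div_nonneg (mul_nonneg (hg0 u) (hg0 v)) hc0.le)
    (fun e => by
      induction e using Sym2.ind with
      | _ u v => rw [hy]; exact hgg u v) hρ0 hρ1
  have hZ : (1000000000 : ℝ) ≤ z := by exact_mod_cast h.z_ge
  have hσ98 := h.σ_ge
  have hup := h.up
  have hnle := h.n_le
  set Z : ℝ := (z : ℝ) with hZdef
  have hZ1 : 1 ≤ Z := by linarith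
  have hZ0 : 0 < Z := by linarith
  have hpow : ∀ k, 0 < Z ^ k := fun k => pow_pos hZ0 k
  have hone : ∀ k : ℕ, 1 ≤ Z ^ k := fun k => one_le_pow₀ hZ1
  have hσ0 : 0 < σ := lt_of_lt_of_le (hpow _) hσ98
  have hZD : ∀ k l : ℕ, k < l → 1000000000 * Z ^ k ≤ Z ^ l := fun k l hkl => by
    have h1 : 1000000000 * Z ^ k ≤ Z ^ (k + 1) := by
      rw [pow_succ']; exact mul_le_mul_of_nonneg_right hZ (hpow k).le
    exact h1.trans (pow_le_pow_right₀ hZ1 (by omega))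
  obtain ⟨D, hD⟩ : ∃ D, D = σ / Z ^ 16 / 4 := ⟨_, rfl⟩
  rw [← hD] at hN hR hg hρp ⊢
  have hD0 : 0 < D := by rw [hD]; have := hpow 16; positivity
  have hDσ : 4 * D ≤ σ := by
    have : 4 * D = σ / Z ^ 16 := by rw [hD]; ring
    rw [this]; exact div_le_self hσ0.le (hone 16)
  obtain ⟨w, hw⟩ : ∃ w, w = Z ^ 4 := ⟨_, rfl⟩
  have hw1 : 1000000000 ≤ w := by rw [hw]; have := hZD 0 4 (by norm_num); norm_num at this; exact this
  have hnw : (Fintype.card V : ℝ) ≤ Real.exp w := by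
    have h1 : (Fintype.card V : ℝ) ≤ 2 ^ z ^ 4 := by exact_mod_cast hnle
    refine h1.trans ?_
    have h2 : Real.exp w = Real.exp 1 ^ z ^ 4 := by
      rw [← Real.exp_nat_mul, hw, hZdef]; push_cast; rw [mul_one]
    rw [h2]
    have := Real.exp_one_gt_d9
    exact pow_le_pow_left₀ (by norm_num) (by linarith) _
  set J : V → Finset V := fun v => Finset.univ.filter fun u => G.Adj v u ∧ u ≠ x0 with hJ
  have hfib : ∀ v (e : Sym2 V), ((J v).filter fun u => s(v, u) = e).card ≤ 1 := fun v e => by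
    have := card_filter_eq_le_one (J v) (fun u => s(v, u))
      (fun a _ b _ hab => Sym2.congr_right.1 hab) e
    convert this
  obtain ⟨δ, hδ⟩ : ∃ δ : ℝ, δ = dg G x0 Finset.univ := ⟨_, rfl⟩
  rw [← hδ] at hg ⊢
  -- regularity of the reserved graph
  have hU := Pr_not_upperReg_le hμ isR (θ := ρ) (A' := Z ^ 10) (ε := 1 / Z ^ 5)
    (x := 1 / Z ^ 5 / 8) (w := w) hρ0 (fun e => (hμR e).le) hup (by
      have h1 := h.σ_le
      by_contra hneg
      have h2 := mul_nonneg (show 0 ≤ -p by linarith) (Nat.cast_nonneg (α := ℝ) (Fintype.card V))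
      have h3 : 0 < σ ^ 2 := by positivity
      linarith) (by have := hpow 5; positivity)
    (by
      have := (div_le_one (hpow 5)).2 (hone 5)
      linarith)
    (by
      obtain ⟨e, he⟩ : ∃ e, e = 1 / Z ^ 5 := ⟨_, rfl⟩
      have h0 : 0 ≤ e := by rw [he]; have := hpow 5; positivity
      have h1 : e ≤ 1 := by rw [he]; exact (div_le_one (hpow 5)).2 (hone 5)
      rw [← he]
      have := mul_le_mul_of_nonneg_left h1 h0
      linarith)
    (by
      have h1 : 4 * w / (1 / Z ^ 5 / 8) = 32 * Z ^ 9 := by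
        have := (hpow 5).ne'
        rw [hw]; field_simp; norm_num
      have h2 : 1 / Z ^ 5 / 8 ≤ 1 := by
        have := (div_le_one (hpow 5)).2 (hone 5)
        linarith
      have h3 : (1 + 1 / Z ^ 5 / 8) * (ρ * (32 * Z ^ 9)) ≤ 2 * (1 / 2 * (32 * Z ^ 9)) := by
        have h9 := hpow 9
        exact mul_le_mul (by linarith) (mul_le_mul_of_nonneg_right hρ1 (by positivity))
          (by positivity) (by norm_num)
      have h4 := hZD 9 10 (by norm_num)
      have h9 := hpow 9
      rw [h1]; linarith) (by linarith) hnw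
  -- concentration of degrees
  have hexp : ∀ t, 2 * w ≤ t → Real.exp (-(t / (1 : ℕ))) ≤ Real.exp (-w) * Real.exp (-w) := by
    intro t ht
    rw [← Real.exp_add]
    apply Real.exp_le_exp.2
    push_cast; linarith
  have hT : ∀ v ≠ x0, g v + D ≤ 3 * (Z ^ 3 * σ) := fun v _ => by
    have h1 := hgup v
    have h2 := mul_le_mul_of_nonneg_right (hone 3) hσ0.le
    linarith
  obtain ⟨s, hs⟩ : ∃ s, s = σ / Z ^ 42 := ⟨_, rfl⟩
  have hs0 : 0 < s := by rw [hs]; have := hpow 42; positivity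
  have hsσ : σ = s * Z ^ 42 := by rw [hs]; have := (hpow 42).ne'; field_simp
  have hs38 : σ / Z ^ 38 = s * Z ^ 4 := by rw [hsσ]; have := (hpow 38).ne'; field_simp
  have hs39 : σ / Z ^ 39 = s * Z ^ 3 := by rw [hsσ]; have := (hpow 38).ne'; field_simp
  have hs56 : Z ^ 56 ≤ s := by
    rw [hs, le_div_iff₀ (hpow 42), ← pow_add]; exact hσ98
  rw [← hs] at hN
  have hx0 : (0 : ℝ) ≤ 1 / Z ^ 42 := by have := hpow 42; positivity
  have hx1 : 1 / Z ^ 42 ≤ 1 := (div_le_one (hpow 42)).2 (hone 42)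
  have hxt : 2 * w ≤ 1 / Z ^ 42 * (s * Z ^ 3) := by
    rw [div_mul_eq_mul_div, le_div_iff₀ (hpow 42), hw]
    have h1 := mul_le_mul_of_nonneg_right hs56 (hpow 3).le
    have h2 := hZD 46 59 (by norm_num)
    have h3 := hpow 46
    have h4 : Z ^ 56 * Z ^ 3 = Z ^ 59 := by ring
    have h5 : 2 * Z ^ 4 * Z ^ 42 = 2 * Z ^ 46 := by ring
    linarith
  have hA1 : ∀ v ∈ Finset.univ.erase x0, Pr μ (fun ω => (1 + 1 / Z ^ 42) * (g v + D + s) +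
      s * Z ^ 3 ≤ (((J v).filter fun u => isN (ω s(v, u))).card : ℝ)) ≤
      Real.exp (-w) * Real.exp (-w) := by
    intro v hv
    refine (Pr_card_ge (J v) (fun u => s(v, u)) (fun _ k => isN k) hμ one_pos
      (fun e => by convert hfib v e) ?_
      hx0 hx1).trans (hexp _ hxt)
    simp_rw [hμN, hy]
    have := (abs_le.1 (hN v (Finset.ne_of_mem_erase hv))).2
    simp_rw [mul_comm (g v) (g _)]
    linarith
  have hA2 : ∀ v ∈ Finset.univ.erase x0, Pr μ (fun ω =>
      (((J v).filter fun u => isN (ω s(v, u))).card : ℝ) ≤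
      (1 - 1 / Z ^ 42) * (g v + D - s) - s * Z ^ 3) ≤
      Real.exp (-w) * Real.exp (-w) := by
    intro v hv
    refine (Pr_card_le (J v) (fun u => s(v, u)) (fun _ k => isN k) hμ one_pos
      (fun e => by convert hfib v e) ?_
      hx0 hx1).trans (hexp _ hxt)
    simp_rw [hμN, hy]
    have := (abs_le.1 (hN v (Finset.ne_of_mem_erase hv))).1
    simp_rw [mul_comm (g v) (g _)]
    linarith
  obtain ⟨e, he⟩ : ∃ e, e = 1 / Z ^ 5 := ⟨_, rfl⟩
  have he0 : 0 < e := by rw [he]; have := hpow 5; positivity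
  have he1 : e ≤ 1 := by rw [he]; exact (div_le_one (hpow 5)).2 (hone 5)
  have heZ : e * Z ^ 5 = 1 := by rw [he]; exact div_mul_cancel₀ _ (hpow 5).ne'
  rw [← he] at hR hU ⊢
  have hA3 : ∀ v ∈ Finset.univ.erase x0, Pr μ (fun ω =>
      (((J v).filter fun u => isR (ω s(v, u))).card : ℝ) ≤
      (1 - e / 8) * ((1 - e / 8) * D) - e / 8 * D) ≤ Real.exp (-w) * Real.exp (-w) := by
    intro v hv
    refine (Pr_card_le (J v) (fun u => s(v, u)) (fun _ k => isR k) hμ one_pos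
      (fun e => by convert hfib v e) ?_
      (by positivity) (by linarith)).trans (hexp _ ?_)
    · simp_rw [hμR]
      exact hR v (Finset.ne_of_mem_erase hv)
    · have h1 : D * 4 * Z ^ 16 = σ := by rw [hD]; have := (hpow 16).ne'; field_simp
      have h2 : 2 * w * Z ^ 10 * (256 * Z ^ 16) ≤ e / 8 * (e / 8 * D) * Z ^ 10 * (256 * Z ^ 16) := by
        have h3 : e / 8 * (e / 8 * D) * Z ^ 10 * (256 * Z ^ 16) = (e * Z ^ 5) ^ 2 * (D * 4 * Z ^ 16) := by
          ring
        rw [h3, heZ, h1, hw]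
        have h4 : 2 * Z ^ 4 * Z ^ 10 * (256 * Z ^ 16) = 512 * Z ^ 30 := by ring
        have h5 := hZD 30 98 (by norm_num)
        have h6 := hpow 30
        rw [h4]; linarith
      have h3 := le_of_mul_le_mul_right h2 (by have := hpow 16; positivity)
      exact le_of_mul_le_mul_right h3 (hpow 10)
  have hP1 := Pr_exists_le_card hμ _ _ hA1
  have hP2 := Pr_exists_le_card hμ _ _ hA2
  have hP3 := Pr_exists_le_card hμ _ _ hA3
  have hcard : ((Finset.univ.erase x0).card : ℝ) * (Real.exp (-w) * Real.exp (-w)) ≤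
      Real.exp (-w) := by
    have h1 : ((Finset.univ.erase x0).card : ℝ) ≤ Fintype.card V := by
      exact_mod_cast (Finset.card_le_univ _)
    have h2 : Real.exp w * (Real.exp (-w) * Real.exp (-w)) = Real.exp (-w) := by
      rw [← mul_assoc, ← Real.exp_add]; simp
    have := mul_le_mul_of_nonneg_right (h1.trans hnw)
      (mul_pos (Real.exp_pos (-w)) (Real.exp_pos (-w))).le
    linarith
  have hsmall : 7 * Real.exp (-w) < 1 := by
    have h1 := Real.add_one_le_exp w
    have h2 : Real.exp w * Real.exp (-w) = 1 := by rw [← Real.exp_add]; simp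
    have h3 := mul_le_mul_of_nonneg_right h1 (Real.exp_pos (-w)).le
    have h4 := mul_le_mul_of_nonneg_right (show 8 ≤ w + 1 by linarith) (Real.exp_pos (-w)).le
    have h5 := Real.exp_pos (-w)
    linarith
  obtain ⟨ω, hω⟩ := exists_not_of_Pr_lt_one hμ (lt_of_le_of_lt ((Pr_or_le hμ _ _).trans
    (add_le_add ((Pr_or_le hμ _ _).trans (add_le_add ((Pr_or_le hμ _ _).trans
      (add_le_add hP1 hP2)) hP3)) hU)) (by linarith))
  push Not at hω
  obtain ⟨⟨⟨h1, h2⟩, h3⟩, h4⟩ := hω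
  have hKx : dg (edgeFilter G fun f => ¬ isN (ω f) ∨ x0 ∈ f) x0 Finset.univ =
      dg G x0 Finset.univ := by
    unfold dg
    congr 1
    ext u
    simp [edgeFilter_adj]
  refine ⟨edgeFilter G fun f => ¬ isN (ω f) ∨ x0 ∈ f, edgeFilter G fun f => isR (ω f) ∧ x0 ∉ f,
    fun u v huv => huv.1, fun u v huv => huv.1, ?_, hKx, ?_, ?_, ?_⟩
  · refine disjoint_of_adj fun u v huv huv' => ?_
    have := hRN _ huv'.2.1
    have h5 := huv.2
    have h6 := huv'.2.2
    tauto
  · intro v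
    by_cases hv : v = x0
    · rw [hv, hKx, hδ, sub_self, abs_zero, hs38]
      have := hpow 4
      positivity
    · have hmem := Finset.mem_erase.2 ⟨hv, Finset.mem_univ v⟩
      have h5 := h1 v hmem
      have h6 := h2 v hmem
      have h7 := dg_edgeFilter_add G (fun f => ¬ isN (ω f) ∨ x0 ∈ f) (fun f => isN (ω f)) v x0 hv
        (fun u hu => by
          have : x0 ∉ s(v, u) := by rw [Sym2.mem_iff]; tauto
          tauto) (Or.inr (Sym2.mem_mk_right _ _))
      obtain ⟨k, hk⟩ : ∃ k, k = ((J v).filter fun u => isN (ω s(v, u))).card := ⟨_, rfl⟩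
      rw [← hk] at h5 h6
      have h7' : dg (edgeFilter G fun f => ¬ isN (ω f) ∨ x0 ∈ f) v Finset.univ + k =
          dg G v Finset.univ := by rw [hk]; convert h7
      have h8 : (dg (edgeFilter G fun f => ¬ isN (ω f) ∨ x0 ∈ f) v Finset.univ : ℝ) + k =
          dg G v Finset.univ := by exact_mod_cast h7'
      have h9 := hg v hv
      have h10 : 1 / Z ^ 42 * (3 * (Z ^ 3 * σ)) = 3 * (s * Z ^ 3) := by
        rw [hsσ]; have := (hpow 42).ne'; field_simp
      have h11 := mul_le_mul_of_nonneg_left (hT v hv) hx0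
      have h12 := mul_le_mul_of_nonneg_right hx1 hs0.le
      have h13 := mul_le_mul_of_nonneg_left (hZD 3 4 (by norm_num)) hs0.le
      have h14 := mul_le_mul_of_nonneg_left (hone 3) hs0.le
      have h15 := mul_nonneg hx0 hs0.le
      rw [hs38, abs_le]
      constructor <;> linarith
  · rw [← hρp]
    refine h4.mono fun u v huv => ⟨huv.1, huv.2.1⟩
  · intro v hv
    have h5 := h3 v (Finset.mem_erase.2 ⟨hv, Finset.mem_univ v⟩)
    have h6 : ((J v).filter fun u => isR (ω s(v, u))).card ≤
        dg (edgeFilter G fun f => isR (ω f) ∧ x0 ∉ f) v Finset.univ := by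
      refine Finset.card_le_card fun u hu => ?_
      simp only [hJ, Finset.mem_filter, Finset.mem_univ, true_and, edgeFilter_adj,
        Sym2.mem_iff] at hu ⊢
      obtain ⟨⟨a, b⟩, c⟩ := hu
      exact ⟨a, c, by rintro (h | h) <;> [exact hv h.symm; exact b h.symm]⟩
    have h7 : (((J v).filter fun u => isR (ω s(v, u))).card : ℝ) ≤
        dg (edgeFilter G fun f => isR (ω f) ∧ x0 ∉ f) v Finset.univ := by exact_mod_cast h6
    have h8 := mul_nonneg (mul_nonneg he0.le he0.le) hD0.le
    have h9 := mul_nonneg he0.le hD0.le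
    linarith

end Kept

lemma card_filter_val_lt_two_pow {T m : ℕ} (hm : m ≤ T) (P : Fin (2 ^ T) → Prop)
    (hP : ∀ k, P k ↔ k.val < 2 ^ m) : (Finset.univ.filter P).card = 2 ^ m := by
  have h2 : 2 ^ m ≤ 2 ^ T := Nat.pow_le_pow_right (by norm_num) hm
  have h3 := Fin.card_filter_val_lt (n := 2 ^ T) (m := 2 ^ m)
  rw [min_eq_right h2] at h3
  rw [← h3]
  congr 1
  ext k
  simp only [Finset.mem_filter, Finset.mem_univ, true_and]
  exact hP k

lemma exists_levels (ι : Type) [Fintype ι] (T : ℕ) :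
    ∃ (μ : ι → Fin (2 ^ T) → ℝ) (low : ℕ → Fin (2 ^ T) → Prop) (φ : ℕ → ℝ), IsProb μ ∧
      (∀ k, ¬ low T k) ∧ (∀ i < T, ∀ k, low (i + 1) k → low i k) ∧ φ T = 0 ∧
      (∀ i < T, φ i = 1 / 2 ^ (i + 1)) ∧
      ∀ i j, ∑ k ∈ Finset.univ.filter (low i), μ j k = φ i := by
  obtain ⟨low, hlow⟩ : ∃ low : ℕ → Fin (2 ^ T) → Prop,
    ∀ i k, low i k ↔ i < T ∧ k.val < 2 ^ (T - (i + 1)) := ⟨_, fun _ _ => Iff.rfl⟩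
  refine ⟨unif ι (Fin (2 ^ T)), low,
    fun i => if i < T then 1 / 2 ^ (i + 1) else 0, isProb_unif, fun k h => lt_irrefl _ ((hlow _ _).1 h).1,
    fun i hi k hk => (hlow _ _).2 ⟨hi, ((hlow _ _).1 hk).2.trans_le
      (Nat.pow_le_pow_right (by norm_num) (by omega))⟩,
    if_neg (lt_irrefl _), fun i hi => if_pos hi, fun i j => ?_⟩
  unfold unif
  rw [Finset.sum_const, nsmul_eq_mul]
  dsimp only
  split_ifs with hi
  · rw [card_filter_val_lt_two_pow (m := T - (i + 1)) (by omega) _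
      fun k => (hlow i k).trans (and_iff_right hi), Fintype.card_fin]
    have h3 : 2 ^ T = 2 ^ (T - (i + 1)) * 2 ^ (i + 1) := by rw [← pow_add]; congr 1; omega
    rw [h3]
    push_cast
    field_simp
  · rw [Finset.filter_false_of_mem fun k _ h => hi ((hlow i k).1 h).1]; simp

lemma exists_scale {a b : ℝ} (hb : 0 < b) (hab : b < a) :
    ∃ T : ℕ, 0 < T ∧ a * (1 / 2 ^ T) ≤ b ∧ b / 2 < a * (1 / 2 ^ T) := by
  have hex : ∃ T : ℕ, a * (1 / 2 ^ T) ≤ b := by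
    obtain ⟨T, hT⟩ := exists_pow_lt_of_lt_one (show 0 < b / a from div_pos hb (hb.trans hab))
      (show (1 / 2 : ℝ) < 1 by norm_num)
    refine ⟨T, ?_⟩
    rw [lt_div_iff₀ (hb.trans hab), one_div_pow] at hT
    linarith
  refine ⟨Nat.find hex, ?_, Nat.find_spec hex, ?_⟩
  · rw [Nat.find_pos]; norm_num; exact hab
  · have h0 : 0 < Nat.find hex := by rw [Nat.find_pos]; norm_num; exact hab
    have := Nat.find_min hex (Nat.sub_lt h0 one_pos)
    obtain ⟨l, hl⟩ : ∃ l, Nat.find hex = l + 1 := ⟨Nat.find hex - 1, by omega⟩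
    rw [hl] at this ⊢
    rw [Nat.add_sub_cancel] at this
    push Not at this
    have h3 : a * (1 / 2 ^ (l + 1)) = a * (1 / 2 ^ l) / 2 := by rw [pow_succ]; field_simp
    linarith

section
variable {V : Type} [Fintype V]

lemma dg_sdiff_add_of_le {G H : SimpleGraph V} (h : H ≤ G) (v : V) :
    dg (G \ H) v Finset.univ + dg H v Finset.univ = dg G v Finset.univ := by
  have h3 := dg_sup_of_disjoint (disjoint_sdiff_self_right (x := H) (y := G)) v Finset.univ
  rw [sup_sdiff_cancel_right h] at h3
  omega

lemma dg_edgeFilter_not (G : SimpleGraph V) (c : Sym2 V → Prop) (v : V) :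
    dg (edgeFilter G fun e => ¬ c e) v Finset.univ +
      ((Finset.univ.filter (G.Adj v)).filter fun u => c s(v, u)).card = dg G v Finset.univ := by
  unfold dg
  rw [← Finset.card_union_of_disjoint]
  · congr 1
    ext u
    simp only [Finset.mem_union, Finset.mem_filter, Finset.mem_univ, true_and, edgeFilter_adj]
    tauto
  · rw [Finset.disjoint_left]
    intro u h1 h2
    simp only [Finset.mem_filter, Finset.mem_univ, true_and, edgeFilter_adj] at h1 h2
    exact h1.2 h2.2

set_option maxHeartbeats 1600000 in
theorem Typical.exists_split {G : SimpleGraph V} {z : ℕ} {p σ : ℝ} {x0 : V}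
    (h : Typical G z p σ x0) : ∃ (T : ℕ) (qR : ℝ) (q : ℕ → ℝ) (P : ℕ → SimpleGraph V)
      (R : SimpleGraph V), Split G z T (dg G x0 Finset.univ) p qR q x0 P R := by
  obtain ⟨K, R, hKG, hRG, hKR, hKx, hKd, hRup, hRd⟩ := h.exists_kept
  obtain ⟨δ, hδ⟩ : ∃ δ : ℕ, δ = dg G x0 Finset.univ := ⟨_, rfl⟩
  have hx0deg := h.degs x0
  rw [← hδ] at hKx hKd hx0deg ⊢
  have hZ : (1000000000 : ℝ) ≤ z := by exact_mod_cast h.z_ge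
  have hσ98 := h.σ_ge
  have hσ2 := h.σ_le
  have hp1 := h.p1
  have hup := h.up
  have hnle := h.n_le
  obtain ⟨Z, hZdef⟩ : ∃ Z : ℝ, Z = z := ⟨_, rfl⟩
  rw [← hZdef] at hZ hσ98 hup hKd hRup hRd hx0deg
  obtain ⟨n, hndef⟩ : ∃ n : ℝ, n = Fintype.card V := ⟨_, rfl⟩
  rw [← hndef] at hσ2 hRup hx0deg
  have hZ1 : 1 ≤ Z := by linarith
  have hZ0 : 0 < Z := by linarith
  have hpow : ∀ k, 0 < Z ^ k := fun k => pow_pos hZ0 k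
  have hone : ∀ k : ℕ, 1 ≤ Z ^ k := fun k => one_le_pow₀ hZ1
  have hσ0 : 0 < σ := lt_of_lt_of_le (hpow _) hσ98
  have hZD : ∀ k l : ℕ, k < l → 1000000000 * Z ^ k ≤ Z ^ l := fun k l hkl => by
    have h1 : 1000000000 * Z ^ k ≤ Z ^ (k + 1) := by
      rw [pow_succ']; exact mul_le_mul_of_nonneg_right hZ (hpow k).le
    exact h1.trans (pow_le_pow_right₀ hZ1 (by omega))
  have hpn0 : 0 < p * n := lt_of_lt_of_le (by positivity) hσ2
  have hn0 : 0 < n := by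
    have h0 : 0 ≤ n := by rw [hndef]; exact Nat.cast_nonneg _
    rcases h0.eq_or_lt with h0 | h0
    · rw [← h0, mul_zero] at hpn0; exact absurd hpn0 (lt_irrefl _)
    · exact h0
  have hp0 : 0 < p := pos_of_mul_pos_left hpn0 hn0.le
  obtain ⟨N, hN⟩ : ∃ N, N = p * n := ⟨_, rfl⟩
  rw [← hN] at hσ2 hpn0 hx0deg
  have hNσ : Z ^ 98 * σ ≤ N := by
    refine le_trans ?_ hσ2
    rw [sq]; exact mul_le_mul_of_nonneg_right hσ98 hσ0.le
  have hNn : N ≤ n := by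
    have := mul_le_mul_of_nonneg_right hp1 hn0.le
    linarith
  obtain ⟨D, hD⟩ : ∃ D, D = σ / Z ^ 16 / 4 := ⟨_, rfl⟩
  rw [← hD] at hRup hRd
  have hDσ : D * Z ^ 16 * 4 = σ := by rw [hD]; have := hpow 16; field_simp
  have hD0 : 0 < D := by rw [hD]; have := hpow 16; positivity
  have hD82 : Z ^ 82 ≤ 4 * D := by
    have h1 : Z ^ 82 * Z ^ 16 ≤ 4 * D * Z ^ 16 := by
      rw [← pow_add]; refine hσ98.trans (le_of_eq ?_); rw [← hDσ]; ring
    exact le_of_mul_le_mul_right h1 (hpow 16)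
  have hDσ' : 4 * D ≤ σ := by
    have := mul_le_mul_of_nonneg_left (hone 16) hD0.le
    linarith
  -- the minimum degree
  obtain ⟨l, hl⟩ : ∃ l, l = 1 / Z ^ 16 := ⟨_, rfl⟩
  have hlZ : l * Z ^ 16 = 1 := by rw [hl]; exact div_mul_cancel₀ _ (hpow 16).ne'
  have hl0 : 0 < l := by rw [hl]; have := hpow 16; positivity
  have hl1 : l ≤ 1 / 1000000000 := by
    rw [hl]
    apply one_div_le_one_div_of_le (by norm_num)
    have := hZD 0 16 (by norm_num); norm_num at this; exact this
  have hδN : |(δ : ℝ) - N| ≤ l * N := by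
    refine hx0deg.trans ?_
    rw [hl, div_mul_eq_mul_div, one_mul, le_div_iff₀ (hpow 16)]
    have h1 : Z ^ 3 * σ * Z ^ 16 = Z ^ 19 * σ := by ring
    rw [h1]
    exact (mul_le_mul_of_nonneg_right (pow_le_pow_right₀ hZ1 (by norm_num)) hσ0.le).trans hNσ
  have hlN : l * N ≤ N / 1000000000 := by
    have := mul_le_mul_of_nonneg_right hl1 hpn0.le
    linarith
  have hδ1 := (abs_le.1 hδN).1
  have hδ2 := (abs_le.1 hδN).2
  obtain ⟨e, he⟩ : ∃ e, e = 1 / Z ^ 5 := ⟨_, rfl⟩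
  have he0 : 0 < e := by rw [he]; have := hpow 5; positivity
  have he1 : e ≤ 1 := by rw [he]; exact (div_le_one (hpow 5)).2 (hone 5)
  have heZ : e * Z ^ 5 = 1 := by rw [he]; exact div_mul_cancel₀ _ (hpow 5).ne'
  have hle : 1000000000 * l ≤ e := by
    rw [hl, he, mul_one_div, div_le_div_iff₀ (hpow 16) (hpow 5), one_mul]
    exact hZD 5 16 (by norm_num)
  rw [← he] at hRup hRd
  have heD0 : 0 < e / 10 * D := by positivity
  have heD : e / 10 * D ≤ D := by
    have := mul_le_mul_of_nonneg_right he1 hD0.le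
    linarith
  have hND : 1000 * D ≤ N := by
    have h1 := mul_le_mul_of_nonneg_right (hone 98) hσ0.le
    have h2 := mul_le_mul_of_nonneg_right (hZD 0 98 (by norm_num)) hσ0.le
    rw [pow_zero, mul_one] at h2
    linarith
  obtain ⟨T, hT0, hT1, hT2⟩ := exists_scale (a := (δ : ℝ)) heD0 (by linarith)
  -- lower bound for all scales
  have hscale : ∀ i ≤ T, e / 20 * D ≤ δ * (1 / 2 ^ i) := fun i hi => by
    have h1 : (1 : ℝ) / 2 ^ T ≤ 1 / 2 ^ i :=
      one_div_le_one_div_of_le (by positivity) (pow_le_pow_right₀ (by norm_num) hi)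
    have := mul_le_mul_of_nonneg_left h1 (Nat.cast_nonneg (α := ℝ) δ)
    linarith
  have hed : e / 20 * D * Z ^ 21 * 80 = σ := by
    have : e / 20 * D * Z ^ 21 * 80 = (e * Z ^ 5) * (D * Z ^ 16 * 4) := by ring
    rw [this, heZ, hDσ, one_mul]
  obtain ⟨ν, hν⟩ : ∃ ν, ν = σ / Z ^ 38 := ⟨_, rfl⟩
  have hν0 : 0 < ν := by rw [hν]; have := hpow 38; positivity
  have hνl : ν ≤ l / 4 * (e / 20 * D) := by
    rw [hν, div_le_iff₀ (hpow 38)]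
    have h1 : l / 4 * (e / 20 * D) * Z ^ 38 * 320 = (l * Z ^ 16) * (e / 20 * D * Z ^ 21 * 80) * Z := by
      ring
    rw [hlZ, hed] at h1
    have := mul_le_mul_of_nonneg_left hZ hσ0.le
    linarith
  rw [← hν] at hKd
  have hνa : ∀ i ≤ T, ν ≤ l / 4 * (δ * (1 / 2 ^ i)) := fun i hi => by
    have := mul_le_mul_of_nonneg_left (hscale i hi) (show 0 ≤ l / 4 by positivity)
    linarith
  obtain ⟨w, hw⟩ : ∃ w, w = Z ^ 4 := ⟨_, rfl⟩
  have hw1 : 1000000000 ≤ w := by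
    rw [hw]; have := hZD 0 4 (by norm_num); norm_num at this; exact this
  have hnw : n ≤ Real.exp w := by
    have h1 : n ≤ 2 ^ z ^ 4 := by rw [hndef]; exact_mod_cast hnle
    refine h1.trans ?_
    have h2 : Real.exp w = Real.exp 1 ^ z ^ 4 := by
      rw [← Real.exp_nat_mul, hw, hZdef]; push_cast; rw [mul_one]
    rw [h2]
    have := Real.exp_one_gt_d9
    exact pow_le_pow_left₀ (by norm_num) (by linarith) _
  have hTw : (T : ℝ) ≤ Real.exp w := by
    refine le_trans ?_ hnw
    have h1 : (T : ℝ) ≤ 2 ^ T := by exact_mod_cast (Nat.lt_two_pow_self (n := T)).le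
    have h2 : 1 ≤ e / 20 * D := by
      have h3 : 1 * Z ^ 21 ≤ e / 20 * D * Z ^ 21 := by
        have := hZD 21 98 (by norm_num)
        have h4 := hpow 21
        linarith
      exact le_of_mul_le_mul_right h3 (hpow 21)
    have h3 := hscale T le_rfl
    have h4 : (2 : ℝ) ^ T ≤ δ := by
      have h5 := h2.trans h3
      rw [mul_one_div, le_div_iff₀ (by positivity)] at h5
      linarith
    have h5 : (δ : ℝ) ≤ n := by
      rw [hδ, hndef]; exact_mod_cast Finset.card_le_univ _
    linarith
  obtain ⟨μ, low, φ, hμ, hlowT, hlow, hφT, hφ, hφs⟩ := exists_levels (Sym2 V) T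
  have hθ : ∀ i < T, 1 / 2 ^ (i + 2) ≤ φ i - φ (i + 1) ∧ φ i - φ (i + 1) ≤ 1 / 2 ^ (i + 1) := by
    intro i hi
    have h0 : (1 : ℝ) / 2 ^ (i + 1) = 2 * (1 / 2 ^ (i + 2)) := by
      rw [pow_succ 2 (i + 1)]; field_simp
    have h1 : (0 : ℝ) < 1 / 2 ^ (i + 2) := by positivity
    rw [hφ i hi]
    rcases Nat.lt_or_ge (i + 1) T with h2 | h2
    · rw [hφ _ h2]; constructor <;> linarith
    · have : i + 1 = T := by omega
      rw [this, hφT, ← this]; constructor <;> linarith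
  have hθs : ∀ i < T, ∀ j, ∑ k ∈ Finset.univ.filter (fun k => low i k ∧ ¬ low (i + 1) k), μ j k ≤
      φ i - φ (i + 1) := by
    intro i hi j
    rw [← hφs i j, ← hφs (i + 1) j, ← Finset.sum_sdiff (s₁ := Finset.univ.filter (low (i + 1)))
      (s₂ := Finset.univ.filter (low i))
      (fun k hk => by simp only [Finset.mem_filter, Finset.mem_univ, true_and] at hk ⊢; exact hlow i hi k hk)]
    rw [add_sub_cancel_right]
    apply le_of_eq
    congr 1
    ext k
    simp
  -- concentration
  have hexp : ∀ t, 4 * w ≤ t → Real.exp (-(t / (1 : ℕ))) ≤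
      Real.exp (-w) * Real.exp (-w) * (Real.exp (-w) * Real.exp (-w)) := by
    intro t ht
    simp only [← Real.exp_add]
    apply Real.exp_le_exp.2
    push_cast; linarith
  have hfib : ∀ v (f : Sym2 V), ((Finset.univ.filter (K.Adj v)).filter fun u => s(v, u) = f).card ≤ 1 :=
    fun v f => by
      have := card_filter_eq_le_one (Finset.univ.filter (K.Adj v)) (fun u => s(v, u))
        (fun a _ b _ hab => Sym2.congr_right.1 hab) f
      convert this
  have hmean : ∀ i v, ∑ u ∈ Finset.univ.filter (K.Adj v),
      ∑ k ∈ Finset.univ.filter (low i), μ s(v, u) k = dg K v Finset.univ * φ i := by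
    intro i v
    simp_rw [hφs]
    rw [Finset.sum_const, nsmul_eq_mul]; rfl
  have hxt : ∀ i < T, 4 * w ≤ l / 8 * (l / 8 * (δ * (1 / 2 ^ (i + 1)))) := by
    intro i hi
    have h1 := mul_le_mul_of_nonneg_left (hscale (i + 1) hi)
      (show 0 ≤ l / 8 * (l / 8) by positivity)
    have h2 : 4 * w * Z ^ 53 ≤ l / 8 * (l / 8) * (e / 20 * D) * Z ^ 53 := by
      have h3 : l / 8 * (l / 8) * (e / 20 * D) * Z ^ 53 * 5120 =
        (l * Z ^ 16) ^ 2 * (e / 20 * D * Z ^ 21 * 80) := by ring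
      rw [hlZ, hed] at h3
      have h4 : 4 * w * Z ^ 53 = 4 * Z ^ 57 := by rw [hw]; ring
      have h5 := hZD 57 98 (by norm_num)
      have h6 := hpow 57
      rw [h4]; linarith
    have := le_of_mul_le_mul_right h2 (hpow 53)
    linarith
  have hA1 : ∀ a ∈ Finset.univ (α := V) ×ˢ Finset.range T, Pr μ (fun ω =>
      (1 + l / 8) * (dg K a.1 Finset.univ * φ a.2) + l / 8 * (δ * (1 / 2 ^ (a.2 + 1))) ≤
      (((Finset.univ.filter (K.Adj a.1)).filter fun u => low a.2 (ω s(a.1, u))).card : ℝ)) ≤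
      Real.exp (-w) * Real.exp (-w) * (Real.exp (-w) * Real.exp (-w)) := by
    intro a ha
    exact (Pr_card_ge (Finset.univ.filter (K.Adj a.1)) (fun u => s(a.1, u)) (fun _ k => low a.2 k)
      hμ one_pos (fun f => by convert hfib a.1 f) (hmean a.2 a.1).le (by positivity)
      (by linarith)).trans (hexp _ (hxt a.2 (Finset.mem_range.1 (Finset.mem_product.1 ha).2)))
  have hA2 : ∀ a ∈ Finset.univ (α := V) ×ˢ Finset.range T, Pr μ (fun ω =>
      (((Finset.univ.filter (K.Adj a.1)).filter fun u => low a.2 (ω s(a.1, u))).card : ℝ) ≤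
      (1 - l / 8) * (dg K a.1 Finset.univ * φ a.2) - l / 8 * (δ * (1 / 2 ^ (a.2 + 1)))) ≤
      Real.exp (-w) * Real.exp (-w) * (Real.exp (-w) * Real.exp (-w)) := by
    intro a ha
    exact (Pr_card_le (Finset.univ.filter (K.Adj a.1)) (fun u => s(a.1, u)) (fun _ k => low a.2 k)
      hμ one_pos (fun f => by convert hfib a.1 f) (hmean a.2 a.1).ge (by positivity)
      (by linarith)).trans (hexp _ (hxt a.2 (Finset.mem_range.1 (Finset.mem_product.1 ha).2)))
  have hU : ∀ i ∈ Finset.range T, Pr μ (fun ω => ¬ UpperReg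
      (edgeFilter G fun f => low i (ω f) ∧ ¬ low (i + 1) (ω f)) ((φ i - φ (i + 1)) * p) (Z ^ 10) e) ≤
      4 * Real.exp (-(3 * w)) := by
    intro i hi
    have hθi := hθ i (Finset.mem_range.1 hi)
    have h12 : (0 : ℝ) < 1 / 2 ^ (i + 2) := by positivity
    have h11 : (1 : ℝ) / 2 ^ (i + 1) ≤ 1 :=
      (div_le_one (by positivity)).2 (one_le_pow₀ (by norm_num))
    refine Pr_not_upperReg_le hμ (fun k => low i k ∧ ¬ low (i + 1) k) (x := e / 8) (by linarith)
      (fun f => by convert hθs i (Finset.mem_range.1 hi) f) hup hp0.le (by positivity) (by linarith) ?_ ?_ (by linarith) ?_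
    · rw [← he]
      have := mul_le_mul_of_nonneg_left he1 he0.le
      linarith
    · have h1 : 4 * (3 * w) / (e / 8) = 96 * Z ^ 9 := by
        have := (hpow 5).ne'
        rw [hw, he]; field_simp; norm_num
      have h3 : (1 + e / 8) * ((φ i - φ (i + 1)) * (32 * Z ^ 9)) ≤ 2 * (1 * (32 * Z ^ 9)) := by
        have h9 := hpow 9
        exact mul_le_mul (by linarith) (mul_le_mul_of_nonneg_right (by linarith) (by positivity))
          (mul_nonneg (by linarith) (by positivity)) (by norm_num)
      have h4 := hZD 9 10 (by norm_num)
      have h9 := hpow 9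
      rw [h1]; linarith
    · rw [← hndef]
      exact hnw.trans (Real.exp_le_exp.2 (by linarith))
  have hP1 := Pr_exists_le_card hμ _ _ hA1
  have hP2 := Pr_exists_le_card hμ _ _ hA2
  have hP3 := Pr_exists_le_card hμ _ _ hU
  obtain ⟨E, hE⟩ : ∃ E, E = Real.exp (-w) := ⟨_, rfl⟩
  have hE0 : 0 < E := by rw [hE]; exact Real.exp_pos _
  have hEw : Real.exp w * E = 1 := by rw [hE, ← Real.exp_add]; simp
  have hEs : 1000000000 * E ≤ 1 := by
    have h1 := Real.add_one_le_exp w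
    have h3 := mul_le_mul_of_nonneg_right (show 1000000000 ≤ Real.exp w by linarith) hE0.le
    linarith
  have hE3 : Real.exp (-(3 * w)) = E * E * E := by
    rw [hE, ← Real.exp_add, ← Real.exp_add]; congr 1; ring
  have hnE : n * E ≤ 1 := by
    have := mul_le_mul_of_nonneg_right hnw hE0.le
    linarith
  have hTE : T * E ≤ 1 := by
    have := mul_le_mul_of_nonneg_right hTw hE0.le
    linarith
  rw [← hE] at hP1 hP2
  rw [hE3] at hP3
  have hc1 : ((Finset.univ (α := V) ×ˢ Finset.range T).card : ℝ) = n * T := by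
    rw [Finset.card_product, Finset.card_univ, Finset.card_range, hndef]; push_cast; rfl
  have hP12 : n * T * (E * E * (E * E)) ≤ E * E := by
    have h1 : n * T * (E * E * (E * E)) = (n * E) * (T * E) * (E * E) := by ring
    rw [h1]
    have h2 : (n * E) * (T * E) ≤ 1 := mul_le_one₀ hnE (by positivity) hTE
    have := mul_le_mul_of_nonneg_right h2 (mul_pos hE0 hE0).le
    linarith
  have hEE : E * E ≤ E := by
    have := mul_le_mul_of_nonneg_right (show E ≤ 1 by linarith) hE0.le
    linarith
  rw [hc1] at hP1 hP2
  rw [Finset.card_range] at hP3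
  have hP3' : (T : ℝ) * (4 * (E * E * E)) ≤ 4 * E := by
    have h1 : (T : ℝ) * (4 * (E * E * E)) = (T * E) * (4 * (E * E)) := by ring
    rw [h1]
    have := mul_le_mul_of_nonneg_right hTE (show 0 ≤ 4 * (E * E) by positivity)
    linarith
  obtain ⟨ω, hω⟩ := exists_not_of_Pr_lt_one hμ (lt_of_le_of_lt ((Pr_or_le hμ _ _).trans
    (add_le_add ((Pr_or_le hμ _ _).trans (add_le_add hP1 hP2)) hP3)) (by linarith))
  push Not at hω
  obtain ⟨⟨h1, h2⟩, h3⟩ := hω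
  obtain ⟨P, hP⟩ : ∃ P : ℕ → SimpleGraph V, ∀ i, P i = edgeFilter K fun f => ¬ low i (ω f) :=
    ⟨_, fun _ => rfl⟩
  have hPT : P T = K := by
    rw [hP]; ext u v
    rw [edgeFilter_adj]
    exact ⟨fun h => h.1, fun h => ⟨h, hlowT _⟩⟩
  have hPmono : ∀ i < T, P i ≤ P (i + 1) := by
    intro i hi u v huv
    rw [hP, edgeFilter_adj] at huv ⊢
    exact ⟨huv.1, fun h => huv.2 (hlow i hi _ h)⟩
  have hdegP : ∀ i < T, ∀ v, |(dg (P i) v Finset.univ : ℝ) - δ * (1 - 1 / 2 ^ (i + 1))| ≤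
      l * (δ * (1 / 2 ^ (i + 1))) := by
    intro i hi v
    have hmem : (v, i) ∈ Finset.univ (α := V) ×ˢ Finset.range T :=
      Finset.mem_product.2 ⟨Finset.mem_univ _, Finset.mem_range.2 hi⟩
    have h4 := h1 (v, i) hmem
    have h5 := h2 (v, i) hmem
    dsimp only at h4 h5
    have h6 := dg_edgeFilter_not K (fun f => low i (ω f)) v
    rw [← hP] at h6
    obtain ⟨k, hk⟩ : ∃ k, k = ((Finset.univ.filter (K.Adj v)).filter fun u => low i (ω s(v, u))).card :=
      ⟨_, rfl⟩
    rw [← hk] at h4 h5 h6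
    have h7 : (dg (P i) v Finset.univ : ℝ) + k = dg K v Finset.univ := by exact_mod_cast h6
    have h8 := abs_le.1 (hKd v)
    obtain ⟨a, ha⟩ : ∃ a : ℝ, a = 1 / 2 ^ (i + 1) := ⟨_, rfl⟩
    have ha0 : 0 < a := by rw [ha]; positivity
    have ha1 : a ≤ 1 := by
      rw [ha]; exact (div_le_one (by positivity)).2 (one_le_pow₀ (by norm_num))
    have h9 := hνa (i + 1) hi
    rw [hφ i hi] at h4 h5
    rw [← ha] at h4 h5 h9 ⊢
    obtain ⟨d, hd⟩ : ∃ d : ℝ, d = dg K v Finset.univ := ⟨_, rfl⟩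
    rw [← hd] at h4 h5 h7 h8
    have h10 : d * a ≤ δ * a + ν := by
      have h11 := mul_le_mul_of_nonneg_right (show d ≤ δ + ν by linarith) ha0.le
      have h12 := mul_le_mul_of_nonneg_left ha1 hν0.le
      linarith
    have h11 : δ * a - ν ≤ d * a := by
      have h11 := mul_le_mul_of_nonneg_right (show δ - ν ≤ d by linarith) ha0.le
      have h12 := mul_le_mul_of_nonneg_left ha1 hν0.le
      linarith
    have h12 := mul_le_mul_of_nonneg_left h10 hl0.le
    have h13 := mul_le_mul_of_nonneg_right hl1 hν0.le
    have h14 : 0 ≤ (δ : ℝ) * a := by positivity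
    have h15 := mul_nonneg hl0.le h14
    rw [abs_le]
    constructor <;> linarith
  have hdegT : ∀ i < T, ∀ v, |(dg (P (i + 1)) v Finset.univ : ℝ) - δ * (1 - φ (i + 1))| ≤
      l * (δ * (1 / 2 ^ (i + 1))) := by
    intro i hi v
    have hnn : 0 ≤ l * (δ * (1 / 2 ^ (i + 1))) := by positivity
    rcases Nat.lt_or_ge (i + 1) T with h4 | h4
    · rw [hφ _ h4]
      refine (hdegP (i + 1) h4 v).trans ?_
      have h5 : (1 : ℝ) / 2 ^ (i + 1) = 2 * (1 / 2 ^ (i + 1 + 1)) := by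
        rw [pow_succ 2 (i + 1)]; field_simp
      rw [h5] at hnn ⊢
      linarith
    · have h5 : i + 1 = T := by omega
      rw [h5, hPT, hφT, sub_zero, mul_one]
      refine (hKd v).trans ((hνa T le_rfl).trans ?_)
      rw [h5] at hnn
      linarith
  refine ⟨T, D / n, fun i => (φ i - φ (i + 1)) * p, P, R, ?_⟩
  have hDn : D / n * n = D := div_mul_cancel₀ _ hn0.ne'
  have hqn : ∀ i, (φ i - φ (i + 1)) * p * n = (φ i - φ (i + 1)) * N := fun i => by rw [hN]; ring
  constructor
  · exact h.z_ge
  · exact h.n_le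
  · exact hPmono
  · rw [hPT]; exact hKG
  · exact hRG
  · rw [hPT]; exact hKR
  · exact hp1
  · rw [← hndef, ← hN]; linarith
  · rw [← hndef, ← hN]; linarith
  · intro i hi
    have := mul_le_mul_of_nonneg_right (hθ i hi).1 hp0.le
    rw [div_eq_mul_one_div, mul_comm]; exact this
  · intro i hi
    have := mul_le_mul_of_nonneg_right (hθ i hi).2 hp0.le
    rw [div_eq_mul_one_div, mul_comm p]; exact this
  · intro i hi
    rw [← hZdef, ← hndef, hqn]
    have h4 := mul_le_mul_of_nonneg_right (hθ i hi).1 hpn0.le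
    have h5 := hscale (i + 1) hi
    have h6 : (1 : ℝ) / 2 ^ (i + 1) = 2 * (1 / 2 ^ (i + 2)) := by
      rw [pow_succ 2 (i + 1)]; field_simp
    have h7 := mul_le_mul_of_nonneg_left (show (δ : ℝ) ≤ 2 * N by linarith)
      (show (0 : ℝ) ≤ 1 / 2 ^ (i + 1) by positivity)
    have h8 : Z ^ 52 * Z ^ 21 ≤ e / 20 * D / 4 * Z ^ 21 := by
      rw [← pow_add]
      have := hZD 73 98 (by norm_num)
      have h9 := hpow 73
      norm_num
      linarith
    have h9 := le_of_mul_le_mul_right h8 (hpow 21)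
    rw [h6] at h5 h7
    linarith
  · intro i hi
    rw [← hZdef, ← he]
    refine (h3 i (Finset.mem_range.2 hi)).mono fun u v huv => ?_
    have h4 := huv.1
    have h5 := huv.2
    rw [hP, edgeFilter_adj] at h4 h5
    rw [edgeFilter_adj]
    exact ⟨hKG h4.1, by by_contra h6; exact h5 ⟨h4.1, fun h7 => h6 ⟨h7, h4.2⟩⟩⟩
  · intro i hi v
    rw [← hZdef, ← hndef, ← he, hqn]
    have h4 := dg_sdiff_add_of_le (hPmono i hi) v
    have h5 : (dg (P (i + 1) \ P i) v Finset.univ : ℝ) + dg (P i) v Finset.univ =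
        dg (P (i + 1)) v Finset.univ := by exact_mod_cast h4
    have h6 := (abs_le.1 (hdegT i hi v)).1
    have h7 := (abs_le.1 (hdegP i hi v)).2
    rw [← hφ i hi] at h7
    obtain ⟨t, ht⟩ : ∃ t, t = φ i - φ (i + 1) := ⟨_, rfl⟩
    have h8 := hθ i hi
    have h9 : (1 : ℝ) / 2 ^ (i + 1) = 2 * (1 / 2 ^ (i + 2)) := by
      rw [pow_succ 2 (i + 1)]; field_simp
    have ht0 : 0 < t := by
      rw [ht]; exact lt_of_lt_of_le (by positivity) h8.1
    have h10 : (1 : ℝ) / 2 ^ (i + 1) ≤ 2 * t := by rw [h9, ht]; linarith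
    rw [hφ i hi] at h7
    have h11 := mul_le_mul_of_nonneg_left h10 (show (0 : ℝ) ≤ l * δ by positivity)
    have h12 : (δ : ℝ) * t = δ * (1 / 2 ^ (i + 1)) - δ * φ (i + 1) := by rw [ht, hφ i hi]; ring
    have h13 : (δ : ℝ) * t - 4 * (l * (δ * t)) ≤ dg (P (i + 1) \ P i) v Finset.univ := by
      linarith
    refine le_trans ?_ h13
    rw [← ht]
    have h14 := mul_le_mul_of_nonneg_right hδ1 ht0.le
    have h15 := mul_le_mul_of_nonneg_right (show (δ : ℝ) ≤ 2 * N by linarith)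
      (show 0 ≤ l * t by positivity)
    have h16 := mul_le_mul_of_nonneg_right hle (show 0 ≤ t * N by positivity)
    have h17 : 0 ≤ l * (t * N) := by positivity
    linarith
  · rw [← hZdef, ← hl]; exact hdegP
  · rw [hPT]; exact hKx
  · rw [div_le_one hn0]; linarith
  · rw [← hZdef, ← hndef, hDn]
    have := hZD 52 82 (by norm_num)
    have h9 := hpow 52
    linarith
  · rw [← hZdef, ← he]; exact hRup
  · rw [← hZdef, ← hndef, ← he, hDn]; exact hRd
  · rw [← hZdef, ← hndef, ← he, hDn]; exact hT1

end

section Independence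
variable {ι κ : Type} [Fintype ι] [Fintype κ] {μ : ι → κ → ℝ}

/-- `F` only depends on the coordinates in `I`. -/
def DependsOnly {β : Type} (I : ι → Prop) (F : (ι → κ) → β) : Prop :=
  ∀ ω ω', (∀ i, I i → ω i = ω' i) → F ω = F ω'

lemma Ex_mul_of_dependsOnly (hμ : IsProb μ) {I : ι → Prop} {F G : (ι → κ) → ℝ}
    (hF : DependsOnly I F) (hG : DependsOnly (fun i => ¬ I i) G) :
    Ex μ (fun ω => F ω * G ω) = Ex μ F * Ex μ G := by
  obtain ⟨w, hw⟩ : ∃ w : (ι → κ) → ℝ, ∀ ω, w ω = ∏ i, μ i (ω i) := ⟨_, fun _ => rfl⟩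
  have h1 : ∑ ω, w ω = 1 := by
    have := Ex_const hμ 1
    unfold Ex at this
    simpa [hw] using this
  unfold Ex
  simp_rw [← hw]
  rw [Finset.sum_mul_sum, ← Fintype.sum_prod_type']
  obtain ⟨pw, hpw⟩ : ∃ pw : (ι → κ) → (ι → κ) → (ι → κ),
    ∀ ω ω' i, pw ω ω' i = if I i then ω i else ω' i := ⟨fun ω ω' i => _, fun _ _ _ => rfl⟩
  have hinv : ∀ a b, pw (pw a b) (pw b a) = a := by
    intro a b; ext i; simp only [hpw]; split_ifs <;> rfl
  obtain ⟨e, he⟩ : ∃ e : ((ι → κ) × (ι → κ)) ≃ ((ι → κ) × (ι → κ)),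
      ∀ x, e x = (pw x.1 x.2, pw x.2 x.1) :=
    ⟨⟨fun x => (pw x.1 x.2, pw x.2 x.1), fun x => (pw x.1 x.2, pw x.2 x.1),
      fun x => Prod.ext (hinv _ _) (hinv _ _), fun x => Prod.ext (hinv _ _) (hinv _ _)⟩,
      fun _ => rfl⟩
  rw [← e.sum_comp]
  have h2 : ∀ x : (ι → κ) × (ι → κ),
      w (e x).1 * F (e x).1 * (w (e x).2 * G (e x).2) = w x.1 * (F x.1 * G x.1) * w x.2 := by
    intro x
    have h3 : w (e x).1 * w (e x).2 = w x.1 * w x.2 := by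
      rw [he, hw, hw, hw, hw, ← Finset.prod_mul_distrib, ← Finset.prod_mul_distrib]
      refine Finset.prod_congr rfl fun i _ => ?_
      dsimp only
      rw [hpw, hpw]
      split_ifs
      · rfl
      · rw [mul_comm]
    have h4 : F (e x).1 = F x.1 := hF _ _ fun i hi => by rw [he]; dsimp only; rw [hpw, if_pos hi]
    have h5 : G (e x).2 = G x.1 := hG _ _ fun i hi => by rw [he]; dsimp only; rw [hpw, if_neg hi]
    rw [h4, h5]
    linear_combination F x.1 * G x.1 * h3
  simp_rw [h2]
  rw [Fintype.sum_prod_type]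
  simp_rw [← Finset.mul_sum, h1, mul_one]

lemma Pr_and_of_dependsOnly (hμ : IsProb μ) {I : ι → Prop} {A B : (ι → κ) → Prop}
    (hA : DependsOnly I A) (hB : DependsOnly (fun i => ¬ I i) B) :
    Pr μ (fun ω => A ω ∧ B ω) = Pr μ A * Pr μ B := by
  unfold Pr
  rw [← Ex_mul_of_dependsOnly (I := I) hμ]
  · congr 1; ext ω
    by_cases h1 : A ω <;> by_cases h2 : B ω <;> simp [h1, h2]
  · intro ω ω' h; simp only [hA ω ω' h]
  · intro ω ω' h; simp only [hB ω ω' h]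

lemma Pr_eq_sum_fiber {α : Type} (Y : (ι → κ) → α) (s : Finset α) (hs : ∀ ω, Y ω ∈ s)
    (A : α → (ι → κ) → Prop) :
    Pr μ (fun ω => A (Y ω) ω) = ∑ a ∈ s, Pr μ (fun ω => A a ω ∧ Y ω = a) := by
  unfold Pr
  rw [← Ex_sum]
  congr 1
  ext ω
  rw [Finset.sum_eq_single (Y ω)]
  · simp
  · intro b _ hb
    rw [if_neg]
    exact fun h => hb h.2.symm
  · exact fun h => absurd (hs ω) h

/-- Comparison of probabilities after substituting an independent random parameter. -/
theorem Pr_comp_le (hμ : IsProb μ) {I : ι → Prop} {α : Type} {Y : (ι → κ) → α} {s : Finset α}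
    (hs : ∀ ω, Y ω ∈ s) (hY : DependsOnly (fun i => ¬ I i) Y) {A B : α → (ι → κ) → Prop}
    (hA : ∀ a, DependsOnly I (A a)) (hB : ∀ a, DependsOnly I (B a)) {Q : α → Prop} {η : ℝ}
    (hη : 0 ≤ η) (h : ∀ a, Q a → Pr μ (A a) ≤ η * Pr μ (B a)) :
    Pr μ (fun ω => Q (Y ω) ∧ A (Y ω) ω) ≤ η * Pr μ (fun ω => B (Y ω) ω) := by
  rw [Pr_eq_sum_fiber Y s hs (fun a ω => Q a ∧ A a ω), Pr_eq_sum_fiber Y s hs B, Finset.mul_sum]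
  refine Finset.sum_le_sum fun a _ => ?_
  have hYa : DependsOnly (fun i => ¬ I i) fun ω => Y ω = a := fun ω ω' h => by
    dsimp only; rw [hY ω ω' h]
  rw [Pr_and_of_dependsOnly hμ (hB a) hYa]
  by_cases hQ : Q a
  · simp only [hQ, true_and]
    rw [Pr_and_of_dependsOnly hμ (hA a) hYa, ← mul_assoc]
    exact mul_le_mul_of_nonneg_right (h a hQ) (Pr_nonneg hμ _)
  · have h0 : Pr μ (fun ω => (Q a ∧ A a ω) ∧ Y ω = a) = 0 := by
      unfold Pr
      simp only [hQ, false_and, if_false]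
      exact Ex_const hμ 0
    rw [h0]
    exact mul_nonneg hη (mul_nonneg (Pr_nonneg hμ _) (Pr_nonneg hμ _))

end Independence

section Bernoulli
variable {ι : Type} [Fintype ι]

/-- The Bernoulli weights. -/
def bern (ι : Type) (p : ℝ) : ι → Bool → ℝ := fun _ b => if b then p else 1 - p

variable {p : ℝ}

lemma isProb_bern (h0 : 0 ≤ p) (h1 : p ≤ 1) : IsProb (bern ι p) :=
  ⟨fun i k => by unfold bern; split_ifs <;> linarith, fun i => by simp [bern]⟩

lemma exp_le_one_add_sq {x : ℝ} (hx : |x| ≤ 1) : Real.exp x ≤ 1 + x + x ^ 2 := by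
  have := (abs_le.1 (Real.abs_exp_sub_one_sub_id_le hx)).2
  linarith

/-- Exponential moments of weighted sums of centred Bernoulli variables. -/
lemma Ex_exp_bern_le (h0 : 0 ≤ p) (h1 : p ≤ 1) (a : ι → ℝ) {t : ℝ} (ha : ∀ i, |t * a i| ≤ 1) :
    Ex (bern ι p) (fun ω => Real.exp (t * ∑ i, a i * ((if ω i then 1 else 0) - p))) ≤
      Real.exp (t ^ 2 * (p * (1 - p) * ∑ i, a i ^ 2)) := by
  have h2 : ∀ ω : ι → Bool, Real.exp (t * ∑ i, a i * ((if ω i then 1 else 0) - p)) =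
      ∏ i, Real.exp (t * (a i * ((if ω i then 1 else 0) - p))) := by
    intro ω; rw [Finset.mul_sum, Real.exp_sum]
  simp_rw [h2]
  rw [Ex_prod (fun i (k : Bool) => Real.exp (t * (a i * ((if k then 1 else 0) - p)))),
    Finset.mul_sum, Finset.mul_sum, Real.exp_sum]
  refine Finset.prod_le_prod (fun i _ => Finset.sum_nonneg fun k _ =>
    mul_nonneg ((isProb_bern h0 h1).nonneg i k) (Real.exp_pos _).le) fun i _ => ?_
  rw [Fintype.sum_bool]
  simp only [bern, if_true, Bool.false_eq_true, if_false]
  have h3 : |t * (a i * (1 - p))| ≤ 1 := by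
    rw [← mul_assoc, abs_mul]
    refine mul_le_one₀ (ha i) (abs_nonneg _) ?_
    rw [abs_le]; constructor <;> linarith
  have h4 : |t * (a i * (0 - p))| ≤ 1 := by
    rw [← mul_assoc, abs_mul]
    refine mul_le_one₀ (ha i) (abs_nonneg _) ?_
    rw [abs_le]; constructor <;> linarith
  have h5 := mul_le_mul_of_nonneg_left (exp_le_one_add_sq h3) h0
  have h6 := mul_le_mul_of_nonneg_left (exp_le_one_add_sq h4) (show 0 ≤ 1 - p by linarith)
  have h7 := Real.add_one_le_exp (t ^ 2 * (p * (1 - p) * a i ^ 2))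
  refine le_trans (add_le_add h5 h6) (le_trans (le_of_eq ?_) h7)
  ring

theorem Pr_bern_ge (h0 : 0 ≤ p) (h1 : p ≤ 1) (a : ι → ℝ) {t τ S : ℝ} (ht : 0 ≤ t)
    (ha : ∀ i, |t * a i| ≤ 1) (hS : ∑ i, a i ^ 2 ≤ S) :
    Pr (bern ι p) (fun ω => τ ≤ ∑ i, a i * ((if ω i then 1 else 0) - p)) ≤
      Real.exp (t ^ 2 * (p * (1 - p) * S) - t * τ) := by
  have h2 := Pr_le_Ex (isProb_bern (ι := ι) h0 h1)
    (A := fun ω => τ ≤ ∑ i, a i * ((if ω i then 1 else 0) - p))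
    (F := fun ω => Real.exp (-(t * τ)) *
      Real.exp (t * ∑ i, a i * ((if ω i then 1 else 0) - p)))
    (fun ω => by positivity) (fun ω h => by
      rw [← Real.exp_add]
      apply Real.one_le_exp
      have := mul_le_mul_of_nonneg_left h ht
      linarith)
  rw [Ex_mul_left] at h2
  refine h2.trans ?_
  have h3 := mul_le_mul_of_nonneg_left (Ex_exp_bern_le h0 h1 a ha) (Real.exp_pos (-(t * τ))).le
  refine h3.trans ?_
  rw [← Real.exp_add]
  apply Real.exp_le_exp.2
  have := mul_le_mul_of_nonneg_left hS (show 0 ≤ t ^ 2 * (p * (1 - p)) from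
    mul_nonneg (sq_nonneg _) (mul_nonneg h0 (by linarith)))
  linarith

/-- A two-sided Bernstein inequality for weighted sums of centred Bernoulli variables. -/
theorem Pr_bern_abs_ge (h0 : 0 ≤ p) (h1 : p ≤ 1) (a : ι → ℝ) {t τ S : ℝ} (ht : 0 ≤ t)
    (ha : ∀ i, |t * a i| ≤ 1) (hS : ∑ i, a i ^ 2 ≤ S) :
    Pr (bern ι p) (fun ω => τ ≤ |∑ i, a i * ((if ω i then 1 else 0) - p)|) ≤
      2 * Real.exp (t ^ 2 * (p * (1 - p) * S) - t * τ) := by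
  have h2 := Pr_bern_ge (τ := τ) h0 h1 a ht ha hS
  have h3 := Pr_bern_ge (τ := τ) (S := S) h0 h1 (fun i => - a i) ht
    (fun i => by rw [mul_neg, abs_neg]; exact ha i) (by simpa using hS)
  have h4 := Pr_mono (isProb_bern (ι := ι) h0 h1)
    (A := fun ω => τ ≤ |∑ i, a i * ((if ω i then 1 else 0) - p)|)
    (B := fun ω => τ ≤ ∑ i, a i * ((if ω i then 1 else 0) - p) ∨
      τ ≤ ∑ i, - a i * ((if ω i then 1 else 0) - p)) (fun ω h => by
        rcases le_abs.1 h with h | h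
        · exact Or.inl h
        · right; rw [← Finset.sum_neg_distrib] at h; simpa only [neg_mul] using h)
  have h5 := Pr_or_le (isProb_bern (ι := ι) h0 h1)
    (fun ω => τ ≤ ∑ i, a i * ((if ω i then 1 else 0) - p))
    (fun ω => τ ≤ ∑ i, - a i * ((if ω i then 1 else 0) - p))
  linarith

lemma prod_ite_card (s : Finset ι) (A : ι → Prop) (x y : ℝ) :
    ∏ i ∈ s, (if A i then x else y) = x ^ (s.filter A).card * y ^ (s.card - (s.filter A).card) := by
  rw [Finset.prod_ite, Finset.prod_const, Finset.prod_const]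
  congr 2
  have := Finset.card_filter_add_card_filter_not (s := s) A
  omega

/-- The probability of a given pattern on a set of coordinates. -/
lemma Pr_bern_pattern (s : Finset ι) (A : ι → Prop) :
    Pr (bern ι p) (fun ω => ∀ i ∈ s, (ω i = true ↔ A i)) =
      p ^ (s.filter A).card * (1 - p) ^ (s.card - (s.filter A).card) := by
  have h1 : ∀ ω : ι → Bool, (if ∀ i ∈ s, (ω i = true ↔ A i) then (1 : ℝ) else 0) =
      ∏ i, if i ∈ s → (ω i = true ↔ A i) then 1 else 0 := by
    intro ω
    rw [Finset.prod_ite_zero]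
    simp
  have h2 : Pr (bern ι p) (fun ω => ∀ i ∈ s, (ω i = true ↔ A i)) = Ex (bern ι p) (fun ω =>
      ∏ i, if i ∈ s → (ω i = true ↔ A i) then 1 else 0) := by
    unfold Pr; congr 1; ext ω; convert h1 ω
  rw [h2, Ex_prod (fun i (k : Bool) => if i ∈ s → (k = true ↔ A i) then (1 : ℝ) else 0),
    ← prod_ite_card, ← Finset.prod_subset (Finset.subset_univ s)]
  · refine Finset.prod_congr rfl fun i hi => ?_
    rw [Fintype.sum_bool]
    by_cases h : A i <;> simp [hi, h, bern]
  · intro i _ hi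
    rw [Fintype.sum_bool]
    simp [hi, bern]

/-- The law of the number of successes on a set of coordinates. -/
lemma Pr_bern_card_eq (s : Finset ι) (a : ℕ) :
    Pr (bern ι p) (fun ω => (s.filter fun i => ω i = true).card = a) =
      s.card.choose a * (p ^ a * (1 - p) ^ (s.card - a)) := by
  have h1 : ∀ ω : ι → Bool, (if (s.filter fun i => ω i = true).card = a then (1 : ℝ) else 0) =
      ∑ T ∈ s.powersetCard a, if ∀ i ∈ s, (ω i = true ↔ i ∈ T) then 1 else 0 := by
    intro ω
    split_ifs with h
    · rw [Finset.sum_eq_single (s.filter fun i => ω i = true)]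
      · rw [if_pos]
        intro i hi
        simp [hi]
      · intro T hT hne
        rw [if_neg]
        intro h2
        apply hne
        ext i
        rw [Finset.mem_filter]
        refine ⟨fun h3 => ?_, fun h3 => (h2 i h3.1).1 h3.2⟩
        have h4 := (Finset.mem_powersetCard.1 hT).1 h3
        exact ⟨h4, (h2 i h4).2 h3⟩
      · intro h2
        exact absurd (Finset.mem_powersetCard.2 ⟨Finset.filter_subset _ _, h⟩) h2
    · symm
      apply Finset.sum_eq_zero
      intro T hT
      rw [if_neg]
      intro h2
      apply h
      rw [Finset.mem_powersetCard] at hT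
      rw [← hT.2]
      congr 1
      ext i
      rw [Finset.mem_filter]
      exact ⟨fun h3 => (h2 i h3.1).1 h3.2, fun h3 => ⟨hT.1 h3, (h2 i (hT.1 h3)).2 h3⟩⟩
  have h2 : Pr (bern ι p) (fun ω => (s.filter fun i => ω i = true).card = a) =
      ∑ T ∈ s.powersetCard a, Pr (bern ι p) (fun ω => ∀ i ∈ s, (ω i = true ↔ i ∈ T)) := by
    unfold Pr
    rw [← Ex_sum]
    congr 1; ext ω
    convert h1 ω
  rw [h2, ← Finset.card_powersetCard, ← nsmul_eq_mul]
  apply Finset.sum_eq_card_nsmul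
  intro T hT
  rw [Finset.mem_powersetCard] at hT
  obtain ⟨M, hM⟩ : ∃ M : ι → Prop, ∀ i, M i ↔ i ∈ T := ⟨_, fun _ => Iff.rfl⟩
  have h3 : (s.filter M).card = a := by
    rw [← hT.2]; congr 1
    ext i; rw [Finset.mem_filter, hM]; exact ⟨fun h => h.2, fun h => ⟨hT.1 h, h⟩⟩
  have h4 := Pr_bern_pattern (p := p) s M
  rw [h3] at h4
  simpa only [hM] using h4

end Bernoulli

section RandomGraph
variable {V : Type} [Fintype V]

/-- The graph with a given indicator function of edges. -/
def rg (ω : Sym2 V → Bool) : SimpleGraph V := edgeFilter ⊤ fun e => ω e = true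

lemma rg_adj (ω : Sym2 V → Bool) (u v : V) : (rg ω).Adj u v ↔ u ≠ v ∧ ω s(u, v) = true := by
  unfold rg; rw [edgeFilter_adj, top_adj]

lemma rg_eq_iff (ω : Sym2 V → Bool) (G : SimpleGraph V) :
    rg ω = G ↔ ∀ e ∈ Finset.univ.filter (fun e : Sym2 V => ¬ e.IsDiag),
      (ω e = true ↔ e ∈ G.edgeSet) := by
  constructor
  · rintro rfl e he
    rw [Finset.mem_filter] at he
    induction e using Sym2.ind with
    | _ u v =>
      rw [mem_edgeSet, rg_adj]
      exact ⟨fun h => ⟨fun h2 => he.2 (Sym2.mk_isDiag_iff.2 h2), h⟩, fun h => h.2⟩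
  · intro h
    ext u v
    rw [rg_adj]
    by_cases huv : u = v
    · subst huv; simp
    · rw [h s(u, v) (Finset.mem_filter.2 ⟨Finset.mem_univ _, fun h2 => huv (Sym2.mk_isDiag_iff.1 h2)⟩),
        mem_edgeSet]
      exact ⟨fun h => h.2, fun h => ⟨huv, h⟩⟩

lemma card_not_isDiag : (Finset.univ.filter (fun e : Sym2 V => ¬ e.IsDiag)).card =
    (Fintype.card V).choose 2 := by
  rw [← Sym2.card_subtype_not_diag, Fintype.card_subtype]

lemma Pr_rg_eq (p : ℝ) (G : SimpleGraph V) : Pr (bern (Sym2 V) p) (fun ω => rg ω = G) =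
    p ^ G.edgeSet.ncard * (1 - p) ^ ((Fintype.card V).choose 2 - G.edgeSet.ncard) := by
  obtain ⟨M, hM⟩ : ∃ M : Sym2 V → Prop, ∀ e, M e ↔ e ∈ G.edgeSet := ⟨_, fun _ => Iff.rfl⟩
  have h1 := Pr_bern_pattern (p := p) (Finset.univ.filter (fun e : Sym2 V => ¬ e.IsDiag)) M
  have h2 : ((Finset.univ.filter (fun e : Sym2 V => ¬ e.IsDiag)).filter
      M).card = G.edgeSet.ncard := by
    rw [← Set.ncard_coe_finset]
    congr 1
    ext e
    simp only [Finset.coe_filter, Finset.mem_filter, Finset.mem_univ, true_and, Set.mem_ofPred_eq, hM]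
    exact ⟨fun h => h.2, fun h => ⟨G.not_isDiag_of_mem_edgeSet h, h⟩⟩
  rw [card_not_isDiag, h2] at h1
  rw [← h1]
  congr 1
  ext ω
  rw [rg_eq_iff]
  simp only [hM]

theorem gnpProb_eq (n : ℕ) (p : ℝ) (A : SimpleGraph (Fin n) → Prop) :
    gnpProb n p A = Pr (bern (Sym2 (Fin n)) p) (fun ω => A (rg ω)) := by
  rw [Pr_eq_sum_fiber (μ := bern (Sym2 (Fin n)) p) rg Finset.univ (fun _ => Finset.mem_univ _)
    fun G _ => A G]
  unfold gnpProb
  refine Finset.sum_congr (by ext; simp) fun G _ => ?_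
  split_ifs with h
  · have := Pr_rg_eq p G
    rw [Fintype.card_fin] at this
    rw [← this]
    simp [h]
  · unfold Pr Ex
    simp [h]

lemma edg_rg (ω : Sym2 V → Bool) (S T : Finset V) : (edg (rg ω) S T : ℝ) =
    ∑ e, ((((S ×ˢ T).filter fun a => a.1 ≠ a.2).filter fun a => s(a.1, a.2) = e).card : ℝ) *
      (if ω e then 1 else 0) := by
  rw [rg, edg_edgeFilter]
  simp_rw [top_adj]
  rw [Finset.card_filter, ← Finset.sum_fiberwise (s := (S ×ˢ T).filter fun a => a.1 ≠ a.2)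
    (g := fun a => s(a.1, a.2))]
  push_cast
  refine Finset.sum_congr rfl fun e _ => ?_
  rw [← nsmul_eq_mul]
  apply Finset.sum_eq_card_nsmul
  intro a ha
  rw [(Finset.mem_filter.1 ha).2]

/-- Concentration of the number of edges between two sets of vertices. -/
theorem Pr_edg_rg {p t : ℝ} (h0 : 0 ≤ p) (h1 : p ≤ 1) (S T : Finset V) (ht0 : 0 ≤ t)
    (ht1 : t ≤ 1 / 2) (τ : ℝ) :
    Pr (bern (Sym2 V) p) (fun ω => τ ≤ |(edg (rg ω) S T : ℝ) -
      p * ((S ×ˢ T).filter fun a => a.1 ≠ a.2).card|) ≤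
      2 * Real.exp (t ^ 2 * (p * (1 - p) * (2 * (S.card * T.card))) - t * τ) := by
  obtain ⟨I, hI⟩ : ∃ I, I = (S ×ˢ T).filter fun a => a.1 ≠ a.2 := ⟨_, rfl⟩
  obtain ⟨a, ha⟩ : ∃ a : Sym2 V → ℕ, ∀ e, a e = (I.filter fun a => s(a.1, a.2) = e).card :=
    ⟨_, fun _ => rfl⟩
  have ha2 : ∀ e, (a e : ℝ) ≤ 2 := fun e => by rw [ha]; exact_mod_cast card_filter_sym2_le I e
  have hsum : ∑ e, (a e : ℝ) = I.card := by
    simp_rw [ha]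
    rw [Finset.card_eq_sum_card_fiberwise (s := I) (f := fun a => s(a.1, a.2)) (t := Finset.univ)
      (fun _ _ => Finset.mem_coe.2 (Finset.mem_univ _))]
    push_cast; rfl
  have hIc : (I.card : ℝ) ≤ S.card * T.card := by
    rw [hI]
    have := Finset.card_filter_le (S ×ˢ T) (fun a => a.1 ≠ a.2)
    rw [Finset.card_product] at this
    exact_mod_cast this
  have h2 := Pr_bern_abs_ge (τ := τ) (S := 2 * (S.card * T.card)) h0 h1 (fun e => (a e : ℝ)) ht0
    (fun e => by
      rw [abs_of_nonneg (mul_nonneg ht0 (Nat.cast_nonneg _))]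
      have := mul_le_mul ht1 (ha2 e) (Nat.cast_nonneg _) (by norm_num)
      linarith)
    (by
      have : ∑ e, (a e : ℝ) ^ 2 ≤ ∑ e, 2 * (a e : ℝ) := Finset.sum_le_sum fun e _ => by
        rw [sq]; exact mul_le_mul_of_nonneg_right (ha2 e) (Nat.cast_nonneg _)
      rw [← Finset.mul_sum, hsum] at this
      linarith)
  refine le_trans (le_of_eq ?_) h2
  congr 1
  ext ω
  rw [edg_rg, ← hI, ← hsum, Finset.mul_sum, ← Finset.sum_sub_distrib]
  have h3 : ∀ e, (a e : ℝ) * ((if ω e then 1 else 0) - p) =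
      (a e : ℝ) * (if ω e then 1 else 0) - p * a e := fun e => by ring
  simp_rw [h3, ha]

lemma dependsOnly_dg_rg {I : Sym2 V → Prop} (v : V) (T : Finset V) (h : ∀ u ∈ T, I s(v, u)) :
    DependsOnly I fun ω : Sym2 V → Bool => dg (rg ω) v T := by
  intro ω ω' hω
  unfold dg
  refine congrArg Finset.card (Finset.ext fun u => ?_)
  rw [Finset.mem_filter, Finset.mem_filter]
  refine and_congr_right fun hu => ?_
  rw [rg_adj, rg_adj, hω _ (h u hu)]

end RandomGraph

section Tools
variable {ι κ : Type} [Fintype ι] [Fintype κ] {μ : ι → κ → ℝ}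

lemma sum_Pr_le_of_disjoint (hμ : IsProb μ) {α : Type} (s : Finset α) {A : α → (ι → κ) → Prop}
    {B : (ι → κ) → Prop} (hd : ∀ ω, ∀ a ∈ s, ∀ b ∈ s, A a ω → A b ω → a = b)
    (h : ∀ ω, ∀ a ∈ s, A a ω → B ω) : ∑ a ∈ s, Pr μ (A a) ≤ Pr μ B := by
  unfold Pr
  rw [← Ex_sum]
  refine Ex_mono hμ fun ω => ?_
  by_cases hex : ∃ a ∈ s, A a ω
  · obtain ⟨a, ha, haA⟩ := hex
    rw [Finset.sum_eq_single a (fun b hb hne => if_neg fun hbA => hne (hd ω b hb a ha hbA haA))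
      fun h => absurd ha h, if_pos haA, if_pos (h ω a ha haA)]
  · push Not at hex
    rw [Finset.sum_eq_zero fun a ha => if_neg (hex a ha)]
    split_ifs <;> norm_num

/-- A slowly decaying law puts little mass on any short interval. -/
lemma Pr_window_le (hμ : IsProb μ) (X : (ι → κ) → ℕ) {L s k m : ℕ} {ρ : ℝ} (hk : 0 < k)
    (hρ0 : 0 ≤ ρ) (hkρ : k * ρ ≤ 1 / 2)
    (hr : ∀ b, L ≤ b → (1 - ρ) * Pr μ (fun ω => X ω = b + 1) ≤ Pr μ (fun ω => X ω = b))
    (hm : L + s + k ≤ m) :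
    Pr μ (fun ω => m < X ω + s ∧ X ω ≤ m + 1) ≤
      (s + 1) * (2 / k) * Pr μ (fun ω => X ω ≤ m + 1) := by
  obtain ⟨f, hf⟩ : ∃ f : ℕ → ℝ, ∀ a, f a = Pr μ (fun ω => X ω = a) := ⟨_, fun _ => rfl⟩
  simp_rw [← hf] at hr
  have hf0 : ∀ a, 0 ≤ f a := fun a => by rw [hf]; exact Pr_nonneg hμ _
  have hk' : (0 : ℝ) < k := by exact_mod_cast hk
  have hk1 : (1 : ℝ) ≤ k := by exact_mod_cast hk
  have hρ1 : ρ ≤ 1 / 2 := by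
    have := mul_le_mul_of_nonneg_right hk1 hρ0
    linarith
  have h1 : ∀ a, L + k ≤ a → ∀ j ≤ k, (1 - j * ρ) * f a ≤ f (a - j) := by
    intro a ha j
    induction j with
    | zero => intro _; simp
    | succ j ih =>
      intro hj
      have h2 := ih (by omega)
      have h3 := hr (a - (j + 1)) (by omega)
      rw [show a - (j + 1) + 1 = a - j by omega] at h3
      have h4 := mul_le_mul_of_nonneg_left h2 (show 0 ≤ 1 - ρ by linarith)
      have h5 : 0 ≤ ρ * (j * ρ) * f a := by have := hf0 a; positivity
      push_cast
      linarith
  have h2 : ∀ a, L + k ≤ a → a ≤ m + 1 → f a ≤ 2 / k * Pr μ (fun ω => X ω ≤ m + 1) := by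
    intro a ha ham
    have h3 : ∑ j ∈ Finset.range k, Pr μ (fun ω => X ω = a - j) ≤ Pr μ (fun ω => X ω ≤ m + 1) := by
      refine sum_Pr_le_of_disjoint hμ _ (fun ω i hi j hj h1 h2 => ?_) fun ω i hi h1 => by omega
      rw [Finset.mem_range] at hi hj
      omega
    have h4 : ∑ j ∈ Finset.range k, f a / 2 ≤ ∑ j ∈ Finset.range k, Pr μ (fun ω => X ω = a - j) := by
      refine Finset.sum_le_sum fun j hj => ?_
      rw [Finset.mem_range] at hj
      have h5 := h1 a ha j hj.le
      rw [← hf]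
      have h6 : (j : ℝ) * ρ ≤ 1 / 2 := by
        have : (j : ℝ) ≤ k := by exact_mod_cast hj.le
        have := mul_le_mul_of_nonneg_right this hρ0
        linarith
      have := mul_le_mul_of_nonneg_right h6 (hf0 a)
      linarith
    rw [Finset.sum_const, Finset.card_range, nsmul_eq_mul] at h4
    rw [div_mul_eq_mul_div, le_div_iff₀ hk']
    linarith
  have h3 : Pr μ (fun ω => m < X ω + s ∧ X ω ≤ m + 1) ≤
      Pr μ (fun ω => ∃ j ∈ Finset.range (s + 1), X ω = m + 1 - j) :=
    Pr_mono hμ fun ω h => ⟨m + 1 - X ω, Finset.mem_range.2 (by omega), by omega⟩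
  refine h3.trans ((Pr_exists_le_card hμ _ _ (c := 2 / k * Pr μ (fun ω => X ω ≤ m + 1))
    fun j hj => ?_).trans (le_of_eq ?_))
  · rw [Finset.mem_range] at hj
    rw [← hf]
    exact h2 _ (by omega) (by omega)
  · rw [Finset.card_range]; push_cast; ring

end Tools

section Gap
variable {V : Type} [Fintype V] {p : ℝ}

lemma Pr_dg_rg_eq (u : V) (a : ℕ) :
    Pr (bern (Sym2 V) p) (fun ω => dg (rg ω) u Finset.univ = a) =
      (Fintype.card V - 1).choose a * (p ^ a * (1 - p) ^ (Fintype.card V - 1 - a)) := by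
  have h1 := Pr_bern_card_eq (p := p) ((Finset.univ.erase u).image fun v => s(u, v)) a
  have hinj : Function.Injective fun v : V => s(u, v) := fun a b h => Sym2.congr_right.1 h
  rw [Finset.card_image_of_injective _ hinj, Finset.card_erase_of_mem (Finset.mem_univ _),
    Finset.card_univ] at h1
  rw [← h1]
  congr 1
  ext ω
  rw [Finset.filter_image, Finset.card_image_of_injective _ hinj]
  unfold dg
  have : Finset.univ.filter ((rg ω).Adj u) =
      (Finset.univ.erase u).filter fun v => ω s(u, v) = true := by
    ext v
    simp only [Finset.mem_filter, Finset.mem_univ, true_and, Finset.mem_erase, rg_adj, and_true]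
    rw [ne_comm]
  rw [this]

lemma binomial_ratio {N b : ℕ} (h0 : 0 < p) (h1 : p < 1) {ρ : ℝ}
    (h : (1 - ρ) * ((N - b : ℕ) * p) ≤ (b + 1) * (1 - p)) :
    (1 - ρ) * (N.choose (b + 1) * (p ^ (b + 1) * (1 - p) ^ (N - (b + 1)))) ≤
      N.choose b * (p ^ b * (1 - p) ^ (N - b)) := by
  rcases Nat.lt_or_ge b N with hb | hb
  · obtain ⟨c, hc⟩ : ∃ c, N - b = c + 1 := ⟨N - b - 1, by omega⟩
    have hc' : N - (b + 1) = c := by omega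
    have h2 := Nat.choose_succ_right_eq N b
    rw [hc] at h h2 ⊢
    rw [hc']
    have h3 : (N.choose (b + 1) : ℝ) * (b + 1) = N.choose b * ((c + 1 : ℕ) : ℝ) := by
      exact_mod_cast h2
    have h4 : 0 ≤ N.choose (b + 1) * (p ^ b * (1 - p) ^ c) := by
      have : 0 < 1 - p := by linarith
      positivity
    have h5 := mul_le_mul_of_nonneg_left h h4
    have h6 : (0 : ℝ) < ((c + 1 : ℕ) : ℝ) := by positivity
    refine le_of_mul_le_mul_right ?_ h6
    calc (1 - ρ) * (N.choose (b + 1) * (p ^ (b + 1) * (1 - p) ^ c)) * ((c + 1 : ℕ) : ℝ)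
        = N.choose (b + 1) * (p ^ b * (1 - p) ^ c) * ((1 - ρ) * (((c + 1 : ℕ) : ℝ) * p)) := by ring
      _ ≤ _ := h5
      _ = (N.choose (b + 1) : ℝ) * (b + 1) * (p ^ b * (1 - p) ^ (c + 1)) := by ring
      _ = _ := by rw [h3]; ring
  · rw [Nat.choose_eq_zero_of_lt (show N < b + 1 by omega)]
    have : 0 < 1 - p := by linarith
    simp only [Nat.cast_zero, zero_mul, mul_zero]
    positivity

/-- With high probability, the vertex of minimum degree is unique and has a large gap to the
next degree. -/
theorem le_Pr_gap (h0 : 0 < p) (h1 : p < 1) (hn : 2 ≤ Fintype.card V) {L s k : ℕ} {ρ ζ : ℝ}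
    (hs : 0 < s) (hk : 0 < k) (hρ0 : 0 ≤ ρ) (hkρ : k * ρ ≤ 1 / 2)
    (hr : ∀ b, L ≤ b → (1 - ρ) * ((Fintype.card V - 1 - b : ℕ) * p) ≤ (b + 1) * (1 - p))
    (hζ : ∀ u v : V, v ≠ u → Pr (bern (Sym2 V) p)
      (fun ω => dg (rg ω) v (Finset.univ.erase u) < L + s + k) ≤ ζ) :
    1 - (s + 1) * (2 / k) - Fintype.card V * (Fintype.card V * ζ) ≤
      Pr (bern (Sym2 V) p) (fun ω => ∃ x0, ∀ v ≠ x0,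
        dg (rg ω) x0 Finset.univ + s ≤ dg (rg ω) v Finset.univ) := by
  have hμ : IsProb (bern (Sym2 V) p) := isProb_bern h0.le h1.le
  obtain ⟨μ, hμdef⟩ : ∃ μ, μ = bern (Sym2 V) p := ⟨_, rfl⟩
  obtain ⟨η, hη⟩ : ∃ η : ℝ, η = (s + 1) * (2 / k) := ⟨_, rfl⟩
  have hη0 : 0 ≤ η := by rw [hη]; positivity
  have hother : ∀ u : V, ∃ v, v ≠ u := fun u =>
    haveI := Fintype.one_lt_card_iff_nontrivial.1 hn; exists_ne u
  obtain ⟨Y, hY⟩ : ∃ Y : V → (Sym2 V → Bool) → ℕ, ∀ u ω, Y u ω =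
      sInf {d | ∃ v ≠ u, d = dg (rg ω) v (Finset.univ.erase u)} := ⟨_, fun _ _ => rfl⟩
  have hYmem : ∀ u ω, ∃ v ≠ u, Y u ω = dg (rg ω) v (Finset.univ.erase u) := by
    intro u ω
    obtain ⟨v, hv⟩ := hother u
    rw [hY]
    exact Nat.sInf_mem (s := {d | ∃ v ≠ u, d = dg (rg ω) v (Finset.univ.erase u)}) ⟨_, v, hv, rfl⟩
  have hYle : ∀ u ω, ∀ v ≠ u, Y u ω ≤ dg (rg ω) v (Finset.univ.erase u) := by
    intro u ω v hv
    rw [hY]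
    exact Nat.sInf_le ⟨v, hv, rfl⟩
  have herase : ∀ (ω : Sym2 V → Bool) u v, dg (rg ω) v (Finset.univ.erase u) ≤
      dg (rg ω) v Finset.univ :=
    fun ω u v => Finset.card_le_card (Finset.filter_subset_filter _ (Finset.erase_subset _ _))
  have herase' : ∀ (ω : Sym2 V → Bool) u v, dg (rg ω) v Finset.univ ≤
      dg (rg ω) v (Finset.univ.erase u) + 1 := by
    intro ω u v
    unfold dg
    rw [Finset.filter_erase]
    exact Nat.le_succ_of_pred_le Finset.pred_card_le_card_erase
  have hYdep : ∀ u, DependsOnly (fun e : Sym2 V => ¬ u ∈ e) (Y u) := by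
    intro u ω ω' hω
    rw [hY, hY]
    congr 1
    ext d
    refine exists_congr fun v => and_congr_right fun hv => ?_
    have := dependsOnly_dg_rg (I := fun e => ¬ u ∈ e) v (Finset.univ.erase u) (fun w hw => by
      rw [Sym2.mem_iff, not_or]
      exact ⟨hv.symm, (Finset.ne_of_mem_erase hw).symm⟩) ω ω' hω
    dsimp only at this
    rw [this]
  have hXdep : ∀ u, DependsOnly (fun e : Sym2 V => u ∈ e) fun ω => dg (rg ω) u Finset.univ :=
    fun u => dependsOnly_dg_rg u _ fun v _ => Sym2.mem_mk_left u v
  have hYrange : ∀ u ω, Y u ω ∈ Finset.range (Fintype.card V + 1) := by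
    intro u ω
    obtain ⟨v, _, hv⟩ := hYmem u ω
    rw [hv, Finset.mem_range, Nat.lt_succ_iff]
    exact Finset.card_le_univ _
  rw [← hμdef] at hμ hζ ⊢
  rw [← hη]
  have hcomp : ∀ u, Pr μ (fun ω => L + s + k ≤ Y u ω ∧ (Y u ω < dg (rg ω) u Finset.univ + s ∧
      dg (rg ω) u Finset.univ ≤ Y u ω + 1)) ≤
      η * Pr μ (fun ω => dg (rg ω) u Finset.univ ≤ Y u ω + 1) := by
    intro u
    refine Pr_comp_le hμ (I := fun e => u ∈ e) (Q := fun m => L + s + k ≤ m)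
      (A := fun m ω => m < dg (rg ω) u Finset.univ + s ∧ dg (rg ω) u Finset.univ ≤ m + 1)
      (B := fun m ω => dg (rg ω) u Finset.univ ≤ m + 1) (hYrange u) (hYdep u)
      (fun m ω ω' h => ?_) (fun m ω ω' h => ?_) hη0 fun m hm => ?_
    · have := hXdep u ω ω' h
      dsimp only at this ⊢
      rw [this]
    · have := hXdep u ω ω' h
      dsimp only at this ⊢
      rw [this]
    · rw [hη]
      refine Pr_window_le hμ (fun ω => dg (rg ω) u Finset.univ) hk hρ0 hkρ (fun b hb => ?_) hm
      rw [hμdef, Pr_dg_rg_eq, Pr_dg_rg_eq]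
      exact binomial_ratio h0 h1 (hr b hb)
  have hlow : ∀ u, Pr μ (fun ω => ¬ L + s + k ≤ Y u ω) ≤ Fintype.card V * ζ := by
    intro u
    have hζ0 : 0 ≤ ζ := by
      obtain ⟨v, hv⟩ := hother u
      exact (Pr_nonneg hμ _).trans (hζ u v hv)
    refine (Pr_mono hμ (B := fun ω => ∃ v ∈ Finset.univ.erase u,
      dg (rg ω) v (Finset.univ.erase u) < L + s + k) fun ω h => ?_).trans
      ((Pr_exists_le_card hμ _ _ fun v hv => hζ u v (Finset.ne_of_mem_erase hv)).trans ?_)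
    · obtain ⟨v, hv, hvY⟩ := hYmem u ω
      exact ⟨v, Finset.mem_erase.2 ⟨hv, Finset.mem_univ _⟩, by omega⟩
    · exact mul_le_mul_of_nonneg_right (by exact_mod_cast Finset.card_le_univ _) hζ0
  have hsplit : ∀ u, Pr μ (fun ω => dg (rg ω) u Finset.univ ≤ Y u ω + 1) ≤
      Pr μ (fun ω => dg (rg ω) u Finset.univ + s ≤ Y u ω) +
        η * Pr μ (fun ω => dg (rg ω) u Finset.univ ≤ Y u ω + 1) + Fintype.card V * ζ := by
    intro u
    refine (Pr_mono hμ (B := fun ω => (dg (rg ω) u Finset.univ + s ≤ Y u ω ∨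
      (L + s + k ≤ Y u ω ∧ (Y u ω < dg (rg ω) u Finset.univ + s ∧
      dg (rg ω) u Finset.univ ≤ Y u ω + 1))) ∨ ¬ L + s + k ≤ Y u ω) fun ω h => by omega).trans
      ((Pr_or_le hμ _ _).trans (add_le_add ((Pr_or_le hμ _ _).trans
        (add_le_add le_rfl (hcomp u))) (hlow u)))
  have hcover : 1 ≤ ∑ u, Pr μ (fun ω => dg (rg ω) u Finset.univ ≤ Y u ω + 1) := by
    have h2 := Pr_mono hμ (A := fun _ => True)
      (B := fun ω => ∃ u ∈ Finset.univ, dg (rg ω) u Finset.univ ≤ Y u ω + 1) (fun ω _ => by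
        have hne : Nonempty V := Fintype.card_pos_iff.1 (by omega)
        obtain ⟨u, hu⟩ := Finite.exists_min fun u => dg (rg ω) u Finset.univ
        obtain ⟨v, hv, hvY⟩ := hYmem u ω
        refine ⟨u, Finset.mem_univ _, (hu v).trans ?_⟩
        rw [hvY]
        exact herase' ω u v)
    have h3 : Pr μ (fun _ => True) = 1 := by
      unfold Pr; simp [Ex_const hμ]
    rw [h3] at h2
    exact h2.trans (Pr_exists_le hμ _ _)
  have hunion : ∑ u, Pr μ (fun ω => dg (rg ω) u Finset.univ + s ≤ Y u ω) ≤
      Pr μ (fun ω => ∃ x0, ∀ v ≠ x0, dg (rg ω) x0 Finset.univ + s ≤ dg (rg ω) v Finset.univ) := by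
    have h2 : ∀ (ω : Sym2 V → Bool) u, dg (rg ω) u Finset.univ + s ≤ Y u ω → ∀ v ≠ u,
        dg (rg ω) u Finset.univ + s ≤ dg (rg ω) v Finset.univ := fun ω u h v hv =>
      h.trans ((hYle u ω v hv).trans (herase ω u v))
    refine sum_Pr_le_of_disjoint hμ _ (fun ω a _ b _ ha hb => ?_) fun ω a _ ha => ⟨a, h2 ω a ha⟩
    by_contra hab
    have h3 := h2 ω a ha b (Ne.symm hab)
    have h4 := h2 ω b hb a hab
    omega
  have hsum := Finset.sum_le_sum fun u (_ : u ∈ Finset.univ) => hsplit u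
  rw [Finset.sum_add_distrib, Finset.sum_add_distrib, ← Finset.mul_sum, Finset.sum_const,
    Finset.card_univ, nsmul_eq_mul] at hsum
  have hP0 := Pr_nonneg hμ (fun ω => ∃ x0, ∀ v ≠ x0,
    dg (rg ω) x0 Finset.univ + s ≤ dg (rg ω) v Finset.univ)
  have hζ0 : 0 ≤ Fintype.card V * ζ := by
    have hne : Nonempty V := Fintype.card_pos_iff.1 (by omega)
    exact (Pr_nonneg hμ _).trans (hlow (Classical.arbitrary V))
  have hζ1 : 0 ≤ Fintype.card V * (Fintype.card V * ζ) := mul_nonneg (Nat.cast_nonneg _) hζ0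
  rcases le_total η 1 with hη1 | hη1
  · have := mul_le_mul_of_nonneg_left hcover (show 0 ≤ 1 - η by linarith)
    linarith
  · linarith

end Gap

section Whp
variable {V : Type} [Fintype V] {p : ℝ}

lemma card_offDiag_bounds (S T : Finset V) :
    ((S ×ˢ T).filter fun a => a.1 ≠ a.2).card ≤ S.card * T.card ∧
      S.card * T.card ≤ ((S ×ˢ T).filter fun a => a.1 ≠ a.2).card + S.card := by
  have h1 := Finset.card_filter_add_card_filter_not (s := S ×ˢ T) fun a => a.1 ≠ a.2
  have h2 : ((S ×ˢ T).filter fun a => ¬ a.1 ≠ a.2).card ≤ S.card := by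
    refine Finset.card_le_card_of_injOn Prod.fst (fun a ha => ?_) fun a ha b hb hab => ?_
    · rw [Finset.mem_coe, Finset.mem_filter, Finset.mem_product] at ha
      exact ha.1.1
    · rw [Finset.mem_coe, Finset.mem_filter, not_not] at ha hb
      exact Prod.ext hab (by rw [← ha.2, ← hb.2, hab])
  rw [Finset.card_product] at h1
  constructor <;> omega

theorem Pr_edg_rg' {t : ℝ} (h0 : 0 ≤ p) (h1 : p ≤ 1) (S T : Finset V) (ht0 : 0 ≤ t)
    (ht1 : t ≤ 1 / 2) (τ : ℝ) :
    Pr (bern (Sym2 V) p) (fun ω => τ + S.card ≤ |(edg (rg ω) S T : ℝ) - p * (S.card * T.card)|) ≤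
      2 * Real.exp (t ^ 2 * (p * (1 - p) * (2 * (S.card * T.card))) - t * τ) := by
  refine (Pr_mono (isProb_bern h0 h1) fun ω h => ?_).trans (Pr_edg_rg h0 h1 S T ht0 ht1 τ)
  have h2 := card_offDiag_bounds S T
  obtain ⟨m, hm⟩ : ∃ m, m = ((S ×ˢ T).filter fun a => a.1 ≠ a.2).card := ⟨_, rfl⟩
  rw [← hm] at h2 ⊢
  have h3 : (m : ℝ) ≤ S.card * T.card := by exact_mod_cast h2.1
  have h4 : (S.card : ℝ) * T.card ≤ m + S.card := by exact_mod_cast h2.2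
  have h5 : |p * (m : ℝ) - p * (S.card * T.card)| ≤ S.card := by
    rw [← mul_sub, abs_mul, abs_of_nonneg h0]
    have h6 : |(m : ℝ) - S.card * T.card| ≤ S.card := by rw [abs_le]; constructor <;> linarith
    exact (mul_le_of_le_one_left (abs_nonneg _) h1).trans h6
  have h6 := abs_sub_le (edg (rg ω) S T : ℝ) (p * m) (p * (S.card * T.card))
  linarith

lemma abs_sum_nbr_le (G : SimpleGraph V) (u : V) {N n H : ℝ} (h0 : 0 ≤ p) (h1 : p ≤ 1)
    (hN : N = p * n)
    (h : |(edg G (Finset.univ.filter (G.Adj u)) (Finset.univ.erase u) : ℝ) -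
      p * (dg G u Finset.univ * (n - 1))| ≤ H + dg G u Finset.univ) :
    |∑ v ∈ Finset.univ.filter (G.Adj u), ((dg G v Finset.univ : ℝ) - N)| ≤
      H + 3 * dg G u Finset.univ := by
  have h2 : ∀ v ∈ Finset.univ.filter (G.Adj u),
      (dg G v Finset.univ : ℝ) = dg G v (Finset.univ.erase u) + 1 := fun v hv => by
    have h3 := dg_sdiff_add G v (Finset.subset_univ {u})
    have h4 : dg G v {u} = 1 := by
      unfold dg
      rw [Finset.filter_singleton, if_pos (Finset.mem_filter.1 hv).2.symm, Finset.card_singleton]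
    rw [h4, Finset.sdiff_singleton_eq_erase] at h3
    rw [← h3]; push_cast; ring
  have h5 : ∑ v ∈ Finset.univ.filter (G.Adj u), ((dg G v Finset.univ : ℝ) - N) =
      edg G (Finset.univ.filter (G.Adj u)) (Finset.univ.erase u) +
        dg G u Finset.univ * (1 - N) := by
    unfold edg
    rw [Finset.sum_congr rfl fun v hv => by rw [h2 v hv, add_sub_assoc], Finset.sum_add_distrib,
      Finset.sum_const, nsmul_eq_mul]
    push_cast
    rfl
  rw [h5]
  obtain ⟨d, hd⟩ : ∃ d : ℝ, d = dg G u Finset.univ := ⟨_, rfl⟩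
  rw [← hd] at h ⊢
  have hd0 : 0 ≤ d := by rw [hd]; exact Nat.cast_nonneg _
  have h6 : p * d ≤ d := mul_le_of_le_one_left hd0 h1
  have h7 : 0 ≤ p * d := mul_nonneg h0 hd0
  rw [abs_le] at h ⊢
  subst hN
  constructor <;> linarith [h.1, h.2]

theorem le_Pr_gap_of_deg {Z σ ζ : ℝ} (h0 : 0 < p) (h1 : p < 1) (hZ : 1000000000 ≤ Z)
    (hσ : σ ^ 2 = p * Fintype.card V * (1 - p)) (hσ98 : Z ^ 98 ≤ σ)
    (hdeg : ∀ (v : V) (T : Finset V), Fintype.card V ≤ T.card + 1 →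
      Pr (bern (Sym2 V) p) (fun ω => Z ^ 3 * σ < |(dg (rg ω) v T : ℝ) - p * Fintype.card V|) ≤ ζ) :
    1 - 384 / Z ^ 13 - Fintype.card V * (Fintype.card V * ζ) ≤
      Pr (bern (Sym2 V) p) (fun ω => ∃ x0, ∀ v ≠ x0,
        (dg (rg ω) x0 Finset.univ : ℝ) + σ / Z ^ 16 ≤ dg (rg ω) v Finset.univ) := by
  have hμ : IsProb (bern (Sym2 V) p) := isProb_bern h0.le h1.le
  obtain ⟨n, hndef⟩ : ∃ n : ℝ, n = Fintype.card V := ⟨_, rfl⟩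
  have hZ1 : 1 ≤ Z := by linarith
  have hZ0 : 0 < Z := by linarith
  have hpow : ∀ k, 0 < Z ^ k := fun k => pow_pos hZ0 k
  have hone : ∀ k : ℕ, 1 ≤ Z ^ k := fun k => one_le_pow₀ hZ1
  have hσ0 : 0 < σ := lt_of_lt_of_le (hpow _) hσ98
  have hZD : ∀ k l : ℕ, k < l → 1000000000 * Z ^ k ≤ Z ^ l := fun k l hkl => by
    have h1 : 1000000000 * Z ^ k ≤ Z ^ (k + 1) := by
      rw [pow_succ']; exact mul_le_mul_of_nonneg_right hZ (hpow k).le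
    exact h1.trans (pow_le_pow_right₀ hZ1 (by omega))
  have hn0 : 0 ≤ n := by rw [hndef]; exact Nat.cast_nonneg _
  obtain ⟨N, hN⟩ : ∃ N, N = p * n := ⟨_, rfl⟩
  have hN0 : 0 ≤ N := by rw [hN]; positivity
  have hNn : N ≤ n := by rw [hN]; exact mul_le_of_le_one_left hn0 h1.le
  rw [← hndef, ← hN] at hdeg hσ
  have hNσ2 : σ ^ 2 ≤ N := by rw [hσ]; exact mul_le_of_le_one_right hN0 (by linarith)
  have hσσ : Z ^ 98 * σ ≤ σ ^ 2 := by
    rw [sq]; exact mul_le_mul_of_nonneg_right hσ98 hσ0.le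
  have hσ1 : 1000000000 ≤ σ := by
    have := hZD 0 98 (by norm_num)
    rw [pow_zero, mul_one] at this
    exact this.trans hσ98
  obtain ⟨A, hA⟩ : ∃ A, A = Z ^ 3 * σ := ⟨_, rfl⟩
  have hσA : 1000000000 * σ ≤ A := by
    rw [hA]
    have := mul_le_mul_of_nonneg_right (hZD 0 3 (by norm_num)) hσ0.le
    rw [pow_zero, mul_one] at this
    exact this
  have hAN : 2 * A ≤ N := by
    have h2 := mul_le_mul_of_nonneg_right (hZD 3 98 (by norm_num)) hσ0.le
    rw [hA] at hσA ⊢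
    linarith
  have hn2 : 2 ≤ Fintype.card V := by
    have : (2 : ℝ) ≤ Fintype.card V := by rw [← hndef]; linarith
    exact_mod_cast this
  have ha : σ / Z ^ 16 ≤ σ := div_le_self hσ0.le (hone _)
  have ha1 : 1 ≤ σ / Z ^ 16 := by
    rw [le_div_iff₀ (hpow _), one_mul]
    exact (pow_le_pow_right₀ hZ1 (by norm_num)).trans hσ98
  have hb : σ / (32 * Z ^ 3) ≤ σ := div_le_self hσ0.le (by linarith [hone 3])
  have hb1 : 2 ≤ σ / (32 * Z ^ 3) := by
    have := hpow 3
    rw [le_div_iff₀ (by positivity)]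
    linarith [hZD 3 98 (by norm_num)]
  obtain ⟨s, hs⟩ : ∃ s, s = ⌈σ / Z ^ 16⌉₊ := ⟨_, rfl⟩
  have hs1 : σ / Z ^ 16 ≤ s := by rw [hs]; exact Nat.le_ceil _
  have hs2 : (s : ℝ) < σ / Z ^ 16 + 1 := by
    rw [hs]; exact Nat.ceil_lt_add_one (by linarith)
  obtain ⟨k, hk⟩ : ∃ k, k = ⌊σ / (32 * Z ^ 3)⌋₊ := ⟨_, rfl⟩
  have hk1 : (k : ℝ) ≤ σ / (32 * Z ^ 3) := by rw [hk]; exact Nat.floor_le (by linarith)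
  have hk2 : σ / (32 * Z ^ 3) < k + 1 := by rw [hk]; exact Nat.lt_floor_add_one _
  obtain ⟨L, hL⟩ : ∃ L, L = ⌈N - 2 * A⌉₊ := ⟨_, rfl⟩
  have hL1 : N - 2 * A ≤ L := by rw [hL]; exact Nat.le_ceil _
  have hL2 : (L : ℝ) < N - 2 * A + 1 := by
    rw [hL]; exact Nat.ceil_lt_add_one (by linarith)
  have hk0 : (0 : ℝ) < k := by linarith
  have hs0 : (0 : ℝ) < s := by linarith
  have h3 := hpow 3
  have hρσ : 16 * Z ^ 3 / σ * σ ^ 2 = 16 * A := by rw [hA]; field_simp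
  have hρ1 : 16 * Z ^ 3 / σ ≤ 1 := by
    rw [div_le_one hσ0]; linarith [hZD 3 98 (by norm_num)]
  have hρ0 : 0 ≤ 16 * Z ^ 3 / σ := by positivity
  have hkρ : k * (16 * Z ^ 3 / σ) ≤ 1 / 2 := by
    refine (mul_le_mul_of_nonneg_right hk1 hρ0).trans (le_of_eq ?_)
    field_simp
    norm_num
  have hG := le_Pr_gap (V := V) (p := p) (L := L) (s := s) (k := k) (ζ := ζ) h0 h1 hn2
    (by exact_mod_cast hs0) (by exact_mod_cast hk0) hρ0 hkρ ?_ ?_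
  · have h4 : (s + 1) * (2 / (k : ℝ)) ≤ 384 / Z ^ 13 := by
      have h5 : (s : ℝ) + 1 ≤ 3 * (σ / Z ^ 16) := by linarith
      have h6 : σ / (64 * Z ^ 3) ≤ k := by
        have : σ / (32 * Z ^ 3) = 2 * (σ / (64 * Z ^ 3)) := by field_simp; norm_num
        linarith
      have h7 : 2 / (k : ℝ) ≤ 2 / (σ / (64 * Z ^ 3)) :=
        div_le_div_of_nonneg_left (by norm_num) (by positivity) h6
      refine (mul_le_mul h5 h7 (by positivity) (by linarith)).trans (le_of_eq ?_)
      have := hpow 16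
      have := hpow 13
      field_simp
      norm_num
    have h5 : Pr (bern (Sym2 V) p) (fun ω => ∃ x0, ∀ v ≠ x0,
        dg (rg ω) x0 Finset.univ + s ≤ dg (rg ω) v Finset.univ) ≤
      Pr (bern (Sym2 V) p) (fun ω => ∃ x0, ∀ v ≠ x0,
        (dg (rg ω) x0 Finset.univ : ℝ) + σ / Z ^ 16 ≤ dg (rg ω) v Finset.univ) := by
      refine Pr_mono hμ fun ω h => ?_
      obtain ⟨x0, hx⟩ := h
      refine ⟨x0, fun v hv => ?_⟩
      have h6 : (dg (rg ω) x0 Finset.univ : ℝ) + s ≤ dg (rg ω) v Finset.univ := by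
        exact_mod_cast hx v hv
      linarith
    linarith
  · intro b hb
    have hb' : N - 2 * A ≤ b := hL1.trans (by exact_mod_cast hb)
    have h4 : ((Fintype.card V - 1 - b : ℕ) : ℝ) ≤ n - N + 2 * A := by
      rcases le_total (Fintype.card V - 1) b with h | h
      · rw [Nat.sub_eq_zero_of_le h, Nat.cast_zero]; linarith
      · rw [Nat.cast_sub h, Nat.cast_sub (by omega), Nat.cast_one, ← hndef]; linarith
    have h5 := mul_le_mul_of_nonneg_right h4 h0.le
    have h6 : (n - N + 2 * A) * p ≤ σ ^ 2 + 2 * A := by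
      have h7 : 2 * A * p ≤ 2 * A := mul_le_of_le_one_right (by linarith) h1.le
      rw [hσ, hN] at *
      linarith
    have h7 := mul_le_mul_of_nonneg_left (h5.trans h6) (sub_nonneg.2 hρ1)
    have h8 : 0 ≤ 16 * Z ^ 3 / σ * (2 * A) := mul_nonneg hρ0 (by linarith)
    have h9 := mul_le_mul_of_nonneg_right hb' (sub_nonneg.2 h1.le)
    have h10 : 0 ≤ A * p := mul_nonneg (by linarith) h0.le
    have h11 : (1 - 16 * Z ^ 3 / σ) * (σ ^ 2 + 2 * A) =
        σ ^ 2 + 2 * A - 16 * A - 16 * Z ^ 3 / σ * (2 * A) := by rw [← hρσ]; ring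
    have h12 : (N - 2 * A) * (1 - p) = σ ^ 2 - 2 * A + 2 * (A * p) := by rw [hσ]; ring
    linarith
  · intro u v _
    refine (Pr_mono hμ fun ω h => ?_).trans (hdeg v (Finset.univ.erase u) ?_)
    · have h4 : (dg (rg ω) v (Finset.univ.erase u) : ℝ) < L + s + k := by exact_mod_cast h
      rw [← hA, lt_abs]
      right
      linarith
    · rw [Finset.card_erase_of_mem (Finset.mem_univ _), Finset.card_univ]; omega

set_option maxHeartbeats 1600000 in
theorem le_Pr_typical {z : ℕ} {σ : ℝ} (h0 : 0 < p) (h1 : p < 1) (hz : 10 ^ 9 ≤ z)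
    (hn : Fintype.card V ≤ 2 ^ z ^ 4) (hσ : σ ^ 2 = p * Fintype.card V * (1 - p))
    (hσ98 : (z : ℝ) ^ 98 ≤ σ) :
    1 - 1 / (z : ℝ) ≤ Pr (bern (Sym2 V) p) (fun ω => ∃ x0, Typical (rg ω) z p σ x0) := by
  have hμ : IsProb (bern (Sym2 V) p) := isProb_bern h0.le h1.le
  have hZ : (1000000000 : ℝ) ≤ z := by exact_mod_cast hz
  obtain ⟨Z, hZdef⟩ : ∃ Z : ℝ, Z = z := ⟨_, rfl⟩
  rw [← hZdef] at hZ hσ98 ⊢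
  obtain ⟨n, hndef⟩ : ∃ n : ℝ, n = Fintype.card V := ⟨_, rfl⟩
  rw [← hndef] at hσ
  have hZ1 : 1 ≤ Z := by linarith
  have hZ0 : 0 < Z := by linarith
  have hpow : ∀ k, 0 < Z ^ k := fun k => pow_pos hZ0 k
  have hσ0 : 0 < σ := lt_of_lt_of_le (hpow _) hσ98
  have hZD : ∀ k l : ℕ, k < l → 1000000000 * Z ^ k ≤ Z ^ l := fun k l hkl => by
    have h1 : 1000000000 * Z ^ k ≤ Z ^ (k + 1) := by
      rw [pow_succ']; exact mul_le_mul_of_nonneg_right hZ (hpow k).le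
    exact h1.trans (pow_le_pow_right₀ hZ1 (by omega))
  have hn0 : 0 ≤ n := by rw [hndef]; exact Nat.cast_nonneg _
  obtain ⟨N, hN⟩ : ∃ N, N = p * n := ⟨_, rfl⟩
  have hN0 : 0 ≤ N := by rw [hN]; positivity
  have hNσ2 : σ ^ 2 ≤ N := by
    rw [hσ, ← hN]; exact mul_le_of_le_one_right hN0 (by linarith)
  have hNn : N ≤ n := by rw [hN]; exact mul_le_of_le_one_left hn0 h1.le
  have hσσ : Z ^ 98 * σ ≤ σ ^ 2 := by
    rw [sq]; exact mul_le_mul_of_nonneg_right hσ98 hσ0.le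
  have hσZ : Z ^ 196 ≤ σ ^ 2 := by
    have := pow_le_pow_left₀ (hpow 98).le hσ98 2
    rwa [← pow_mul] at this
  have hNpos : 0 < N := lt_of_lt_of_le (by positivity) hNσ2
  have hnpos : 0 < n := lt_of_lt_of_le hNpos hNn
  -- the basic small probability
  obtain ⟨w, hw⟩ : ∃ w, w = Z ^ 4 := ⟨_, rfl⟩
  have hw1 : 1000000000 ≤ w := by
    rw [hw]; have := hZD 0 4 (by norm_num); norm_num at this; exact this
  have hnw : n ≤ Real.exp w := by
    have h1 : n ≤ 2 ^ z ^ 4 := by rw [hndef]; exact_mod_cast hn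
    refine h1.trans ?_
    have h2 : Real.exp w = Real.exp 1 ^ z ^ 4 := by
      rw [← Real.exp_nat_mul, hw, hZdef]; push_cast; rw [mul_one]
    rw [h2]
    have := Real.exp_one_gt_d9
    exact pow_le_pow_left₀ (by norm_num) (by linarith) _
  obtain ⟨E, hE⟩ : ∃ E, E = Real.exp (-w) := ⟨_, rfl⟩
  have hE0 : 0 < E := by rw [hE]; exact Real.exp_pos _
  have hEw : Real.exp w * E = 1 := by rw [hE, ← Real.exp_add]; simp
  have hEw' : w * E ≤ 1 := by
    have h1 := Real.add_one_le_exp w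
    have h3 := mul_le_mul_of_nonneg_right (show w ≤ Real.exp w by linarith) hE0.le
    linarith
  have hE3 : ∀ x, x ≤ -(3 * w) → 2 * Real.exp x ≤ 2 * (E * E * E) := fun x hx => by
    have : Real.exp (-(3 * w)) = E * E * E := by
      rw [hE, ← Real.exp_add, ← Real.exp_add]; congr 1; ring
    rw [← this]
    have := Real.exp_le_exp.2 hx
    linarith
  have hnE : n * E ≤ 1 := by
    have := mul_le_mul_of_nonneg_right hnw hE0.le
    linarith
  have hE1 : E ≤ 1 := by
    have := mul_le_mul_of_nonneg_right (show 1 ≤ w by linarith) hE0.le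
    linarith
  have hEE : E * E ≤ E := mul_le_of_le_one_left hE0.le hE1
  have hnE2 : n * (E * E * E) ≤ E := by
    have : n * (E * E * E) = (n * E) * (E * E) := by ring
    rw [this]
    exact (mul_le_of_le_one_left (by positivity) hnE).trans hEE
  -- upper regularity
  have hup : Pr (bern (Sym2 V) p) (fun ω => ¬ UpperReg (rg ω) p (32 * Z ^ 9) (1 / Z ^ 5 / 8)) ≤
      4 * E := by
    have h2 : UpperReg (⊤ : SimpleGraph V) 1 0 0 := by
      intro S T
      have : edg (⊤ : SimpleGraph V) S T ≤ S.card * T.card := by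
        unfold edg
        exact (Finset.sum_le_sum fun v _ => dg_le_card _ v T).trans (by simp)
      have h3 : (edg (⊤ : SimpleGraph V) S T : ℝ) ≤ S.card * T.card := by exact_mod_cast this
      linarith
    have h5 := hpow 5
    have h3 := Pr_not_upperReg_le (w := w) (A' := 32 * Z ^ 9) (ε := 1 / Z ^ 5 / 8)
      (x := 1 / Z ^ 5 / 8) hμ (fun k : Bool => k = true) h0.le
      (fun e => by rw [Finset.sum_filter, Fintype.sum_bool]; simp [bern]) h2 zero_le_one
      (by positivity) ?_ (by linarith) ?_ (by linarith) (by rw [← hndef]; exact hnw)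
    · rw [mul_one, ← hE] at h3
      exact h3
    · rw [div_div, div_le_one (by positivity)]
      have := one_le_pow₀ hZ1 (n := 5)
      linarith
    · rw [hw]
      apply le_of_eq
      field_simp
      ring
  -- degrees
  have hdeg : ∀ (v : V) (T : Finset V), Fintype.card V ≤ T.card + 1 →
      Pr (bern (Sym2 V) p) (fun ω => Z ^ 3 * σ < |(dg (rg ω) v T : ℝ) - N|) ≤ 2 * (E * E * E) := by
    intro v T hT
    have hT1 : n - 1 ≤ T.card := by
      have : n ≤ T.card + 1 := by rw [hndef]; exact_mod_cast hT
      linarith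
    have hT2 : (T.card : ℝ) ≤ n := by rw [hndef]; exact_mod_cast Finset.card_le_univ _
    have h3 := hpow 3
    have h98 := hZD 3 98 (by norm_num)
    have ht1 : Z ^ 3 / (4 * σ) ≤ 1 / 2 := by
      rw [div_le_iff₀ (by positivity)]; linarith
    refine (Pr_mono hμ fun ω h => ?_).trans
      ((Pr_edg_rg' h0.le h1.le {v} T (t := Z ^ 3 / (4 * σ)) (by positivity) ht1 (Z ^ 3 * σ - 2)).trans
        (hE3 _ ?_))
    · have h4 : edg (rg ω) {v} T = dg (rg ω) v T := by unfold edg; rw [Finset.sum_singleton]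
      rw [h4, Finset.card_singleton, Nat.cast_one, one_mul]
      have h5 : |p * (T.card : ℝ) - N| ≤ 1 := by
        rw [hN, ← mul_sub, abs_mul, abs_of_pos h0]
        refine mul_le_one₀ h1.le (abs_nonneg _) ?_
        rw [abs_le]; constructor <;> linarith
      have h6 := abs_sub_le (dg (rg ω) v T : ℝ) (p * T.card) N
      linarith
    · rw [Finset.card_singleton, Nat.cast_one, one_mul]
      have h4 : p * (1 - p) * (2 * T.card) ≤ 2 * σ ^ 2 := by
        rw [hσ]
        have := mul_le_mul_of_nonneg_left hT2 (show 0 ≤ p * (1 - p) from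
          mul_nonneg h0.le (by linarith))
        linarith
      have h5 := mul_le_mul_of_nonneg_left h4 (sq_nonneg (Z ^ 3 / (4 * σ)))
      have h6 : (Z ^ 3 / (4 * σ)) ^ 2 * (2 * σ ^ 2) = Z ^ 6 / 8 := by field_simp; norm_num
      have h7 : Z ^ 3 / (4 * σ) * (Z ^ 3 * σ - 2) = Z ^ 6 / 4 - 2 * (Z ^ 3 / (4 * σ)) := by
        field_simp
      have h8 := hZD 4 6 (by norm_num)
      rw [h6] at h5
      rw [h7, hw]
      linarith [hpow 4]
  -- total degree
  have htot : Pr (bern (Sym2 V) p) (fun ω => n * σ / (2 * Z ^ 62) + n ≤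
      |(edg (rg ω) Finset.univ Finset.univ : ℝ) - p * (n * n)|) ≤ 2 * (E * E * E) := by
    have h62 := hpow 62
    have ht1 : 1 / (8 * Z ^ 62 * σ) ≤ 1 / 2 := by
      apply one_div_le_one_div_of_le (by norm_num)
      have h3 : 1 ≤ Z ^ 62 := one_le_pow₀ hZ1
      have h4 : 1 ≤ σ := (one_le_pow₀ hZ1).trans hσ98
      have := mul_le_mul h3 h4 (by norm_num) h62.le
      linarith
    have h2 := (Pr_edg_rg' h0.le h1.le (Finset.univ (α := V)) Finset.univ
      (t := 1 / (8 * Z ^ 62 * σ)) (by positivity) ht1 (n * σ / (2 * Z ^ 62)))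
    rw [Finset.card_univ, ← hndef] at h2
    refine h2.trans (hE3 _ ?_)
    have h3 : p * (1 - p) * (2 * (n * n)) = 2 * n * σ ^ 2 := by rw [hσ]; ring
    have h4 : (1 / (8 * Z ^ 62 * σ)) ^ 2 * (2 * n * σ ^ 2) - 1 / (8 * Z ^ 62 * σ) *
        (n * σ / (2 * Z ^ 62)) = - (n / (32 * Z ^ 124)) := by
      field_simp; norm_num
    rw [h3, h4, neg_le_neg_iff, le_div_iff₀ (by have := hpow 124; positivity), hw]
    have h5 := hZD 128 196 (by norm_num)
    have h6 : 3 * Z ^ 4 * (32 * Z ^ 124) = 96 * Z ^ 128 := by ring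
    rw [h6]
    linarith [hpow 128]
  -- neighbourhoods
  have hnbr : ∀ u : V, Pr (bern (Sym2 V) p) (fun ω =>
      ((dg (rg ω) u Finset.univ : ℝ) ≤ 2 * N) ∧
      N * σ / (2 * Z ^ 62) + dg (rg ω) u Finset.univ ≤
        |(edg (rg ω) (Finset.univ.filter ((rg ω).Adj u)) (Finset.univ.erase u) : ℝ) -
          p * (dg (rg ω) u Finset.univ * (n - 1))|) ≤ 2 * (E * E * E) := by
    intro u
    have hcard : (((Finset.univ.erase u).card : ℕ) : ℝ) = n - 1 := by
      rw [Finset.card_erase_of_mem (Finset.mem_univ _), Finset.card_univ, hndef,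
        Nat.cast_sub (Fintype.card_pos_iff.2 ⟨u⟩), Nat.cast_one]
    have h2 := Pr_comp_le hμ (I := fun e : Sym2 V => ¬ u ∈ e) (s := Finset.univ)
      (Y := fun ω => Finset.univ.filter ((rg ω).Adj u))
      (A := fun S ω => N * σ / (2 * Z ^ 62) + S.card ≤
        |(edg (rg ω) (S.erase u) (Finset.univ.erase u) : ℝ) - p * (S.card * (n - 1))|)
      (B := fun _ _ => True) (Q := fun S => (S.card : ℝ) ≤ 2 * N ∧ u ∉ S) (η := 2 * (E * E * E))
      (fun _ => Finset.mem_univ _) ?_ ?_ (fun _ _ _ _ => rfl) (by positivity) ?_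
    · have h3 : Pr (bern (Sym2 V) p) (fun _ => True) = 1 := by
        unfold Pr; simp [Ex_const hμ]
      rw [h3, mul_one] at h2
      refine (Pr_mono hμ fun ω h => ?_).trans h2
      have h4 : u ∉ Finset.univ.filter ((rg ω).Adj u) := by simp
      rw [Finset.erase_eq_of_notMem h4]
      exact ⟨⟨h.1, h4⟩, h.2⟩
    · intro ω ω' h
      ext v
      simp only [Finset.mem_filter, Finset.mem_univ, true_and, rg_adj]
      rw [h _ (not_not.2 (Sym2.mem_mk_left u v))]
    · intro S ω ω' h
      have h3 : edg (rg ω) (S.erase u) (Finset.univ.erase u) =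
          edg (rg ω') (S.erase u) (Finset.univ.erase u) := by
        unfold edg
        refine Finset.sum_congr rfl fun v hv => ?_
        exact dependsOnly_dg_rg (I := fun e => ¬ u ∈ e) v (Finset.univ.erase u) (fun w hw => by
          rw [Sym2.mem_iff, not_or]
          exact ⟨(Finset.ne_of_mem_erase hv).symm, (Finset.ne_of_mem_erase hw).symm⟩) ω ω' h
      dsimp only
      rw [h3]
    · intro S hS
      have h3 : Pr (bern (Sym2 V) p) (fun _ => True) = 1 := by
        unfold Pr; simp [Ex_const hμ]
      rw [h3, mul_one, Finset.erase_eq_of_notMem hS.2]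
      have h62 := hpow 62
      have ht1 : 1 / (16 * Z ^ 62 * σ) ≤ 1 / 2 := by
        apply one_div_le_one_div_of_le (by norm_num)
        have h3 : 1 ≤ Z ^ 62 := one_le_pow₀ hZ1
        have h4 : 1 ≤ σ := (one_le_pow₀ hZ1).trans hσ98
        have := mul_le_mul h3 h4 (by norm_num) h62.le
        linarith
      have h4 := (Pr_edg_rg' h0.le h1.le S (Finset.univ.erase u)
        (t := 1 / (16 * Z ^ 62 * σ)) (by positivity) ht1 (N * σ / (2 * Z ^ 62)))
      rw [hcard] at h4
      refine h4.trans (hE3 _ ?_)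
      have h5 : p * (1 - p) * (2 * (S.card * (n - 1))) ≤ 4 * N * σ ^ 2 := by
        have h6 : (S.card : ℝ) * (n - 1) ≤ 2 * N * n :=
          (mul_le_mul_of_nonneg_left (by linarith) (Nat.cast_nonneg _)).trans
            (mul_le_mul_of_nonneg_right hS.1 hn0)
        have h7 := mul_le_mul_of_nonneg_left h6 (show 0 ≤ p * (1 - p) from
          mul_nonneg h0.le (by linarith))
        rw [hσ]
        linarith
      have h6 := mul_le_mul_of_nonneg_left h5 (sq_nonneg (1 / (16 * Z ^ 62 * σ)))
      have h7 : (1 / (16 * Z ^ 62 * σ)) ^ 2 * (4 * N * σ ^ 2) - 1 / (16 * Z ^ 62 * σ) *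
          (N * σ / (2 * Z ^ 62)) = - (N / (64 * Z ^ 124)) := by
        field_simp; norm_num
      have h8 : 3 * w ≤ N / (64 * Z ^ 124) := by
        rw [le_div_iff₀ (by have := hpow 124; positivity), hw]
        have h5 := hZD 128 196 (by norm_num)
        have h6 : 3 * Z ^ 4 * (64 * Z ^ 124) = 192 * Z ^ 128 := by ring
        rw [h6]
        linarith [hpow 128]
      linarith
  -- the largest gap
  have hgap := le_Pr_gap_of_deg h0 h1 hZ (by rw [← hndef]; exact hσ) hσ98
    (fun v T hT => by rw [← hndef, ← hN]; exact hdeg v T hT)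
  rw [← hndef] at hgap
  have hcomb : 1 - Pr (bern (Sym2 V) p) (fun ω => ∃ x0, Typical (rg ω) z p σ x0) ≤
      4 * E + n * (2 * (E * E * E)) + 2 * (E * E * E) + n * (2 * (E * E * E)) +
        (384 / Z ^ 13 + n * (n * (2 * (E * E * E)))) := by
    have hdegs := Pr_exists_le_card hμ Finset.univ
      (fun v ω => Z ^ 3 * σ < |(dg (rg ω) v Finset.univ : ℝ) - N|)
      (fun v _ => hdeg v Finset.univ (by rw [Finset.card_univ]; omega))
    have hnbrs := Pr_exists_le_card hμ Finset.univ _ (fun u _ => hnbr u)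
    rw [Finset.card_univ, ← hndef] at hdegs hnbrs
    rw [← Pr_not hμ]
    have h2 := Pr_not hμ (fun ω => ∃ x0, ∀ v ≠ x0,
        (dg (rg ω) x0 Finset.univ : ℝ) + σ / Z ^ 16 ≤ dg (rg ω) v Finset.univ)
    have h3 : Pr (bern (Sym2 V) p) (fun ω => ¬ ∃ x0, ∀ v ≠ x0,
        (dg (rg ω) x0 Finset.univ : ℝ) + σ / Z ^ 16 ≤ dg (rg ω) v Finset.univ) ≤
        384 / Z ^ 13 + n * (n * (2 * (E * E * E))) := by linarith
    refine (Pr_mono hμ fun ω h => ?_).trans <|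
      (Pr_or_le hμ _ _).trans <| add_le_add ((Pr_or_le hμ _ _).trans <| add_le_add
        ((Pr_or_le hμ _ _).trans <| add_le_add ((Pr_or_le hμ _ _).trans <|
          add_le_add hup hdegs) htot) hnbrs) h3
    by_contra hc
    push Not at hc
    obtain ⟨⟨⟨⟨hc1, hc2⟩, hc3⟩, hc4⟩, x0, hc5⟩ := hc
    have hc2' : ∀ v, |(dg (rg ω) v Finset.univ : ℝ) - N| ≤ Z ^ 3 * σ :=
      fun v => hc2 v (Finset.mem_univ v)
    have h62 := hpow 62
    have hhalf : ∀ x : ℝ, x * σ / Z ^ 62 = x * σ / (2 * Z ^ 62) + x * σ / (2 * Z ^ 62) :=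
      fun x => by field_simp; norm_num
    have hsmall : ∀ x : ℝ, 0 ≤ x → 6 * x ≤ x * σ / (2 * Z ^ 62) := fun x hx => by
      rw [le_div_iff₀ (by positivity)]
      have h4 : 12 * Z ^ 62 ≤ σ := by linarith [hZD 62 98 (by norm_num)]
      have := mul_le_mul_of_nonneg_left h4 hx
      linarith
    refine h ⟨x0, hz, hn, h1.le, ?_, ?_, ?_, ?_, ?_, ?_, ?_⟩
    · rw [← hZdef]; exact hσ98
    · rw [← hndef, ← hN]; exact hNσ2
    · rw [← hZdef]; exact hc1
    · rw [← hZdef, ← hndef, ← hN]; exact hc2'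
    · rw [← hZdef]; exact hc5
    · intro u
      rw [← hZdef, ← hndef, ← hN]
      have h4 : (dg (rg ω) u Finset.univ : ℝ) ≤ 2 * N := by
        have h5 := (abs_le.1 (hc2' u)).2
        have h6 := mul_le_mul_of_nonneg_right (hZD 3 98 (by norm_num)) hσ0.le
        have h7 := mul_pos (hpow 3) hσ0
        linarith
      have h5 := abs_sum_nbr_le (rg ω) u h0.le h1.le hN (hc4 u (Finset.mem_univ u) h4).le
      have h6 := hsmall N hN0
      have h7 := hhalf N
      linarith
    · rw [← hZdef, ← hndef, ← hN]
      have h4 : ∑ v, ((dg (rg ω) v Finset.univ : ℝ) - N) =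
          (edg (rg ω) Finset.univ Finset.univ : ℝ) - p * (n * n) := by
        unfold edg
        rw [Finset.sum_sub_distrib, Finset.sum_const, nsmul_eq_mul, Finset.card_univ, ← hndef, hN]
        push_cast
        ring
      rw [h4]
      have h5 := hsmall n hn0
      have h6 := hhalf n
      have h7 := mul_le_mul_of_nonneg_left (show
        |(edg (rg ω) Finset.univ Finset.univ : ℝ) - p * (n * n)| ≤ n * σ / Z ^ 62 by linarith) h0.le
      refine h7.trans (le_of_eq ?_)
      rw [hN]; ring
  have h2 : n * (n * (2 * (E * E * E))) ≤ 2 * E := by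
    have : n * (n * (2 * (E * E * E))) = 2 * ((n * E) * (n * E) * E) := by ring
    rw [this]
    have h3 : n * E * (n * E) ≤ 1 := mul_le_one₀ hnE (by positivity) hnE
    have := mul_le_of_le_one_left hE0.le h3
    linarith
  have h3 : E * E * E ≤ E := (mul_le_of_le_one_right (by positivity) hE1).trans hEE
  have h4 : 12 * E + 384 / Z ^ 13 ≤ 1 / Z := by
    have h5 : E ≤ 1 / Z ^ 4 := by
      rw [le_div_iff₀ (hpow 4), ← hw]; linarith
    have h6 : 12 / Z ^ 4 ≤ 1 / (2 * Z) := by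
      have := hpow 4
      rw [div_le_div_iff₀ (by positivity) (by positivity)]
      have := hZD 1 4 (by norm_num)
      rw [pow_one] at this
      linarith
    have h7 : 384 / Z ^ 13 ≤ 1 / (2 * Z) := by
      have := hpow 13
      rw [div_le_div_iff₀ (by positivity) (by positivity)]
      have := hZD 1 13 (by norm_num)
      rw [pow_one] at this
      linarith
    have h8 : 1 / Z = 1 / (2 * Z) + 1 / (2 * Z) := by field_simp; norm_num
    have h9 : 12 / Z ^ 4 = 12 * (1 / Z ^ 4) := by ring
    linarith
  linarith

end Whp

theorem Typical.hasPropertyH {n : ℕ} {G : SimpleGraph (Fin n)} {z : ℕ} {p σ : ℝ} {x0 : Fin n}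
    (hn : 3 ≤ n) (h : Typical G z p σ x0) : HasPropertyH n G := by
  have : Nonempty (Fin n) := ⟨x0⟩
  obtain ⟨x1, h1, h2⟩ := exists_dg_eq_minDeg G
  have hσ0 : 0 ≤ σ := (by positivity : (0 : ℝ) ≤ (z : ℝ) ^ 98).trans h.σ_ge
  have h3 : dg G x0 Finset.univ = minDeg G := by
    refine le_antisymm ?_ (h2 x0)
    rw [← h1]
    by_cases hx : x1 = x0
    · rw [hx]
    · have h4 := h.gap x1 hx
      have h5 : 0 ≤ σ / (z : ℝ) ^ 16 := by positivity
      have h6 : (dg G x0 Finset.univ : ℝ) ≤ dg G x1 Finset.univ := by linarith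
      exact_mod_cast h6
  obtain ⟨T, q, qR, P, R, h4⟩ := h.exists_split
  rw [h3] at h4
  have h5 := h4.exists_perms (by rw [Fintype.card_fin]; exact hn)
  rw [Fintype.card_fin] at h5
  exact hasPropertyH_of_perms hn h5

lemma pow_fifty_le {z : ℕ} {l : ℝ} (hz : 2 * 32 ^ 50 ≤ z) (h : (z : ℝ) ^ 4 ≤ 32 * l) :
    ((z : ℝ) ^ 98) ^ 2 ≤ l ^ 50 / 2 := by
  have hz' : (2 * 32 ^ 50 : ℝ) ≤ z := by exact_mod_cast hz
  have h0 : (0 : ℝ) ≤ z := Nat.cast_nonneg z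
  have h1 : (1 : ℝ) ≤ z := le_trans (by norm_num) hz'
  have h2 := pow_le_pow_left₀ (pow_nonneg h0 4) h 50
  rw [mul_pow, ← pow_mul] at h2
  have h3 : (z : ℝ) ^ 200 = z ^ 196 * z ^ 4 := by rw [← pow_add]
  have h4 : (z : ℝ) ≤ z ^ 4 := le_self_pow₀ h1 (by norm_num)
  have h5 := mul_le_mul_of_nonneg_left (hz'.trans h4) (pow_nonneg h0 196)
  rw [← pow_mul]
  norm_num at h2 h3 h5 ⊢
  linarith

/-- A suitable scale: an integer of order `(log n) ^ (1 / 4)`. -/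
lemma exists_log_scale {n : ℕ} {m : ℕ} (hm : 1 ≤ m) (hn : 2 ^ (m ^ 4) ≤ n) :
    ∃ z : ℕ, m ≤ z ∧ n ≤ 2 ^ z ^ 4 ∧ (z : ℝ) ^ 4 ≤ 32 * Real.log n := by
  have hex : ∃ z : ℕ, n ≤ 2 ^ z ^ 4 := by
    refine ⟨n, (Nat.lt_two_pow_self).le.trans (Nat.pow_le_pow_right (by norm_num) ?_)⟩
    exact Nat.le_self_pow (by norm_num) n
  obtain ⟨z, hz⟩ : ∃ z, z = Nat.find hex := ⟨_, rfl⟩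
  have h1 : n ≤ 2 ^ z ^ 4 := by rw [hz]; exact Nat.find_spec hex
  have h2 : m ≤ z := by
    have h3 := (Nat.pow_le_pow_iff_right (by norm_num : 1 < 2)).1 (hn.trans h1)
    exact (Nat.pow_le_pow_iff_left (by norm_num)).1 h3
  refine ⟨z, h2, h1, ?_⟩
  have hn1 : 1 ≤ n := Nat.one_le_two_pow.trans hn
  have h5 : 2 ^ (z - 1) ^ 4 ≤ n ∧ m ≤ z := by
    refine ⟨?_, h2⟩
    have := Nat.find_min hex (m := z - 1) (by omega)
    omega
  by_cases hz1 : z = 1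
  · have h6 : m = 1 := by omega
    have h7 : (2 : ℝ) ≤ n := by rw [h6] at hn; exact_mod_cast hn
    have h8 := Real.log_le_log (by norm_num) h7
    have h9 := Real.log_two_gt_d9
    rw [hz1]
    norm_num
    linarith
  · have h6 : ((2 : ℝ) ^ (z - 1) ^ 4) ≤ n := by exact_mod_cast h5.1
    have h7 := Real.log_le_log (by positivity) h6
    rw [Real.log_pow] at h7
    have h9 := Real.log_two_gt_d9
    have h10 : (z : ℝ) ≤ 2 * ((z - 1 : ℕ) : ℝ) := by
      have : z ≤ 2 * (z - 1) := by omega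
      exact_mod_cast this
    have h11 := pow_le_pow_left₀ (Nat.cast_nonneg z) h10 4
    rw [mul_pow] at h11
    push_cast at h7
    have h12 : (0 : ℝ) ≤ ((z - 1 : ℕ) : ℝ) ^ 4 := by positivity
    have h13 := mul_le_mul_of_nonneg_left (show (1 / 2 : ℝ) ≤ Real.log 2 by linarith) h12
    linarith

lemma eventually_log_pow_le :
    ∃ N : ℕ, ∀ n : ℕ, N ≤ n → Real.log n ^ 50 ≤ (n : ℝ) ^ (3 / 4 : ℝ) * Real.log n ^ 9 ∧
      1 ≤ Real.log n := by
  have h1 := (isLittleO_log_rpow_rpow_atTop (s := (3 / 4 : ℝ)) 41 (by norm_num)).bound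
    (show (0 : ℝ) < 1 by norm_num)
  have h2 : ∀ᶠ x : ℝ in Filter.atTop, 1 ≤ Real.log x :=
    Real.tendsto_log_atTop.eventually_ge_atTop 1
  obtain ⟨N, hN⟩ := Filter.eventually_atTop.1 (tendsto_natCast_atTop_atTop.eventually (h1.and h2))
  refine ⟨N, fun n hn => ?_⟩
  obtain ⟨h3, h4⟩ := hN n hn
  refine ⟨?_, h4⟩
  have h5 : Real.log (n : ℝ) ^ (41 : ℝ) = Real.log n ^ 41 := by
    rw [← Real.rpow_natCast]; norm_num
  rw [h5, Real.norm_of_nonneg (by positivity), Real.norm_of_nonneg (by positivity), one_mul] at h3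
  have h6 := mul_le_mul_of_nonneg_right h3 (show 0 ≤ Real.log n ^ 9 by positivity)
  rwa [← pow_add] at h6

/-- In the given range of `p`, the variance of a degree is large. -/
lemma variance_ge {n p l : ℝ} (hn : 0 < n) (hl : 1 ≤ l)
    (hnl : l ^ 50 ≤ n ^ (3 / 4 : ℝ) * l ^ 9) (hp : l ^ 50 / n ≤ p)
    (hp' : p ≤ 1 - n ^ (-(1 / 4 : ℝ)) * l ^ 9) :
    0 < p ∧ p < 1 ∧ l ^ 50 / 2 ≤ p * n * (1 - p) := by
  have hl0 : 0 < l := by linarith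
  have h1 : 0 < p := lt_of_lt_of_le (by positivity) hp
  have h2 : 0 < n ^ (-(1 / 4 : ℝ)) * l ^ 9 := by positivity
  refine ⟨h1, by linarith, ?_⟩
  rw [div_le_iff₀ hn] at hp
  rcases le_total p (1 / 2) with h | h
  · have := mul_le_mul hp (show (1 / 2 : ℝ) ≤ 1 - p by linarith) (by norm_num) (by positivity)
    linarith
  · have h3 : n * n ^ (-(1 / 4 : ℝ)) = n ^ (3 / 4 : ℝ) := by
      nth_rewrite 1 [← Real.rpow_one n]
      rw [← Real.rpow_add hn]; norm_num
    have h4 : n ^ (3 / 4 : ℝ) * l ^ 9 ≤ n * (1 - p) := by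
      rw [← h3, mul_assoc]
      exact mul_le_mul_of_nonneg_left (by linarith) hn.le
    have h5 : 0 ≤ n * (1 - p) := (by positivity : 0 ≤ n ^ (3 / 4 : ℝ) * l ^ 9).trans h4
    have h6 := mul_le_mul_of_nonneg_right h h5
    linarith

theorem exists_le_gnpProb (ε : ℝ) (hε : 0 < ε) :
    ∃ N : ℕ, ∀ n : ℕ, N ≤ n → ∀ p : ℝ,
      (Real.log (n : ℝ)) ^ 50 / (n : ℝ) ≤ p →
      p ≤ 1 - (n : ℝ) ^ (-(1 / 4 : ℝ)) * (Real.log (n : ℝ)) ^ 9 →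
      1 - ε ≤ gnpProb n p (fun G => HasPropertyH n G) := by
  obtain ⟨N, hN⟩ := eventually_log_pow_le
  obtain ⟨e, he⟩ := exists_nat_ge (1 / ε)
  obtain ⟨m, hm⟩ : ∃ m : ℕ, m = 10 ^ 9 + 2 * 32 ^ 50 + e := ⟨_, rfl⟩
  have hm9 : 10 ^ 9 ≤ m := by omega
  have hm50 : 2 * 32 ^ 50 ≤ m := by omega
  have hme : e ≤ m := by omega
  clear hm
  refine ⟨N + 2 ^ m ^ 4 + 3, fun n hn p hp hp' => ?_⟩
  generalize hM : 2 ^ m ^ 4 = M at hn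
  obtain ⟨h1, h2⟩ := hN n (by omega)
  obtain ⟨z, hmz, hnz, hzl⟩ := exists_log_scale (n := n) (m := m) (by omega) (by rw [hM]; omega)
  have hn0 : (0 : ℝ) < n := by
    have : 0 < n := by omega
    exact_mod_cast this
  obtain ⟨hp0, hp1, hv⟩ := variance_ge hn0 h2 h1 hp hp'
  have hv2 := (pow_fifty_le (hm50.trans hmz) hzl).trans hv
  have hv0 : 0 ≤ p * n * (1 - p) := (sq_nonneg _).trans hv2
  have h3 := le_Pr_typical (V := Fin n) (z := z) (σ := Real.sqrt (p * n * (1 - p))) hp0 hp1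
    (hm9.trans hmz) (by rw [Fintype.card_fin]; exact hnz)
    (by rw [Fintype.card_fin, Real.sq_sqrt hv0]) (Real.le_sqrt_of_sq_le hv2)
  rw [gnpProb_eq]
  have h4 : 1 / (z : ℝ) ≤ ε := by
    have h5 : 1 / ε ≤ z := he.trans (by exact_mod_cast hme.trans hmz)
    have h6 : (0 : ℝ) < z := lt_of_lt_of_le (by positivity) h5
    rw [div_le_iff₀ hε] at h5
    rw [div_le_iff₀ h6]
    linarith
  have h5 := h3.trans (Pr_mono (isProb_bern hp0.le hp1.le) fun ω h =>
    h.elim fun x0 h => h.hasPropertyH (by omega))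
  linarith

end EDHC

open EDHC in
/-- Theorem 1.2 (main theorem): whp `G_{n,p}` has property `H` for
`log^50 n / n ≤ p ≤ 1 - n^{-1/4} log^9 n`. -/
theorem stmt_0 :
    ∀ ε : ℝ, 0 < ε → ∃ N : ℕ, ∀ n : ℕ, N ≤ n → ∀ p : ℝ,
      (Real.log n) ^ 50 / n ≤ p → p ≤ 1 - (n : ℝ) ^ (-(1 / 4 : ℝ)) * (Real.log n) ^ 9 →
      1 - ε ≤ EDHC.gnpProb n p (fun G => EDHC.HasPropertyH n G) := by
  intro ε hε
  exact EDHC.exists_le_gnpProb ε hε
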